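/- Let k be a number field and S a finite set of places of k containing the archimedean places. Let L_1, …, L_m (m ≥ 2) be pairwise non-proportional nonzero linear forms in the variables x_0, …, x_n with coefficients in k which are linearly dependent over k. Let R be a subset of P^n(k) at whose points none of the L_i vanish, and suppose that for each pair of indices i, j there exists a_{ij} ∈ k^* such that a_{ij}·L_i(P)/L_j(P) ∈ O_{k,S} for all P ∈ R. Then R is contained in a finite union of hyperplanes of P^n; in particular, R is not Zariski-dense. -/

import Mathlib

open scoped BigOperators
open NumberField IsDedekindDomain

set_option linter.unusedSectionVars false

namespace SubspaceAux

open MvPolynomial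

section Diag
variable {σ : Type*} [Fintype σ] [DecidableEq σ] {K : Type*} [Field K]

/-- Product of the binomial coefficients of the coordinates. -/
def mchoose (a μ : σ →₀ ℕ) : ℕ := ∏ i, (a i).choose (μ i)

/-- The diagonal operator multiplying the monomial of exponent `a` by `mchoose a μ`. -/
noncomputable def diagOp (μ : σ →₀ ℕ) : MvPolynomial σ K →ₗ[K] MvPolynomial σ K :=
  (basisMonomials σ K).constr K fun a => monomial a (mchoose a μ : K)

theorem coeff_diagOp (μ a : σ →₀ ℕ) (P : MvPolynomial σ K) :
    coeff a (diagOp μ P) = mchoose a μ * coeff a P := by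
  induction P using MvPolynomial.induction_on' with
  | monomial b c =>
    have h : (monomial b c : MvPolynomial σ K) = c • basisMonomials σ K b := by
      simp [coe_basisMonomials, smul_monomial]
    rw [h, diagOp, map_smul, Module.Basis.constr_basis]
    simp only [coeff_smul, coe_basisMonomials, coeff_monomial, smul_eq_mul]
    split_ifs with h
    · subst h; ring
    · simp
  | add p q hp hq => rw [map_add, coeff_add, coeff_add, hp, hq, mul_add]

/-- The span of the functions `mchoose · μ` with `|μ| ≤ s`. -/
def chooseSpan (σ K : Type*) [Fintype σ] [Field K] (s : ℕ) :
    Submodule K ((σ →₀ ℕ) → K) :=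
  Submodule.span K {f | ∃ μ : σ →₀ ℕ, ∑ i, μ i ≤ s ∧ f = fun a => (mchoose a μ : K)}

theorem coord_mul_mem_chooseSpan {s : ℕ} {f : (σ →₀ ℕ) → K} (hf : f ∈ chooseSpan σ K s)
    (i : σ) (c : K) : (fun a : σ →₀ ℕ => ((a i : K) - c) * f a) ∈ chooseSpan σ K (s + 1) := by
  have hmono : chooseSpan σ K s ≤ chooseSpan σ K (s + 1) := by
    apply Submodule.span_mono
    rintro g ⟨μ, h1, h2⟩
    exact ⟨μ, by omega, h2⟩
  have key : (fun a : σ →₀ ℕ => (a i : K) * f a) ∈ chooseSpan σ K (s + 1) := by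
    induction hf using Submodule.span_induction with
    | mem x hx =>
      obtain ⟨μ, h1, rfl⟩ := hx
      have h : (fun a : σ →₀ ℕ => (a i : K) * (mchoose a μ : K)) =
          ((μ i + 1 : ℕ) : K) • (fun a => (mchoose a (μ + Finsupp.single i 1) : K))
          + (μ i : K) • (fun a => (mchoose a μ : K)) := by
        funext a
        simp only [Pi.add_apply, Pi.smul_apply, smul_eq_mul]
        norm_cast
        unfold mchoose
        rw [← Finset.mul_prod_erase Finset.univ _ (Finset.mem_univ i),
          ← Finset.mul_prod_erase Finset.univ (fun j => (a j).choose ((μ + Finsupp.single i 1 : σ →₀ ℕ) j))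
            (Finset.mem_univ i)]
        have h3 : ∏ x ∈ Finset.univ.erase i, (a x).choose ((μ + Finsupp.single i 1 : σ →₀ ℕ) x) =
            ∏ x ∈ Finset.univ.erase i, (a x).choose (μ x) := by
          apply Finset.prod_congr rfl
          intro x hx
          have : x ≠ i := (Finset.mem_erase.mp hx).1
          simp [this.symm]
        rw [h3]
        have h4 : (μ i + 1) * (a i).choose (μ i + 1) + μ i * (a i).choose (μ i) =
            a i * (a i).choose (μ i) := by
          have := Nat.choose_succ_right_eq (a i) (μ i)
          rcases le_or_gt (μ i) (a i) with h5 | h5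
          · obtain ⟨t, ht⟩ := Nat.exists_eq_add_of_le h5
            rw [ht] at this ⊢
            simp only [Nat.add_sub_cancel_left] at this
            nlinarith [this]
          · rw [Nat.choose_eq_zero_of_lt h5, Nat.choose_eq_zero_of_lt (by omega)]; simp
        simp only [Finsupp.add_apply, Finsupp.single_eq_same]
        rw [← mul_assoc, ← mul_assoc, ← mul_assoc, ← add_mul, h4]
      rw [h]
      refine Submodule.add_mem _ (Submodule.smul_mem _ _ (Submodule.subset_span
        ⟨_, ?_, rfl⟩)) (Submodule.smul_mem _ _ (Submodule.subset_span ⟨_, by omega, rfl⟩))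
      simp only [Finsupp.add_apply, Finset.sum_add_distrib]
      have : ∑ x, (Finsupp.single i 1 : σ →₀ ℕ) x = 1 := by
        simp [Finsupp.single_apply]
      omega
    | zero => simp only [Pi.zero_apply, mul_zero]; exact Submodule.zero_mem _
    | add x y _ _ hx hy =>
      simp only [Pi.add_apply, mul_add]; exact Submodule.add_mem _ hx hy
    | smul t x _ hx =>
      have h : (fun a : σ →₀ ℕ => (a i : K) * (t • x) a) =
          t • (fun a : σ →₀ ℕ => (a i : K) * x a) := by
        funext a; simp; ring
      rw [h]; exact Submodule.smul_mem _ _ hx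
  have h : (fun a : σ →₀ ℕ => ((a i : K) - c) * f a) =
      (fun a : σ →₀ ℕ => (a i : K) * f a) - c • f := by
    funext a; simp; ring
  rw [h]
  exact Submodule.sub_mem _ key (Submodule.smul_mem _ _ (hmono hf))

theorem exists_det_mchoose_ne_zero [CharZero K] (r : ℕ) (a : Fin r → (σ →₀ ℕ))
    (ha : Function.Injective a) :
    ∃ μ : Fin r → (σ →₀ ℕ), (∀ i, ∑ j, μ i j ≤ (i : ℕ)) ∧
      (Matrix.of fun i j => (mchoose (a j) (μ i) : K)).det ≠ 0 := by
  induction r with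
  | zero => exact ⟨Fin.elim0, fun i => i.elim0, by simp⟩
  | succ r ih =>
    obtain ⟨μ, hμ, hdet⟩ := ih (fun j => a j.castSucc)
      (fun x y h => Fin.castSucc_injective _ (ha h))
    by_contra hcon
    push Not at hcon
    -- cofactors along the last row
    let A : (σ →₀ ℕ) → Matrix (Fin (r + 1)) (Fin (r + 1)) K := fun ν =>
      Matrix.of fun i j => (mchoose (a j) ((Fin.snoc μ ν : Fin (r + 1) → (σ →₀ ℕ)) i) : K)
    let c : Fin (r + 1) → K := fun j => (-1) ^ (((Fin.last r : Fin (r+1)) : ℕ) + (j : ℕ)) *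
      ((A 0).submatrix (Fin.last r).succAbove j.succAbove).det
    have hsub : ∀ ν (j : Fin (r + 1)), (A ν).submatrix (Fin.last r).succAbove j.succAbove =
        (A 0).submatrix (Fin.last r).succAbove j.succAbove := by
      intro ν j
      ext x y
      simp [A, Fin.succAbove_last]
    have hexp : ∀ ν, (A ν).det = ∑ j, c j * (mchoose (a j) ν : K) := by
      intro ν
      rw [Matrix.det_succ_row _ (Fin.last r)]
      apply Finset.sum_congr rfl
      intro j _
      rw [hsub]
      simp only [c, A, Matrix.of_apply, Fin.snoc_last]
      ring
    have hzero : ∀ f ∈ chooseSpan σ K r, ∑ j, c j * f (a j) = 0 := by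
      intro f hf
      induction hf using Submodule.span_induction with
      | mem x hx =>
        obtain ⟨ν, h1, rfl⟩ := hx
        rw [← hexp]
        apply hcon (Fin.snoc μ ν)
        intro i
        refine Fin.lastCases ?_ (fun i => ?_) i
        · simpa using h1
        · simpa using hμ i
      | zero => simp
      | add x y _ _ hx hy => simp [mul_add, Finset.sum_add_distrib, hx, hy]
      | smul t x _ hx =>
        have : ∑ j, c j * (t • x) (a j) = t * ∑ j, c j * x (a j) := by
          rw [Finset.mul_sum]; apply Finset.sum_congr rfl; intro j _; simp; ring
        rw [this, hx, mul_zero]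
    have hne : ∀ j : Fin r, ∃ i, a j.castSucc i ≠ a (Fin.last r) i := by
      intro j
      by_contra h
      push Not at h
      exact (Fin.castSucc_lt_last j).ne (ha (Finsupp.ext h))
    choose ix hix using hne
    have hmem : ∀ s : Finset (Fin r), (fun x : σ →₀ ℕ =>
        ∏ j ∈ s, ((x (ix j) : K) - (a j.castSucc (ix j) : K))) ∈ chooseSpan σ K s.card := by
      intro s
      induction s using Finset.induction_on with
      | empty =>
        refine Submodule.subset_span ⟨0, by simp, ?_⟩
        funext x; simp [mchoose]
      | insert j s hj ih2 =>
        rw [Finset.card_insert_of_notMem hj]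
        simp_rw [Finset.prod_insert hj]
        exact coord_mul_mem_chooseSpan ih2 _ _
    have h1 := hzero _ (by simpa using hmem Finset.univ)
    rw [Fin.sum_univ_castSucc, Finset.sum_eq_zero, zero_add] at h1
    · rcases mul_eq_zero.mp h1 with h2 | h2
      · apply hdet
        have h3 : (A 0).submatrix (Fin.last r).succAbove (Fin.last r).succAbove =
            Matrix.of fun i j => (mchoose (a j.castSucc) (μ i) : K) := by
          ext x y; simp [A, Fin.succAbove_last]
        simp only [c, h3] at h2
        rcases mul_eq_zero.mp h2 with h4 | h4
        · exact absurd h4 (pow_ne_zero _ (by simp))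
        · exact h4
      · rw [Finset.prod_eq_zero_iff] at h2
        obtain ⟨j, _, h3⟩ := h2
        rw [sub_eq_zero, Nat.cast_inj] at h3
        exact hix j h3.symm
    · intro j _
      rw [Finset.prod_eq_zero (Finset.mem_univ j) (sub_self _), mul_zero]

end Diag

section Wronskian
open scoped MonomialOrder
variable {σ : Type*} [Fintype σ] [LinearOrder σ] {K : Type*} [Field K]

theorem coeff_prod_of_degree_le {ι : Type*} [DecidableEq ι] (m : MonomialOrder σ)
    (s : Finset ι) (f : ι → MvPolynomial σ K) (a : ι → σ →₀ ℕ)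
    (h : ∀ i ∈ s, m.degree (f i) ≼[m] a i) :
    coeff (∑ i ∈ s, a i) (∏ i ∈ s, f i) = ∏ i ∈ s, coeff (a i) (f i) ∧
      m.degree (∏ i ∈ s, f i) ≼[m] ∑ i ∈ s, a i := by
  induction s using Finset.induction_on with
  | empty => simp
  | insert i s hi ih =>
    have h1 := h i (Finset.mem_insert_self i s)
    have h2 := ih fun j hj => h j (Finset.mem_insert_of_mem hj)
    rw [Finset.sum_insert hi, Finset.prod_insert hi, Finset.prod_insert hi,
      m.coeff_mul_of_add_of_degree_le h1 h2.2, h2.1]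
    refine ⟨rfl, m.degree_mul_le.trans ?_⟩
    simp only [map_add]
    exact add_le_add h1 h2.2

theorem exists_injective_degree (m : MonomialOrder σ) (W : Submodule K (MvPolynomial σ K))
    (r : ℕ) (hr : Module.finrank K W = r) :
    ∃ ψ : Fin r → MvPolynomial σ K, (∀ i, ψ i ∈ W) ∧ (∀ i, ψ i ≠ 0) ∧
      Function.Injective fun i => m.degree (ψ i) := by
  classical
  rcases Nat.eq_zero_or_pos r with h0 | hpos
  · subst h0; exact ⟨Fin.elim0, fun i => i.elim0, fun i => i.elim0, fun i => i.elim0⟩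
  have : FiniteDimensional K W := FiniteDimensional.of_finrank_pos (by omega)
  let A : Set (σ →₀ ℕ) := {a | ∃ u ∈ W, u ≠ 0 ∧ m.degree u = a}
  have hA : ∃ B : Finset (σ →₀ ℕ), ↑B ⊆ A ∧ B.card = r := by
    by_cases hfin : A.Finite
    · have hcard : r ≤ hfin.toFinset.card := by
        by_contra hlt
        push Not at hlt
        let Φ : W →ₗ[K] (hfin.toFinset → K) := LinearMap.pi fun a =>
          (lcoeff K a.1).comp W.subtype
        have hker : LinearMap.ker Φ ≠ ⊥ := by
          apply LinearMap.ker_ne_bot_of_finrank_lt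
          simpa [hr] using hlt
        obtain ⟨u, hu, hne⟩ := Submodule.exists_mem_ne_zero_of_ne_bot hker
        have hne' : (u : MvPolynomial σ K) ≠ 0 := by simpa using hne
        have hmem : m.degree (u : MvPolynomial σ K) ∈ hfin.toFinset := by
          simpa using ⟨u, u.2, hne', rfl⟩
        have h1 := congrFun (LinearMap.mem_ker.mp hu) ⟨_, hmem⟩
        exact (m.coeff_degree_ne_zero_iff.mpr hne') h1
      obtain ⟨B, hB, hBc⟩ := Finset.exists_subset_card_eq hcard
      exact ⟨B, fun x hx => hfin.mem_toFinset.mp (hB hx), hBc⟩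
    · obtain ⟨B, hB, hBc⟩ := Set.Infinite.exists_subset_card_eq hfin r
      exact ⟨B, hB, hBc⟩
  obtain ⟨B, hB, hBc⟩ := hA
  let e := B.equivFinOfCardEq hBc
  have hch : ∀ i : Fin r, ∃ u ∈ W, u ≠ 0 ∧ m.degree u = (e.symm i : σ →₀ ℕ) := fun i =>
    hB (e.symm i).2
  choose ψ h1 h2 h3 using hch
  refine ⟨ψ, h1, h2, fun i j hij => ?_⟩
  simp only [h3] at hij
  exact e.symm.injective (Subtype.ext hij)

theorem exists_det_diagOp_ne_zero [CharZero K] {r : ℕ} (φ : Fin r → MvPolynomial σ K)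
    (hφ : LinearIndependent K φ) :
    ∃ μ : Fin r → (σ →₀ ℕ), (∀ i, ∑ j, μ i j ≤ (i : ℕ)) ∧
      (Matrix.of fun i j => diagOp (μ i) (φ j)).det ≠ 0 := by
  classical
  obtain ⟨ψ, hψ, hne, hinj⟩ := exists_injective_degree MonomialOrder.lex
    (Submodule.span K (Set.range φ)) r (by
      simpa using finrank_span_eq_card hφ)
  obtain ⟨μ, hμ, hdet⟩ := exists_det_mchoose_ne_zero (K := K) r _ hinj
  refine ⟨μ, hμ, fun hzero => ?_⟩
  have hg : ∀ j, ∃ g : Fin r → K, ∑ i, g i • φ i = ψ j := fun j =>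
    (Submodule.mem_span_range_iff_exists_fun K).mp (hψ j)
  choose g hg using hg
  set m : MonomialOrder σ := MonomialOrder.lex
  have hmul : (Matrix.of fun i j => diagOp (μ i) (ψ j)) =
      (Matrix.of fun i j => diagOp (μ i) (φ j)) * (Matrix.of fun i j => C (g j i)) := by
    ext1 i j
    simp only [Matrix.mul_apply, Matrix.of_apply, ← hg, map_sum, map_smul]
    exact Finset.sum_congr rfl fun x _ => by rw [smul_eq_C_mul, mul_comm]
  have h0 : (Matrix.of fun i j => diagOp (μ i) (ψ j)).det = 0 := by
    rw [hmul, Matrix.det_mul, hzero, zero_mul]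
  have hdeg : ∀ i j, m.degree (diagOp (μ i) (ψ j)) ≼[m] m.degree (ψ j) := by
    intro i j
    rw [m.degree_le_iff]
    intro a ha
    apply m.le_degree
    rw [mem_support_iff, coeff_diagOp] at ha
    exact mem_support_iff.mpr (right_ne_zero_of_mul ha)
  have hcoeff : coeff (∑ j, m.degree (ψ j)) (Matrix.of fun i j => diagOp (μ i) (ψ j)).det =
      (Matrix.of fun i j => (mchoose (m.degree (ψ j)) (μ i) : K)).det *
        ∏ j, m.leadingCoeff (ψ j) := by
    rw [Matrix.det_apply, Matrix.det_apply, coeff_sum, Finset.sum_mul]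
    apply Finset.sum_congr rfl
    intro π _
    have : (Equiv.Perm.sign π • ∏ i, (Matrix.of fun i j => diagOp (μ i) (ψ j)) (π i) i :
        MvPolynomial σ K) = ((Equiv.Perm.sign π : ℤ) : K) •
        ∏ i, (Matrix.of fun i j => diagOp (μ i) (ψ j)) (π i) i := by
      rw [Int.cast_smul_eq_zsmul]; rfl
    rw [this, coeff_smul]
    simp only [Matrix.of_apply]
    rw [(coeff_prod_of_degree_le m Finset.univ _ _ fun j _ => hdeg (π j) j).1]
    simp only [coeff_diagOp, Finset.prod_mul_distrib]
    rw [Units.smul_def, zsmul_eq_mul, smul_eq_mul, mul_assoc]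
    rfl
  rw [h0, coeff_zero] at hcoeff
  rcases mul_eq_zero.mp hcoeff.symm with h | h
  · exact hdet h
  · rw [Finset.prod_eq_zero_iff] at h
    obtain ⟨j, _, hj⟩ := h
    exact hne j (m.leadingCoeff_eq_zero_iff.mp hj)

end Wronskian

section Index
variable {σ : Type*} [Fintype σ] [DecidableEq σ] {K : Type*} [Field K]

theorem mem_supported_iff_coeff {s : Set σ} {P : MvPolynomial σ K} :
    P ∈ supported K s ↔ ∀ a, coeff a P ≠ 0 → ∀ i ∉ s, a i = 0 := by
  rw [mem_supported]
  constructor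
  · intro h a ha i hi
    by_contra hne
    exact hi (h (by
      rw [Finset.mem_coe, mem_vars_iff_mem_support]
      exact ⟨a, mem_support_iff.mpr ha, Finsupp.mem_support_iff.mpr hne⟩))
  · intro h i hi
    rw [Finset.mem_coe, mem_vars_iff_mem_support] at hi
    obtain ⟨a, ha, hia⟩ := hi
    by_contra hn
    exact (Finsupp.mem_support_iff.mp hia) (h a (mem_support_iff.mp ha) i hn)

theorem coeff_mul_of_disjoint {s t : Set σ} (hst : Disjoint s t) {P Q : MvPolynomial σ K}
    (hP : P ∈ supported K s) (hQ : Q ∈ supported K t) {a b : σ →₀ ℕ}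
    (ha : ∀ i ∉ s, a i = 0) (hb : ∀ i ∉ t, b i = 0) :
    coeff (a + b) (P * Q) = coeff a P * coeff b Q := by
  rw [coeff_mul, Finset.sum_eq_single (a, b)]
  · rintro ⟨c, d⟩ hcd hne
    rw [Finset.HasAntidiagonal.mem_antidiagonal] at hcd
    by_contra h
    have hc := mem_supported_iff_coeff.mp hP c (left_ne_zero_of_mul h)
    have hd := mem_supported_iff_coeff.mp hQ d (right_ne_zero_of_mul h)
    apply hne
    have hac : c = a := by
      ext i
      by_cases hi : i ∈ s
      · have hit : i ∉ t := Set.disjoint_left.mp hst hi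
        have := DFunLike.congr_fun hcd i
        simp only [Finsupp.add_apply, hd i hit, hb i hit, add_zero] at this
        exact this
      · rw [hc i hi, ha i hi]
    subst hac
    simpa using hcd
  · intro h
    rw [Finset.HasAntidiagonal.mem_antidiagonal] at h
    exact absurd rfl h

/-- The translation `P(X) ↦ P(X + ξ)`. -/
noncomputable def shift (ξ : σ → K) : MvPolynomial σ K →ₐ[K] MvPolynomial σ K :=
  aeval fun i => X i + C (ξ i)

theorem shift_shift_neg (ξ : σ → K) (P : MvPolynomial σ K) :
    shift (fun i => - ξ i) (shift ξ P) = P := by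
  have : (shift (fun i => - ξ i)).comp (shift ξ) = AlgHom.id K (MvPolynomial σ K) := by
    apply algHom_ext
    intro i
    simp [shift]
  exact DFunLike.congr_fun this P

theorem shift_ne_zero (ξ : σ → K) {P : MvPolynomial σ K} (hP : P ≠ 0) : shift ξ P ≠ 0 := by
  intro h
  apply hP
  rw [← shift_shift_neg ξ P, h, map_zero]

theorem shift_mem_supported {s : Set σ} (ξ : σ → K) {P : MvPolynomial σ K}
    (hP : P ∈ supported K s) : shift ξ P ∈ supported K s := by
  have : supported K s ≤ (supported K s).comap (shift ξ) := by
    conv_lhs => rw [supported]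
    rw [Algebra.adjoin_le_iff]
    rintro _ ⟨i, hi, rfl⟩
    simp only [shift, Subalgebra.coe_comap, Set.mem_preimage, aeval_X, SetLike.mem_coe]
    refine add_mem (X_mem_supported.mpr hi) ?_
    exact Subalgebra.algebraMap_mem _ _
  exact this hP

theorem shift_pderiv (ξ : σ → K) (j : σ) (P : MvPolynomial σ K) :
    shift ξ (pderiv j P) = pderiv j (shift ξ P) := by
  induction P using MvPolynomial.induction_on with
  | C a => simp [shift]
  | add p q hp hq => simp [hp, hq]
  | mul_X p i hp =>
    simp only [Derivation.leibniz, smul_eq_mul, map_add, map_mul, hp, pderiv_X]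
    simp only [shift, aeval_X, map_add, pderiv_X, pderiv_C, add_zero]
    congr 2
    by_cases h : j = i
    · subst h; simp
    · simp [h]

/-- The weight `∑ b_i / d_i` of an exponent. -/
noncomputable def wt (d : σ → ℝ) (b : σ →₀ ℕ) : ℝ := ∑ i, (b i : ℝ) / d i

theorem wt_add (d : σ → ℝ) (a b : σ →₀ ℕ) : wt d (a + b) = wt d a + wt d b := by
  simp [wt, add_div, Finset.sum_add_distrib]

theorem wt_single (d : σ → ℝ) (j : σ) (k : ℕ) : wt d (Finsupp.single j k) = k / d j := by
  rw [wt, Finset.sum_eq_single j]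
  · simp
  · intro i _ hi; simp [hi.symm]
  · simp

theorem wt_nonneg {d : σ → ℝ} (hd : ∀ i, 0 ≤ d i) (b : σ →₀ ℕ) : 0 ≤ wt d b :=
  Finset.sum_nonneg fun i _ => div_nonneg (Nat.cast_nonneg _) (hd i)

/-- The index of `P` at `ξ` relative to the weights `d` is at least `t`. -/
def IndGe (ξ : σ → K) (d : σ → ℝ) (t : ℝ) (P : MvPolynomial σ K) : Prop :=
  ∀ b, coeff b (shift ξ P) ≠ 0 → t ≤ wt d b

namespace IndGe
variable {ξ : σ → K} {d : σ → ℝ} {t u : ℝ} {P Q : MvPolynomial σ K}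

theorem mono (h : IndGe ξ d t P) (hut : u ≤ t) : IndGe ξ d u P := fun b hb => hut.trans (h b hb)

theorem of_nonpos (hd : ∀ i, 0 ≤ d i) (ht : t ≤ 0) : IndGe ξ d t P :=
  fun b _ => ht.trans (wt_nonneg hd b)

theorem add (hP : IndGe ξ d t P) (hQ : IndGe ξ d t Q) : IndGe ξ d t (P + Q) := by
  intro b hb
  rw [map_add, coeff_add] at hb
  by_cases h : coeff b (shift ξ P) = 0
  · exact hQ b fun h2 => hb (by rw [h, h2, add_zero])
  · exact hP b h

theorem smul (c : K) (hP : IndGe ξ d t P) : IndGe ξ d t (c • P) := by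
  intro b hb
  rw [map_smul, coeff_smul, smul_eq_mul] at hb
  exact hP b (right_ne_zero_of_mul hb)

theorem mul (hP : IndGe ξ d t P) (hQ : IndGe ξ d u Q) : IndGe ξ d (t + u) (P * Q) := by
  classical
  intro b hb
  rw [map_mul, coeff_mul] at hb
  obtain ⟨⟨x, y⟩, hxy, hne⟩ := Finset.exists_ne_zero_of_sum_ne_zero hb
  rw [Finset.HasAntidiagonal.mem_antidiagonal] at hxy
  rw [← hxy, wt_add]
  exact add_le_add (hP x (left_ne_zero_of_mul hne)) (hQ y (right_ne_zero_of_mul hne))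

theorem zero : IndGe ξ d t (0 : MvPolynomial σ K) := by
  intro b hb; simp at hb

theorem sum {ι : Type*} (s : Finset ι) (f : ι → MvPolynomial σ K)
    (h : ∀ i ∈ s, IndGe ξ d t (f i)) : IndGe ξ d t (∑ i ∈ s, f i) := by
  classical
  induction s using Finset.induction_on with
  | empty => exact zero
  | insert i s hi ih =>
    rw [Finset.sum_insert hi]
    exact (h i (Finset.mem_insert_self i s)).add
      (ih fun j hj => h j (Finset.mem_insert_of_mem hj))

theorem prod {ι : Type*} (hd : ∀ i, 0 ≤ d i) (s : Finset ι) (f : ι → MvPolynomial σ K)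
    (τ : ι → ℝ) (h : ∀ i ∈ s, IndGe ξ d (τ i) (f i)) :
    IndGe ξ d (∑ i ∈ s, τ i) (∏ i ∈ s, f i) := by
  classical
  induction s using Finset.induction_on with
  | empty => exact of_nonpos hd (by simp)
  | insert i s hi ih =>
    rw [Finset.sum_insert hi, Finset.prod_insert hi]
    exact (h i (Finset.mem_insert_self i s)).mul
      (ih fun j hj => h j (Finset.mem_insert_of_mem hj))

theorem det {r : ℕ} (hd : ∀ i, 0 ≤ d i) (A : Matrix (Fin r) (Fin r) (MvPolynomial σ K))
    (τ : Fin r → ℝ) (h : ∀ i j, IndGe ξ d (τ j) (A i j)) : IndGe ξ d (∑ j, τ j) A.det := by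
  classical
  rw [Matrix.det_apply]
  refine sum _ _ fun π _ => ?_
  have h1 := (prod hd Finset.univ (fun i => A (π i) i) τ fun j _ => h (π j) j).smul
    (((Equiv.Perm.sign π : ℤ) : K))
  rwa [Int.cast_smul_eq_zsmul] at h1

theorem pderiv (hd : ∀ i, 0 ≤ d i) (hP : IndGe ξ d t P) (j : σ) :
    IndGe ξ d (t - 1 / d j) (X j * MvPolynomial.pderiv j P) := by
  have h1 : IndGe ξ d (t - 1 / d j) (MvPolynomial.pderiv j P) := by
    intro b hb
    rw [shift_pderiv, coeff_pderiv] at hb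
    have h2 := hP _ (left_ne_zero_of_mul hb)
    rw [wt_add, wt_single] at h2
    push_cast at h2
    linarith
  have h2 : IndGe ξ d 0 (X j : MvPolynomial σ K) := of_nonpos hd le_rfl
  simpa using h2.mul h1

end IndGe

theorem coeff_X_mul_pderiv (j : σ) (a : σ →₀ ℕ) (P : MvPolynomial σ K) :
    coeff a (X j * pderiv j P) = a j * coeff a P := by
  rw [coeff_X_mul']
  split_ifs with h
  · rw [coeff_pderiv]
    have hj : a j ≠ 0 := Finsupp.mem_support_iff.mp h
    have h1 : a - Finsupp.single j 1 + Finsupp.single j 1 = a := by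
      apply tsub_add_cancel_of_le
      rw [Finsupp.single_le_iff]; omega
    rw [h1, mul_comm]
    congr 1
    have := DFunLike.congr_fun h1 j
    simp only [Finsupp.add_apply, Finsupp.single_eq_same] at this
    have h2 := congrArg (Nat.cast (R := K)) this
    push_cast at h2
    exact h2
  · rw [Finsupp.notMem_support_iff.mp h]; simp

theorem mchoose_single (a : σ →₀ ℕ) (j : σ) (k : ℕ) :
    mchoose a (Finsupp.single j k) = (a j).choose k := by
  rw [mchoose, Finset.prod_eq_single j]
  · simp
  · intro i _ hi; simp [hi.symm]
  · simp

theorem IndGe.diagOp_single [CharZero K] {ξ : σ → K} {d : σ → ℝ} (hd : ∀ i, 0 ≤ d i) {t : ℝ}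
    {P : MvPolynomial σ K} (hP : IndGe ξ d t P) (j : σ) (k : ℕ) :
    IndGe ξ d (t - k / d j) (diagOp (Finsupp.single j k) P) := by
  induction k with
  | zero =>
    have : diagOp (Finsupp.single j 0) P = P := by
      ext a; rw [coeff_diagOp, mchoose_single]; simp
    rw [this]; simpa using hP
  | succ k ih =>
    have hk : ((k : K) + 1) ≠ 0 := by exact_mod_cast Nat.succ_ne_zero k
    have h1 : diagOp (Finsupp.single j (k + 1)) P = ((k : K) + 1)⁻¹ •
        (X j * MvPolynomial.pderiv j (diagOp (Finsupp.single j k) P) +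
          (-(k : K)) • diagOp (Finsupp.single j k) P) := by
      ext a
      rw [coeff_smul, coeff_add, coeff_smul, coeff_X_mul_pderiv, coeff_diagOp, coeff_diagOp,
        mchoose_single, mchoose_single, smul_eq_mul, smul_eq_mul, eq_inv_mul_iff_mul_eq₀ hk]
      have h2 : ((a j).choose (k + 1) : K) * (k + 1) = (a j).choose k * ((a j : K) - k) := by
        rcases le_or_gt k (a j) with h | h
        · have := Nat.choose_succ_right_eq (a j) k
          rw [← Nat.cast_sub h]; exact_mod_cast this
        · rw [Nat.choose_eq_zero_of_lt h, Nat.choose_eq_zero_of_lt (by omega)]; simp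
      linear_combination (coeff a P) * h2
    rw [h1]
    have h2 : t - ((k + 1 : ℕ) : ℝ) / d j = (t - k / d j) - 1 / d j := by push_cast; ring
    rw [h2]
    refine IndGe.smul _ ((ih.pderiv hd j).add (IndGe.smul _ (ih.mono ?_)))
    have : 0 ≤ 1 / d j := by have := hd j; positivity
    linarith

theorem IndGe.diagOp [CharZero K] {ξ : σ → K} {d : σ → ℝ} (hd : ∀ i, 0 ≤ d i) {t : ℝ}
    {P : MvPolynomial σ K} (hP : IndGe ξ d t P) (μ : σ →₀ ℕ) :
    IndGe ξ d (t - wt d μ) (diagOp μ P) := by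
  induction μ using Finsupp.induction generalizing t P with
  | zero =>
    have : SubspaceAux.diagOp 0 P = P := by
      ext a; rw [coeff_diagOp]; simp [mchoose]
    rw [this]; simpa [wt] using hP
  | single_add j k μ hj hk ih =>
    have h1 : SubspaceAux.diagOp (Finsupp.single j k + μ) P =
        SubspaceAux.diagOp μ (SubspaceAux.diagOp (Finsupp.single j k) P) := by
      ext a
      rw [coeff_diagOp, coeff_diagOp, coeff_diagOp, ← mul_assoc, mchoose_single]
      congr 1
      norm_cast
      unfold mchoose
      rw [← Finset.mul_prod_erase Finset.univ _ (Finset.mem_univ j),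
        ← Finset.mul_prod_erase Finset.univ (fun i => (a i).choose (μ i)) (Finset.mem_univ j)]
      have hμj : μ j = 0 := Finsupp.notMem_support_iff.mp hj
      simp only [Finsupp.add_apply, Finsupp.single_eq_same, hμj, add_zero, Nat.choose_zero_right,
        one_mul]
      rw [mul_comm]
      congr 1
      apply Finset.prod_congr rfl
      intro i hi
      have : i ≠ j := (Finset.mem_erase.mp hi).1
      simp [this.symm]
    rw [h1, wt_add, wt_single, ← sub_sub]
    exact ih (hP.diagOp_single hd j k)

end Index

section Decomp
variable {σ : Type*} [Fintype σ] [DecidableEq σ] {K : Type*} [Field K]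

theorem exists_tensor_decomposition {s : Set σ} {y : σ} {P : MvPolynomial σ K}
    (hP : P ∈ supported K (insert y s)) {e : ℕ} (he : degreeOf y P ≤ e) :
    ∃ (r : ℕ) (φ ψ : Fin r → MvPolynomial σ K), r ≤ e + 1 ∧ (∀ i, φ i ∈ supported K s) ∧
      (∀ i, ψ i ∈ supported K {y}) ∧ LinearIndependent K φ ∧ LinearIndependent K ψ ∧
      P = ∑ i, φ i * ψ i := by
  let p : Fin (e + 1) → MvPolynomial σ K := fun c =>
    ∑ a ∈ P.support with a y = (c : ℕ), monomial (a.erase y) (coeff a P)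
  have hp : ∀ c, p c ∈ supported K s := by
    intro c
    refine Subalgebra.sum_mem _ fun a ha => ?_
    rw [mem_supported_iff_coeff]
    intro b hb i hi
    rw [coeff_monomial] at hb
    split_ifs at hb with h
    · rw [← h]
      by_cases hiy : i = y
      · rw [hiy, Finsupp.erase_same]
      · rw [Finsupp.erase_ne hiy]
        exact mem_supported_iff_coeff.mp hP a hb i (by simp [hiy, hi])
    · exact absurd rfl hb
  have hPsum : P = ∑ c : Fin (e + 1), p c * X y ^ (c : ℕ) := by
    conv_lhs => rw [P.as_sum]
    have hmaps : ∀ a ∈ P.support, a y < e + 1 := fun a ha =>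
      Nat.lt_succ_of_le ((degreeOf_le_iff.mp he) a ha)
    have h1 := Finset.sum_fiberwise_of_maps_to (s := P.support) (t := Finset.range (e + 1))
      (g := fun a => a y) (fun a ha => Finset.mem_range.mpr (hmaps a ha))
      (fun a => monomial a (coeff a P))
    rw [← h1, Finset.sum_range]
    refine Finset.sum_congr rfl fun c _ => ?_
    simp only [p, Finset.sum_mul]
    refine Finset.sum_congr rfl fun a ha => ?_
    rw [X_pow_eq_monomial, monomial_mul, mul_one]
    congr 1
    rw [← (Finset.mem_filter.mp ha).2, Finsupp.erase_add_single]
  let W := Submodule.span K (Set.range p)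
  have hpW : ∀ c, p c ∈ W := fun c => Submodule.subset_span ⟨c, rfl⟩
  have hfin : Module.Finite K W := FiniteDimensional.span_of_finite K (Set.finite_range p)
  let bs := Module.finBasis K W
  refine ⟨Module.finrank K W, fun i => bs i,
    fun i => ∑ c : Fin (e + 1), bs.repr ⟨p c, hpW c⟩ i • X y ^ (c : ℕ), ?_, ?_, ?_, ?_, ?_, ?_⟩
  · exact (finrank_range_le_card (R := K) p).trans (by simp)
  · intro i
    have : W ≤ (supported K s).toSubmodule := by
      rw [Submodule.span_le]
      rintro _ ⟨c, rfl⟩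
      exact hp c
    exact this (bs i).2
  · intro i
    refine Subalgebra.sum_mem _ fun c _ => Subalgebra.smul_mem _ (Subalgebra.pow_mem _ ?_ _) _
    exact X_mem_supported.mpr rfl
  · exact bs.linearIndependent.map' W.subtype (Submodule.ker_subtype W)
  · rw [Fintype.linearIndependent_iff]
    intro g hg
    let Λ : W →ₗ[K] K := bs.constr K g
    have hΛ : ∀ c, Λ ⟨p c, hpW c⟩ = 0 := by
      intro c
      have h1 := congrArg (coeff (Finsupp.single y (c : ℕ))) hg
      simp only [coeff_sum, coeff_smul, coeff_zero, smul_eq_mul] at h1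
      rw [Module.Basis.constr_apply_fintype]
      rw [← h1]
      refine Finset.sum_congr rfl fun i _ => ?_
      rw [Finset.sum_eq_single c]
      · simp [coeff_X_pow, mul_comm]
      · intro c' _ hc'
        rw [coeff_X_pow, if_neg, mul_zero]
        intro h
        exact hc' (Fin.ext (Finsupp.single_injective y h))
      · simp
    have hzero : ∀ w : W, Λ w = 0 := by
      rintro ⟨w, hw⟩
      induction hw using Submodule.span_induction with
      | mem x hx => obtain ⟨c, rfl⟩ := hx; exact hΛ c
      | zero => exact map_zero Λ
      | add x z hx hz h1 h2 =>
        have := map_add Λ ⟨x, hx⟩ ⟨z, hz⟩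
        rw [h1, h2, add_zero] at this
        exact this
      | smul t x hx h1 =>
        have := map_smul Λ t ⟨x, hx⟩
        rw [h1, smul_zero] at this
        exact this
    intro i
    rw [← hzero (bs i)]
    exact (bs.constr_basis K g i).symm
  · conv_lhs => rw [hPsum]
    simp only [Finset.mul_sum]
    rw [Finset.sum_comm]
    refine Finset.sum_congr rfl fun c _ => ?_
    have h1 := congrArg Subtype.val (bs.sum_repr ⟨p c, hpW c⟩)
    simp only [Submodule.coe_sum, Submodule.coe_smul] at h1
    conv_lhs => rw [← h1, Finset.sum_mul]
    refine Finset.sum_congr rfl fun i _ => ?_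
    simp [Algebra.smul_def]
    ring

theorem diagOp_mul_of_disjoint {s t : Set σ} (hst : Disjoint s t) {P Q : MvPolynomial σ K}
    (hP : P ∈ supported K s) (hQ : Q ∈ supported K t) {μ ν : σ →₀ ℕ}
    (hμ : ∀ i ∉ s, μ i = 0) (hν : ∀ i ∉ t, ν i = 0) :
    diagOp μ (diagOp ν (P * Q)) = diagOp μ P * diagOp ν Q := by
  ext c
  rw [coeff_diagOp, coeff_diagOp, coeff_mul, coeff_mul, Finset.mul_sum, Finset.mul_sum]
  refine Finset.sum_congr rfl fun x hx => ?_
  rw [Finset.HasAntidiagonal.mem_antidiagonal] at hx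
  rw [coeff_diagOp, coeff_diagOp]
  by_cases h1 : coeff x.1 P = 0
  · simp [h1]
  by_cases h2 : coeff x.2 Q = 0
  · simp [h2]
  have ha := mem_supported_iff_coeff.mp hP _ h1
  have hb := mem_supported_iff_coeff.mp hQ _ h2
  have e1 : mchoose c μ = mchoose x.1 μ := by
    refine Finset.prod_congr rfl fun i _ => ?_
    by_cases hi : i ∈ s
    · rw [← hx, Finsupp.add_apply, hb i (Set.disjoint_left.mp hst hi), add_zero]
    · simp [hμ i hi]
  have e2 : mchoose c ν = mchoose x.2 ν := by
    refine Finset.prod_congr rfl fun i _ => ?_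
    by_cases hi : i ∈ t
    · rw [← hx, Finsupp.add_apply, ha i (Set.disjoint_right.mp hst hi), zero_add]
    · simp [hν i hi]
  rw [e1, e2]; ring

theorem diagOp_eq_zero_of_supported {s : Set σ} {P : MvPolynomial σ K}
    (hP : P ∈ supported K s) {μ : σ →₀ ℕ} {i : σ} (hi : i ∉ s) (hμ : μ i ≠ 0) :
    diagOp μ P = 0 := by
  ext a
  rw [coeff_diagOp, coeff_zero]
  by_cases h : coeff a P = 0
  · rw [h, mul_zero]
  · have h0 := mem_supported_iff_coeff.mp hP a h i hi
    have : mchoose a μ = 0 := by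
      apply Finset.prod_eq_zero (Finset.mem_univ i)
      rw [h0]; exact Nat.choose_eq_zero_of_lt (by omega)
    rw [this]; simp

theorem diagOp_mem_supported {s : Set σ} {P : MvPolynomial σ K}
    (hP : P ∈ supported K s) (μ : σ →₀ ℕ) : diagOp μ P ∈ supported K s := by
  rw [mem_supported_iff_coeff] at hP ⊢
  intro a ha
  rw [coeff_diagOp] at ha
  exact hP a (right_ne_zero_of_mul ha)

/-- The coefficients of the two factors of a product in separate variables can be
normalised to be coefficients of the product. -/
theorem exists_normalized_factors {s t : Set σ} (hst : Disjoint s t) {P Q : MvPolynomial σ K}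
    (hP : P ∈ supported K s) (hQ : Q ∈ supported K t) (hQ0 : Q ≠ 0) :
    ∃ (κ : K) (b : σ →₀ ℕ), κ ≠ 0 ∧ ∀ a, coeff a (κ • P) ≠ 0 →
      coeff a (κ • P) = coeff (a + b) (P * Q) := by
  obtain ⟨b, hb⟩ := ne_zero_iff.mp hQ0
  refine ⟨coeff b Q, b, hb, fun a ha => ?_⟩
  rw [coeff_smul, smul_eq_mul] at ha ⊢
  rw [coeff_mul_of_disjoint hst hP hQ (mem_supported_iff_coeff.mp hP a (right_ne_zero_of_mul ha))
    (mem_supported_iff_coeff.mp hQ b hb), mul_comm]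

end Decomp

section WNorm
variable {σ : Type*} [Fintype σ] [DecidableEq σ] {K : Type*} [Field K]

/-- The weighted `ℓ¹`-norm of a polynomial. -/
noncomputable def wnorm (f : AbsoluteValue K ℝ) (q : σ → ℝ) (P : MvPolynomial σ K) : ℝ :=
  ∑ a ∈ P.support, f (coeff a P) * ∏ i, q i ^ a i

variable {f : AbsoluteValue K ℝ} {q : σ → ℝ}

theorem wnorm_eq_sum {P : MvPolynomial σ K} {T : Finset (σ →₀ ℕ)} (h : P.support ⊆ T) :
    wnorm f q P = ∑ a ∈ T, f (coeff a P) * ∏ i, q i ^ a i := by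
  refine Finset.sum_subset h fun a _ ha => ?_
  rw [notMem_support_iff.mp ha, map_zero, zero_mul]

theorem wnorm_nonneg (hq : ∀ i, 0 ≤ q i) (P : MvPolynomial σ K) : 0 ≤ wnorm f q P :=
  Finset.sum_nonneg fun _ _ => mul_nonneg (f.nonneg _)
    (Finset.prod_nonneg fun i _ => pow_nonneg (hq i) _)

theorem coeff_le_wnorm (hq : ∀ i, 0 ≤ q i) (P : MvPolynomial σ K) (a : σ →₀ ℕ) :
    f (coeff a P) * ∏ i, q i ^ a i ≤ wnorm f q P := by
  by_cases h : a ∈ P.support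
  · exact Finset.single_le_sum (f := fun a => f (coeff a P) * ∏ i, q i ^ a i)
      (fun _ _ => mul_nonneg (f.nonneg _) (Finset.prod_nonneg fun i _ => pow_nonneg (hq i) _)) h
  · rw [notMem_support_iff.mp h, map_zero, zero_mul]; exact wnorm_nonneg hq P

theorem wnorm_zero : wnorm f q (0 : MvPolynomial σ K) = 0 := by simp [wnorm]

theorem wnorm_monomial (a : σ →₀ ℕ) (c : K) :
    wnorm f q (monomial a c) = f c * ∏ i, q i ^ a i := by
  rw [wnorm_eq_sum (T := {a}) support_monomial_subset]; simp

theorem wnorm_C (c : K) : wnorm f q (C c) = f c := by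
  rw [C_apply, wnorm_monomial]; simp

theorem wnorm_X (i : σ) : wnorm f q (X i : MvPolynomial σ K) = q i := by
  rw [X, wnorm_monomial, Finset.prod_eq_single i]
  · simp
  · intro j _ hj; simp [hj.symm]
  · simp

theorem wnorm_add_le (hq : ∀ i, 0 ≤ q i) (P Q : MvPolynomial σ K) :
    wnorm f q (P + Q) ≤ wnorm f q P + wnorm f q Q := by
  rw [wnorm_eq_sum (T := P.support ∪ Q.support) support_add,
    wnorm_eq_sum (P := P) (T := P.support ∪ Q.support) Finset.subset_union_left,
    wnorm_eq_sum (P := Q) (T := P.support ∪ Q.support) Finset.subset_union_right,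
    ← Finset.sum_add_distrib]
  refine Finset.sum_le_sum fun a _ => ?_
  rw [← add_mul, coeff_add]
  exact mul_le_mul_of_nonneg_right (f.add_le _ _)
    (Finset.prod_nonneg fun i _ => pow_nonneg (hq i) _)

theorem wnorm_sum_le (hq : ∀ i, 0 ≤ q i) {ι : Type*} (s : Finset ι)
    (g : ι → MvPolynomial σ K) : wnorm f q (∑ i ∈ s, g i) ≤ ∑ i ∈ s, wnorm f q (g i) := by
  classical
  induction s using Finset.induction_on with
  | empty => simp [wnorm_zero]
  | insert i s hi ih =>
    rw [Finset.sum_insert hi, Finset.sum_insert hi]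
    exact (wnorm_add_le hq _ _).trans (by linarith)

theorem wnorm_mul_le (hq : ∀ i, 0 ≤ q i) (P Q : MvPolynomial σ K) :
    wnorm f q (P * Q) ≤ wnorm f q P * wnorm f q Q := by
  conv_lhs => rw [P.as_sum, Q.as_sum, Finset.sum_mul_sum]
  refine (wnorm_sum_le hq _ _).trans ?_
  conv_rhs => rw [wnorm, wnorm, Finset.sum_mul_sum]
  refine Finset.sum_le_sum fun a _ => (wnorm_sum_le hq _ _).trans
    (Finset.sum_le_sum fun b _ => le_of_eq ?_)
  rw [monomial_mul, wnorm_monomial, map_mul]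
  simp only [Finsupp.add_apply, pow_add, Finset.prod_mul_distrib]
  ring

theorem wnorm_smul (c : K) (P : MvPolynomial σ K) :
    wnorm f q (c • P) = f c * wnorm f q P := by
  rw [wnorm_eq_sum (T := P.support) support_smul, wnorm, Finset.mul_sum]
  refine Finset.sum_congr rfl fun a _ => ?_
  rw [coeff_smul, smul_eq_mul, map_mul, mul_assoc]

theorem wnorm_one : wnorm f q (1 : MvPolynomial σ K) = 1 := by
  rw [← C_1, wnorm_C, map_one]

theorem wnorm_prod_le (hq : ∀ i, 0 ≤ q i) {ι : Type*} (s : Finset ι)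
    (g : ι → MvPolynomial σ K) : wnorm f q (∏ i ∈ s, g i) ≤ ∏ i ∈ s, wnorm f q (g i) := by
  classical
  induction s using Finset.induction_on with
  | empty => simp [wnorm_one]
  | insert i s hi ih =>
    rw [Finset.prod_insert hi, Finset.prod_insert hi]
    exact (wnorm_mul_le hq _ _).trans (mul_le_mul_of_nonneg_left ih (wnorm_nonneg hq _))

theorem wnorm_pow_le (hq : ∀ i, 0 ≤ q i) (P : MvPolynomial σ K) (k : ℕ) :
    wnorm f q (P ^ k) ≤ wnorm f q P ^ k := by
  simpa using wnorm_prod_le (f := f) hq (Finset.range k) (fun _ => P)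

theorem wnorm_det_le (hq : ∀ i, 0 ≤ q i) {r : ℕ} (A : Matrix (Fin r) (Fin r) (MvPolynomial σ K))
    {B : ℝ} (h : ∀ i j, wnorm f q (A i j) ≤ B) : wnorm f q A.det ≤ r.factorial * B ^ r := by
  rw [Matrix.det_apply]
  refine (wnorm_sum_le hq _ _).trans ?_
  have : ∀ π ∈ (Finset.univ : Finset (Equiv.Perm (Fin r))),
      wnorm f q (Equiv.Perm.sign π • ∏ i, A (π i) i) ≤ B ^ r := by
    intro π _
    have h1 : (Equiv.Perm.sign π • ∏ i, A (π i) i) =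
        (((Equiv.Perm.sign π : ℤ) : K)) • ∏ i, A (π i) i := by
      rw [Int.cast_smul_eq_zsmul]; rfl
    rw [h1, wnorm_smul]
    have h2 : f (((Equiv.Perm.sign π : ℤ) : K)) = 1 := by
      rcases Int.units_eq_one_or (Equiv.Perm.sign π) with h | h <;> simp [h]
    rw [h2, one_mul]
    refine (wnorm_prod_le hq _ _).trans ?_
    refine (Finset.prod_le_prod (fun i _ => wnorm_nonneg hq _) fun i _ => h (π i) i).trans ?_
    simp
  refine (Finset.sum_le_sum this).trans ?_
  simp [Fintype.card_perm]

theorem abv_natCast_le (f : AbsoluteValue K ℝ) (n : ℕ) : f (n : K) ≤ n := by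
  induction n with
  | zero => simp
  | succ n ih =>
    push_cast
    exact (f.add_le _ _).trans (by rw [map_one]; linarith)

end WNorm

/-- The arithmetic input on a field with a finite set of places: absolute values with
multiplicities, rings of integers, a logarithmic height, and the classical finiteness and
smallness principles. -/
structure PlaceSystem (K : Type*) [Field K] (S : Type) [Fintype S] where
  abv : S → AbsoluteValue K ℝ
  mult : S → ℕ
  mult_pos : ∀ v, 1 ≤ mult v
  v₀ : S
  mult_v₀ : mult v₀ = 1
  int : Subring K
  ring : Subring K
  int_le : int ≤ ring
  frac : ∀ x : K, ∃ d ∈ int, d ≠ 0 ∧ d * x ∈ int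
  one_le_prod : ∀ x ∈ ring, x ≠ 0 → 1 ≤ ∏ v, abv v x ^ mult v
  minkowski : ∀ (ι : Type) [Fintype ι] [Nonempty ι] (L : S → Matrix ι ι K),
    ∃ C : ℝ, 0 < C ∧ ∀ b : S → ι → ℝ, (∀ v i, 0 < b v i) →
      C ≤ ∏ v, (∏ i, b v i) ^ mult v →
      ∃ x : ι → K, x ≠ 0 ∧ (∀ i, x i ∈ ring) ∧ ∀ v i, abv v ((L v).mulVec x i) ≤ b v i
  siegel : ∃ C : ℝ, 1 ≤ C ∧ ∀ (ι κ : Type) [Fintype ι] [Fintype κ] (A : κ → ι → K) (b : ℝ),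
    0 ≤ b → Nonempty ι → 2 * Fintype.card κ ≤ Fintype.card ι → Fintype.card ι ≤ Real.exp b →
      (∀ i j, A i j ∈ int ∧ ∀ v, abv v (A i j) ≤ Real.exp b) →
      ∃ x : ι → K, x ≠ 0 ∧
        (∀ j, x j ∈ int ∧ ∀ v, abv v (x j) ≤ Real.exp (C * (b + 1))) ∧
        ∀ i, ∑ j, A i j * x j = 0
  ht : K → ℝ
  ht_nonneg : ∀ x, 0 ≤ ht x
  ht_inv : ∀ x, ht x⁻¹ = ht x
  ht_mul_le : ∀ x y, ht (x * y) ≤ ht x + ht y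
  ht_add_le : ∀ x y, ht (x + y) ≤ ht x + ht y + 1
  abv_le : ∀ v x, abv v x ≤ Real.exp (ht x)
  northcott : ∀ B : ℝ, {x | ht x ≤ B}.Finite
  root_bound : ∃ C : ℝ, 1 ≤ C ∧ ∀ (p : Polynomial K) (ξ : K) (t D : ℕ) (b : ℝ), 0 ≤ b → p ≠ 0 →
    p.natDegree ≤ D → (∀ i, p.coeff i ∈ ring) → (∀ v i, abv v (p.coeff i) ≤ Real.exp b) →
    (Polynomial.X - Polynomial.C ξ) ^ t ∣ p → t * ht ξ ≤ C * (b + D)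

section Roth
variable {K : Type*} [Field K] {S : Type} [Fintype S] (PS : PlaceSystem K S)

theorem sum_max_sub_ge {τ : ℝ} (h0 : 0 < τ) (h1 : τ ≤ 1) {r e : ℕ} (he : 1 ≤ e)
    (hr : r ≤ e + 1) : r * τ ^ 2 / 8 ≤ ∑ j : Fin r, max 0 (τ - (j : ℕ) / e) := by
  have he' : (1 : ℝ) ≤ e := by exact_mod_cast he
  have hr' : (r : ℝ) ≤ e + 1 := by exact_mod_cast hr
  rw [Fin.sum_univ_eq_sum_range (fun j => max 0 (τ - (j : ℝ) / e)) r]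
  set n := min r (⌊τ * e / 2⌋₊ + 1) with hn
  have hsub : Finset.range n ⊆ Finset.range r := Finset.range_mono (min_le_left _ _)
  have h2 : ∑ j ∈ Finset.range n, τ / 2 ≤ ∑ j ∈ Finset.range r, max 0 (τ - (j : ℝ) / e) := by
    refine (Finset.sum_le_sum fun j hj => ?_).trans
      (Finset.sum_le_sum_of_subset_of_nonneg hsub fun _ _ _ => le_max_left _ _)
    have hj1 : j ≤ ⌊τ * e / 2⌋₊ := by
      have := Finset.mem_range.mp hj
      omega
    have hj2 : (j : ℝ) ≤ τ * e / 2 := (Nat.le_floor_iff (by positivity)).mp hj1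
    refine le_max_of_le_right ?_
    have : (j : ℝ) / e ≤ τ / 2 := by rw [div_le_iff₀ (by linarith)]; linarith
    linarith
  refine le_trans ?_ h2
  rw [Finset.sum_const, Finset.card_range, nsmul_eq_mul]
  have h3 : (r : ℝ) * τ / 4 ≤ n := by
    rw [hn]; push_cast
    refine le_min ?_ ?_
    · have : (0 : ℝ) ≤ r := Nat.cast_nonneg r
      nlinarith
    · have h4 : τ * e / 2 < ⌊τ * e / 2⌋₊ + 1 := Nat.lt_floor_add_one _
      rcases le_or_gt 1 (τ * e / 2) with h5 | h5
      · nlinarith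
      · have : (0 : ℝ) ≤ ⌊τ * (e : ℝ) / 2⌋₊ := Nat.cast_nonneg _
        nlinarith
  nlinarith

theorem mchoose_le {σ : Type*} [Fintype σ] (a μ : σ →₀ ℕ) : mchoose a μ ≤ 2 ^ ∑ i, a i := by
  rw [← Finset.prod_pow_eq_pow_sum]
  exact Finset.prod_le_prod' fun i _ => Nat.choose_le_two_pow _ _

theorem wnorm_le_of_coeff_injective {σ : Type*} [Fintype σ] [DecidableEq σ]
    (f : AbsoluteValue K ℝ) {P Q : MvPolynomial σ K} (b : σ →₀ ℕ)
    (h : ∀ a, coeff a P ≠ 0 → coeff a P = coeff (a + b) Q) :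
    wnorm f 1 P ≤ wnorm f 1 Q := by
  simp only [wnorm, Pi.one_apply, one_pow, Finset.prod_const_one, mul_one]
  have h1 : ∑ a ∈ P.support, f (coeff a P) =
      ∑ c ∈ P.support.image (fun a => a + b), f (coeff c Q) := by
    rw [Finset.sum_image fun x _ y _ hxy => add_right_cancel hxy]
    exact Finset.sum_congr rfl fun a ha => by rw [h a (mem_support_iff.mp ha)]
  rw [h1]
  refine Finset.sum_le_sum_of_subset_of_nonneg ?_ fun _ _ _ => f.nonneg _
  intro c hc
  obtain ⟨a, ha, rfl⟩ := Finset.mem_image.mp hc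
  rw [mem_support_iff, ← h a (mem_support_iff.mp ha)]
  exact mem_support_iff.mp ha

/-- One-variable root bound for polynomials in a single variable of a larger set. -/
theorem exists_coeff_shift_of_supported_singleton {σ : Type*} [Fintype σ] [DecidableEq σ] :
    ∃ C : ℝ, 1 ≤ C ∧ ∀ (y : σ) (ξ : σ → K) (P : MvPolynomial σ K) (t D : ℕ) (b : ℝ), 0 ≤ b →
      P ≠ 0 → P ∈ supported K {y} → degreeOf y P ≤ D → (∀ a, coeff a P ∈ PS.ring) →
      (∀ v, wnorm (PS.abv v) 1 P ≤ Real.exp b) → C * (b + D) < t * PS.ht (ξ y) →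
      ∃ k < t, coeff (Finsupp.single y k) (shift ξ P) ≠ 0 := by
  obtain ⟨C, hC, h⟩ := PS.root_bound
  refine ⟨C, hC, fun y ξ P t D b hb hP hPy hD hint hnorm hlt => ?_⟩
  by_contra hcon
  push Not at hcon
  -- passage to one-variable polynomials
  let φ : MvPolynomial σ K →ₐ[K] Polynomial K := aeval fun _ => Polynomial.X
  have hmon : ∀ Q ∈ supported K ({y} : Set σ), ∀ a, coeff a Q ≠ 0 →
      a = Finsupp.single y (a y) := by
    intro Q hQ a ha
    ext i
    by_cases hi : i = y
    · simp [hi]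
    · rw [mem_supported_iff_coeff.mp hQ a ha i (by simpa using hi)]
      simp [Ne.symm hi]
  have hcoeff : ∀ Q ∈ supported K ({y} : Set σ), ∀ k,
      (φ Q).coeff k = coeff (Finsupp.single y k) Q := by
    intro Q hQ k
    conv_lhs => rw [Q.as_sum, map_sum, Polynomial.finsetSum_coeff]
    have h1 : ∀ a ∈ Q.support, (φ (monomial a (coeff a Q))).coeff k =
        if a = Finsupp.single y k then coeff a Q else 0 := by
      intro a ha
      have h2 := hmon Q hQ a (mem_support_iff.mp ha)
      have h3 : φ (monomial a (coeff a Q)) =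
          Polynomial.C (coeff a Q) * Polynomial.X ^ (a y) := by
        rw [h2]
        simp [φ, aeval_monomial]
      rw [h3, Polynomial.coeff_C_mul_X_pow]
      by_cases h4 : k = a y
      · rw [if_pos h4, if_pos (by rw [h4]; exact h2)]
      · rw [if_neg h4, if_neg]
        intro h5
        apply h4
        rw [h5]; simp
    rw [Finset.sum_congr rfl h1, Finset.sum_ite_eq']
    split_ifs with h5
    · rfl
    · exact (notMem_support_iff.mp h5).symm
  have hshift : φ (shift ξ P) = Polynomial.taylor (ξ y) (φ P) := by
    have h1 : ∀ Q ∈ supported K ({y} : Set σ),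
        φ (shift ξ Q) = Polynomial.taylorAlgHom (ξ y) (φ Q) := by
      have : supported K ({y} : Set σ) ≤
          AlgHom.equalizer (φ.comp (shift ξ)) ((Polynomial.taylorAlgHom (ξ y)).comp φ) := by
        conv_lhs => rw [supported]
        rw [Algebra.adjoin_le_iff]
        rintro _ ⟨i, hi, rfl⟩
        rw [Set.mem_singleton_iff.mp hi]
        simp [φ, shift]
      intro Q hQ
      exact this hQ
    exact h1 P hPy
  have hne : φ P ≠ 0 := by
    obtain ⟨a, ha⟩ := ne_zero_iff.mp hP
    intro h0
    apply ha
    rw [hmon P hPy a ha, ← hcoeff P hPy, h0, Polynomial.coeff_zero]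
  have hdvd : (Polynomial.X - Polynomial.C (ξ y)) ^ t ∣ φ P := by
    have h1 : Polynomial.X ^ t ∣ Polynomial.taylor (ξ y) (φ P) := by
      rw [Polynomial.X_pow_dvd_iff]
      intro k hk
      rw [← hshift, hcoeff _ (shift_mem_supported ξ hPy)]
      exact hcon k hk
    exact (Polynomial.X_sub_C_pow_dvd_iff).mpr h1
  have := h (φ P) (ξ y) t D b hb hne ?_ ?_ ?_ hdvd
  · linarith
  · rw [Polynomial.natDegree_le_iff_coeff_eq_zero]
    intro k hk
    rw [hcoeff P hPy]
    by_contra h0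
    have := degreeOf_le_iff.mp hD _ (mem_support_iff.mpr h0)
    simp at this; omega
  · intro i; rw [hcoeff P hPy]; exact hint _
  · intro v i
    rw [hcoeff P hPy]
    refine le_trans ?_ (hnorm v)
    simpa using coeff_le_wnorm (f := PS.abv v) (q := (1 : σ → ℝ)) (by simp) P (Finsupp.single y i)

end Roth

section Roth
variable {K : Type*} [Field K] {S : Type} [Fintype S] (PS : PlaceSystem K S)

theorem degreeOf_det_le {σ : Type*} {r : ℕ}
    (A : Matrix (Fin r) (Fin r) (MvPolynomial σ K)) (i : σ) {D : ℕ}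
    (h : ∀ x y, degreeOf i (A x y) ≤ D) : degreeOf i A.det ≤ r * D := by
  rw [Matrix.det_apply]
  refine (degreeOf_sum_le _ _ _).trans (Finset.sup_le fun π _ => ?_)
  have h1 : (Equiv.Perm.sign π • ∏ i, A (π i) i) =
      C (((Equiv.Perm.sign π : ℤ) : K)) * ∏ i, A (π i) i := by
    rw [← smul_eq_C_mul, Int.cast_smul_eq_zsmul]; rfl
  rw [h1]
  refine (degreeOf_C_mul_le _ _ _).trans ?_
  refine (degreeOf_prod_le _ _ _).trans ?_
  refine (Finset.sum_le_sum fun x _ => h _ _).trans ?_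
  simp

theorem det_mem_ring {σ : Type*} {r : ℕ} (R : Subring K)
    (A : Matrix (Fin r) (Fin r) (MvPolynomial σ K))
    (h : ∀ x y a, coeff a (A x y) ∈ R) (a : σ →₀ ℕ) : coeff a A.det ∈ R := by
  have key : ∀ P : MvPolynomial σ K, (∀ a, coeff a P ∈ R) ↔ P ∈ (map R.subtype).range := by
    intro P
    rw [RingHom.mem_range, ← Set.mem_range, mem_range_map_iff_coeffs_subset]
    constructor
    · intro h x hx
      obtain ⟨a, _, rfl⟩ := mem_coeffs_iff.mp hx
      exact ⟨⟨_, h a⟩, rfl⟩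
    · intro h a
      by_cases h0 : coeff a P = 0
      · rw [h0]; exact zero_mem R
      · obtain ⟨x, hx⟩ := h (coeff_mem_coeffs a h0)
        rw [← hx]; exact x.2
  revert a
  rw [key, Matrix.det_apply]
  refine Subring.sum_mem _ fun π _ => ?_
  refine Subring.zsmul_mem _ (Subring.prod_mem _ fun i _ => (key _).mp (h _ _)) _

/-- **Roth's lemma.** -/
theorem exists_small_index [CharZero K] {σ : Type*} [Fintype σ] [LinearOrder σ] (s : Finset σ) :
    ∀ τ : ℝ, 0 < τ → ∃ ω : ℝ, 0 < ω ∧ ω ≤ 1 ∧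
      ∀ (d : σ → ℕ) (ξ : σ → K) (P : MvPolynomial σ K) (b D : ℝ), (∀ i, 1 ≤ d i) → 0 ≤ b →
        P ≠ 0 → P ∈ supported K (s : Set σ) → (∀ i, degreeOf i P ≤ d i) →
        (∀ a, coeff a P ∈ PS.ring) → (∀ v, wnorm (PS.abv v) 1 P ≤ Real.exp b) →
        (∀ i ∈ s, ∀ j ∈ s, i < j → (d i : ℝ) ≤ ω * d j) → (∀ i ∈ s, (d i : ℝ) ≤ D) →
        (∀ i ∈ s, b + D ≤ ω * (d i * PS.ht (ξ i))) →
        ∃ a, coeff a (shift ξ P) ≠ 0 ∧ wt (fun i => (d i : ℝ)) a < τ := by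
  classical
  induction s using Finset.induction_on_min with
  | empty =>
    intro τ hτ
    refine ⟨1, one_pos, le_rfl, fun d ξ P b D _ _ hP hPs _ _ _ _ _ _ => ?_⟩
    obtain ⟨a, ha⟩ := ne_zero_iff.mp (shift_ne_zero ξ hP)
    refine ⟨a, ha, ?_⟩
    have h1 : a = 0 := by
      ext i
      exact mem_supported_iff_coeff.mp (shift_mem_supported ξ hPs) a ha i (by simp)
    rw [h1]; simpa [wt] using hτ
  | insert y s hy ih =>
    intro τ₁ hτ₁
    have hys : y ∉ s := fun h => (hy y h).false
    set τ := min τ₁ 1 with hτdef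
    have hτ : 0 < τ := lt_min hτ₁ one_pos
    have hτ1 : τ ≤ 1 := min_le_right _ _
    set ρ := τ ^ 2 / 64 with hρ
    have hρ0 : 0 < ρ := by positivity
    obtain ⟨ω₁, hω₁, hω₁1, IH⟩ := ih ρ hρ0
    obtain ⟨Cr, hCr, hroot⟩ := exists_coeff_shift_of_supported_singleton PS (σ := σ)
    set M : ℝ := (Fintype.card σ : ℝ) with hM
    have hM0 : 0 ≤ M := Nat.cast_nonneg _
    set ω := min (min (τ / 2) (ω₁ / (2 * M + 3))) (ρ / (2 * (Cr * (2 * M + 3)))) with hω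
    have hCr0 : 0 < Cr := by linarith
    have hω0 : 0 < ω := by rw [hω]; refine lt_min (lt_min ?_ ?_) ?_ <;> positivity
    have hωτ : ω ≤ τ / 2 := (min_le_left _ _).trans (min_le_left _ _)
    have hωω₁ : ω * (2 * M + 3) ≤ ω₁ := by
      rw [← le_div_iff₀ (by positivity)]
      exact (min_le_left _ _).trans (min_le_right _ _)
    have hωρ : ω * (2 * (Cr * (2 * M + 3))) ≤ ρ := by
      rw [← le_div_iff₀ (by positivity)]
      exact min_le_right _ _
    have hω_le : ω ≤ ω₁ := by nlinarith
    refine ⟨ω, hω0, by linarith, fun d ξ P b D hd hb hP hPs hdeg hint hnorm hratio hD hht => ?_⟩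
    by_contra hcon
    push Not at hcon
    have hd0 : ∀ i, (0 : ℝ) < d i := fun i => by exact_mod_cast hd i
    have hd0' : ∀ i, (0 : ℝ) ≤ (fun i => (d i : ℝ)) i := fun i => (hd0 i).le
    have hInd : IndGe ξ (fun i => (d i : ℝ)) τ P := fun a ha =>
      (min_le_left _ _).trans (hcon a ha)
    rw [Finset.coe_insert] at hPs
    obtain ⟨r, φ, ψ, hr, hφs, hψs, hφ, hψ, hPsum⟩ :=
      exists_tensor_decomposition hPs (hdeg y)
    have hr1 : 1 ≤ r := by
      by_contra h
      have : r = 0 := by omega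
      subst this
      exact hP (by simpa using hPsum)
    have hr0 : (0 : ℝ) < r := by exact_mod_cast hr1
    obtain ⟨μ, hμ, hμdet⟩ := exists_det_diagOp_ne_zero φ hφ
    obtain ⟨ν, hν, hνdet⟩ := exists_det_diagOp_ne_zero ψ hψ
    have hdisj : Disjoint (s : Set σ) {y} := by
      rw [Set.disjoint_singleton_right]; exact_mod_cast hys
    have hμs : ∀ x, ∀ i ∉ (s : Set σ), μ x i = 0 := by
      intro x i hi
      by_contra h0
      exact hμdet (Matrix.det_eq_zero_of_row_eq_zero x fun j =>
        diagOp_eq_zero_of_supported (hφs j) hi h0)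
    have hνy : ∀ x, ∀ i ∉ ({y} : Set σ), ν x i = 0 := by
      intro x i hi
      by_contra h0
      exact hνdet (Matrix.det_eq_zero_of_row_eq_zero x fun j =>
        diagOp_eq_zero_of_supported (hψs j) hi h0)
    -- the generalised Wronskian factors
    set U₁ := (Matrix.of fun i j => diagOp (μ i) (φ j)).det with hU₁
    set U₂ := (Matrix.of fun i j => diagOp (ν i) (ψ j)).det with hU₂
    set A : Matrix (Fin r) (Fin r) (MvPolynomial σ K) :=
      Matrix.of fun i j => diagOp (μ i) (diagOp (ν j) P) with hA
    have hAU : A.det = U₁ * U₂ := by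
      rw [hU₁, hU₂, ← Matrix.det_transpose (Matrix.of fun i j => diagOp (ν i) (ψ j)),
        ← Matrix.det_mul]
      congr 1
      ext1 i j
      simp only [hA, Matrix.of_apply, Matrix.mul_apply, Matrix.transpose_apply]
      conv_lhs => rw [hPsum]
      simp only [map_sum]
      exact Finset.sum_congr rfl fun l _ =>
        diagOp_mul_of_disjoint hdisj (hφs l) (hψs l) (hμs i) (hνy j)
    have hU₁s : U₁ ∈ supported K (s : Set σ) := by
      rw [hU₁, Matrix.det_apply]
      exact Subalgebra.sum_mem _ fun π _ => Subalgebra.zsmul_mem _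
        (Subalgebra.prod_mem _ fun i _ => diagOp_mem_supported (hφs i) _) _
    have hU₂y : U₂ ∈ supported K ({y} : Set σ) := by
      rw [hU₂, Matrix.det_apply]
      exact Subalgebra.sum_mem _ fun π _ => Subalgebra.zsmul_mem _
        (Subalgebra.prod_mem _ fun i _ => diagOp_mem_supported (hψs i) _) _
    -- lower bound for the index
    have hμwt : ∀ x, wt (fun i => (d i : ℝ)) (μ x) ≤ ω := by
      intro x
      have h1 : wt (fun i => (d i : ℝ)) (μ x) ≤ ∑ i, (μ x i : ℝ) * (ω / d y) := by
        refine Finset.sum_le_sum fun i _ => ?_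
        by_cases hi : i ∈ s
        · have h2 := hratio y (Finset.mem_insert_self _ _) i (Finset.mem_insert_of_mem hi)
            (hy i hi)
          rw [div_eq_mul_inv]
          refine mul_le_mul_of_nonneg_left ?_ (Nat.cast_nonneg _)
          rw [inv_eq_one_div, div_le_div_iff₀ (hd0 i) (hd0 y)]
          linarith
        · rw [hμs x i (by exact_mod_cast hi)]; simp
      refine h1.trans ?_
      rw [← Finset.sum_mul]
      have h3 : (∑ i, (μ x i : ℝ)) ≤ d y := by
        have h4 := hμ x
        have h5 : ∑ j, μ x j ≤ d y := by have := x.2; omega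
        exact_mod_cast h5
      calc (∑ i, (μ x i : ℝ)) * (ω / d y) ≤ d y * (ω / d y) :=
            mul_le_mul_of_nonneg_right h3 (div_nonneg hω0.le (hd0 y).le)
        _ = ω := by field_simp [(hd0 y).ne']
    have hνwt : ∀ x : Fin r, wt (fun i => (d i : ℝ)) (ν x) ≤ (x : ℕ) / d y := by
      intro x
      have h1 : wt (fun i => (d i : ℝ)) (ν x) = (ν x y : ℝ) / d y := by
        rw [wt, Finset.sum_eq_single y]
        · intro i _ hi; rw [hνy x i hi]; simp
        · simp
      rw [h1]
      have h2 : ν x y ≤ (x : ℕ) :=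
        (Finset.single_le_sum (f := fun j => ν x j) (fun _ _ => Nat.zero_le _)
          (Finset.mem_univ y)).trans (hν x)
      have h3 : (ν x y : ℝ) ≤ ((x : ℕ) : ℝ) := by exact_mod_cast h2
      exact div_le_div_of_nonneg_right h3 (hd0 y).le
    have hAInd : IndGe ξ (fun i => (d i : ℝ)) (r * τ ^ 2 / 32) A.det := by
      refine (IndGe.det hd0' A (fun j => max 0 (τ / 2 - (j : ℕ) / (d y : ℕ))) ?_).mono ?_
      · intro i j
        rcases le_total (τ / 2 - (j : ℕ) / (d y : ℕ) : ℝ) 0 with h | h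
        · rw [max_eq_left h]; exact IndGe.of_nonpos hd0' le_rfl
        · rw [max_eq_right h]
          refine ((hInd.diagOp hd0' (ν j)).diagOp hd0' (μ i)).mono ?_
          have := hμwt i
          have := hνwt j
          linarith
      · have := sum_max_sub_ge (τ := τ / 2) (by linarith) (by linarith) (hd y) hr
        refine le_trans (le_of_eq ?_) this
        ring
    -- size of the determinant
    set D₀ : ℝ := D with hD₀
    have hDy : (d y : ℝ) ≤ D := hD y (Finset.mem_insert_self _ _)
    have hD1 : 1 ≤ D := le_trans (by exact_mod_cast hd y) hDy
    have hentry : ∀ v i j, wnorm (PS.abv v) 1 (A i j) ≤ Real.exp (b + 2 * M * D) := by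
      intro v i j
      have hsupp : (A i j).support ⊆ P.support := by
        intro a ha
        rw [mem_support_iff] at ha ⊢
        simp only [hA, Matrix.of_apply, coeff_diagOp] at ha
        exact right_ne_zero_of_mul (right_ne_zero_of_mul ha)
      rw [wnorm_eq_sum hsupp, Real.exp_add]
      refine le_trans ?_ (mul_le_mul_of_nonneg_right (hnorm v) (Real.exp_pos _).le)
      rw [wnorm, Finset.sum_mul]
      refine Finset.sum_le_sum fun a ha => ?_
      simp only [Pi.one_apply, one_pow, Finset.prod_const_one, mul_one]
      simp only [hA, Matrix.of_apply, coeff_diagOp, map_mul]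
      have hsum : ((∑ i, a i : ℕ) : ℝ) ≤ M * D := by
        push_cast
        have : ∀ i ∈ Finset.univ, (a i : ℝ) ≤ D := by
          intro i _
          by_cases hi : i ∈ insert y s
          · refine le_trans ?_ (hD i hi)
            exact_mod_cast degreeOf_le_iff.mp (hdeg i) a ha
          · rw [mem_supported_iff_coeff.mp hPs a (mem_support_iff.mp ha) i
              (by simpa using hi)]
            simp; linarith
        refine (Finset.sum_le_sum this).trans ?_
        simp [hM]
      have hch : ∀ κ : σ →₀ ℕ, PS.abv v (mchoose a κ : K) ≤ Real.exp (M * D) := by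
        intro κ
        refine (abv_natCast_le _ _).trans ?_
        have h1 : ((mchoose a κ : ℕ) : ℝ) ≤ (2 : ℝ) ^ (∑ i, a i) := by
          exact_mod_cast mchoose_le a κ
        refine h1.trans ?_
        have h2 : (2 : ℝ) ≤ Real.exp 1 := by
          have := Real.add_one_le_exp (1 : ℝ); linarith
        calc (2 : ℝ) ^ (∑ i, a i) ≤ Real.exp 1 ^ (∑ i, a i) :=
              pow_le_pow_left₀ (by norm_num) h2 _
          _ = Real.exp ((∑ i, a i : ℕ) : ℝ) := by rw [← Real.exp_nat_mul]; simp
          _ ≤ _ := Real.exp_le_exp.mpr hsum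
      have h3 := hch (μ i)
      have h4 := hch (ν j)
      have h5 : Real.exp (2 * M * D) = Real.exp (M * D) * Real.exp (M * D) := by
        rw [← Real.exp_add]; ring_nf
      rw [h5]
      have e0 := (PS.abv v).nonneg (coeff a P)
      have e1 := (PS.abv v).nonneg (mchoose a (μ i) : K)
      have e2 := (PS.abv v).nonneg (mchoose a (ν j) : K)
      calc _ ≤ Real.exp (M * D) * (Real.exp (M * D) * (PS.abv v) (coeff a P)) := by gcongr
        _ = _ := by ring
    set b' : ℝ := r * (b + (2 * M + 2) * D) with hb'
    have hUnorm : ∀ v, wnorm (PS.abv v) 1 A.det ≤ Real.exp b' := by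
      intro v
      refine (wnorm_det_le (by simp) A (hentry v)).trans ?_
      have h1 : ((r.factorial : ℕ) : ℝ) ≤ Real.exp (r * (2 * D)) := by
        have h2 : ((r.factorial : ℕ) : ℝ) ≤ (r : ℝ) ^ r := by
          exact_mod_cast Nat.factorial_le_pow r
        refine h2.trans ?_
        rw [Real.exp_nat_mul]
        refine pow_le_pow_left₀ hr0.le ?_ _
        have h3 : (r : ℝ) ≤ d y + 1 := by exact_mod_cast hr
        have := Real.add_one_le_exp (2 * D)
        linarith
      rw [← Real.exp_nat_mul]
      calc _ ≤ Real.exp (r * (2 * D)) * Real.exp (r * (b + 2 * M * D)) := by gcongr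
        _ = _ := by rw [← Real.exp_add, hb']; ring_nf
    have hUint : ∀ a, coeff a A.det ∈ PS.ring := by
      refine det_mem_ring PS.ring A fun i j a => ?_
      simp only [hA, Matrix.of_apply, coeff_diagOp]
      exact PS.ring.mul_mem (natCast_mem _ _) (PS.ring.mul_mem (natCast_mem _ _) (hint a))
    have hUdeg : ∀ i, degreeOf i A.det ≤ r * d i := by
      intro i
      refine degreeOf_det_le A i fun x z => ?_
      rw [degreeOf_le_iff]
      intro a ha
      rw [mem_support_iff] at ha
      simp only [hA, Matrix.of_apply, coeff_diagOp] at ha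
      exact degreeOf_le_iff.mp (hdeg i) a
        (mem_support_iff.mpr (right_ne_zero_of_mul (right_ne_zero_of_mul ha)))
    -- transfer to a normalised factor
    have transfer : ∀ (V : MvPolynomial σ K) (c : σ →₀ ℕ), (∀ a, coeff a V ≠ 0 →
        coeff a V = coeff (a + c) A.det) → (∀ a, coeff a V ∈ PS.ring) ∧
        (∀ v, wnorm (PS.abv v) 1 V ≤ Real.exp b') ∧ ∀ i, degreeOf i V ≤ r * d i := by
      intro V c hV
      refine ⟨fun a => ?_, fun v => (wnorm_le_of_coeff_injective _ c hV).trans (hUnorm v),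
        fun i => ?_⟩
      · by_cases h : coeff a V = 0
        · rw [h]; exact zero_mem _
        · rw [hV a h]; exact hUint _
      · rw [degreeOf_le_iff]
        intro a ha
        rw [mem_support_iff] at ha
        have h1 := hV a ha
        have h2 := degreeOf_le_iff.mp (hUdeg i) (a + c) (mem_support_iff.mpr (h1 ▸ ha))
        rw [Finsupp.add_apply] at h2; omega
    obtain ⟨κ₁, c₁, hκ₁, hV₁⟩ := exists_normalized_factors hdisj hU₁s hU₂y hνdet
    obtain ⟨κ₂, c₂, hκ₂, hV₂⟩ := exists_normalized_factors hdisj.symm hU₂y hU₁s hμdet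
    rw [← hAU] at hV₁
    rw [mul_comm U₂ U₁, ← hAU] at hV₂
    obtain ⟨i1, n1, g1⟩ := transfer _ _ hV₁
    obtain ⟨i2, n2, g2⟩ := transfer _ _ hV₂
    have hb'0 : 0 ≤ b' := by rw [hb']; positivity
    have hbD : b' + r * D ≤ r * ((2 * M + 3) * (b + D)) := by
      rw [hb']
      have : 0 ≤ r * ((2 * M + 2) * b) := by positivity
      nlinarith
    have hV₁0 : κ₁ • U₁ ≠ 0 := smul_ne_zero hκ₁ hμdet
    have hV₂0 : κ₂ • U₂ ≠ 0 := smul_ne_zero hκ₂ hνdet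
    obtain ⟨a₁, ha₁, hw₁⟩ := IH (fun i => r * d i) ξ (κ₁ • U₁) b' (r * D)
      (fun i => Nat.mul_pos hr1 (hd i)) hb'0 hV₁0
      (Subalgebra.smul_mem _ hU₁s _) g1 i1 n1
      (fun i hi j hj hij => by
        have h1 := hratio i (Finset.mem_insert_of_mem hi) j (Finset.mem_insert_of_mem hj) hij
        have h2 : ω * d j ≤ ω₁ * d j := mul_le_mul_of_nonneg_right hω_le (hd0 j).le
        push_cast
        calc (r : ℝ) * d i ≤ r * (ω₁ * d j) := by gcongr; linarith
          _ = _ := by ring)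
      (fun i hi => by
        push_cast
        exact mul_le_mul_of_nonneg_left (hD i (Finset.mem_insert_of_mem hi)) hr0.le)
      (fun i hi => by
        refine hbD.trans ?_
        have h1 := hht i (Finset.mem_insert_of_mem hi)
        have h0 : 0 ≤ (d i : ℝ) * PS.ht (ξ i) := mul_nonneg (hd0 i).le (PS.ht_nonneg _)
        push_cast
        calc (r : ℝ) * ((2 * M + 3) * (b + D))
            ≤ r * ((2 * M + 3) * (ω * (d i * PS.ht (ξ i)))) := by gcongr
          _ = r * ((ω * (2 * M + 3)) * (d i * PS.ht (ξ i))) := by ring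
          _ ≤ r * (ω₁ * (d i * PS.ht (ξ i))) := by gcongr
          _ = _ := by ring)
    have hyht := hht y (Finset.mem_insert_self _ _)
    have hypos : 0 < (d y : ℝ) * PS.ht (ξ y) := by
      have h0 : 0 ≤ (d y : ℝ) * PS.ht (ξ y) := mul_nonneg (hd0 y).le (PS.ht_nonneg _)
      rcases h0.eq_or_lt with h | h
      · rw [← h] at hyht; linarith
      · exact h
    obtain ⟨k, hk, hk0⟩ := hroot y ξ (κ₂ • U₂) ⌈ρ * (r * d y)⌉₊ (r * d y) b' hb'0 hV₂0
      (Subalgebra.smul_mem _ hU₂y _) (g2 y) i2 n2 (by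
        have h1 : ρ * (r * d y) ≤ (⌈ρ * (r * d y)⌉₊ : ℝ) := Nat.le_ceil _
        push_cast
        have h2 : b' + r * d y ≤ r * ((2 * M + 3) * (ω * (d y * PS.ht (ξ y)))) := by
          calc b' + r * d y ≤ b' + r * D := by gcongr
            _ ≤ _ := hbD
            _ ≤ _ := by gcongr
        have h3 : Cr * (b' + r * d y) ≤ r * (d y * PS.ht (ξ y)) * (ρ / 2) := by
          calc Cr * (b' + r * d y) ≤ Cr * (r * ((2 * M + 3) * (ω * (d y * PS.ht (ξ y))))) := by
                gcongr
            _ = r * (d y * PS.ht (ξ y)) * (ω * (2 * (Cr * (2 * M + 3))) / 2) := by ring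
            _ ≤ _ := by gcongr
        have h4 : 0 < r * (d y * PS.ht (ξ y)) * ρ := by positivity
        have h5 : r * (d y * PS.ht (ξ y)) * ρ ≤ ⌈ρ * (r * d y)⌉₊ * PS.ht (ξ y) := by
          calc r * (d y * PS.ht (ξ y)) * ρ = (ρ * (r * d y)) * PS.ht (ξ y) := by ring
            _ ≤ _ := mul_le_mul_of_nonneg_right h1 (PS.ht_nonneg _)
        linarith)
    have hk' : (k : ℝ) < ρ * (r * d y) := Nat.lt_ceil.mp hk
    have hprod : coeff (a₁ + Finsupp.single y k) (shift ξ (κ₁ • U₁ * (κ₂ • U₂))) ≠ 0 := by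
      rw [map_mul, coeff_mul_of_disjoint hdisj
        (shift_mem_supported ξ (Subalgebra.smul_mem _ hU₁s _))
        (shift_mem_supported ξ (Subalgebra.smul_mem _ hU₂y _))
        (mem_supported_iff_coeff.mp (shift_mem_supported ξ (Subalgebra.smul_mem _ hU₁s _)) a₁ ha₁)
        (fun i hi => by
          have : i ≠ y := hi
          simp [this.symm])]
      exact mul_ne_zero ha₁ hk0
    have hprodInd : IndGe ξ (fun i => (d i : ℝ)) (r * τ ^ 2 / 32) (κ₁ • U₁ * (κ₂ • U₂)) := by
      rw [smul_mul_smul_comm, ← hAU]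
      exact hAInd.smul _
    have hfinal := hprodInd _ hprod
    rw [wt_add, wt_single] at hfinal
    have hw₁' : wt (fun i => (d i : ℝ)) a₁ = r * wt (fun i => ((r * d i : ℕ) : ℝ)) a₁ := by
      rw [wt, wt, Finset.mul_sum]
      refine Finset.sum_congr rfl fun i _ => ?_
      push_cast
      have := hd0 i
      field_simp
    rw [hw₁'] at hfinal
    have h6 : (k : ℝ) / d y < ρ * r := by
      rw [div_lt_iff₀ (hd0 y)]; linarith
    have h7 : r * wt (fun i => ((r * d i : ℕ) : ℝ)) a₁ < r * ρ := by gcongr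
    rw [hρ] at h6 h7
    linarith

end Roth

section Chebyshev

theorem sum_piFinset_sq_le {μ α : Type*} [Fintype μ] [DecidableEq μ]
    (A : μ → Finset α) (f : μ → α → ℝ) (h0 : ∀ j, ∑ a ∈ A j, f j a = 0)
    (h1 : ∀ j, ∀ a ∈ A j, |f j a| ≤ 1) :
    ∑ b ∈ Fintype.piFinset A, (∑ j, f j (b j)) ^ 2 ≤
      Fintype.card μ * (Fintype.piFinset A).card := by
  classical
  have hcross : ∀ j k, j ≠ k → ∑ b ∈ Fintype.piFinset A, f j (b j) * f k (b k) = 0 := by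
    intro j k hjk
    have h2 : ∀ b ∈ Fintype.piFinset A, f j (b j) * f k (b k) =
        ∏ l, (if l = j then f j (b l) else if l = k then f k (b l) else 1) := by
      intro b _
      rw [← Finset.mul_prod_erase _ _ (Finset.mem_univ j), if_pos rfl,
        ← Finset.mul_prod_erase _ _ (Finset.mem_erase.mpr ⟨hjk.symm, Finset.mem_univ k⟩),
        if_neg hjk.symm, if_pos rfl, Finset.prod_eq_one, mul_one]
      intro l hl
      rw [Finset.mem_erase, Finset.mem_erase] at hl
      rw [if_neg hl.2.1, if_neg hl.1]
    rw [Finset.sum_congr rfl h2,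
      ← Finset.prod_univ_sum A (fun l a => if l = j then f j a else if l = k then f k a else 1)]
    refine Finset.prod_eq_zero (Finset.mem_univ j) ?_
    simp [h0]
  have h3 : ∀ b ∈ Fintype.piFinset A, (∑ j, f j (b j)) ^ 2 =
      ∑ j, ∑ k, f j (b j) * f k (b k) := by
    intro b _
    rw [sq, Finset.sum_mul_sum]
  rw [Finset.sum_congr rfl h3, Finset.sum_comm]
  have h4 : ∀ j ∈ (Finset.univ : Finset μ),
      ∑ b ∈ Fintype.piFinset A, ∑ k, f j (b j) * f k (b k) ≤ (Fintype.piFinset A).card := by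
    intro j _
    rw [Finset.sum_comm, Finset.sum_eq_single j]
    · refine (Finset.sum_le_card_nsmul _ _ 1 fun b hb => ?_).trans (by simp)
      have := h1 j _ (Fintype.mem_piFinset.mp hb j)
      rw [← sq, ← sq_abs]
      exact pow_le_one₀ (abs_nonneg _) this
    · intro k _ hk
      exact hcross j k hk.symm
    · simp
  refine (Finset.sum_le_sum h4).trans ?_
  simp

theorem card_filter_lt_abs_sum_le {μ α : Type*} [Fintype μ] [DecidableEq μ]
    (A : μ → Finset α) (f : μ → α → ℝ) (h0 : ∀ j, ∑ a ∈ A j, f j a = 0)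
    (h1 : ∀ j, ∀ a ∈ A j, |f j a| ≤ 1) {T : ℝ} (hT : 0 < T) :
    T ^ 2 * ((Fintype.piFinset A).filter fun b => T < |∑ j, f j (b j)|).card ≤
      Fintype.card μ * (Fintype.piFinset A).card := by
  classical
  refine le_trans ?_ (sum_piFinset_sq_le A f h0 h1)
  refine le_trans ?_ (Finset.sum_le_sum_of_subset_of_nonneg (Finset.filter_subset
    (fun b => T < |∑ j, f j (b j)|) _) fun _ _ _ => sq_nonneg _)
  rw [mul_comm, ← nsmul_eq_mul]
  refine Finset.card_nsmul_le_sum _ _ _ fun b hb => ?_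
  rw [← sq_abs (∑ j, f j (b j))]
  exact pow_le_pow_left₀ hT.le (Finset.mem_filter.mp hb).2.le 2

theorem sum_piAntidiag_apply {ι : Type*} [Fintype ι] [DecidableEq ι] (d : ℕ) (i : ι) :
    (Fintype.card ι : ℝ) * ∑ b ∈ Finset.piAntidiag (Finset.univ : Finset ι) d, (b i : ℝ) =
      d * (Finset.piAntidiag (Finset.univ : Finset ι) d).card := by
  have hsym : ∀ k, ∑ b ∈ Finset.piAntidiag (Finset.univ : Finset ι) d, (b k : ℝ) =
      ∑ b ∈ Finset.piAntidiag (Finset.univ : Finset ι) d, (b i : ℝ) := by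
    intro k
    have hmem : ∀ b ∈ Finset.piAntidiag (Finset.univ : Finset ι) d,
        b ∘ Equiv.swap i k ∈ Finset.piAntidiag (Finset.univ : Finset ι) d := by
      intro b hb
      rw [Finset.mem_piAntidiag] at hb ⊢
      refine ⟨?_, fun _ _ => Finset.mem_univ _⟩
      rw [← hb.1]
      exact Equiv.sum_comp (Equiv.swap i k) b
    refine Finset.sum_nbij' (fun b => b ∘ Equiv.swap i k) (fun b => b ∘ Equiv.swap i k)
      hmem hmem ?_ ?_ ?_
    · intro b _; ext x; simp
    · intro b _; ext x; simp
    · intro b _; simp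
  have h1 : ∑ k, ∑ b ∈ Finset.piAntidiag (Finset.univ : Finset ι) d, (b k : ℝ) =
      d * (Finset.piAntidiag (Finset.univ : Finset ι) d).card := by
    rw [Finset.sum_comm]
    have : ∀ b ∈ Finset.piAntidiag (Finset.univ : Finset ι) d, ∑ k, (b k : ℝ) = d := by
      intro b hb
      rw [Finset.mem_piAntidiag] at hb
      exact_mod_cast hb.1
    rw [Finset.sum_congr rfl this]
    simp [mul_comm]
  rw [← h1, Finset.sum_congr rfl fun k _ => hsym k]
  simp

theorem card_unbalanced_le {μ ι : Type*} [Fintype μ] [DecidableEq μ] [Fintype ι]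
    [DecidableEq ι] [Nonempty ι] (d : μ → ℕ) (hd : ∀ j, 1 ≤ d j) (i : ι) {T : ℝ} (hT : 0 < T) :
    T ^ 2 * ((Fintype.piFinset fun j => Finset.piAntidiag (Finset.univ : Finset ι) (d j)).filter
      fun b => T < |∑ j, (b j i : ℝ) / d j - Fintype.card μ / Fintype.card ι|).card ≤
      Fintype.card μ *
        (Fintype.piFinset fun j => Finset.piAntidiag (Finset.univ : Finset ι) (d j)).card := by
  have hN : (1 : ℝ) ≤ Fintype.card ι := by exact_mod_cast Fintype.card_pos
  have hd0 : ∀ j, (0 : ℝ) < d j := fun j => by exact_mod_cast hd j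
  have key := card_filter_lt_abs_sum_le
    (fun j => Finset.piAntidiag (Finset.univ : Finset ι) (d j))
    (fun j b => (b i : ℝ) / d j - 1 / Fintype.card ι) ?_ ?_ hT
  · convert key using 6
    rw [Finset.sum_sub_distrib]
    simp [div_eq_mul_inv]
  · intro j
    rw [Finset.sum_sub_distrib, ← Finset.sum_div]
    have := sum_piAntidiag_apply (d j) i
    have h0 := (hd0 j).ne'
    simp only [Finset.sum_const, nsmul_eq_mul]
    field_simp
    linarith
  · intro j b hb
    rw [Finset.mem_piAntidiag] at hb
    have h1 : b i ≤ d j := by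
      rw [← hb.1]; exact Finset.single_le_sum (f := b) (fun _ _ => Nat.zero_le _) (Finset.mem_univ i)
    have h2 : (b i : ℝ) / d j ≤ 1 := by
      rw [div_le_one (hd0 j)]; exact_mod_cast h1
    have h3 : (0 : ℝ) ≤ (b i : ℝ) / d j := by positivity
    have h4 : (1 : ℝ) / Fintype.card ι ≤ 1 := by rw [div_le_one (by linarith)]; exact hN
    have h5 : (0 : ℝ) ≤ 1 / Fintype.card ι := by positivity
    rw [abs_le]; constructor <;> linarith

end Chebyshev

section LinSubst
variable {K : Type*} [Field K] {μ ι κ : Type*} [Fintype μ] [DecidableEq μ] [Fintype ι]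
  [DecidableEq ι] [Fintype κ] [DecidableEq κ]

theorem wnorm_mono {σ : Type*} [Fintype σ] {f : AbsoluteValue K ℝ} {q q' : σ → ℝ}
    (hq : ∀ i, 0 ≤ q i) (h : ∀ i, q i ≤ q' i) (P : MvPolynomial σ K) :
    wnorm f q P ≤ wnorm f q' P :=
  Finset.sum_le_sum fun _ _ => mul_le_mul_of_nonneg_left
    (Finset.prod_le_prod (fun i _ => pow_nonneg (hq i) _)
      fun i _ => pow_le_pow_left₀ (hq i) (h i) _) (f.nonneg _)

theorem wnorm_aeval_le {σ τ : Type*} [Fintype σ] [DecidableEq σ] [Fintype τ] [DecidableEq τ]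
    {f : AbsoluteValue K ℝ} {q : τ → ℝ}
    (hq : ∀ i, 0 ≤ q i) (g : σ → MvPolynomial τ K) (P : MvPolynomial σ K) :
    wnorm f q (aeval g P) ≤ wnorm f (fun i => wnorm f q (g i)) P := by
  conv_lhs => rw [P.as_sum, map_sum]
  refine (wnorm_sum_le hq _ _).trans (Finset.sum_le_sum fun a _ => ?_)
  rw [aeval_monomial, algebraMap_eq, ← smul_eq_C_mul, wnorm_smul, Finsupp.prod_fintype _ _ (by simp)]
  refine mul_le_mul_of_nonneg_left ?_ (f.nonneg _)
  exact (wnorm_prod_le hq _ _).trans (Finset.prod_le_prod (fun i _ => wnorm_nonneg hq _)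
    fun i _ => wnorm_pow_le hq _ _)

theorem isWeightedHomogeneous_aeval {σ τ M : Type*} [Fintype σ] [AddCommMonoid M]
    {w : σ → M} {w' : τ → M} {g : σ → MvPolynomial τ K}
    (hg : ∀ i, IsWeightedHomogeneous w' (g i) (w i)) {P : MvPolynomial σ K} {d : M}
    (hP : IsWeightedHomogeneous w P d) : IsWeightedHomogeneous w' (aeval g P) d := by
  rw [P.as_sum, map_sum]
  refine IsWeightedHomogeneous.sum _ _ _ fun a ha => ?_
  rw [aeval_monomial, algebraMap_eq, Finsupp.prod_fintype _ _ (by simp)]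
  refine IsWeightedHomogeneous.C_mul ?_ _
  rw [← hP (mem_support_iff.mp ha), Finsupp.weight_apply, Finsupp.sum_fintype _ _ (by simp)]
  exact IsWeightedHomogeneous.prod _ _ _ fun i _ => (hg i).pow _

/-- Multihomogeneity weights for variables in blocks. -/
def blockWt (p : μ × ι) : μ → ℕ := Pi.single p.1 1

theorem weight_blockWt (a : μ × ι →₀ ℕ) (j : μ) :
    Finsupp.weight blockWt a j = ∑ i, a (j, i) := by
  rw [Finsupp.weight_apply, Finsupp.sum_fintype _ _ (by simp), Finset.sum_apply,
    Fintype.sum_prod_type, Finset.sum_eq_single j]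
  · simp [blockWt]
  · intro k _ hk
    simp [blockWt, Pi.single_eq_of_ne hk.symm]
  · simp

/-- Simultaneous linear substitution in blocks of variables. -/
noncomputable def linSubst (M : μ → Matrix ι κ K) :
    MvPolynomial (μ × ι) K →ₐ[K] MvPolynomial (μ × κ) K :=
  aeval fun p => ∑ l, C (M p.1 p.2 l) * X (p.1, l)

theorem linSubst_linSubst {κ' : Type*} [Fintype κ'] [DecidableEq κ'] (L : μ → Matrix ι κ K)
    (M : μ → Matrix κ κ' K) (P : MvPolynomial (μ × ι) K) :
    linSubst M (linSubst L P) = linSubst (fun j => L j * M j) P := by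
  have : (linSubst M).comp (linSubst L) = linSubst (fun j => L j * M j) := by
    refine algHom_ext fun p => ?_
    simp only [linSubst, AlgHom.comp_apply, aeval_X, map_sum, map_mul, aeval_C, algebraMap_eq,
      Matrix.mul_apply, Finset.sum_mul, Finset.mul_sum]
    rw [Finset.sum_comm]
    simp only [mul_assoc]
  exact DFunLike.congr_fun this P

theorem isWeightedHomogeneous_linSubst (M : μ → Matrix ι κ K) {P : MvPolynomial (μ × ι) K}
    {d : μ → ℕ} (hP : IsWeightedHomogeneous blockWt P d) :
    IsWeightedHomogeneous blockWt (linSubst M P) d := by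
  refine isWeightedHomogeneous_aeval (fun p => ?_) hP
  refine IsWeightedHomogeneous.sum _ _ _ fun l _ => ?_
  exact (isWeightedHomogeneous_X K blockWt (p.1, l)).C_mul _

theorem wnorm_linSubst_le {f : AbsoluteValue K ℝ} {q : μ × κ → ℝ} (hq : ∀ i, 0 ≤ q i)
    (M : μ → Matrix ι κ K) (P : MvPolynomial (μ × ι) K) :
    wnorm f q (linSubst M P) ≤ wnorm f (fun p => ∑ l, f (M p.1 p.2 l) * q (p.1, l)) P := by
  refine (wnorm_aeval_le hq _ P).trans
    (wnorm_mono (fun p => wnorm_nonneg hq _) (fun p => ?_) P)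
  refine (wnorm_sum_le hq _ _).trans (le_of_eq (Finset.sum_congr rfl fun l _ => ?_))
  rw [← smul_eq_C_mul, wnorm_smul, wnorm_X]

theorem coeff_linSubst_mem (R : Subring K) {M : μ → Matrix ι κ K} (hM : ∀ j i l, M j i l ∈ R)
    {P : MvPolynomial (μ × ι) K} (hP : ∀ a, coeff a P ∈ R) (a : μ × κ →₀ ℕ) :
    coeff a (linSubst M P) ∈ R := by
  let M' : μ → Matrix ι κ R := fun j i l => ⟨M j i l, hM j i l⟩
  obtain ⟨P', rfl⟩ : P ∈ Set.range (map R.subtype) := by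
    rw [mem_range_map_iff_coeffs_subset]
    intro x hx
    obtain ⟨a, _, rfl⟩ := mem_coeffs_iff.mp hx
    exact ⟨⟨_, hP a⟩, rfl⟩
  have h1 : linSubst M (map R.subtype P') =
      map R.subtype (aeval (fun p : μ × ι => ∑ l, C (M' p.1 p.2 l) * X (p.1, l)) P') := by
    have h2 : (linSubst M).toRingHom.comp (map R.subtype) = (map R.subtype).comp
        (aeval (R := R) (fun p : μ × ι => ∑ l, C (M' p.1 p.2 l) * X (p.1, l))).toRingHom := by
      refine ringHom_ext (fun r => ?_) (fun p => ?_)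
      · simp [linSubst]
      · simp [linSubst, M']
    exact DFunLike.congr_fun h2 P'
  rw [h1, coeff_map]
  exact Subtype.property _

end LinSubst

section Auxiliary
variable {K : Type*} [Field K] {S : Type} [Fintype S] (PS : PlaceSystem K S)

theorem card_piAntidiag_le_exp {ι : Type*} [Fintype ι] [DecidableEq ι] (d : ℕ) :
    ((Finset.piAntidiag (Finset.univ : Finset ι) d).card : ℝ) ≤
      Real.exp ((Fintype.card ι : ℝ) * d) := by
  have h3 : Finset.piAntidiag (Finset.univ : Finset ι) d ⊆
      Fintype.piFinset fun _ => Finset.range (d + 1) := by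
    intro b hb
    rw [Finset.mem_piAntidiag] at hb
    rw [Fintype.mem_piFinset]
    intro i
    rw [Finset.mem_range, Nat.lt_succ_iff, ← hb.1]
    exact Finset.single_le_sum (f := b) (fun _ _ => Nat.zero_le _) (Finset.mem_univ i)
  have h4 := Finset.card_le_card h3
  rw [Fintype.card_piFinset] at h4
  simp only [Finset.card_range, Finset.prod_const, Finset.card_univ] at h4
  have h5 : ((Finset.piAntidiag (Finset.univ : Finset ι) d).card : ℝ) ≤
      ((d : ℝ) + 1) ^ Fintype.card ι := by exact_mod_cast h4
  refine h5.trans ?_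
  rw [Real.exp_nat_mul]
  exact pow_le_pow_left₀ (by positivity) (Real.add_one_le_exp _) _

set_option maxHeartbeats 1000000 in
/-- The auxiliary polynomial: it is balanced with respect to each of the given frames. -/
theorem exists_auxiliary_polynomial {ι : Type} [Fintype ι] [DecidableEq ι] [Nonempty ι]
    (M : S → Matrix ι ι K) (hM : ∀ v i l, M v i l ∈ PS.int) {ε : ℝ} (hε : 0 < ε) :
    ∃ m : ℕ, 1 ≤ m ∧ ∃ C : ℝ, 1 ≤ C ∧ ∀ d : Fin m → ℕ, (∀ j, 1 ≤ d j) →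
      ∃ F : MvPolynomial (Fin m × ι) K, F ≠ 0 ∧ IsWeightedHomogeneous blockWt F d ∧
        (∀ a, coeff a F ∈ PS.int) ∧
        (∀ v, wnorm (PS.abv v) 1 F ≤ Real.exp (C * ∑ j, (d j : ℝ))) ∧
        ∀ v b, coeff b (linSubst (fun _ => M v) F) ≠ 0 → ∀ i,
          |∑ j, (b (j, i) : ℝ) / d j - m / Fintype.card ι| ≤ ε * m := by
  classical
  obtain ⟨Cs, hCs, siegel⟩ := PS.siegel
  set N : ℝ := (Fintype.card ι : ℝ) with hN
  have hN1 : (1 : ℝ) ≤ N := by rw [hN]; exact_mod_cast Fintype.card_pos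
  have hS1 : (1 : ℝ) ≤ Fintype.card S := by
    have : Nonempty S := ⟨PS.v₀⟩
    exact_mod_cast Fintype.card_pos
  obtain ⟨m, hm⟩ := exists_nat_ge (2 * N * Fintype.card S / ε ^ 2 + 1)
  have hm1 : (1 : ℝ) ≤ m := by
    have : 0 ≤ 2 * N * Fintype.card S / ε ^ 2 := by positivity
    linarith
  -- a bound for the entries
  obtain ⟨c, hc0, hc⟩ : ∃ c : ℝ, 0 ≤ c ∧ ∀ w v i, ∑ l, PS.abv w (M v i l) ≤ Real.exp c := by
    refine ⟨∑ w, ∑ v, ∑ i, ∑ l, PS.abv w (M v i l), ?_, fun w v i => ?_⟩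
    · exact Finset.sum_nonneg fun _ _ => Finset.sum_nonneg fun _ _ => Finset.sum_nonneg
        fun _ _ => Finset.sum_nonneg fun _ _ => AbsoluteValue.nonneg _ _
    · refine le_trans ?_ ((le_add_of_nonneg_right zero_le_one).trans (Real.add_one_le_exp _))
      have e1 := Finset.single_le_sum (f := fun w => ∑ v, ∑ i, ∑ l, PS.abv w (M v i l))
        (fun _ _ => Finset.sum_nonneg fun _ _ => Finset.sum_nonneg
        fun _ _ => Finset.sum_nonneg fun _ _ => AbsoluteValue.nonneg _ _) (Finset.mem_univ w)
      have e2 := Finset.single_le_sum (f := fun v => ∑ i, ∑ l, PS.abv w (M v i l))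
        (fun _ _ => Finset.sum_nonneg
        fun _ _ => Finset.sum_nonneg fun _ _ => AbsoluteValue.nonneg _ _) (Finset.mem_univ v)
      have e3 := Finset.single_le_sum (f := fun i => ∑ l, PS.abv w (M v i l))
        (fun _ _ => Finset.sum_nonneg fun _ _ => AbsoluteValue.nonneg _ _) (Finset.mem_univ i)
      exact (e3.trans e2).trans e1
  refine ⟨m, by exact_mod_cast hm1, c + N + Cs * (c + N + 1), by nlinarith, fun d hd => ?_⟩
  have hd0 : ∀ j, (1 : ℝ) ≤ d j := fun j => by exact_mod_cast hd j
  set Δ : ℝ := ∑ j, (d j : ℝ) with hΔ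
  have hΔ1 : 1 ≤ Δ := by
    have : ∑ j : Fin m, (1 : ℝ) ≤ Δ := Finset.sum_le_sum fun j _ => hd0 j
    simp at this; linarith
  set B := Fintype.piFinset fun j => Finset.piAntidiag (Finset.univ : Finset ι) (d j) with hB
  let e : (Fin m → ι → ℕ) → (Fin m × ι →₀ ℕ) := fun b =>
    Finsupp.equivFunOnFinite.symm fun p => b p.1 p.2
  have he : ∀ b j i, e b (j, i) = b j i := fun b j i => rfl
  have heinj : Function.Injective e := by
    intro b b' h
    ext j i
    rw [← he b, h, he]
  have hBmem : ∀ b, b ∈ B ↔ ∀ j, ∑ i, b j i = d j := by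
    intro b
    simp [hB, Fintype.mem_piFinset, Finset.mem_piAntidiag]
  have hwh : ∀ b ∈ B, IsWeightedHomogeneous blockWt (monomial (e b) (1 : K)) d := by
    intro b hb
    refine isWeightedHomogeneous_monomial _ _ _ ?_
    ext j
    rw [weight_blockWt]
    exact (hBmem b).mp hb j
  let bad : (Fin m → ι → ℕ) → ι → Prop := fun b i =>
    ε * m < |∑ j, (b j i : ℝ) / d j - m / N|
  let α := {b // b ∈ B}
  let β := {p : S × α // ∃ i, bad p.2 i}
  -- counting
  have hcount : 2 * Fintype.card β ≤ Fintype.card α := by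
    have h1 : Fintype.card β ≤ Fintype.card S * ∑ i, (B.filter fun b => bad b i).card := by
      refine le_trans ?_ (Nat.mul_le_mul_left _ Finset.card_biUnion_le)
      rw [← Fintype.card_coe, ← Fintype.card_prod]
      refine Fintype.card_le_of_injective
        (fun p => (p.1.1, ⟨p.1.2.1, Finset.mem_biUnion.mpr ?_⟩)) ?_
      · obtain ⟨i, hi⟩ := p.2
        exact ⟨i, Finset.mem_univ _, Finset.mem_filter.mpr ⟨p.1.2.2, hi⟩⟩
      · intro p p' h
        rw [Prod.ext_iff, Subtype.ext_iff] at h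
        have h2 : p.1.1 = p'.1.1 := h.1
        have h3 : p.1.2.1 = p'.1.2.1 := h.2
        exact Subtype.ext (Prod.ext h2 (Subtype.ext h3))
    have h4 : ∀ i, (2 * N * Fintype.card S) * ((B.filter fun b => bad b i).card : ℝ) ≤ B.card := by
      intro i
      have h5 := card_unbalanced_le d hd i (T := ε * m) (by positivity)
      rw [Fintype.card_fin] at h5
      have h6 : 2 * N * Fintype.card S ≤ ε ^ 2 * m := by
        have : 2 * N * Fintype.card S / ε ^ 2 ≤ m := by linarith
        rw [div_le_iff₀ (by positivity)] at this
        linarith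
      have h7 : (m : ℝ) * ((ε ^ 2 * m) * ((B.filter fun b => bad b i).card : ℝ)) ≤
          m * B.card := by
        calc _ = (ε * m) ^ 2 * ((B.filter fun b => bad b i).card : ℝ) := by ring
          _ ≤ _ := h5
      have h8 := le_of_mul_le_mul_left h7 (by linarith)
      refine le_trans ?_ h8
      gcongr
    have h9 : (2 * Fintype.card β : ℝ) ≤ Fintype.card α := by
      have h10 : (Fintype.card α : ℝ) = B.card := by simp [α]
      rw [h10]
      have h11 : (Fintype.card β : ℝ) ≤
          Fintype.card S * ∑ i, ((B.filter fun b => bad b i).card : ℝ) := by exact_mod_cast h1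
      have h12 : N * (2 * Fintype.card S * ∑ i, ((B.filter fun b => bad b i).card : ℝ)) ≤
          N * B.card := by
        calc _ = ∑ i, (2 * N * Fintype.card S) * ((B.filter fun b => bad b i).card : ℝ) := by
              rw [← Finset.mul_sum]; ring
          _ ≤ ∑ i : ι, (B.card : ℝ) := Finset.sum_le_sum fun i _ => h4 i
          _ = _ := by simp [hN]
      have h13 := le_of_mul_le_mul_left h12 (by linarith)
      linarith
    exact_mod_cast h9
  have hαcard : (Fintype.card α : ℝ) ≤ Real.exp ((c + N) * Δ) := by
    have h1 : (Fintype.card α : ℝ) = ∏ j,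
        ((Finset.piAntidiag (Finset.univ : Finset ι) (d j)).card : ℝ) := by
      simp [α, hB]
    rw [h1]
    refine (Finset.prod_le_prod (fun _ _ => Nat.cast_nonneg _) fun j _ => card_piAntidiag_le_exp (d j)).trans ?_
    rw [← Real.exp_sum, ← Finset.mul_sum, Real.exp_le_exp]
    have : 0 ≤ c * Δ := by positivity
    rw [← hΔ]; linarith
  have hαne : Nonempty α := by
    obtain ⟨i0⟩ := ‹Nonempty ι›
    exact ⟨⟨fun j => Pi.single i0 (d j), (hBmem _).mpr fun j => by simp⟩⟩
  let A : β → α → K := fun p b =>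
    coeff (e p.1.2) (linSubst (fun _ => M p.1.1) (monomial (e b) (1 : K)))
  have hmonint : ∀ b a, coeff a (monomial b (1 : K) : MvPolynomial (Fin m × ι) K) ∈ PS.int := by
    intro b a
    rw [coeff_monomial]; split_ifs
    · exact one_mem _
    · exact zero_mem _
  obtain ⟨x, hx0, hx, hxA⟩ := siegel α β A ((c + N) * Δ) (by positivity) hαne hcount hαcard (by
    intro p b
    refine ⟨coeff_linSubst_mem PS.int (fun _ => hM p.1.1) (hmonint _) _, fun v => ?_⟩
    have h1 := coeff_le_wnorm (f := PS.abv v) (q := (1 : Fin m × ι → ℝ)) (by simp)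
      (linSubst (fun _ => M p.1.1) (monomial (e b) (1 : K))) (e p.1.2)
    simp only [Pi.one_apply, one_pow, Finset.prod_const_one, mul_one] at h1
    refine h1.trans ((wnorm_linSubst_le (by simp) _ _).trans ?_)
    rw [wnorm_monomial, map_one, one_mul]
    have h2 : ∀ q ∈ (Finset.univ : Finset (Fin m × ι)),
        (∑ l, PS.abv v (M p.1.1 q.2 l) * (1 : Fin m × ι → ℝ) (q.1, l)) ^ (e b q) ≤
          Real.exp (c * e b q) := by
      intro q _
      rw [mul_comm c, Real.exp_nat_mul]
      refine pow_le_pow_left₀ (Finset.sum_nonneg fun _ _ => by simp) ?_ _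
      simpa using hc v p.1.1 q.2
    refine (Finset.prod_le_prod (fun q _ => pow_nonneg (Finset.sum_nonneg fun _ _ => by simp) _)
      h2).trans ?_
    rw [← Real.exp_sum, ← Finset.mul_sum, Real.exp_le_exp, Fintype.sum_prod_type]
    have h3 : ∑ j, ∑ i, (e b (j, i) : ℝ) = Δ := by
      rw [hΔ]
      refine Finset.sum_congr rfl fun j _ => ?_
      rw [← (hBmem _).mp b.2 j]
      push_cast
      rfl
    rw [h3]
    have : 0 ≤ N * Δ := by positivity
    linarith)
  set F : MvPolynomial (Fin m × ι) K := ∑ b : α, monomial (e b) (x b) with hF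
  have hFcoeff : ∀ b : α, coeff (e b) F = x b := by
    intro b
    rw [hF, coeff_sum, Finset.sum_eq_single b]
    · simp
    · intro b' _ hb'
      rw [coeff_monomial, if_neg]
      intro h
      exact hb' (Subtype.ext (heinj h))
    · simp
  have hFw : IsWeightedHomogeneous blockWt F d := by
    refine IsWeightedHomogeneous.sum _ _ _ fun b _ => ?_
    have := (hwh b b.2).C_mul (x b)
    rwa [C_mul_monomial, mul_one] at this
  refine ⟨F, ?_, hFw, ?_, ?_, ?_⟩
  · intro h
    refine hx0 (funext fun b => ?_)
    rw [← hFcoeff b, h]; simp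
  · intro a
    rw [hF, coeff_sum]
    refine sum_mem fun b _ => ?_
    rw [coeff_monomial]; split_ifs
    · exact (hx b).1
    · exact zero_mem _
  · intro v
    refine (wnorm_sum_le (by simp) _ _).trans ?_
    have h1 : ∀ b ∈ (Finset.univ : Finset α), wnorm (PS.abv v) 1 (monomial (e b) (x b)) ≤
        Real.exp (Cs * ((c + N) * Δ + 1)) := by
      intro b _
      rw [wnorm_monomial]
      simpa using (hx b).2 v
    refine (Finset.sum_le_card_nsmul _ _ _ h1).trans ?_
    rw [nsmul_eq_mul, Finset.card_univ]
    refine (mul_le_mul_of_nonneg_right hαcard (Real.exp_pos _).le).trans ?_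
    rw [← Real.exp_add, Real.exp_le_exp]
    have : Cs * 1 ≤ Cs * Δ := by gcongr
    nlinarith
  · intro v b hb i
    by_contra hcon
    push Not at hcon
    have hb' := isWeightedHomogeneous_linSubst (fun _ => M v) hFw hb
    let b₀ : Fin m → ι → ℕ := fun j i => b (j, i)
    have hb₀ : b₀ ∈ B := by
      rw [hBmem]; intro j
      rw [← hb', weight_blockWt]
    have heb : e b₀ = b := by ext p; rfl
    have h2 := hxA ⟨(v, ⟨b₀, hb₀⟩), ⟨i, hcon⟩⟩
    refine hb ?_
    rw [← h2, hF, map_sum, coeff_sum]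
    refine Finset.sum_congr rfl fun a _ => ?_
    simp only [A, heb]
    have h3 : (monomial (e a) (x a) : MvPolynomial (Fin m × ι) K) =
        C (x a) * monomial (e a) 1 := by rw [C_mul_monomial, mul_one]
    rw [h3, map_mul, algHom_C, algebraMap_eq, coeff_C_mul, mul_comm]

end Auxiliary

section Index
variable {K : Type*} [Field K] {S : Type} [Fintype S] (PS : PlaceSystem K S)

theorem balanced_exponent_le {ι : Type*} [Fintype ι] [Nonempty ι] {m : ℕ} {d : Fin m → ℕ}
    {q : Fin m → ℝ} {D ε G : ℝ} {c : ι → ℝ} (hd : ∀ j, 1 ≤ d j) (hD : 0 ≤ D)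
    (hq₁ : ∀ j, d j * q j ≤ D) (hq₂ : ∀ j, D - ε * D ≤ d j * q j) (hc : ∀ i, |c i| ≤ G)
    (b : Fin m × ι →₀ ℕ) (hb : ∀ j, ∑ i, b (j, i) = d j)
    (hbal : ∀ i, |∑ j, (b (j, i) : ℝ) / d j - m / Fintype.card ι| ≤ ε * m) :
    ∑ p : Fin m × ι, c p.2 * q p.1 * b p ≤
      D * (m / Fintype.card ι) * ∑ i, c i + (Fintype.card ι + 1) * G * ε * m * D := by
  have hd0 : ∀ j, (0 : ℝ) < d j := fun j => by exact_mod_cast hd j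
  set N : ℝ := (Fintype.card ι : ℝ) with hN
  have h1 : ∀ p : Fin m × ι, c p.2 * q p.1 * b p ≤
      D * (c p.2 * ((b p : ℝ) / d p.1)) + G * ε * D * ((b p : ℝ) / d p.1) := by
    rintro ⟨j, i⟩
    have h2 : q j = (d j * q j) / d j := by field_simp [(hd0 j).ne']
    have h3 : |c i * (d j * q j - D)| ≤ G * (ε * D) := by
      rw [abs_mul]
      refine mul_le_mul (hc i) ?_ (abs_nonneg _) ((abs_nonneg _).trans (hc i))
      rw [abs_le]; constructor <;> linarith [hq₁ j, hq₂ j]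
    have h4 := (abs_le.mp h3).2
    have h5 : (0 : ℝ) ≤ (b (j, i) : ℝ) / d j := by positivity
    calc c i * q j * b (j, i) = (c i * (d j * q j - D) + D * c i) * ((b (j, i) : ℝ) / d j) := by
          have := (hd0 j).ne'
          field_simp
          ring
      _ ≤ (G * (ε * D) + D * c i) * ((b (j, i) : ℝ) / d j) := by gcongr
      _ = _ := by ring
  refine (Finset.sum_le_sum fun p _ => h1 p).trans ?_
  rw [Finset.sum_add_distrib, ← Finset.mul_sum, ← Finset.mul_sum]
  have h6 : ∑ p : Fin m × ι, (b p : ℝ) / d p.1 = m := by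
    rw [Fintype.sum_prod_type]
    have : ∀ j, ∑ i, (b (j, i) : ℝ) / d j = 1 := by
      intro j
      rw [← Finset.sum_div, div_eq_one_iff_eq (hd0 j).ne']
      exact_mod_cast hb j
    simp [this]
  have h7 : ∑ p : Fin m × ι, c p.2 * ((b p : ℝ) / d p.1) ≤
      (m / N) * ∑ i, c i + N * (G * (ε * m)) := by
    rw [Fintype.sum_prod_type_right]
    have h8 : ∀ i, ∑ j, c i * ((b (j, i) : ℝ) / d j) ≤ c i * (m / N) + G * (ε * m) := by
      intro i
      rw [← Finset.mul_sum]
      have h9 : |c i * (∑ j, (b (j, i) : ℝ) / d j - m / N)| ≤ G * (ε * m) := by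
        rw [abs_mul]
        exact mul_le_mul (hc i) (hbal i) (abs_nonneg _) ((abs_nonneg _).trans (hc i))
      have := (abs_le.mp h9).2
      linarith
    refine (Finset.sum_le_sum fun i _ => h8 i).trans (le_of_eq ?_)
    rw [Finset.sum_add_distrib, ← Finset.sum_mul]
    simp [hN, mul_comm]
  rw [h6]
  have := mul_le_mul_of_nonneg_left h7 hD
  linarith

theorem abv_coeff_le {ι : Type*} [Fintype ι] [DecidableEq ι] [Nonempty ι] {m : ℕ} {d : Fin m → ℕ}
    {q : Fin m → ℝ} {D ε G C₁ C₃ : ℝ} {c : ι → ℝ} (f : AbsoluteValue K ℝ)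
    (hd : ∀ j, 1 ≤ d j) (hD : 0 ≤ D)
    (hq₁ : ∀ j, d j * q j ≤ D) (hq₂ : ∀ j, D - ε * D ≤ d j * q j) (hc : ∀ i, |c i| ≤ G)
    (H : MvPolynomial (Fin m × ι) K) (hH : IsWeightedHomogeneous blockWt H d)
    (hHn : wnorm f 1 H ≤ Real.exp (C₁ * ∑ j, (d j : ℝ)))
    (hbal : ∀ b, coeff b H ≠ 0 → ∀ i,
      |∑ j, (b (j, i) : ℝ) / d j - m / Fintype.card ι| ≤ ε * m)
    (A : Fin m → Matrix ι ι K) (lam : Fin m × ι → ℝ) (hlam : ∀ p, 0 < lam p)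
    (hA : ∀ j l i, f (A j i l) ≤ Real.exp C₃ * lam (j, l) * Real.exp (c i * q j))
    (a : Fin m × ι →₀ ℕ) :
    f (coeff a (linSubst A H)) ≤ Real.exp ((C₁ + Fintype.card ι + C₃) * (∑ j, (d j : ℝ)) +
      (D * (m / Fintype.card ι) * ∑ i, c i + (Fintype.card ι + 1) * G * ε * m * D)) *
      ∏ p, lam p ^ a p := by
  classical
  set N : ℝ := (Fintype.card ι : ℝ) with hN
  have hw : ∀ p, (0 : ℝ) ≤ (fun p => (lam p)⁻¹) p := fun p => (inv_pos.mpr (hlam p)).le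
  have h1 := coeff_le_wnorm (f := f) hw (linSubst A H) a
  have h2 := h1.trans (wnorm_linSubst_le hw A H)
  have h3 : ∀ p : Fin m × ι, ∑ l, f (A p.1 p.2 l) * (lam (p.1, l))⁻¹ ≤
      Real.exp (N + C₃ + c p.2 * q p.1) := by
    rintro ⟨j, i⟩
    have h4 : ∀ l ∈ (Finset.univ : Finset ι), f (A j i l) * (lam (j, l))⁻¹ ≤
        Real.exp (C₃ + c i * q j) := by
      intro l _
      rw [← div_eq_mul_inv, div_le_iff₀ (hlam _), Real.exp_add]
      refine (hA j l i).trans (le_of_eq (by ring))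
    refine (Finset.sum_le_card_nsmul _ _ _ h4).trans ?_
    rw [nsmul_eq_mul, Finset.card_univ, add_assoc, Real.exp_add N]
    refine mul_le_mul_of_nonneg_right ?_ (Real.exp_pos _).le
    have := Real.add_one_le_exp N
    linarith
  have h5 : wnorm f (fun p => ∑ l, f (A p.1 p.2 l) * (lam (p.1, l))⁻¹) H ≤
      Real.exp ((C₁ + N + C₃) * (∑ j, (d j : ℝ)) +
      (D * (m / N) * ∑ i, c i + (N + 1) * G * ε * m * D)) := by
    refine (wnorm_mono (fun p => Finset.sum_nonneg fun l _ =>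
      mul_nonneg (f.nonneg _) (hw _)) h3 H).trans ?_
    have h6 : wnorm f (fun p => Real.exp (N + C₃ + c p.2 * q p.1)) H ≤
        wnorm f 1 H * Real.exp ((N + C₃) * (∑ j, (d j : ℝ)) +
          (D * (m / N) * ∑ i, c i + (N + 1) * G * ε * m * D)) := by
      rw [wnorm, wnorm, Finset.sum_mul]
      refine Finset.sum_le_sum fun b hb => ?_
      simp only [Pi.one_apply, one_pow, Finset.prod_const_one, mul_one]
      refine mul_le_mul_of_nonneg_left ?_ (f.nonneg _)
      have hb0 := mem_support_iff.mp hb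
      have hbd : ∀ j, ∑ i, b (j, i) = d j := by
        intro j; rw [← hH hb0, weight_blockWt]
      have h7 := balanced_exponent_le hd hD hq₁ hq₂ hc b hbd (hbal b hb0)
      have h8 : ∑ p : Fin m × ι, (b p : ℝ) = ∑ j, (d j : ℝ) := by
        rw [Fintype.sum_prod_type]
        refine Finset.sum_congr rfl fun j _ => ?_
        rw [← hbd j]; push_cast; rfl
      simp only [← Real.exp_nat_mul, ← Real.exp_sum]
      rw [Real.exp_le_exp]
      calc ∑ p : Fin m × ι, (b p : ℝ) * (N + C₃ + c p.2 * q p.1) =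
          (N + C₃) * ∑ p : Fin m × ι, (b p : ℝ) + ∑ p : Fin m × ι, c p.2 * q p.1 * b p := by
            rw [Finset.mul_sum, ← Finset.sum_add_distrib]
            exact Finset.sum_congr rfl fun p _ => by ring
        _ ≤ _ := by rw [h8]; linarith
    refine h6.trans ?_
    refine (mul_le_mul_of_nonneg_right hHn (Real.exp_pos _).le).trans (le_of_eq ?_)
    rw [← Real.exp_add]; ring_nf
  have h9 := h2.trans h5
  simp only [inv_pow, Finset.prod_inv_distrib] at h9
  rw [← div_eq_mul_inv, div_le_iff₀ (Finset.prod_pos fun p _ => pow_pos (hlam p) _)] at h9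
  exact h9

/-- The index of the auxiliary polynomial along the hyperplanes is large. -/
theorem index_lower_bound {ι : Type*} [Fintype ι] [DecidableEq ι] [Nonempty ι] {m : ℕ}
    {d : Fin m → ℕ} {q : Fin m → ℝ} {D ε G C₁ C₃ δ B : ℝ} {c : S → ι → ℝ} (i₀ : ι)
    (hd : ∀ j, 1 ≤ d j) (hD : 0 < D)
    (hq₁ : ∀ j, d j * q j ≤ D) (hq₂ : ∀ j, D - ε * D ≤ d j * q j) (hc : ∀ v i, |c v i| ≤ G)
    (hc0 : ∑ v, (PS.mult v : ℝ) * ∑ i, c v i = 0) (hδB : 0 ≤ δ + B) (hδ : 0 ≤ δ)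
    (H : S → MvPolynomial (Fin m × ι) K) (hH : ∀ v, IsWeightedHomogeneous blockWt (H v) d)
    (hHn : ∀ v, wnorm (PS.abv v) 1 (H v) ≤ Real.exp (C₁ * ∑ j, (d j : ℝ)))
    (hbal : ∀ v b, coeff b (H v) ≠ 0 → ∀ i,
      |∑ j, (b (j, i) : ℝ) / d j - m / Fintype.card ι| ≤ ε * m)
    (A : S → Fin m → Matrix ι ι K) (lam : S → Fin m × ι → ℝ) (hlam : ∀ v p, 0 < lam v p)
    (hA : ∀ v j l i, PS.abv v (A v j i l) ≤
      Real.exp C₃ * lam v (j, l) * Real.exp (c v i * q j))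
    (hlam₁ : ∀ j, ∀ l ≠ i₀, ∏ v, lam v (j, l) ^ PS.mult v ≤ Real.exp (-δ * q j))
    (hlam₂ : ∀ j, ∏ v, lam v (j, i₀) ^ PS.mult v ≤ Real.exp (B * q j))
    (P : MvPolynomial (Fin m × ι) K) (hP : ∀ v, P = linSubst (A v) (H v))
    (hint : ∀ a, coeff a P ∈ PS.ring) (a : Fin m × ι →₀ ℕ) (ha : coeff a P ≠ 0) :
    δ * m * (1 - ε) * D ≤ (∑ v, (PS.mult v : ℝ)) * ((C₁ + Fintype.card ι + C₃) * (∑ j, (d j : ℝ)) +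
      (Fintype.card ι + 1) * G * ε * m * D) + (δ + B) * D * ∑ j, (a (j, i₀) : ℝ) / d j := by
  classical
  have hd0 : ∀ j, (0 : ℝ) < d j := fun j => by exact_mod_cast hd j
  set N : ℝ := (Fintype.card ι : ℝ) with hN
  have h1 := PS.one_le_prod _ (hint a) ha
  have had : ∀ j, ∑ i, a (j, i) = d j := by
    intro j
    have hw := isWeightedHomogeneous_linSubst (A PS.v₀) (hH PS.v₀)
    rw [← hP] at hw
    rw [← hw ha, weight_blockWt]
  set E : S → ℝ := fun v => (C₁ + N + C₃) * (∑ j, (d j : ℝ)) +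
      (D * (m / N) * ∑ i, c v i + (N + 1) * G * ε * m * D) with hE
  have h2 : ∀ v ∈ (Finset.univ : Finset S), PS.abv v (coeff a P) ^ PS.mult v ≤
      Real.exp (PS.mult v * E v) * (∏ p, lam v p ^ a p) ^ PS.mult v := by
    intro v _
    rw [Real.exp_nat_mul, ← mul_pow]
    refine pow_le_pow_left₀ (AbsoluteValue.nonneg _ _) ?_ _
    have := abv_coeff_le (PS.abv v) hd hD.le hq₁ hq₂ (hc v) (H v) (hH v) (hHn v) (hbal v) (A v)
      (lam v) (hlam v) (hA v) a
    rwa [← hP v] at this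
  have h3 := h1.trans (Finset.prod_le_prod (fun v _ => pow_nonneg (AbsoluteValue.nonneg _ _) _) h2)
  rw [Finset.prod_mul_distrib, ← Real.exp_sum] at h3
  have h4 : ∏ v, (∏ p, lam v p ^ a p) ^ PS.mult v =
      ∏ p, (∏ v, lam v p ^ PS.mult v) ^ a p := by
    simp only [← Finset.prod_pow]
    rw [Finset.prod_comm]
    refine Finset.prod_congr rfl fun p _ => Finset.prod_congr rfl fun v _ => ?_
    rw [← pow_mul, ← pow_mul, mul_comm]
  have h5 : ∀ p ∈ (Finset.univ : Finset (Fin m × ι)), (∏ v, lam v p ^ PS.mult v) ^ a p ≤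
      Real.exp (a p * (-δ * q p.1 + if p.2 = i₀ then (δ + B) * q p.1 else 0)) := by
    rintro ⟨j, l⟩ _
    rw [Real.exp_nat_mul]
    refine pow_le_pow_left₀ (Finset.prod_nonneg fun v _ => pow_nonneg (hlam v _).le _) ?_ _
    by_cases hl : l = i₀
    · simp only [hl, if_true]
      refine (hlam₂ j).trans (le_of_eq ?_)
      ring_nf
    · simp only [hl, if_false, add_zero]
      exact hlam₁ j l hl
  rw [h4] at h3
  have h6 := h3.trans (mul_le_mul_of_nonneg_left (Finset.prod_le_prod
    (fun p _ => pow_nonneg (Finset.prod_nonneg fun v _ => pow_nonneg (hlam v _).le _) _) h5)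
    (Real.exp_pos _).le)
  rw [← Real.exp_sum, ← Real.exp_add, Real.one_le_exp_iff] at h6
  have h7 : ∑ v, (PS.mult v : ℝ) * E v = (∑ v, (PS.mult v : ℝ)) *
      ((C₁ + N + C₃) * (∑ j, (d j : ℝ)) + (N + 1) * G * ε * m * D) := by
    have : ∀ v, (PS.mult v : ℝ) * E v = PS.mult v *
        ((C₁ + N + C₃) * (∑ j, (d j : ℝ)) + (N + 1) * G * ε * m * D) +
        D * (m / N) * (PS.mult v * ∑ i, c v i) := by
      intro v; rw [hE]; ring
    simp only [this]
    rw [Finset.sum_add_distrib, ← Finset.sum_mul, ← Finset.mul_sum, hc0]; ring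
  have h8 : ∑ p : Fin m × ι, (a p : ℝ) * (-δ * q p.1 + if p.2 = i₀ then (δ + B) * q p.1 else 0) =
      ∑ j, (-δ * (d j * q j) + (δ + B) * ((d j * q j) * ((a (j, i₀) : ℝ) / d j))) := by
    rw [Fintype.sum_prod_type]
    refine Finset.sum_congr rfl fun j _ => ?_
    simp only [mul_add, Finset.sum_add_distrib, ← Finset.sum_mul]
    have h9 : (∑ i, (a (j, i) : ℝ)) = d j := by exact_mod_cast had j
    rw [h9]
    simp only [mul_ite, mul_zero, Finset.sum_ite_eq', Finset.mem_univ, if_true]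
    have := (hd0 j).ne'
    field_simp
  rw [h7, h8] at h6
  have h10 : ∀ j ∈ (Finset.univ : Finset (Fin m)),
      (-δ * (d j * q j) + (δ + B) * ((d j * q j) * ((a (j, i₀) : ℝ) / d j))) ≤
      -δ * (D - ε * D) + (δ + B) * (D * ((a (j, i₀) : ℝ) / d j)) := by
    intro j _
    have e1 : δ * (D - ε * D) ≤ δ * (d j * q j) := mul_le_mul_of_nonneg_left (hq₂ j) hδ
    have e2 : (δ + B) * ((d j * q j) * ((a (j, i₀) : ℝ) / d j)) ≤
        (δ + B) * (D * ((a (j, i₀) : ℝ) / d j)) := by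
      refine mul_le_mul_of_nonneg_left (mul_le_mul_of_nonneg_right (hq₁ j) (by positivity)) hδB
    linarith
  have h11 := h6.trans (add_le_add_right (Finset.sum_le_sum h10) _)
  rw [Finset.sum_add_distrib, ← Finset.mul_sum Finset.univ (fun j => D * ((a (j, i₀) : ℝ) / d j)),
    ← Finset.mul_sum Finset.univ (fun j => ((a (j, i₀) : ℝ) / d j))] at h11
  simp only [Finset.sum_const, Finset.card_univ, Fintype.card_fin, nsmul_eq_mul] at h11
  linarith

end Index

section Transfer
variable {K : Type*} [Field K] {μ ι : Type*} [Fintype μ] [DecidableEq μ] [Fintype ι]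
  [DecidableEq ι]

theorem shift_zero_apply {σ : Type*} [Fintype σ] (P : MvPolynomial σ K) :
    shift (0 : σ → K) P = P := by
  simp [shift]

/-- Dehomogenisation: `X (j, i₀)` becomes a coefficient variable and `X (j, i₁)` becomes `1`. -/
noncomputable def dehomog (i₀ i₁ : ι) :
    MvPolynomial (μ × ι) K →ₐ[K] MvPolynomial (μ × ι) (MvPolynomial μ K) :=
  aeval fun p => if p.2 = i₀ then C (X p.1) else if p.2 = i₁ then 1 else X p

noncomputable def distinguishedExp (i₀ : ι) (a : μ × ι →₀ ℕ) : μ →₀ ℕ :=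
  Finsupp.equivFunOnFinite.symm fun j => a (j, i₀)

noncomputable def remainingExp (i₀ i₁ : ι) (a : μ × ι →₀ ℕ) : μ × ι →₀ ℕ :=
  a.filter fun p => p.2 ≠ i₀ ∧ p.2 ≠ i₁

theorem dehomog_monomial {i₀ i₁ : ι} (h : i₁ ≠ i₀) (a : μ × ι →₀ ℕ) (c : K) :
    dehomog i₀ i₁ (monomial a c) =
      monomial (remainingExp i₀ i₁ a) (monomial (distinguishedExp i₀ a) c) := by
  rw [dehomog, aeval_monomial, Finsupp.prod_fintype _ _ (by simp)]
  rw [monomial_eq (s := remainingExp i₀ i₁ a), monomial_eq (s := distinguishedExp i₀ a),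
    Finsupp.prod_fintype _ _ (by simp), Finsupp.prod_fintype _ _ (by simp), C_mul, mul_assoc]
  congr 1
  rw [map_prod]
  have h1 : ∏ j, (C (X j ^ distinguishedExp i₀ a j) : MvPolynomial (μ × ι) (MvPolynomial μ K)) =
      ∏ p : μ × ι, if p.2 = i₀ then C (X p.1 ^ a p) else 1 := by
    rw [Fintype.prod_prod_type]
    refine Finset.prod_congr rfl fun j _ => ?_
    simp [distinguishedExp]
  rw [h1, ← Finset.prod_mul_distrib]
  refine Finset.prod_congr rfl fun p _ => ?_
  by_cases h0 : p.2 = i₀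
  · simp [h0, remainingExp]
  · by_cases h2 : p.2 = i₁
    · simp [h2, remainingExp, h]
    · simp [h0, h2, remainingExp]

theorem eq_of_exponents {i₀ i₁ : ι} {d : μ → ℕ} {a a' : μ × ι →₀ ℕ}
    (ha : ∀ j, ∑ i, a (j, i) = d j) (ha' : ∀ j, ∑ i, a' (j, i) = d j)
    (h₁ : distinguishedExp i₀ a = distinguishedExp i₀ a')
    (h₂ : remainingExp i₀ i₁ a = remainingExp i₀ i₁ a') : a = a' := by
  have h3 : ∀ j, ∀ i ≠ i₁, a (j, i) = a' (j, i) := by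
    intro j i hi
    by_cases h0 : i = i₀
    · subst h0
      exact DFunLike.congr_fun h₁ j
    · have := DFunLike.congr_fun h₂ (j, i)
      simpa [remainingExp, h0, hi] using this
  ext ⟨j, i⟩
  by_cases hi : i = i₁
  · subst hi
    have e1 := ha j
    have e2 := ha' j
    rw [← Finset.add_sum_erase _ _ (Finset.mem_univ i)] at e1 e2
    rw [Finset.sum_congr rfl fun l hl => h3 j l (Finset.ne_of_mem_erase hl)] at e1
    omega
  · exact h3 j i hi

theorem coeff_dehomog {i₀ i₁ : ι} (h : i₁ ≠ i₀) {d : μ → ℕ} {G : MvPolynomial (μ × ι) K}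
    (hG : IsWeightedHomogeneous blockWt G d) {a : μ × ι →₀ ℕ} (ha : coeff a G ≠ 0) :
    coeff (distinguishedExp i₀ a) (coeff (remainingExp i₀ i₁ a) (dehomog i₀ i₁ G)) =
      coeff a G := by
  have hdeg : ∀ a, coeff a G ≠ 0 → ∀ j, ∑ i, a (j, i) = d j := by
    intro a ha j; rw [← hG ha, weight_blockWt]
  conv_lhs => rw [G.as_sum, map_sum, coeff_sum, coeff_sum]
  rw [Finset.sum_eq_single a]
  · rw [dehomog_monomial h, coeff_monomial, if_pos rfl, coeff_monomial, if_pos rfl]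
  · intro a' ha' hne
    rw [dehomog_monomial h, coeff_monomial]
    split_ifs with h1
    · rw [coeff_monomial, if_neg]
      intro h2
      exact hne (eq_of_exponents (hdeg _ (mem_support_iff.mp ha')) (hdeg _ ha) h2 h1)
    · simp
  · intro ha'
    exact absurd (mem_support_iff.mpr ha) ha'

theorem exists_of_coeff_dehomog_ne_zero {i₀ i₁ : ι} (h : i₁ ≠ i₀) {G : MvPolynomial (μ × ι) K}
    {β : μ × ι →₀ ℕ} {α : μ →₀ ℕ} (hne : coeff α (coeff β (dehomog i₀ i₁ G)) ≠ 0) :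
    ∃ a, coeff a G ≠ 0 ∧ distinguishedExp i₀ a = α ∧ remainingExp i₀ i₁ a = β := by
  rw [G.as_sum, map_sum, coeff_sum, coeff_sum] at hne
  obtain ⟨a, ha, h1⟩ := Finset.exists_ne_zero_of_sum_ne_zero hne
  refine ⟨a, mem_support_iff.mp ha, ?_⟩
  rw [dehomog_monomial h, coeff_monomial] at h1
  split_ifs at h1 with h2
  · rw [coeff_monomial] at h1
    split_ifs at h1 with h3
    · exact ⟨h3, h2⟩
    · exact absurd rfl h1
  · exact absurd rfl h1

/-- A substitution fixing the outer variables and changing the coefficient variables acts on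
coefficients of lowest degree through its constant term. -/
theorem coeff_eval₂_of_minimal {κ : Type*} [Fintype κ] {A : Type*} [CommRing A]
    (h : A →+* MvPolynomial κ A) (P : MvPolynomial κ A) (β : κ →₀ ℕ)
    (hβ : ∀ γ, coeff γ P ≠ 0 → β.degree ≤ γ.degree) :
    coeff β (eval₂Hom h X P) = constantCoeff (h (coeff β P)) := by
  classical
  conv_lhs => rw [P.as_sum, map_sum, coeff_sum]
  have hX : ∀ γ c, eval₂Hom h X (monomial γ c) = h c * monomial γ 1 := by
    intro γ c
    rw [coe_eval₂Hom, eval₂_monomial, monomial_eq (s := γ), C_1, one_mul]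
  have key : ∀ γ ∈ P.support, γ ≠ β → coeff β (eval₂Hom h X (monomial γ (coeff γ P))) = 0 := by
    intro γ hγ hne
    rw [hX, coeff_mul_monomial', if_neg]
    intro hle
    have h1 := hβ γ (mem_support_iff.mp hγ)
    apply hne
    have h2 : (β - γ) + γ = β := tsub_add_cancel_of_le hle
    have h3 := congrArg Finsupp.degree h2
    rw [map_add] at h3
    have h4 : (β - γ).degree = 0 := by omega
    rw [Finsupp.degree_eq_zero_iff] at h4
    rw [← h2, h4, zero_add]
  rw [Finset.sum_eq_single β (fun γ hγ hne => key γ hγ hne)]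
  · rw [hX, coeff_mul_monomial', if_pos le_rfl, tsub_self, mul_one]
    rfl
  · intro hn
    rw [notMem_support_iff.mp hn]
    simp

/-- The coordinate change making the first linear form of each block a coefficient variable. -/
noncomputable def straighten (i₀ i₁ : ι) (h : μ → Matrix ι ι K) :
    MvPolynomial μ K →+* MvPolynomial (μ × ι) (MvPolynomial μ K) :=
  (aeval fun j => C (X j) + C (C (-h j i₀ i₁)) -
    ∑ l ∈ (Finset.univ.erase i₀).erase i₁, C (C (h j i₀ l)) * X (j, l) :
    MvPolynomial μ K →ₐ[K] MvPolynomial (μ × ι) (MvPolynomial μ K)).toRingHom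

theorem constantCoeff_straighten (i₀ i₁ : ι) (h : μ → Matrix ι ι K) (f : MvPolynomial μ K) :
    constantCoeff (straighten i₀ i₁ h f) = shift (fun j => -h j i₀ i₁) f := by
  have : (constantCoeff.comp (straighten i₀ i₁ h)) =
      (shift (fun j => -h j i₀ i₁)).toRingHom := by
    refine ringHom_ext (fun r => ?_) (fun j => ?_)
    · simp [straighten, shift, MvPolynomial.algebraMap_apply]
    · simp [straighten, shift, sub_eq_add_neg]
  exact DFunLike.congr_fun this f

theorem straighten_dehomog_linSubst {i₀ i₁ : ι} (hi : i₁ ≠ i₀) (h : μ → Matrix ι ι K)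
    (h₁ : ∀ j, h j i₀ i₀ = 1) (j : μ) :
    eval₂Hom (straighten i₀ i₁ h) X (dehomog i₀ i₁ (linSubst h (X (j, i₀)))) =
      C (X j) := by
  have e : ∀ c : K, eval₂Hom (straighten i₀ i₁ h) (X : μ × ι → MvPolynomial (μ × ι) (MvPolynomial μ K))
      (dehomog i₀ i₁ (C c)) = C (C c) := by
    intro c
    simp [dehomog, straighten, MvPolynomial.algebraMap_apply]
  simp only [linSubst, aeval_X, map_sum, map_mul, e]
  have hmem : i₁ ∈ Finset.univ.erase i₀ := Finset.mem_erase.mpr ⟨hi, Finset.mem_univ _⟩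
  rw [← Finset.add_sum_erase _ _ (Finset.mem_univ i₀), ← Finset.add_sum_erase _ _ hmem]
  have h2 : ∀ l ∈ (Finset.univ.erase i₀).erase i₁,
      C (C (h j i₀ l)) * eval₂Hom (straighten i₀ i₁ h)
        (X : μ × ι → MvPolynomial (μ × ι) (MvPolynomial μ K)) (dehomog i₀ i₁ (X (j, l))) =
      C (C (h j i₀ l)) * X (j, l) := by
    intro l hl
    have hl1 := Finset.ne_of_mem_erase hl
    have hl0 := Finset.ne_of_mem_erase (Finset.mem_of_mem_erase hl)
    simp [dehomog, hl1, hl0]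
  rw [Finset.sum_congr rfl h2]
  have h3 : eval₂Hom (straighten i₀ i₁ h) (X : μ × ι → MvPolynomial (μ × ι) (MvPolynomial μ K))
      (dehomog i₀ i₁ (X (j, i₀))) = C (X j) + C (C (-h j i₀ i₁)) -
    ∑ l ∈ (Finset.univ.erase i₀).erase i₁, C (C (h j i₀ l)) * X (j, l) := by
    simp [dehomog, straighten]
  have h4 : eval₂Hom (straighten i₀ i₁ h) (X : μ × ι → MvPolynomial (μ × ι) (MvPolynomial μ K))
      (dehomog i₀ i₁ (X (j, i₁))) = 1 := by
    simp [dehomog, hi]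
  rw [h3, h4, h₁]
  simp only [map_neg, C_1]
  ring

theorem indGe_monomial_zero {d : μ → ℝ} (α : μ →₀ ℕ) (c : K) :
    IndGe (0 : μ → K) d (wt d α) (monomial α c) := by
  intro b hb
  rw [shift_zero_apply, coeff_monomial] at hb
  split_ifs at hb with h
  · rw [h]
  · exact absurd rfl hb

/-- From a block-homogeneous polynomial all of whose monomials, in suitable coordinates, contain
the first linear forms to high order, one extracts a polynomial in one variable per block
with the same index at the corresponding point. -/
theorem exists_polynomial_of_block {i₀ i₁ : ι} (hi : i₁ ≠ i₀) {d : μ → ℕ}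
    (h : μ → Matrix ι ι K) (h₁ : ∀ j, h j i₀ i₀ = 1)
    {G P : MvPolynomial (μ × ι) K} (hG0 : G ≠ 0) (hG : IsWeightedHomogeneous blockWt G d)
    (hGP : G = linSubst h P) {t : ℝ}
    (hP : ∀ a, coeff a P ≠ 0 → t ≤ ∑ j, (a (j, i₀) : ℝ) / d j) :
    ∃ f : MvPolynomial μ K, f ≠ 0 ∧ (∀ j, degreeOf j f ≤ d j) ∧
      (∀ α, coeff α f ≠ 0 → ∃ a, coeff α f = coeff a G) ∧
      (∀ g : AbsoluteValue K ℝ, wnorm g 1 f ≤ wnorm g 1 G) ∧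
      IndGe (fun j => -h j i₀ i₁) (fun j => (d j : ℝ)) t f := by
  classical
  set A := dehomog i₀ i₁ G with hA
  have hdeg : ∀ a, coeff a G ≠ 0 → ∀ j, ∑ i, a (j, i) = d j := by
    intro a ha j; rw [← hG ha, weight_blockWt]
  have hA0 : A.support.Nonempty := by
    obtain ⟨a, ha⟩ := ne_zero_iff.mp hG0
    refine ⟨remainingExp i₀ i₁ a, ?_⟩
    rw [mem_support_iff]
    intro h0
    have := coeff_dehomog hi hG ha
    rw [← hA, h0, coeff_zero] at this
    exact ha this.symm
  obtain ⟨β, hβ, hmin⟩ := Finset.exists_min_image A.support (fun γ => γ.degree) hA0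
  have hsrc : ∀ α, coeff α (coeff β A) ≠ 0 → ∃ a, coeff a G ≠ 0 ∧ distinguishedExp i₀ a = α ∧
      coeff α (coeff β A) = coeff a G := by
    intro α hα
    obtain ⟨a, ha, h2, h3⟩ := exists_of_coeff_dehomog_ne_zero hi hα
    refine ⟨a, ha, h2, ?_⟩
    rw [← coeff_dehomog hi hG ha, h2, h3]
  refine ⟨coeff β A, mem_support_iff.mp hβ, fun j => ?_, fun α hα => ?_, fun g => ?_, ?_⟩
  · rw [degreeOf_le_iff]
    intro α hα
    obtain ⟨a, ha, rfl, -⟩ := hsrc α (mem_support_iff.mp hα)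
    rw [← hdeg a ha j]
    exact Finset.single_le_sum (f := fun i => a (j, i)) (fun _ _ => Nat.zero_le _)
      (Finset.mem_univ i₀)
  · obtain ⟨a, -, -, h2⟩ := hsrc α hα
    exact ⟨a, h2⟩
  · choose! φ hφ0 hφ1 hφ2 using hsrc
    simp only [wnorm, Pi.one_apply, one_pow, Finset.prod_const_one, mul_one]
    have e1 : ∑ α ∈ (coeff β A).support, g (coeff α (coeff β A)) =
        ∑ a ∈ (coeff β A).support.image φ, g (coeff a G) := by
      rw [Finset.sum_image]
      · exact Finset.sum_congr rfl fun α hα => by rw [hφ2 α (mem_support_iff.mp hα)]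
      · intro x hx y hy hxy
        rw [← hφ1 x (mem_support_iff.mp hx), ← hφ1 y (mem_support_iff.mp hy), hxy]
    rw [e1]
    refine Finset.sum_le_sum_of_subset_of_nonneg ?_ fun _ _ _ => g.nonneg _
    intro a ha
    obtain ⟨α, hα, rfl⟩ := Finset.mem_image.mp ha
    exact mem_support_iff.mpr (hφ0 α (mem_support_iff.mp hα))
  · have hcoef := coeff_eval₂_of_minimal (straighten i₀ i₁ h) A β
      fun γ hγ => hmin γ (mem_support_iff.mpr hγ)
    rw [constantCoeff_straighten] at hcoef
    have hI : IndGe (0 : μ → K) (fun j => (d j : ℝ)) t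
        (coeff β (eval₂Hom (straighten i₀ i₁ h) X A)) := by
      set Θ : MvPolynomial (μ × ι) K →+* MvPolynomial (μ × ι) (MvPolynomial μ K) :=
        (eval₂Hom (straighten i₀ i₁ h) X).comp
          ((dehomog i₀ i₁).toRingHom.comp (linSubst h).toRingHom) with hΘ
      have hΘX : ∀ j, Θ (X (j, i₀)) = C (X j) := straighten_dehomog_linSubst hi h h₁
      have hAΘ : eval₂Hom (straighten i₀ i₁ h) X A = Θ P := by
        rw [hA, hGP]; rfl
      rw [hAΘ, P.as_sum, map_sum, coeff_sum]
      refine IndGe.sum _ _ fun a ha => ?_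
      rw [monomial_eq, Finsupp.prod_fintype _ _ (by simp), map_mul, map_prod,
        Fintype.prod_prod_type]
      simp only [map_pow]
      have e2 : ∀ j, ∏ i, Θ (X (j, i)) ^ a (j, i) = C (X j ^ a (j, i₀)) *
          ∏ i ∈ Finset.univ.erase i₀, Θ (X (j, i)) ^ a (j, i) := by
        intro j
        rw [← Finset.mul_prod_erase _ _ (Finset.mem_univ i₀), hΘX, C_pow]
      simp only [e2]
      rw [Finset.prod_mul_distrib, ← map_prod, mul_left_comm, coeff_C_mul]
      have e3 : ∏ j, (X j : MvPolynomial μ K) ^ a (j, i₀) = monomial (distinguishedExp i₀ a) 1 := by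
        rw [monomial_eq, Finsupp.prod_fintype _ _ (by simp)]
        simp [distinguishedExp]
      rw [e3]
      have e4 : t ≤ wt (fun j => (d j : ℝ)) (distinguishedExp i₀ a) :=
        hP a (mem_support_iff.mp ha)
      rw [← add_zero t]
      exact ((indGe_monomial_zero _ 1).mono e4).mul
        (IndGe.of_nonpos (fun j => Nat.cast_nonneg (d j)) le_rfl)
    rw [hcoef] at hI
    intro b hb
    exact hI b (by rwa [shift_zero_apply])

end Transfer

section TwistedHeight
variable {K : Type*} [Field K] {ι : Type*} [Fintype ι] [DecidableEq ι]

/-- The norm attached to a system of linear forms and a system of weights. -/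
noncomputable def tnorm (f : AbsoluteValue K ℝ) (L : Matrix ι ι K) (t : ι → ℝ) (x : ι → K) : ℝ :=
  ⨆ i, f (L.mulVec x i) / t i

theorem abv_mulVec_le_tnorm (f : AbsoluteValue K ℝ) (L : Matrix ι ι K) {t : ι → ℝ}
    (ht : ∀ i, 0 < t i) (x : ι → K) (i : ι) : f (L.mulVec x i) ≤ tnorm f L t x * t i := by
  rw [← div_le_iff₀ (ht i)]
  exact le_ciSup (f := fun i => f (L.mulVec x i) / t i) (Set.finite_range _).bddAbove i

theorem tnorm_le [Nonempty ι] {f : AbsoluteValue K ℝ} {L : Matrix ι ι K} {t : ι → ℝ}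
    (ht : ∀ i, 0 < t i) {x : ι → K} {c : ℝ} (h : ∀ i, f (L.mulVec x i) ≤ c * t i) :
    tnorm f L t x ≤ c :=
  ciSup_le fun i => (div_le_iff₀ (ht i)).mpr (h i)

theorem tnorm_nonneg (f : AbsoluteValue K ℝ) (L : Matrix ι ι K) {t : ι → ℝ}
    (ht : ∀ i, 0 < t i) (x : ι → K) : 0 ≤ tnorm f L t x :=
  Real.iSup_nonneg fun i => div_nonneg (f.nonneg _) (ht i).le

theorem tnorm_pos (f : AbsoluteValue K ℝ) {L : Matrix ι ι K} (hL : L.det ≠ 0) {t : ι → ℝ}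
    (ht : ∀ i, 0 < t i) {x : ι → K} (hx : x ≠ 0) : 0 < tnorm f L t x := by
  have h1 : L.mulVec x ≠ 0 := fun h => hx (Matrix.eq_zero_of_mulVec_eq_zero hL h)
  obtain ⟨i, hi⟩ := Function.ne_iff.mp h1
  have h2 := abv_mulVec_le_tnorm f L ht x i
  have h3 : 0 < f (L.mulVec x i) := f.pos hi
  exact pos_of_mul_pos_left (h3.trans_le h2) (ht i).le

variable {S : Type} [Fintype S] (PS : PlaceSystem K S)

/-- The twisted height of a vector. -/
noncomputable def theight (L : S → Matrix ι ι K) (t : S → ι → ℝ) (x : ι → K) : ℝ :=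
  ∏ v, tnorm (PS.abv v) (L v) (t v) x ^ PS.mult v

theorem exists_common_denominator {α : Type*} [Fintype α] (x : α → K) :
    ∃ d ∈ PS.int, d ≠ 0 ∧ ∀ i, d * x i ∈ PS.int := by
  classical
  choose d hd hd0 hdx using fun i => PS.frac (x i)
  refine ⟨∏ i, d i, prod_mem fun i _ => hd i, Finset.prod_ne_zero_iff.mpr fun i _ => hd0 i,
    fun i => ?_⟩
  rw [← Finset.prod_erase_mul _ _ (Finset.mem_univ i), mul_assoc]
  exact mul_mem (prod_mem fun i _ => hd i) (hdx i)

end TwistedHeight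

section
variable {K : Type*} [Field K] {μ ι : Type*} [Fintype μ] [DecidableEq μ] [Fintype ι]
  [DecidableEq ι]

theorem linSubst_one (P : MvPolynomial (μ × ι) K) :
    linSubst (fun _ => (1 : Matrix ι ι K)) P = P := by
  have : linSubst (fun _ : μ => (1 : Matrix ι ι K)) = AlgHom.id K _ := by
    refine algHom_ext fun p => ?_
    simp [linSubst, Matrix.one_apply]
  rw [this]; rfl

theorem wnorm_linSubst_le_exp {f : AbsoluteValue K ℝ} {M : μ → Matrix ι ι K} {c : ℝ}
    (hM : ∀ j i, ∑ l, f (M j i l) ≤ Real.exp c) {d : μ → ℕ} {P : MvPolynomial (μ × ι) K}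
    (hP : IsWeightedHomogeneous blockWt P d) :
    wnorm f 1 (linSubst M P) ≤ Real.exp (c * ∑ j, (d j : ℝ)) * wnorm f 1 P := by
  refine (wnorm_linSubst_le (fun _ => zero_le_one) M P).trans ?_
  refine (wnorm_mono (q' := fun _ => Real.exp c) (fun p => Finset.sum_nonneg fun l _ => ?_)
    (fun p => ?_) P).trans (le_of_eq ?_)
  · simp
  · simpa using hM p.1 p.2
  · rw [wnorm, wnorm, Finset.mul_sum]
    refine Finset.sum_congr rfl fun a ha => ?_
    have hbd : ∀ j, ∑ i, a (j, i) = d j := by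
      intro j; rw [← hP (mem_support_iff.mp ha), weight_blockWt]
    rw [Finset.prod_pow_eq_pow_sum, ← Real.exp_nat_mul, Fintype.sum_prod_type]
    simp only [hbd, Pi.one_apply, one_pow, Finset.prod_const_one, mul_one]
    push_cast
    rw [mul_comm c, mul_comm]

end

theorem exists_lacunary {P : ℝ → Prop} (hP : ∀ r, ∃ q ≥ r, P q) (R κ : ℝ) (m : ℕ) :
    ∃ q : Fin m → ℝ, (∀ j, P (q j)) ∧ (∀ j, R ≤ q j) ∧ ∀ i j, i < j → κ * q j ≤ q i := by
  induction m with
  | zero => exact ⟨Fin.elim0, fun j => j.elim0, fun j => j.elim0, fun j => j.elim0⟩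
  | succ m ih =>
    obtain ⟨q, h1, h2, h3⟩ := ih
    obtain ⟨r, hr, hPr⟩ := hP (max R (∑ j, |κ * q j|))
    refine ⟨Fin.cons r q, fun j => ?_, fun j => ?_, fun i j hij => ?_⟩
    · refine Fin.cases hPr (fun j => ?_) j
      simpa using h1 j
    · refine Fin.cases ((le_max_left _ _).trans hr) (fun j => ?_) j
      simpa using h2 j
    · obtain ⟨j, rfl⟩ := Fin.exists_succ_eq.mpr (Fin.ne_zero_of_lt hij)
      refine Fin.cases (fun _ => ?_) (fun i hij => ?_) i hij
      · simp only [Fin.cons_succ, Fin.cons_zero]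
        exact (le_abs_self _).trans ((Finset.single_le_sum (f := fun j => |κ * q j|)
          (fun _ _ => abs_nonneg _) (Finset.mem_univ j)).trans ((le_max_right _ _).trans hr))
      · simpa using h3 i j (by simpa using hij)

section Columns
variable {K : Type*} [Field K] {ι : Type*} [Fintype ι] [DecidableEq ι]

/-- The matrix whose column `i₀` is a basis vector and whose other columns are given. -/
def columnMatrix (i₀ : ι) (x : ι → ι → K) : Matrix ι ι K :=
  fun i l => if l = i₀ then (if i = i₀ then 1 else 0) else x l i

theorem vecMul_columnMatrix {i₀ : ι} {x : ι → ι → K} {ℓ : ι → K}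
    (h : ∀ l ≠ i₀, ∑ i, ℓ i * x l i = 0) :
    Matrix.vecMul ℓ (columnMatrix i₀ x) = Pi.single i₀ (ℓ i₀) := by
  ext l
  rw [Matrix.vecMul, dotProduct]
  by_cases hl : l = i₀
  · subst hl; simp [columnMatrix]
  · simp [columnMatrix, hl, h l hl]

theorem det_columnMatrix_ne_zero {i₀ : ι} {x : ι → ι → K} {ℓ : ι → K}
    (h : ∀ l ≠ i₀, ∑ i, ℓ i * x l i = 0) (h0 : ℓ i₀ ≠ 0)
    (hx : LinearIndependent K fun l : {l // l ≠ i₀} => x l) :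
    (columnMatrix i₀ x).det ≠ 0 := by
  intro hdet
  obtain ⟨y, hy0, hy⟩ := Matrix.exists_mulVec_eq_zero_iff.mpr hdet
  have h1 : y i₀ = 0 := by
    have : dotProduct ℓ ((columnMatrix i₀ x).mulVec y) = 0 := by rw [hy]; simp
    rw [Matrix.dotProduct_mulVec, vecMul_columnMatrix h, single_dotProduct] at this
    exact (mul_eq_zero.mp this).resolve_left h0
  have h2 : ∑ l : {l // l ≠ i₀}, y l • x l = 0 := by
    ext i
    have h3 := congrFun hy i
    rw [Matrix.mulVec, dotProduct, ← Finset.add_sum_erase _ _ (Finset.mem_univ i₀), h1, mul_zero,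
      zero_add] at h3
    rw [Finset.sum_apply, ← Finset.sum_subtype (Finset.univ.erase i₀) (by simp)
      (fun l => (y l • x l) i)]
    refine Eq.trans (Finset.sum_congr rfl fun l hl => ?_) h3
    simp [columnMatrix, Finset.ne_of_mem_erase hl, mul_comm]
  have h4 := Fintype.linearIndependent_iff.mp hx (fun l => y l) h2
  refine hy0 (funext fun l => ?_)
  by_cases hl : l = i₀
  · rw [hl, h1]; rfl
  · exact h4 ⟨l, hl⟩

theorem inv_columnMatrix_apply {i₀ : ι} {x : ι → ι → K} {ℓ : ι → K}
    (h : ∀ l ≠ i₀, ∑ i, ℓ i * x l i = 0) (h0 : ℓ i₀ ≠ 0)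
    (hx : LinearIndependent K fun l : {l // l ≠ i₀} => x l) (i : ι) :
    (columnMatrix i₀ x)⁻¹ i₀ i = ℓ i / ℓ i₀ := by
  have hdet := det_columnMatrix_ne_zero h h0 hx
  have h1 := congrArg (fun w => Matrix.vecMul w (columnMatrix i₀ x)⁻¹) (vecMul_columnMatrix h)
  simp only [Matrix.vecMul_vecMul, Matrix.mul_nonsing_inv _ (IsUnit.mk0 _ hdet),
    Matrix.vecMul_one] at h1
  have h2 := congrFun h1 i
  rw [Matrix.vecMul, single_dotProduct] at h2
  rw [h2, mul_div_cancel_left₀ _ h0]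

end Columns

section Approximation
variable {K : Type*} [Field K] {S : Type} [Fintype S] (PS : PlaceSystem K S)

/-- A hyperplane spanned by points of small twisted height. -/
structure SmallHyperplane {ι : Type} [Fintype ι] [DecidableEq ι] (L : S → Matrix ι ι K)
    (c : S → ι → ℝ) (δ : ℝ) (i₀ : ι) (q : ℝ) (ℓ : ι → K) (x : ι → ι → K) : Prop where
  ne : ℓ i₀ ≠ 0
  orth : ∀ l ≠ i₀, ∑ i, ℓ i * x l i = 0
  indep : LinearIndependent K fun l : {l // l ≠ i₀} => x l
  mem : ∀ l i, x l i ∈ PS.ring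
  small : ∀ l ≠ i₀, theight PS L (fun v i => Real.exp (c v i * q)) (x l) ≤ Real.exp (-δ * q)

variable {PS}

theorem SmallHyperplane.ne_zero {ι : Type} [Fintype ι] [DecidableEq ι] {L : S → Matrix ι ι K}
    {c : S → ι → ℝ} {δ : ℝ} {i₀ : ι} {q : ℝ} {ℓ : ι → K} {x : ι → ι → K}
    (h : SmallHyperplane PS L c δ i₀ q ℓ x) {l : ι} (hl : l ≠ i₀) : x l ≠ 0 :=
  h.indep.ne_zero ⟨l, hl⟩

/-- The auxiliary polynomial, restricted to the hyperplanes, yields a polynomial in several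
variables of large index at the point of coordinate ratios. -/
theorem exists_polynomial_of_smallHyperplanes {ι : Type} [Fintype ι] [DecidableEq ι]
    [Nonempty ι] {L : S → Matrix ι ι K} (hL : ∀ v, (L v).det ≠ 0) {c : S → ι → ℝ} {δ G C₃ : ℝ}
    {i₀ i₁ : ι} (hi : i₁ ≠ i₀) (hδ : 0 < δ) (hG : 0 ≤ G) (hc : ∀ v i, |c v i| ≤ G)
    (hc0 : ∑ v, (PS.mult v : ℝ) * ∑ i, c v i = 0) (hC₃ : 0 ≤ C₃)
    (hL₃ : ∀ v i l, PS.abv v (L v i l) ≤ Real.exp C₃)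
    {m : ℕ} {C₁ ε : ℝ} {M : S → Matrix ι ι K} {e : K} (he : e ∈ PS.int) (he0 : e ≠ 0)
    (hML : ∀ v, M v * L v = e • (1 : Matrix ι ι K))
    {C₂ : ℝ} (hM : ∀ v i, ∑ l, PS.abv v (M v i l) ≤ Real.exp C₂)
    (heC : ∀ v, PS.abv v e ≤ Real.exp C₂)
    {d : Fin m → ℕ} (hd : ∀ j, 1 ≤ d j) {F : MvPolynomial (Fin m × ι) K} (hF0 : F ≠ 0)
    (hFh : IsWeightedHomogeneous blockWt F d) (hFi : ∀ a, coeff a F ∈ PS.int)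
    (hFn : ∀ v, wnorm (PS.abv v) 1 F ≤ Real.exp (C₁ * ∑ j, (d j : ℝ)))
    (hFb : ∀ v b, coeff b (linSubst (fun _ => M v) F) ≠ 0 → ∀ i,
          |∑ j, (b (j, i) : ℝ) / d j - m / Fintype.card ι| ≤ ε * m)
    {q : Fin m → ℝ} (hq : ∀ j, 0 ≤ q j) {D : ℝ} (hD : 0 < D) (hq₁ : ∀ j, d j * q j ≤ D)
    (hq₂ : ∀ j, D - ε * D ≤ d j * q j) {ℓ : Fin m → ι → K} {x : Fin m → ι → ι → K}
    (hx : ∀ j, SmallHyperplane PS L c δ i₀ (q j) (ℓ j) (x j)) {t : ℝ}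
    (ht : (∑ v, (PS.mult v : ℝ)) * ((C₂ + C₁ + Fintype.card ι + C₃) * (∑ j, (d j : ℝ)) +
      (Fintype.card ι + 1) * G * ε * m * D) + (δ + (∑ v, (PS.mult v : ℝ)) * G) * D * t ≤
      δ * m * (1 - ε) * D) :
    ∃ f : MvPolynomial (Fin m) K, f ≠ 0 ∧ (∀ j, degreeOf j f ≤ d j) ∧
      (∀ α, coeff α f ∈ PS.ring) ∧
      (∀ v, wnorm (PS.abv v) 1 f ≤ Real.exp ((C₂ + C₁) * ∑ j, (d j : ℝ))) ∧
      IndGe (fun j => -(ℓ j i₁ / ℓ j i₀)) (fun j => (d j : ℝ)) t f := by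
  classical
  set G₀ : MvPolynomial (Fin m × ι) K := linSubst (fun _ => e • (1 : Matrix ι ι K)) F with hG₀
  set g : Fin m → Matrix ι ι K := fun j => columnMatrix i₀ (x j) with hg
  have hdet : ∀ j, (g j).det ≠ 0 := fun j =>
    det_columnMatrix_ne_zero (hx j).orth (hx j).ne (hx j).indep
  have hG₀h : IsWeightedHomogeneous blockWt G₀ d := isWeightedHomogeneous_linSubst _ hFh
  have hG₀0 : G₀ ≠ 0 := by
    intro h0
    apply hF0
    rw [← linSubst_one F]
    have : linSubst (fun _ : Fin m => e⁻¹ • (1 : Matrix ι ι K)) G₀ =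
        linSubst (fun _ => (1 : Matrix ι ι K)) F := by
      rw [hG₀, linSubst_linSubst]
      simp [smul_smul, he0]
    rw [← this, h0, map_zero]
  set P := linSubst g G₀ with hP
  have hGP : G₀ = linSubst (fun j => (g j)⁻¹) P := by
    rw [hP, linSubst_linSubst]
    simp only [fun j => Matrix.mul_nonsing_inv _ (IsUnit.mk0 _ (hdet j)), linSubst_one]
  have hG₀i : ∀ a, coeff a G₀ ∈ PS.int := by
    refine coeff_linSubst_mem PS.int (fun j i l => ?_) hFi
    rw [Matrix.smul_apply, Matrix.one_apply]
    split_ifs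
    · simpa using he
    · simp [PS.int.zero_mem]
  have hPr : ∀ a, coeff a P ∈ PS.ring := by
    refine coeff_linSubst_mem PS.ring (fun j i l => ?_) fun a => PS.int_le (hG₀i a)
    simp only [hg, columnMatrix]
    split_ifs
    · exact PS.ring.one_mem
    · exact PS.ring.zero_mem
    · exact (hx j).mem l i
  set H : S → MvPolynomial (Fin m × ι) K := fun v => linSubst (fun _ => M v) F with hH
  have hPH : ∀ v, P = linSubst (fun j => L v * g j) (H v) := by
    intro v
    rw [hP, hG₀, hH, linSubst_linSubst, linSubst_linSubst]
    simp only [← Matrix.mul_assoc, hML]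
  have hHn : ∀ v, wnorm (PS.abv v) 1 (H v) ≤ Real.exp ((C₂ + C₁) * ∑ j, (d j : ℝ)) := by
    intro v
    refine (wnorm_linSubst_le_exp (fun _ => hM v) hFh).trans ?_
    rw [add_mul, Real.exp_add]
    exact mul_le_mul_of_nonneg_left (hFn v) (Real.exp_pos _).le
  have hGn : ∀ v, wnorm (PS.abv v) 1 G₀ ≤ Real.exp ((C₂ + C₁) * ∑ j, (d j : ℝ)) := by
    intro v
    refine (wnorm_linSubst_le_exp (c := C₂) (fun _ i => ?_) hFh).trans ?_
    · rw [Finset.sum_eq_single i]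
      · simpa using heC v
      · intro l _ hl
        simp [Matrix.one_apply_ne hl.symm]
      · simp
    · rw [add_mul, Real.exp_add]
      exact mul_le_mul_of_nonneg_left (hFn v) (Real.exp_pos _).le
  set lam : S → Fin m × ι → ℝ := fun v p => if p.2 = i₀ then Real.exp (G * q p.1) else
    tnorm (PS.abv v) (L v) (fun i => Real.exp (c v i * q p.1)) (x p.1 p.2) with hlam
  have hlam0 : ∀ v p, 0 < lam v p := by
    rintro v ⟨j, l⟩
    simp only [hlam]
    split_ifs with hl
    · exact Real.exp_pos _
    · exact tnorm_pos _ (hL v) (fun i => Real.exp_pos _) ((hx j).ne_zero hl)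
  have hA : ∀ v j l i, PS.abv v ((L v * g j) i l) ≤
      Real.exp C₃ * lam v (j, l) * Real.exp (c v i * q j) := by
    intro v j l i
    by_cases hl : l = i₀
    · have h1 : (L v * g j) i l = L v i i₀ := by
        rw [Matrix.mul_apply]; simp [hg, columnMatrix, hl]
      rw [h1]
      simp only [hlam, hl, if_true]
      rw [mul_assoc, ← Real.exp_add]
      refine (hL₃ v i i₀).trans (le_mul_of_one_le_right (Real.exp_pos _).le ?_)
      rw [Real.one_le_exp_iff, ← add_mul]
      exact mul_nonneg (by linarith [(abs_le.mp (hc v i)).1]) (hq j)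
    · have h1 : (L v * g j) i l = (L v).mulVec (x j l) i := by
        rw [Matrix.mul_apply]; simp [hg, columnMatrix, hl, Matrix.mulVec, dotProduct]
      rw [h1]
      simp only [hlam, hl, if_false]
      refine (abv_mulVec_le_tnorm (PS.abv v) (L v) (t := fun i => Real.exp (c v i * q j))
        (fun i => Real.exp_pos _) (x j l) i).trans ?_
      refine mul_le_mul_of_nonneg_right ?_ (Real.exp_pos _).le
      exact le_mul_of_one_le_left (tnorm_nonneg _ _ (fun i => Real.exp_pos _) _)
        (Real.one_le_exp hC₃)
  have hindex : ∀ a, coeff a P ≠ 0 → t ≤ ∑ j, (a (j, i₀) : ℝ) / d j := by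
    intro a ha
    have hB : 0 ≤ (∑ v, (PS.mult v : ℝ)) * G := by positivity
    have h1 := index_lower_bound PS (C₁ := C₂ + C₁) (B := (∑ v, (PS.mult v : ℝ)) * G) i₀ hd hD
      hq₁ hq₂ hc hc0 (by linarith) hδ.le H (fun v => isWeightedHomogeneous_linSubst _ hFh) hHn hFb
      (fun v j => L v * g j) lam hlam0 hA ?_ ?_ P hPH hPr a ha
    · have h2 := ht.trans h1
      have h3 : 0 < (δ + (∑ v, (PS.mult v : ℝ)) * G) * D := by positivity
      exact le_of_mul_le_mul_left (by linarith) h3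
    · intro j l hl
      simp only [hlam, hl, if_false]
      exact (hx j).small l hl
    · intro j
      simp only [hlam, if_true, ← Real.exp_nat_mul, ← Real.exp_sum]
      rw [← Finset.sum_mul, mul_assoc]
  obtain ⟨f, hf0, hfd, hfc, hfn, hfI⟩ := exists_polynomial_of_block hi (fun j => (g j)⁻¹)
    (fun j => by rw [inv_columnMatrix_apply (hx j).orth (hx j).ne (hx j).indep,
      div_self (hx j).ne]) hG₀0 hG₀h hGP hindex
  refine ⟨f, hf0, hfd, fun α => ?_, fun v => (hfn _).trans (hGn v), ?_⟩
  · by_cases hα : coeff α f = 0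
    · rw [hα]; exact PS.ring.zero_mem
    · obtain ⟨a, ha⟩ := hfc α hα
      rw [ha]
      exact PS.int_le (hG₀i a)
  · have : (fun j => -(g j)⁻¹ i₀ i₁) = fun j => -(ℓ j i₁ / ℓ j i₀) := by
      funext j
      rw [inv_columnMatrix_apply (hx j).orth (hx j).ne (hx j).indep]
    rw [← this]
    exact hfI

end Approximation

section RatioBound
variable {K : Type*} [Field K] {S : Type} [Fintype S] (PS : PlaceSystem K S)

theorem le_exp_of_le {a b : ℝ} (h : a ≤ b) : a ≤ Real.exp b := by
  linarith [Real.add_one_le_exp b]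

/-- The coordinate ratios of a hyperplane spanned by points of small twisted height have small
height. -/
theorem exists_bound_ratio [CharZero K] {ι : Type} [Fintype ι] [DecidableEq ι]
    {L : S → Matrix ι ι K} (hL : ∀ v, (L v).det ≠ 0) {c : S → ι → ℝ} {δ η : ℝ}
    {i₀ i₁ : ι} (hi : i₁ ≠ i₀) (hδ : 0 < δ) (hη : 0 < η)
    (hc0 : ∑ v, (PS.mult v : ℝ) * ∑ i, c v i = 0) :
    ∃ q₀ : ℝ, ∀ q ≥ q₀, ∀ ℓ x, SmallHyperplane PS L c δ i₀ q ℓ x →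
      PS.ht (ℓ i₁ / ℓ i₀) ≤ η * q := by
  classical
  have : Nonempty ι := ⟨i₀⟩
  by_contra hcon
  push Not at hcon
  set n : ℝ := ∑ v, (PS.mult v : ℝ) with hn
  have hn1 : 1 ≤ n := by
    have h1 : (1 : ℝ) ≤ PS.mult PS.v₀ := by exact_mod_cast PS.mult_pos _
    exact h1.trans (Finset.single_le_sum (f := fun v => (PS.mult v : ℝ))
      (fun _ _ => Nat.cast_nonneg _) (Finset.mem_univ _))
  set N : ℝ := (Fintype.card ι : ℝ) with hN
  have hN1 : (1 : ℝ) ≤ N := by rw [hN]; exact_mod_cast Fintype.card_pos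
  set G : ℝ := ∑ v, ∑ i, |c v i| with hGdef
  have hG : 0 ≤ G := Finset.sum_nonneg fun _ _ => Finset.sum_nonneg fun _ _ => abs_nonneg _
  have hc : ∀ v i, |c v i| ≤ G := fun v i =>
    (Finset.single_le_sum (f := fun i => |c v i|) (fun _ _ => abs_nonneg _)
      (Finset.mem_univ i)).trans
    (Finset.single_le_sum (f := fun v => ∑ i, |c v i|)
      (fun _ _ => Finset.sum_nonneg fun _ _ => abs_nonneg _) (Finset.mem_univ v))
  obtain ⟨C₃, hC₃, hL₃⟩ : ∃ C₃ : ℝ, 0 ≤ C₃ ∧ ∀ v i l, PS.abv v (L v i l) ≤ Real.exp C₃ := by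
    refine ⟨∑ p : S × ι × ι, PS.abv p.1 (L p.1 p.2.1 p.2.2),
      Finset.sum_nonneg fun _ _ => AbsoluteValue.nonneg _ _, fun v i l => le_exp_of_le ?_⟩
    exact Finset.single_le_sum (f := fun p : S × ι × ι => PS.abv p.1 (L p.1 p.2.1 p.2.2))
      (fun _ _ => AbsoluteValue.nonneg _ _) (Finset.mem_univ (v, i, l))
  obtain ⟨e, he, he0, heM⟩ := exists_common_denominator PS
    fun p : S × ι × ι => (L p.1)⁻¹ p.2.1 p.2.2
  set M : S → Matrix ι ι K := fun v => e • (L v)⁻¹ with hMdef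
  have hML : ∀ v, M v * L v = e • (1 : Matrix ι ι K) := fun v => by
    rw [hMdef, Matrix.smul_mul, Matrix.nonsing_inv_mul _ (IsUnit.mk0 _ (hL v))]
  have hMi : ∀ v i l, M v i l ∈ PS.int := fun v i l => by
    simpa [hMdef] using heM (v, i, l)
  obtain ⟨C₂, hC₂, hM, heC⟩ : ∃ C₂ : ℝ, 0 ≤ C₂ ∧
      (∀ v i, ∑ l, PS.abv v (M v i l) ≤ Real.exp C₂) ∧ ∀ v, PS.abv v e ≤ Real.exp C₂ := by
    have h1 : 0 ≤ ∑ p : S × ι, ∑ l, PS.abv p.1 (M p.1 p.2 l) :=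
      Finset.sum_nonneg fun _ _ => Finset.sum_nonneg fun _ _ => AbsoluteValue.nonneg _ _
    have h2 : 0 ≤ ∑ v, PS.abv v e := Finset.sum_nonneg fun _ _ => AbsoluteValue.nonneg _ _
    refine ⟨(∑ p : S × ι, ∑ l, PS.abv p.1 (M p.1 p.2 l)) + ∑ v, PS.abv v e,
      add_nonneg h1 h2, fun v i => le_exp_of_le ?_, fun v => le_exp_of_le ?_⟩
    · have := Finset.single_le_sum (f := fun p : S × ι => ∑ l, PS.abv p.1 (M p.1 p.2 l))
        (fun _ _ => Finset.sum_nonneg fun _ _ => AbsoluteValue.nonneg _ _) (Finset.mem_univ (v, i))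
      linarith
    · have := Finset.single_le_sum (f := fun v => PS.abv v e)
        (fun _ _ => AbsoluteValue.nonneg _ _) (Finset.mem_univ v)
      linarith
  set ε : ℝ := min (1 / 4) (δ / (4 * n * (N + 1) * (G + 1))) with hεdef
  have hε : 0 < ε := lt_min (by norm_num) (by positivity)
  have hε4 : ε ≤ 1 / 4 := min_le_left _ _
  have hε' : n * ((N + 1) * G * ε) ≤ δ / 4 := by
    have h1 : ε * (4 * n * (N + 1) * (G + 1)) ≤ δ :=
      (le_div_iff₀ (by positivity)).mp (min_le_right _ _)
    have h2 : 0 ≤ n * (N + 1) * ε := by positivity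
    nlinarith
  obtain ⟨m, hm, C₁, hC₁, aux⟩ := exists_auxiliary_polynomial PS M hMi hε
  have hm' : (1 : ℝ) ≤ m := by exact_mod_cast hm
  set θ : ℝ := δ / (4 * (δ + n * G)) with hθdef
  have hδG : 0 < δ + n * G := by positivity
  have hθ : 0 < θ := by positivity
  obtain ⟨ω, hω, hω1, roth⟩ := exists_small_index PS (Finset.univ : Finset (Fin m)) (θ * m)
    (by positivity)
  set h₁ := PS.ht (-1) with hh₁
  have hh₁0 : 0 ≤ h₁ := PS.ht_nonneg _
  set C₄ := C₂ + C₁ + N + C₃ with hC₄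
  have hC₄1 : 1 ≤ C₄ := by linarith
  set R : ℝ := 1 + 4 * n * C₄ / δ + 4 * (C₂ + C₁ + 1) * m / (ω * η) + 2 * h₁ / η with hR
  have hC21 : 0 < C₂ + C₁ + 1 := by linarith
  have r1 : 0 ≤ 4 * n * C₄ / δ := by positivity
  have r2 : 0 ≤ 4 * (C₂ + C₁ + 1) * m / (ω * η) := by positivity
  have r3 : 0 ≤ 2 * h₁ / η := by positivity
  have hR1 : 1 ≤ R := by rw [hR]; linarith
  have hRa : 4 * n * C₄ ≤ R * δ := by rw [← div_le_iff₀ hδ, hR]; linarith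
  have hRb : 4 * (C₂ + C₁ + 1) * m ≤ R * (ω * η) := by
    rw [← div_le_iff₀ (by positivity), hR]; linarith
  have hRc : 2 * h₁ ≤ R * η := by rw [← div_le_iff₀ hη, hR]; linarith
  obtain ⟨q, hqP, hqR, hqlac⟩ := exists_lacunary (P := fun q => ∃ ℓ x,
    SmallHyperplane PS L c δ i₀ q ℓ x ∧ η * q < PS.ht (ℓ i₁ / ℓ i₀))
    (fun r => by
      obtain ⟨q, hq, ℓ, x, h1, h2⟩ := hcon r
      exact ⟨q, hq, ℓ, x, h1, h2⟩) R (2 / ω) m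
  choose ℓ x hx hht using hqP
  have hq1 : ∀ j, 1 ≤ q j := fun j => hR1.trans (hqR j)
  have hq0 : ∀ j, 0 < q j := fun j => one_pos.trans_le (hq1 j)
  set D : ℝ := (∑ j, q j) / ε with hD
  have hqD : ∀ j, q j ≤ ε * D := fun j => by
    rw [hD, mul_div_cancel₀ _ hε.ne']
    exact Finset.single_le_sum (f := q) (fun j _ => (hq0 j).le) (Finset.mem_univ j)
  have hD0 : 0 < D := by
    have := (hq0 ⟨0, hm⟩).trans_le (hqD ⟨0, hm⟩)
    exact pos_of_mul_pos_right this hε.le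
  set d : Fin m → ℕ := fun j => ⌊D / q j⌋₊ with hd
  have hdle : ∀ j, (d j : ℝ) ≤ D / q j := fun j => Nat.floor_le (div_nonneg hD0.le (hq0 j).le)
  have hq₁ : ∀ j, d j * q j ≤ D := fun j => (le_div_iff₀ (hq0 j)).mp (hdle j)
  have hq₂ : ∀ j, D - ε * D ≤ d j * q j := fun j => by
    have h1 : D / q j < d j + 1 := Nat.lt_floor_add_one _
    rw [div_lt_iff₀ (hq0 j)] at h1
    linarith [hqD j]
  have hd1 : ∀ j, 1 ≤ d j := fun j => by
    rw [hd, Nat.one_le_floor_iff, one_le_div (hq0 j)]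
    nlinarith [hqD j]
  have hhalf : ∀ j, D / 2 ≤ d j * q j := fun j => by nlinarith [hq₂ j]
  have hdR : ∀ j, (d j : ℝ) * R ≤ D := fun j =>
    (mul_le_mul_of_nonneg_left (hqR j) (Nat.cast_nonneg _)).trans (hq₁ j)
  have hsum : (∑ j, (d j : ℝ)) * R ≤ m * D := by
    rw [Finset.sum_mul]
    refine (Finset.sum_le_card_nsmul _ _ _ fun j _ => hdR j).trans ?_
    simp
  have hsum0 : 0 ≤ ∑ j, (d j : ℝ) := Finset.sum_nonneg fun _ _ => Nat.cast_nonneg _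
  obtain ⟨F, hF0, hFh, hFi, hFn, hFb⟩ := aux d hd1
  obtain ⟨f, hf0, hfd, hfr, hfn, hfI⟩ := exists_polynomial_of_smallHyperplanes hL hi hδ hG hc hc0
    hC₃ hL₃ he he0 hML hM heC hd1 hF0 hFh hFi hFn hFb (fun j => (hq0 j).le) hD0 hq₁ hq₂ hx
    (t := θ * m) (by
      have e1 : n * (C₄ * ∑ j, (d j : ℝ)) ≤ δ * m * D / 4 := by
        have : 4 * n * C₄ * (∑ j, (d j : ℝ)) ≤ δ * (m * D) :=
          calc 4 * n * C₄ * (∑ j, (d j : ℝ)) ≤ R * δ * ∑ j, (d j : ℝ) :=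
                mul_le_mul_of_nonneg_right hRa hsum0
            _ = δ * ((∑ j, (d j : ℝ)) * R) := by ring
            _ ≤ _ := mul_le_mul_of_nonneg_left hsum hδ.le
        linarith
      have e2 : n * ((N + 1) * G * ε * m * D) ≤ δ / 4 * (m * D) := by
        have := mul_le_mul_of_nonneg_right hε' (by positivity : 0 ≤ m * D)
        linarith
      have e3 : (δ + n * G) * D * (θ * m) = δ / 4 * (m * D) := by
        rw [hθdef]; field_simp
      have e4 : δ * m * ε * D ≤ δ * m * D / 4 := by
        have := mul_le_mul_of_nonneg_right hε4 (by positivity : 0 ≤ δ * (m * D))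
        linarith
      rw [e3]
      linarith)
  obtain ⟨a, ha, hlt⟩ := roth d (fun j => -(ℓ j i₁ / ℓ j i₀)) f
    ((C₂ + C₁) * ∑ j, (d j : ℝ)) (∑ j, (d j : ℝ)) hd1 (by positivity) hf0 (by simp [supported_univ])
    hfd hfr hfn (fun i _ j _ hij => by
      have h1 : (d i : ℝ) * q i ≤ D := hq₁ i
      have h2 := hqlac i j hij
      have h3 : 2 * q j ≤ ω * q i := by
        have := mul_le_mul_of_nonneg_left h2 hω.le
        rwa [← mul_assoc, mul_div_cancel₀ _ hω.ne'] at this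
      have h4 := hhalf j
      have h5 : (d i : ℝ) * q i ≤ ω * d j * q i := by
        have : (d j : ℝ) * (2 * q j) ≤ d j * (ω * q i) :=
          mul_le_mul_of_nonneg_left h3 (Nat.cast_nonneg _)
        linarith
      exact le_of_mul_le_mul_right h5 (hq0 i))
    (fun i _ => Finset.single_le_sum (f := fun j => (d j : ℝ)) (fun _ _ => Nat.cast_nonneg _)
      (Finset.mem_univ i))
    (fun i _ => by
      have h2 : PS.ht (ℓ i i₁ / ℓ i i₀) ≤ h₁ + PS.ht (-(ℓ i i₁ / ℓ i i₀)) := by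
        have := PS.ht_mul_le (-1) (-(ℓ i i₁ / ℓ i i₀))
        rwa [neg_one_mul, neg_neg] at this
      have h3 : η / 2 * q i ≤ PS.ht (-(ℓ i i₁ / ℓ i i₀)) := by
        have h4 := hht i
        have h5 : R * η ≤ η * q i := by rw [mul_comm]; exact mul_le_mul_of_nonneg_left (hqR i) hη.le
        linarith
      have h4 : (d i : ℝ) * (η / 2 * q i) ≤ d i * PS.ht (-(ℓ i i₁ / ℓ i i₀)) :=
        mul_le_mul_of_nonneg_left h3 (Nat.cast_nonneg _)
      have h5 : η / 4 * D ≤ d i * PS.ht (-(ℓ i i₁ / ℓ i i₀)) := by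
        have := mul_le_mul_of_nonneg_left (hhalf i) hη.le
        linarith
      have h6 : ω * (η / 4 * D) ≤ ω * (d i * PS.ht (-(ℓ i i₁ / ℓ i i₀))) :=
        mul_le_mul_of_nonneg_left h5 hω.le
      refine le_trans ?_ h6
      have h7 : R * ((C₂ + C₁ + 1) * ∑ j, (d j : ℝ)) ≤ R * (ω * (η / 4 * D)) := by
        have e1 := mul_le_mul_of_nonneg_left hsum hC21.le
        have e2 := mul_le_mul_of_nonneg_right hRb hD0.le
        linarith
      have h8 := le_of_mul_le_mul_left h7 (one_pos.trans_le hR1)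
      linarith)
  exact absurd (hfI a ha) (not_le.mpr hlt)

end RatioBound

section FiniteHyperplanes
variable {K : Type*} [Field K] {ι : Type*} [Fintype ι] [DecidableEq ι]

theorem abv_det_le (f : AbsoluteValue K ℝ) {A : Matrix ι ι K} {r s : ι → ℝ}
    (h : ∀ i l, f (A i l) ≤ r i * s l) :
    f A.det ≤ (Fintype.card ι).factorial * ((∏ i, r i) * ∏ l, s l) := by
  rw [Matrix.det_apply]
  refine (f.sum_le _ _).trans ?_
  have h1 : ∀ σ ∈ (Finset.univ : Finset (Equiv.Perm ι)),
      f (Equiv.Perm.sign σ • ∏ i, A (σ i) i) ≤ (∏ i, r i) * ∏ l, s l := by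
    intro σ _
    rw [AbsoluteValue.map_units_int_smul, map_prod, ← Equiv.prod_comp σ r, ← Finset.prod_mul_distrib]
    exact Finset.prod_le_prod (fun _ _ => f.nonneg _) fun i _ => h _ _
  refine (Finset.sum_le_card_nsmul _ _ _ h1).trans (le_of_eq ?_)
  rw [Finset.card_univ, Fintype.card_perm, nsmul_eq_mul]

theorem det_updateCol_columnMatrix {i₀ : ι} {x : ι → ι → K} {ℓ : ι → K}
    (h : ∀ l ≠ i₀, ∑ i, ℓ i * x l i = 0) (h0 : ℓ i₀ ≠ 0) (y : ι → K) :
    ((columnMatrix i₀ x).updateCol i₀ y).det = (columnMatrix i₀ x).det * ∑ k, ℓ k / ℓ i₀ * y k := by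
  have h1 := congrArg (dotProduct ℓ) (Matrix.mulVec_cramer (columnMatrix i₀ x) y)
  rw [Matrix.dotProduct_mulVec, vecMul_columnMatrix h, single_dotProduct, Matrix.cramer_apply,
    dotProduct_smul, smul_eq_mul, dotProduct] at h1
  have h2 : ∑ k, ℓ k / ℓ i₀ * y k = (∑ k, ℓ k * y k) / ℓ i₀ := by
    rw [Finset.sum_div]
    exact Finset.sum_congr rfl fun k _ => by ring
  rw [h2, ← mul_div_assoc, ← h1, mul_div_cancel_left₀ _ h0]

theorem abv_coordinate_le (f : AbsoluteValue K ℝ) {L : Matrix ι ι K} (hL : L.det ≠ 0) {t : ι → ℝ}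
    (ht : ∀ i, 0 < t i) {i₀ : ι} {x : ι → ι → K} {ℓ : ι → K}
    (h : ∀ l ≠ i₀, ∑ i, ℓ i * x l i = 0) (h0 : ℓ i₀ ≠ 0) (i : ι) :
    f L.det * f (columnMatrix i₀ x).det * f (∑ k, ℓ k / ℓ i₀ * L⁻¹ k i) * t i ≤
      (Fintype.card ι).factorial * ((∏ k, t k) * ∏ l ∈ Finset.univ.erase i₀, tnorm f L t (x l)) := by
  set B : Matrix ι ι K := L * (columnMatrix i₀ x).updateCol i₀ (fun k => L⁻¹ k i) with hB
  have hdet : f B.det = f L.det * f (columnMatrix i₀ x).det * f (∑ k, ℓ k / ℓ i₀ * L⁻¹ k i) := by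
    rw [hB, Matrix.det_mul, det_updateCol_columnMatrix h h0, map_mul, map_mul, mul_assoc]
  have hcol : ∀ k, B k i₀ = (1 : Matrix ι ι K) k i := by
    intro k
    rw [← Matrix.mul_nonsing_inv L (IsUnit.mk0 _ hL), hB, Matrix.mul_apply, Matrix.mul_apply]
    simp
  have hcol' : ∀ k, ∀ l ≠ i₀, B k l = L.mulVec (x l) k := by
    intro k l hl
    rw [hB, Matrix.mul_apply, Matrix.mulVec, dotProduct]
    simp [hl, columnMatrix]
  have hbound : ∀ k l, f (B k l) ≤ t k * (if l = i₀ then (t i)⁻¹ else tnorm f L t (x l)) := by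
    intro k l
    by_cases hl : l = i₀
    · rw [if_pos hl, hl, hcol]
      by_cases hk : k = i
      · subst hk
        simp [(ht k).ne']
      · rw [Matrix.one_apply_ne hk, map_zero]
        exact mul_nonneg (ht k).le (inv_pos.mpr (ht i)).le
    · rw [if_neg hl, hcol' k l hl, mul_comm]
      exact abv_mulVec_le_tnorm f L ht (x l) k
  have h1 := abv_det_le f hbound
  rw [← Finset.mul_prod_erase _ (fun l => if l = i₀ then (t i)⁻¹ else tnorm f L t (x l))
    (Finset.mem_univ i₀), if_pos rfl,
    Finset.prod_congr rfl (fun l hl => if_neg (Finset.ne_of_mem_erase hl))] at h1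
  rw [← hdet, ← le_div_iff₀ (ht i)]
  refine h1.trans (le_of_eq ?_)
  field_simp

variable {S : Type} [Fintype S] (PS : PlaceSystem K S)

theorem ht_sum_le {α : Type*} (s : Finset α) (x : α → K) :
    PS.ht (∑ i ∈ s, x i) ≤ PS.ht 0 + ∑ i ∈ s, (PS.ht (x i) + 1) := by
  classical
  induction s using Finset.induction_on with
  | empty => simp
  | insert i s hi ih =>
    rw [Finset.sum_insert hi, Finset.sum_insert hi]
    linarith [PS.ht_add_le (x i) (∑ i ∈ s, x i)]

theorem exp_neg_ht_le (v : S) {x : K} (hx : x ≠ 0) : Real.exp (-PS.ht x) ≤ PS.abv v x := by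
  have h1 := PS.abv_le v x⁻¹
  rw [PS.ht_inv, map_inv₀] at h1
  rw [Real.exp_neg]
  exact inv_le_of_inv_le₀ ((PS.abv v).pos hx) h1

theorem vecMul_inv_coordinates {L : Matrix ι ι K} (hL : L.det ≠ 0) (ℓ x : ι → K) :
    ∑ i, ℓ i * x i = ∑ i, Matrix.vecMul ℓ L⁻¹ i * L.mulVec x i := by
  change dotProduct ℓ x = dotProduct (Matrix.vecMul ℓ L⁻¹) (L.mulVec x)
  rw [Matrix.dotProduct_mulVec, Matrix.vecMul_vecMul, Matrix.nonsing_inv_mul _ (IsUnit.mk0 _ hL),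
    Matrix.vecMul_one]

end FiniteHyperplanes

section Penultimate
variable {K : Type*} [Field K] {S : Type} [Fintype S] (PS : PlaceSystem K S)

theorem exists_finite_hyperplanes_of_index [CharZero K] {ι : Type} [Fintype ι] [DecidableEq ι]
    (hι : 2 ≤ Fintype.card ι) {L : S → Matrix ι ι K} (hL : ∀ v, (L v).det ≠ 0) {c : S → ι → ℝ}
    {δ : ℝ} (hδ : 0 < δ) (hc0 : ∑ v, (PS.mult v : ℝ) * ∑ i, c v i = 0) (i₀ : ι) :
    ∃ q₀ : ℝ, ∃ Λ : Finset (ι → K), ∀ q ≥ q₀, ∀ ℓ x, SmallHyperplane PS L c δ i₀ q ℓ x →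
      ∃ ℓ' ∈ Λ, ∃ a : K, a ≠ 0 ∧ ℓ = a • ℓ' := by
  classical
  have : Nonempty ι := ⟨i₀⟩
  set n : ℝ := ∑ v, (PS.mult v : ℝ) with hn
  have hn1 : 1 ≤ n := by
    have h1 : (1 : ℝ) ≤ PS.mult PS.v₀ := by exact_mod_cast PS.mult_pos _
    exact h1.trans (Finset.single_le_sum (f := fun v => (PS.mult v : ℝ))
      (fun _ _ => Nat.cast_nonneg _) (Finset.mem_univ _))
  set N : ℝ := (Fintype.card ι : ℝ) with hN
  have hN1 : (1 : ℝ) ≤ N := by rw [hN]; exact_mod_cast Fintype.card_pos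
  set η : ℝ := δ / (4 * n * N) with hηdef
  have hη : 0 < η := by positivity
  have hη4 : n * (N * η) = δ / 4 := by rw [hηdef]; field_simp
  choose q₁ hq₁ using fun i₁ : {i // i ≠ i₀} =>
    exists_bound_ratio PS hL (c := c) i₁.2 hδ hη hc0
  -- a fixed form for every pattern of supports
  let Pat (I : S → Finset ι) (ℓ : ι → K) : Prop :=
    ℓ ≠ 0 ∧ ∀ v i, Matrix.vecMul ℓ (L v)⁻¹ i ≠ 0 → i ∈ I v
  have hfix : ∀ I : S → Finset ι, (∃ ℓ, Pat I ℓ) → ∃ ℓ, Pat I ℓ ∧ ∀ i, ℓ i ∈ PS.int := by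
    rintro I ⟨ℓ, h1, h2⟩
    obtain ⟨d, -, hd0, hd⟩ := exists_common_denominator PS ℓ
    refine ⟨d • ℓ, ⟨smul_ne_zero hd0 h1, fun v i hi => h2 v i fun h0 => hi ?_⟩, fun i => hd i⟩
    rw [Matrix.smul_vecMul, Pi.smul_apply, h0, smul_zero]
  let fixed (I : S → Finset ι) : ι → K := if h : ∃ ℓ, Pat I ℓ then (hfix I h).choose else 0
  -- constants
  obtain ⟨C', hC'⟩ : ∃ C' : ℝ, ∀ I v, ∑ i, PS.abv v (Matrix.vecMul (fixed I) (L v)⁻¹ i) ≤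
      Real.exp C' := by
    refine ⟨∑ p : (S → Finset ι) × S, ∑ i, PS.abv p.2 (Matrix.vecMul (fixed p.1) (L p.2)⁻¹ i),
      fun I v => le_exp_of_le ?_⟩
    exact Finset.single_le_sum (f := fun p : (S → Finset ι) × S =>
      ∑ i, PS.abv p.2 (Matrix.vecMul (fixed p.1) (L p.2)⁻¹ i))
      (fun _ _ => Finset.sum_nonneg fun _ _ => AbsoluteValue.nonneg _ _) (Finset.mem_univ (I, v))
  obtain ⟨C, hC0, hC⟩ : ∃ C : ℝ, 0 ≤ C ∧ ∀ v i, ((Fintype.card ι).factorial : ℝ) ≤ Real.exp C ∧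
      PS.ht (L v).det ≤ C ∧ PS.ht 0 + ∑ k, (PS.ht 1 + PS.ht ((L v)⁻¹ k i) + 1) ≤ C := by
    have p0 : ∀ p : S × ι, 0 ≤ PS.ht (L p.1).det +
        (PS.ht 0 + ∑ k, (PS.ht 1 + PS.ht ((L p.1)⁻¹ k p.2) + 1)) := fun p =>
      add_nonneg (PS.ht_nonneg _) (add_nonneg (PS.ht_nonneg _) (Finset.sum_nonneg fun k _ =>
        add_nonneg (add_nonneg (PS.ht_nonneg _) (PS.ht_nonneg _)) zero_le_one))
    refine ⟨(Fintype.card ι).factorial + ∑ p : S × ι, (PS.ht (L p.1).det +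
        (PS.ht 0 + ∑ k, (PS.ht 1 + PS.ht ((L p.1)⁻¹ k p.2) + 1))),
      add_nonneg (Nat.cast_nonneg _) (Finset.sum_nonneg fun p _ => p0 p), fun v i => ?_⟩
    have h1 := Finset.single_le_sum (f := fun p : S × ι => PS.ht (L p.1).det +
        (PS.ht 0 + ∑ k, (PS.ht 1 + PS.ht ((L p.1)⁻¹ k p.2) + 1))) (fun p _ => p0 p)
        (Finset.mem_univ (v, i))
    simp only at h1
    have h2 : (0 : ℝ) ≤ (Fintype.card ι).factorial := Nat.cast_nonneg _
    have h3 := PS.ht_nonneg (L v).det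
    have h4 : 0 ≤ PS.ht 0 + ∑ k, (PS.ht 1 + PS.ht ((L v)⁻¹ k i) + 1) :=
      add_nonneg (PS.ht_nonneg _) (Finset.sum_nonneg fun k _ =>
        add_nonneg (add_nonneg (PS.ht_nonneg _) (PS.ht_nonneg _)) zero_le_one)
    refine ⟨le_exp_of_le ?_, ?_, ?_⟩ <;> linarith
  refine ⟨(∑ i, |q₁ i|) + 4 * (n * (3 * C)) / δ + |n * C'| / δ + 1, Finset.univ.image fixed,
    fun q hq ℓ x hx => ?_⟩
  have s1 : 0 ≤ ∑ i, |q₁ i| := Finset.sum_nonneg fun _ _ => abs_nonneg _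
  have s2 : 0 ≤ 4 * (n * (3 * C)) / δ := by positivity
  have s3 : 0 ≤ |n * C'| / δ := by positivity
  have hq0 : 0 < q := by linarith
  have hqa : 4 * (n * (3 * C)) ≤ q * δ := by rw [← div_le_iff₀ hδ]; linarith
  have hqb : n * C' < q * δ :=
    (le_abs_self _).trans_lt (by rw [← div_lt_iff₀ hδ]; linarith)
  have hratio : ∀ k, PS.ht (ℓ k / ℓ i₀) ≤ PS.ht 1 + η * q := by
    intro k
    by_cases hk : k = i₀
    · rw [hk, div_self hx.ne]
      have : 0 ≤ η * q := by positivity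
      linarith
    · have h1 : q₁ ⟨k, hk⟩ ≤ q := by
        have := Finset.single_le_sum (f := fun i => |q₁ i|) (fun _ _ => abs_nonneg _)
          (Finset.mem_univ ⟨k, hk⟩)
        have h2 := le_abs_self (q₁ ⟨k, hk⟩)
        linarith
      have := hq₁ ⟨k, hk⟩ q h1 ℓ x hx
      simp only at this
      linarith [PS.ht_nonneg 1]
  set w : S → ι → K := fun v i => ∑ k, ℓ k / ℓ i₀ * (L v)⁻¹ k i with hw
  have hwht : ∀ v i, PS.ht (w v i) ≤ C + N * η * q := by
    intro v i
    refine (ht_sum_le PS _ _).trans ?_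
    have h1 : ∑ k, (PS.ht (ℓ k / ℓ i₀ * (L v)⁻¹ k i) + 1) ≤
        ∑ k : ι, ((PS.ht 1 + PS.ht ((L v)⁻¹ k i) + 1) + η * q) :=
      Finset.sum_le_sum fun k _ => by
        linarith [PS.ht_mul_le (ℓ k / ℓ i₀) ((L v)⁻¹ k i), hratio k]
    have h2 : ∑ k : ι, ((PS.ht 1 + PS.ht ((L v)⁻¹ k i) + 1) + η * q) =
        ∑ k : ι, (PS.ht 1 + PS.ht ((L v)⁻¹ k i) + 1) + Fintype.card ι * (η * q) := by
      rw [Finset.sum_add_distrib (g := fun _ => η * q)]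
      simp only [Finset.sum_const, Finset.card_univ, nsmul_eq_mul]
    linarith [(hC v i).2.2, h1.trans_eq h2]
  have hwℓ : ∀ v, Matrix.vecMul ℓ (L v)⁻¹ = ℓ i₀ • w v := by
    intro v
    ext i
    rw [Matrix.vecMul, dotProduct, Pi.smul_apply, smul_eq_mul, hw, Finset.mul_sum]
    refine Finset.sum_congr rfl fun k _ => ?_
    rw [← mul_assoc, mul_div_cancel₀ _ hx.ne]
  have hℓ0 : ℓ ≠ 0 := fun h => hx.ne (by rw [h]; rfl)
  have hwne : ∀ v, w v ≠ 0 := by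
    intro v h0
    have h1 := hwℓ v
    rw [h0, smul_zero] at h1
    have h2 := congrArg (fun z => Matrix.vecMul z (L v)) h1
    simp only [Matrix.vecMul_vecMul, Matrix.nonsing_inv_mul _ (IsUnit.mk0 _ (hL v)),
      Matrix.vecMul_one, Matrix.zero_vecMul] at h2
    exact hℓ0 h2
  set I : S → Finset ι := fun v => Finset.univ.filter fun i => w v i ≠ 0 with hI
  have hInon : ∀ v, (I v).Nonempty := by
    intro v
    obtain ⟨i, hi⟩ := Function.ne_iff.mp (hwne v)
    exact ⟨i, by simpa [hI] using hi⟩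
  choose im him hmax using fun v => Finset.exists_max_image (I v) (c v) (hInon v)
  have himw : ∀ v, w v (im v) ≠ 0 := fun v => (Finset.mem_filter.mp (him v)).2
  have hPat : ∃ ℓ, Pat I ℓ := by
    refine ⟨ℓ, hℓ0, fun v i hi => ?_⟩
    rw [hwℓ] at hi
    exact Finset.mem_filter.mpr ⟨Finset.mem_univ _, right_ne_zero_of_mul hi⟩
  have hfixed : fixed I = (hfix I hPat).choose := dif_pos hPat
  obtain ⟨⟨hf0, hfI⟩, hfint⟩ : Pat I (fixed I) ∧ ∀ i, fixed I i ∈ PS.int := by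
    rw [hfixed]; exact (hfix I hPat).choose_spec
  have htpos : ∀ v i, 0 < Real.exp (c v i * q) := fun v i => Real.exp_pos _
  set E : ℝ := ∑ v, (PS.mult v : ℝ) * c v (im v) with hE
  have hdet := det_columnMatrix_ne_zero hx.orth hx.ne hx.indep
  have hdetr : (columnMatrix i₀ x).det ∈ PS.ring := by
    rw [Matrix.det_apply]
    refine sum_mem fun σ _ => ?_
    rw [Units.smul_def]
    refine zsmul_mem (prod_mem fun i _ => ?_) _
    rw [columnMatrix]
    split_ifs
    · exact PS.ring.one_mem
    · exact PS.ring.zero_mem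
    · exact hx.mem _ _
  -- the exponent attached to the pattern is negative
  have hEneg : E * q ≤ 0 := by
    have h1 : ∀ v ∈ (Finset.univ : Finset S), PS.abv v (columnMatrix i₀ x).det ^ PS.mult v ≤
        Real.exp (PS.mult v * (3 * C + N * η * q + (∑ k, c v k) * q - c v (im v) * q)) *
          (∏ l ∈ Finset.univ.erase i₀, tnorm (PS.abv v) (L v) (fun i => Real.exp (c v i * q))
            (x l)) ^ PS.mult v := by
      intro v _
      rw [Real.exp_nat_mul, ← mul_pow]
      refine pow_le_pow_left₀ (AbsoluteValue.nonneg _ _) ?_ _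
      have e1 := abv_coordinate_le (PS.abv v) (hL v) (htpos v) hx.orth hx.ne (im v)
      set Tn := ∏ l ∈ Finset.univ.erase i₀, tnorm (PS.abv v) (L v) (fun i => Real.exp (c v i * q))
            (x l) with hTn
      have hTn0 : 0 ≤ Tn := Finset.prod_nonneg fun l _ => tnorm_nonneg _ _ (htpos v) _
      set Δ := PS.abv v (columnMatrix i₀ x).det with hΔ
      have hΔ0 : 0 ≤ Δ := AbsoluteValue.nonneg _ _
      have e2 : Real.exp (-C) ≤ PS.abv v (L v).det :=
        (Real.exp_le_exp.mpr (by linarith [(hC v i₀).2.1])).trans (exp_neg_ht_le PS v (hL v))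
      have e3 : Real.exp (-(C + N * η * q)) ≤ PS.abv v (w v (im v)) :=
        (Real.exp_le_exp.mpr (by linarith [hwht v (im v)])).trans (exp_neg_ht_le PS v (himw v))
      have e4 : Real.exp (-C) * Δ * Real.exp (-(C + N * η * q)) * Real.exp (c v (im v) * q) ≤
          Real.exp C * (Real.exp ((∑ k, c v k) * q) * Tn) := by
        refine le_trans ?_ (e1.trans ?_)
        · gcongr
        · rw [← Real.exp_sum, ← Finset.sum_mul]
          refine mul_le_mul_of_nonneg_right (hC v i₀).1 ?_
          exact mul_nonneg (Real.exp_pos _).le hTn0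
      have e5 : Δ = Real.exp (C + (C + N * η * q) - c v (im v) * q) *
          (Real.exp (-C) * Δ * Real.exp (-(C + N * η * q)) * Real.exp (c v (im v) * q)) := by
        have : Real.exp (C + (C + N * η * q) - c v (im v) * q) * (Real.exp (-C) *
            Real.exp (-(C + N * η * q)) * Real.exp (c v (im v) * q)) = 1 := by
          rw [← Real.exp_add, ← Real.exp_add, ← Real.exp_add, Real.exp_eq_one_iff]; ring
        calc Δ = (Real.exp (C + (C + N * η * q) - c v (im v) * q) * (Real.exp (-C) *
            Real.exp (-(C + N * η * q)) * Real.exp (c v (im v) * q))) * Δ := by rw [this, one_mul]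
          _ = _ := by ring
      rw [e5]
      refine (mul_le_mul_of_nonneg_left e4 (Real.exp_pos _).le).trans (le_of_eq ?_)
      rw [← mul_assoc, ← mul_assoc, ← Real.exp_add, ← Real.exp_add]
      congr 2
      ring
    have h2 := (PS.one_le_prod _ hdetr hdet).trans (Finset.prod_le_prod
      (fun v _ => pow_nonneg (AbsoluteValue.nonneg _ _) _) h1)
    rw [Finset.prod_mul_distrib, ← Real.exp_sum] at h2
    simp only [← Finset.prod_pow] at h2
    rw [Finset.prod_comm] at h2
    have h3 : ∏ l ∈ Finset.univ.erase i₀, ∏ v, tnorm (PS.abv v) (L v)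
        (fun i => Real.exp (c v i * q)) (x l) ^ PS.mult v ≤ Real.exp (-δ * q) := by
      refine (Finset.prod_le_prod (fun l _ => Finset.prod_nonneg fun v _ =>
        pow_nonneg (tnorm_nonneg _ _ (htpos v) _) _)
        (fun l hl => hx.small l (Finset.ne_of_mem_erase hl))).trans ?_
      rw [Finset.prod_const, Finset.card_erase_of_mem (Finset.mem_univ _), Finset.card_univ]
      refine pow_le_of_le_one (Real.exp_pos _).le ?_ (by omega)
      rw [Real.exp_le_one_iff]
      have : 0 ≤ δ * q := by positivity
      linarith
    have h4 := h2.trans (mul_le_mul_of_nonneg_left h3 (Real.exp_pos _).le)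
    rw [← Real.exp_add, Real.one_le_exp_iff] at h4
    have h5 : ∑ v, (PS.mult v : ℝ) * (3 * C + N * η * q + (∑ k, c v k) * q - c v (im v) * q) =
        n * (3 * C + N * η * q) - E * q := by
      have : ∀ v, (PS.mult v : ℝ) * (3 * C + N * η * q + (∑ k, c v k) * q - c v (im v) * q) =
          PS.mult v * (3 * C + N * η * q) + (PS.mult v * ∑ k, c v k) * q -
            (PS.mult v * c v (im v)) * q := fun v => by ring
      simp only [this, Finset.sum_sub_distrib, Finset.sum_add_distrib, ← Finset.sum_mul]
      rw [hc0, zero_mul, add_zero]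
    rw [h5] at h4
    have h6 : n * (N * η * q) = δ / 4 * q := by rw [← hη4]; ring
    have h7 : 0 ≤ δ * q := by positivity
    linarith
  -- the fixed form vanishes on the hyperplane
  have hvan : ∀ l ≠ i₀, ∑ i, fixed I i * x l i = 0 := by
    intro l hl
    by_contra hne
    have hr : ∑ i, fixed I i * x l i ∈ PS.ring :=
      sum_mem fun i _ => mul_mem (PS.int_le (hfint i)) (hx.mem l i)
    have h1 : ∀ v ∈ (Finset.univ : Finset S), PS.abv v (∑ i, fixed I i * x l i) ^ PS.mult v ≤
        Real.exp (PS.mult v * (C' + c v (im v) * q)) *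
          tnorm (PS.abv v) (L v) (fun i => Real.exp (c v i * q)) (x l) ^ PS.mult v := by
      intro v _
      rw [Real.exp_nat_mul, ← mul_pow]
      refine pow_le_pow_left₀ (AbsoluteValue.nonneg _ _) ?_ _
      rw [vecMul_inv_coordinates (hL v)]
      set Tn := tnorm (PS.abv v) (L v) (fun i => Real.exp (c v i * q)) (x l) with hTn
      have hTn0 : 0 ≤ Tn := tnorm_nonneg _ _ (htpos v) _
      have e1 : PS.abv v (∑ i, Matrix.vecMul (fixed I) (L v)⁻¹ i * (L v).mulVec (x l) i) ≤
          ∑ i, PS.abv v (Matrix.vecMul (fixed I) (L v)⁻¹ i) *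
            (Real.exp (c v (im v) * q) * Tn) := by
        refine ((PS.abv v).sum_le _ _).trans (Finset.sum_le_sum fun i _ => ?_)
        rw [map_mul]
        by_cases hi : Matrix.vecMul (fixed I) (L v)⁻¹ i = 0
        · rw [hi, map_zero, zero_mul, zero_mul]
        · refine mul_le_mul_of_nonneg_left ?_ (AbsoluteValue.nonneg _ _)
          refine (abv_mulVec_le_tnorm (PS.abv v) (L v) (htpos v) (x l) i).trans ?_
          rw [mul_comm]
          refine mul_le_mul_of_nonneg_right ?_ hTn0
          rw [Real.exp_le_exp]
          exact mul_le_mul_of_nonneg_right (hmax v i (hfI v i hi)) hq0.le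
      refine e1.trans ?_
      rw [← Finset.sum_mul, Real.exp_add, mul_assoc]
      exact mul_le_mul_of_nonneg_right (hC' I v) (mul_nonneg (Real.exp_pos _).le hTn0)
    have h2 := (PS.one_le_prod _ hr hne).trans (Finset.prod_le_prod
      (fun v _ => pow_nonneg (AbsoluteValue.nonneg _ _) _) h1)
    rw [Finset.prod_mul_distrib, ← Real.exp_sum] at h2
    have h4 := h2.trans (mul_le_mul_of_nonneg_left (hx.small l hl) (Real.exp_pos _).le)
    rw [← Real.exp_add, Real.one_le_exp_iff] at h4
    have h5 : ∑ v, (PS.mult v : ℝ) * (C' + c v (im v) * q) = n * C' + E * q := by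
      have : ∀ v, (PS.mult v : ℝ) * (C' + c v (im v) * q) =
          PS.mult v * C' + (PS.mult v * c v (im v)) * q := fun v => by ring
      simp only [this, Finset.sum_add_distrib, ← Finset.sum_mul]
      rfl
    rw [h5] at h4
    linarith
  refine ⟨fixed I, Finset.mem_image_of_mem _ (Finset.mem_univ _), ?_⟩
  have hprop : fixed I = (fixed I i₀ / ℓ i₀) • ℓ := by
    set z : ι → K := fixed I - (fixed I i₀ / ℓ i₀) • ℓ with hz
    have hz0 : z i₀ = 0 := by simp [hz, hx.ne]
    have hzv : ∀ l ≠ i₀, ∑ i, z i * x l i = 0 := by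
      intro l hl
      simp only [hz, Pi.sub_apply, Pi.smul_apply, smul_eq_mul, sub_mul, Finset.sum_sub_distrib,
        hvan l hl, mul_assoc, ← Finset.mul_sum, hx.orth l hl, mul_zero, sub_zero]
    have h1 := vecMul_columnMatrix hzv
    rw [hz0, Pi.single_zero] at h1
    have h2 := Matrix.eq_zero_of_vecMul_eq_zero hdet h1
    exact sub_eq_zero.mp h2
  have hne : fixed I i₀ ≠ 0 := by
    intro h0
    rw [h0, zero_div, zero_smul] at hprop
    exact hf0 hprop
  refine ⟨ℓ i₀ / fixed I i₀, div_ne_zero hx.ne hne, ?_⟩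
  have h1 := congrArg (fun z => (ℓ i₀ / fixed I i₀) • z) hprop
  rw [h1, smul_smul, div_mul_div_cancel₀ hne, div_self hx.ne, one_smul]

end Penultimate

section Minima
variable {K : Type*} [Field K] {S : Type} [Fintype S] (PS : PlaceSystem K S)
  {ι : Type} [Fintype ι] [DecidableEq ι]

/-- The volume of the parallelepipeds attached to a system of weights. -/
noncomputable def tvol (t : S → ι → ℝ) : ℝ := ∏ v, (∏ i, t v i) ^ PS.mult v

theorem tvol_pos {t : S → ι → ℝ} (ht : ∀ v i, 0 < t v i) : 0 < tvol PS t :=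
  Finset.prod_pos fun v _ => pow_pos (Finset.prod_pos fun i _ => ht v i) _

theorem theight_nonneg (L : S → Matrix ι ι K) {t : S → ι → ℝ} (ht : ∀ v i, 0 < t v i)
    (x : ι → K) : 0 ≤ theight PS L t x :=
  Finset.prod_nonneg fun v _ => pow_nonneg (tnorm_nonneg _ _ (ht v) _) _

/-- The analogue of Minkowski's first theorem for twisted heights. -/
theorem exists_theight_pow_mul_tvol_le [Nonempty ι] (L : S → Matrix ι ι K) :
    ∃ C : ℝ, 0 < C ∧ ∀ t : S → ι → ℝ, (∀ v i, 0 < t v i) →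
      ∃ x : ι → K, x ≠ 0 ∧ (∀ i, x i ∈ PS.ring) ∧
        theight PS L t x ^ Fintype.card ι * tvol PS t ≤ C := by
  classical
  obtain ⟨C, hC, h⟩ := PS.minkowski ι L
  refine ⟨C, hC, fun t ht => ?_⟩
  have hD := tvol_pos PS ht
  set N := Fintype.card ι with hN
  have hN0 : N ≠ 0 := Fintype.card_ne_zero
  obtain ⟨l, hl, hlN⟩ : ∃ l : ℝ, 0 < l ∧ l ^ N = C / tvol PS t :=
    ⟨(C / tvol PS t) ^ (1 / (N : ℝ)), by positivity, by
      rw [← Real.rpow_natCast, ← Real.rpow_mul (by positivity), one_div_mul_cancel (by positivity),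
        Real.rpow_one]⟩
  set a : S → ℝ := Function.update (fun _ => 1) PS.v₀ l with ha
  have ha0 : ∀ v, 0 < a v := by
    intro v
    by_cases hv : v = PS.v₀
    · rw [ha, hv, Function.update_self]; exact hl
    · rw [ha, Function.update_of_ne hv]; exact one_pos
  have hprod : ∏ v, a v ^ PS.mult v = l := by
    rw [Fintype.prod_eq_single PS.v₀ fun v hv => by rw [ha, Function.update_of_ne hv, one_pow],
      ha, Function.update_self, PS.mult_v₀, pow_one]
  obtain ⟨x, hx0, hxr, hx⟩ := h (fun v i => a v * t v i) (fun v i => mul_pos (ha0 v) (ht v i)) (by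
    have : ∏ v, (∏ i, a v * t v i) ^ PS.mult v = (∏ v, a v ^ PS.mult v) ^ N * tvol PS t := by
      rw [tvol, ← Finset.prod_pow, ← Finset.prod_mul_distrib]
      refine Finset.prod_congr rfl fun v _ => ?_
      rw [Finset.prod_mul_distrib, Finset.prod_const, Finset.card_univ, mul_pow, ← pow_mul,
        ← pow_mul, mul_comm N]
    rw [this, hprod, hlN, div_mul_cancel₀ _ hD.ne'])
  refine ⟨x, hx0, hxr, ?_⟩
  have h1 : theight PS L t x ≤ l := by
    rw [← hprod]
    exact Finset.prod_le_prod (fun v _ => pow_nonneg (tnorm_nonneg _ _ (ht v) _) _) fun v _ =>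
      pow_le_pow_left₀ (tnorm_nonneg _ _ (ht v) _) (tnorm_le (ht v) (hx v)) _
  calc theight PS L t x ^ N * tvol PS t ≤ l ^ N * tvol PS t := by
        gcongr
        exact theight_nonneg PS L ht x
    _ = C := by rw [hlN, div_mul_cancel₀ _ hD.ne']

theorem exists_le_tvol_mul_prod_theight {L : S → Matrix ι ι K} (hL : ∀ v, (L v).det ≠ 0) :
    ∃ c : ℝ, 0 < c ∧ ∀ t : S → ι → ℝ, (∀ v i, 0 < t v i) →
      ∀ (κ : Type) [Fintype κ] (_ : κ ≃ ι) (x : κ → ι → K), LinearIndependent K x →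
        (∀ l i, x l i ∈ PS.ring) → c ≤ tvol PS t * ∏ l, theight PS L t (x l) := by
  refine ⟨∏ v, (PS.abv v (L v).det / (Fintype.card ι).factorial) ^ PS.mult v,
    Finset.prod_pos fun v _ => pow_pos (div_pos ((PS.abv v).pos (hL v)) (by positivity)) _,
    fun t ht κ _ e x hx hxr => ?_⟩
  set M : Matrix ι ι K := Matrix.of (x ∘ e.symm) with hM
  have hMdet : M.det ≠ 0 := by
    have h1 : LinearIndependent K M.row := hx.comp _ e.symm.injective
    have := (Matrix.linearIndependent_rows_iff_isUnit.mp h1)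
    exact ((Matrix.isUnit_iff_isUnit_det _).mp this).ne_zero
  have hMr : M.det ∈ PS.ring := by
    rw [Matrix.det_apply]
    refine sum_mem fun σ _ => ?_
    rw [Units.smul_def]
    exact zsmul_mem (prod_mem fun i _ => hxr _ _) _
  have h1 := PS.one_le_prod _ hMr hMdet
  have h2 : ∀ v, PS.abv v (L v).det / (Fintype.card ι).factorial * PS.abv v M.det ≤
      (∏ i, t v i) * ∏ l, tnorm (PS.abv v) (L v) (t v) (x l) := by
    intro v
    have h3 : ∀ i l, PS.abv v ((L v * M.transpose) i l) ≤
        t v i * tnorm (PS.abv v) (L v) (t v) (x (e.symm l)) := by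
      intro i l
      rw [mul_comm (t v i)]
      exact abv_mulVec_le_tnorm _ _ (ht v) _ _
    have h4 := abv_det_le (PS.abv v) h3
    rw [Matrix.det_mul, Matrix.det_transpose, map_mul,
      e.symm.prod_comp (fun l => tnorm (PS.abv v) (L v) (t v) (x l))] at h4
    rw [div_mul_eq_mul_div, div_le_iff₀ (by positivity)]
    linarith
  calc _ ≤ (∏ v, (PS.abv v (L v).det / (Fintype.card ι).factorial) ^ PS.mult v) *
        ∏ v, PS.abv v M.det ^ PS.mult v :=
        le_mul_of_one_le_right (Finset.prod_nonneg fun v _ => by positivity) h1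
    _ = ∏ v, (PS.abv v (L v).det / (Fintype.card ι).factorial * PS.abv v M.det) ^ PS.mult v := by
        rw [← Finset.prod_mul_distrib]
        exact Finset.prod_congr rfl fun v _ => (mul_pow _ _ _).symm
    _ ≤ ∏ v, ((∏ i, t v i) * ∏ l, tnorm (PS.abv v) (L v) (t v) (x l)) ^ PS.mult v :=
        Finset.prod_le_prod (fun v _ => by positivity) fun v _ =>
          pow_le_pow_left₀ (by positivity) (h2 v) _
    _ = _ := by
        simp only [mul_pow, Finset.prod_mul_distrib, tvol, theight, ← Finset.prod_pow]
        congr 1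
        exact Finset.prod_comm

theorem exists_one_le_theight_mul {L : S → Matrix ι ι K} (hL : ∀ v, (L v).det ≠ 0) :
    ∃ C : ℝ, 1 ≤ C ∧ ∀ t : S → ι → ℝ, (∀ v i, 0 < t v i) → ∀ B : ℝ, (∀ v i, t v i ≤ B) →
      ∀ x : ι → K, x ≠ 0 → (∀ i, x i ∈ PS.ring) →
        1 ≤ theight PS L t x * (C * B) ^ ∑ v, PS.mult v := by
  set C : ℝ := 1 + ∑ v, ∑ i, ∑ k, PS.abv v ((L v)⁻¹ i k) with hC
  refine ⟨C, le_add_of_nonneg_right (Finset.sum_nonneg fun v _ => Finset.sum_nonneg fun i _ =>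
    Finset.sum_nonneg fun k _ => (PS.abv v).nonneg _), fun t ht B hB x hx hxr => ?_⟩
  obtain ⟨i, hi⟩ := Function.ne_iff.mp hx
  refine (PS.one_le_prod _ (hxr i) hi).trans ?_
  rw [theight, ← Finset.prod_pow_eq_pow_sum, ← Finset.prod_mul_distrib]
  refine Finset.prod_le_prod (fun v _ => pow_nonneg ((PS.abv v).nonneg _) _) fun v _ => ?_
  rw [← mul_pow]
  refine pow_le_pow_left₀ ((PS.abv v).nonneg _) ?_ _
  have h1 : x = (L v)⁻¹.mulVec ((L v).mulVec x) := by
    rw [Matrix.mulVec_mulVec, Matrix.nonsing_inv_mul _ (IsUnit.mk0 _ (hL v)), Matrix.one_mulVec]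
  have hB0 : 0 < B := (ht v i).trans_le (hB v i)
  have hn := tnorm_nonneg (PS.abv v) (L v) (ht v) x
  calc PS.abv v (x i) = PS.abv v (∑ k, (L v)⁻¹ i k * (L v).mulVec x k) := by
        conv_lhs => rw [h1]
        rfl
    _ ≤ ∑ k, PS.abv v ((L v)⁻¹ i k) * (tnorm (PS.abv v) (L v) (t v) x * B) := by
        refine ((PS.abv v).sum_le _ _).trans (Finset.sum_le_sum fun k _ => ?_)
        rw [map_mul]
        refine mul_le_mul_of_nonneg_left ?_ ((PS.abv v).nonneg _)
        exact (abv_mulVec_le_tnorm _ _ (ht v) _ _).trans (mul_le_mul_of_nonneg_left (hB v k) hn)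
    _ = tnorm (PS.abv v) (L v) (t v) x * ((∑ k, PS.abv v ((L v)⁻¹ i k)) * B) := by
        rw [← Finset.sum_mul]; ring
    _ ≤ _ := by
        refine mul_le_mul_of_nonneg_left (mul_le_mul_of_nonneg_right ?_ hB0.le) hn
        have h2 : ∑ k, PS.abv v ((L v)⁻¹ i k) ≤ ∑ i, ∑ k, PS.abv v ((L v)⁻¹ i k) :=
          Finset.single_le_sum (f := fun i => ∑ k, PS.abv v ((L v)⁻¹ i k))
            (fun i _ => Finset.sum_nonneg fun k _ => (PS.abv v).nonneg _) (Finset.mem_univ i)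
        have h3 : ∑ i, ∑ k, PS.abv v ((L v)⁻¹ i k) ≤ ∑ v, ∑ i, ∑ k, PS.abv v ((L v)⁻¹ i k) :=
          Finset.single_le_sum (f := fun v => ∑ i, ∑ k, PS.abv v ((L v)⁻¹ i k))
            (fun v _ => Finset.sum_nonneg fun i _ => Finset.sum_nonneg fun k _ =>
              (PS.abv v).nonneg _) (Finset.mem_univ v)
        linarith

/-- A system of vectors approximately realising the successive minima of a twisted height. -/
structure Minima (L : S → Matrix ι ι K) (t : S → ι → ℝ) {N : ℕ} (g : Fin N → ι → K)
    (η : Fin N → ℝ) : Prop where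
  indep : LinearIndependent K g
  mem : ∀ s i, g s i ∈ PS.ring
  mono : Monotone η
  pos : ∀ s, 0 < η s
  le : ∀ s, theight PS L t (g s) ≤ 2 * η s
  ge : ∀ s x, (∀ i, x i ∈ PS.ring) → x ∉ Submodule.span K (g '' {j | j < s}) →
    η s ≤ theight PS L t x

theorem exists_minima {L : S → Matrix ι ι K} (hL : ∀ v, (L v).det ≠ 0) {t : S → ι → ℝ}
    (ht : ∀ v i, 0 < t v i) {N : ℕ} (hN : Fintype.card ι = N) :
    ∃ (g : Fin N → ι → K) (η : Fin N → ℝ), Minima PS L t g η := by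
  classical
  set h := theight PS L t with hh
  set E : Submodule K (ι → K) → Set ℝ := fun U => h '' {x | (∀ i, x i ∈ PS.ring) ∧ x ∉ U} with hE
  obtain ⟨c, hc, hlow⟩ : ∃ c : ℝ, 0 < c ∧ ∀ x, x ≠ 0 → (∀ i, x i ∈ PS.ring) → c ≤ h x := by
    obtain ⟨C, hC, hCx⟩ := exists_one_le_theight_mul PS hL
    set B : ℝ := 1 + ∑ v, ∑ i, t v i with hB
    have hB1 : 1 ≤ B := le_add_of_nonneg_right (Finset.sum_nonneg fun v _ =>
      Finset.sum_nonneg fun i _ => (ht v i).le)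
    refine ⟨1 / (C * B) ^ ∑ v, PS.mult v, by positivity, fun x hx hxr => ?_⟩
    rw [div_le_iff₀ (by positivity)]
    refine hCx t ht B (fun v i => ?_) x hx hxr
    have h1 := Finset.single_le_sum (f := t v) (fun i _ => (ht v i).le) (Finset.mem_univ i)
    have h2 := Finset.single_le_sum (f := fun v => ∑ i, t v i)
      (fun v _ => Finset.sum_nonneg fun i _ => (ht v i).le) (Finset.mem_univ v)
    linarith
  have hEbdd : ∀ U, BddBelow (E U) := fun U => ⟨c, by
    rintro _ ⟨x, ⟨hxr, hxU⟩, rfl⟩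
    exact hlow x (fun h0 => hxU (h0 ▸ U.zero_mem)) hxr⟩
  have hEne : ∀ U, U ≠ ⊤ → (E U).Nonempty := by
    intro U hU
    by_contra hne
    rw [Set.image_nonempty, Set.not_nonempty_iff_eq_empty] at hne
    apply hU
    rw [eq_top_iff, ← (Pi.basisFun K ι).span_eq, Submodule.span_le]
    rintro _ ⟨i, rfl⟩
    by_contra hi
    have : Pi.basisFun K ι i ∈ ({x | (∀ i, x i ∈ PS.ring) ∧ x ∉ U} : Set (ι → K)) := by
      refine ⟨fun j => ?_, hi⟩
      rw [Pi.basisFun_apply, Pi.single_apply]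
      split_ifs
      exacts [one_mem _, zero_mem _]
    rw [hne] at this
    exact this
  have hEpos : ∀ U, U ≠ ⊤ → 0 < sInf (E U) := by
    intro U hU
    refine hc.trans_le (le_csInf (hEne U hU) ?_)
    rintro _ ⟨x, ⟨hxr, hxU⟩, rfl⟩
    exact hlow x (fun h0 => hxU (h0 ▸ U.zero_mem)) hxr
  have hnext : ∀ U : Submodule K (ι → K), ∃ x : ι → K, U ≠ ⊤ →
      (∀ i, x i ∈ PS.ring) ∧ x ∉ U ∧ h x ≤ 2 * sInf (E U) := by
    intro U
    by_cases hU : U = ⊤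
    · exact ⟨0, fun h => absurd hU h⟩
    · obtain ⟨_, ⟨x, ⟨hxr, hxU⟩, rfl⟩, hx⟩ := exists_lt_of_csInf_lt (hEne U hU)
        (show sInf (E U) < 2 * sInf (E U) by linarith [hEpos U hU])
      exact ⟨x, fun _ => ⟨hxr, hxU, hx.le⟩⟩
  choose next hnext using hnext
  set U : ℕ → Submodule K (ι → K) :=
    fun n => Nat.rec ⊥ (fun _ V => V ⊔ Submodule.span K {next V}) n with hUdef
  have hU0 : U 0 = ⊥ := rfl
  have hUs : ∀ n, U (n + 1) = U n ⊔ Submodule.span K {next (U n)} := fun n => rfl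
  have hUspan : ∀ n, U n = Submodule.span K ((fun j => next (U j)) '' {j | j < n}) := by
    intro n
    induction n with
    | zero => simp [hU0]
    | succ n ih =>
      have : {j | j < n + 1} = insert n {j | j < n} := by
        ext j; simp only [Set.mem_ofPred_eq, Set.mem_insert_iff]; omega
      rw [hUs, this, Set.image_insert_eq, Submodule.span_insert, ← ih, sup_comm]
  have hUrank : ∀ n ≤ N, Module.finrank K (U n) = n := by
    intro n
    induction n with
    | zero => intro _; rw [hU0, finrank_bot]
    | succ n ih =>
      intro hn
      have h1 := ih (by omega)
      have hne : U n ≠ ⊤ := by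
        intro h0
        rw [h0, finrank_top, Module.finrank_fintype_fun_eq_card, hN] at h1
        omega
      rw [hUs, Submodule.finrank_sup_span_singleton (hnext _ hne).2.1, h1]
  have hUne : ∀ n < N, U n ≠ ⊤ := by
    intro n hn h0
    have h1 := hUrank n hn.le
    rw [h0, finrank_top, Module.finrank_fintype_fun_eq_card, hN] at h1
    omega
  have hUmono : Monotone U := monotone_nat_of_le_succ fun n => by rw [hUs]; exact le_sup_left
  have himg : ∀ n ≤ N, (fun s : Fin N => next (U s)) '' {j | (j : ℕ) < n} =
      (fun j => next (U j)) '' {j | j < n} := by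
    intro n hn
    ext y
    constructor
    · rintro ⟨j, hj, rfl⟩
      exact ⟨j, hj, rfl⟩
    · rintro ⟨j, hj, rfl⟩
      exact ⟨⟨j, lt_of_lt_of_le hj hn⟩, hj, rfl⟩
  refine ⟨fun s => next (U s), fun s => sInf (E (U s)), ?_, ?_, ?_, ?_, ?_, ?_⟩
  · rw [linearIndependent_iff_card_eq_finrank_span, Fintype.card_fin, Set.finrank]
    have h1 : Set.range (fun s : Fin N => next (U s)) = (fun j => next (U j)) '' {j | j < N} := by
      rw [← himg N le_rfl, ← Set.image_univ]
      congr 1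
      ext j; simp
    rw [h1, ← hUspan, hUrank N le_rfl]
  · exact fun s i => (hnext _ (hUne s s.2)).1 i
  · intro s s' hss
    refine csInf_le_csInf (hEbdd _) (hEne _ (hUne s' s'.2)) ?_
    refine Set.image_mono fun x hx => ⟨hx.1, fun hxU => hx.2 (hUmono hss hxU)⟩
  · exact fun s => hEpos _ (hUne s s.2)
  · exact fun s => (hnext _ (hUne s s.2)).2.2
  · intro s x hxr hx
    refine csInf_le (hEbdd _) ⟨x, ⟨hxr, ?_⟩, rfl⟩
    rw [hUspan, ← himg s s.2.le]
    exact hx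

end Minima

section Davenport
variable {K : Type*} [Field K] {ι : Type} [Fintype ι] [DecidableEq ι]

theorem exists_redundant_form (f : AbsoluteValue K ℝ) (L : Matrix ι ι K) {t : ι → ℝ}
    (ht : ∀ i, 0 < t i) (A : Finset ι) (V : Submodule K (ι → K))
    (hV : Module.finrank K V < A.card) :
    ∃ i₀ ∈ A, ∀ x ∈ V, ∀ c : ℝ, 0 ≤ c → (∀ i ∈ A.erase i₀, f (L.mulVec x i) ≤ c * t i) →
      f (L.mulVec x i₀) ≤ A.card * c * t i₀ := by
  classical
  set φ : A → Module.Dual K V :=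
    fun i => ((LinearMap.proj i.1).comp L.mulVecLin).comp V.subtype with hφ
  have hdep : ¬ LinearIndependent K φ := by
    intro h
    have h1 := h.fintype_card_le_finrank
    rw [Subspace.dual_finrank_eq, Fintype.card_coe] at h1
    omega
  obtain ⟨α, hα, i₁, hi₁⟩ := Fintype.not_linearIndependent_iff.mp hdep
  obtain ⟨i₀, -, hmax⟩ := Finset.exists_max_image Finset.univ (fun i : A => f (α i) * t i)
    ⟨i₁, Finset.mem_univ _⟩
  have hα0 : α i₀ ≠ 0 := by
    intro h0
    have h1 := hmax i₁ (Finset.mem_univ _)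
    rw [h0, map_zero, zero_mul] at h1
    exact absurd (mul_pos (f.pos hi₁) (ht _)) (not_lt.mpr h1)
  refine ⟨i₀, i₀.2, fun x hx c hc hb => ?_⟩
  have h1 : ∑ i : A, α i * L.mulVec x i = 0 := by
    have := congrArg (fun ψ : Module.Dual K V => ψ ⟨x, hx⟩) hα
    simpa [hφ] using this
  have h2 : α i₀ * L.mulVec x i₀ = - ∑ i ∈ Finset.univ.erase i₀, α i * L.mulVec x i := by
    rw [← Finset.add_sum_erase _ _ (Finset.mem_univ i₀)] at h1
    exact eq_neg_of_add_eq_zero_left h1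
  have hpos := f.pos hα0
  have h3 : f (α i₀) * f (L.mulVec x i₀) ≤ A.card * (c * (f (α i₀) * t i₀)) := by
    rw [← map_mul, h2, f.map_neg]
    refine (f.sum_le _ _).trans ((Finset.sum_le_card_nsmul _ _ (c * (f (α i₀) * t i₀)) ?_).trans ?_)
    · intro i hi
      rw [map_mul]
      have h4 := hb i (Finset.mem_erase.mpr
        ⟨fun h => (Finset.ne_of_mem_erase hi) (Subtype.ext h), i.2⟩)
      calc f (α i) * f (L.mulVec x i) ≤ f (α i) * (c * t i) :=
            mul_le_mul_of_nonneg_left h4 (f.nonneg _)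
        _ = c * (f (α i) * t i) := by ring
        _ ≤ _ := mul_le_mul_of_nonneg_left (hmax i (Finset.mem_univ _)) hc
    · rw [nsmul_eq_mul]
      refine mul_le_mul_of_nonneg_right ?_ (mul_nonneg hc (mul_nonneg (f.nonneg _) (ht _).le))
      exact_mod_cast (Finset.card_le_univ _).trans_eq (Fintype.card_coe A)
  have h5 : f (α i₀) * f (L.mulVec x i₀) ≤ f (α i₀) * (A.card * c * t i₀) :=
    h3.trans_eq (by ring)
  exact le_of_mul_le_mul_left h5 hpos

theorem exists_elimination_order (f : AbsoluteValue K ℝ) (L : Matrix ι ι K) {t : ι → ℝ}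
    (ht : ∀ i, 0 < t i) (n : ℕ) (A : Finset ι) (hA : A.card = n) (g : Fin n → ι → K) :
    ∃ π : Fin n → ι, Function.Injective π ∧ (∀ s, π s ∈ A) ∧
      ∀ s, ∀ x ∈ Submodule.span K (g '' {j | j ≤ s}), ∀ c : ℝ, 0 ≤ c →
        (∀ j ≤ s, f (L.mulVec x (π j)) ≤ c * t (π j)) →
        ∀ i ∈ A, f (L.mulVec x i) ≤ (Fintype.card ι : ℝ) ^ n * c * t i := by
  classical
  induction n generalizing A with
  | zero => exact ⟨Fin.elim0, fun a => a.elim0, fun a => a.elim0, fun a => a.elim0⟩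
  | succ n ih =>
    set V := Submodule.span K (Set.range fun j : Fin n => g j.castSucc) with hV
    have hrank : Module.finrank K V < A.card := by
      have := finrank_range_le_card (R := K) (fun j : Fin n => g j.castSucc)
      rw [Fintype.card_fin] at this
      rw [hA]
      exact Nat.lt_succ_of_le this
    obtain ⟨i₀, hi₀, hred⟩ := exists_redundant_form f L ht A V hrank
    obtain ⟨π, hπ, hπA, hπx⟩ := ih (A.erase i₀) (by rw [Finset.card_erase_of_mem hi₀, hA]; rfl)
      (fun j => g j.castSucc)
    have hN1 : (1 : ℝ) ≤ Fintype.card ι := by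
      exact_mod_cast Fintype.card_pos_iff.mpr ⟨i₀⟩
    have hpow : (1 : ℝ) ≤ (Fintype.card ι : ℝ) ^ n := one_le_pow₀ hN1
    refine ⟨Fin.snoc π i₀, ?_, ?_, ?_⟩
    · rw [Fin.snoc_injective_iff]
      refine ⟨hπ, ?_⟩
      rintro ⟨j, hj⟩
      exact Finset.ne_of_mem_erase (hπA j) hj
    · intro s
      refine Fin.lastCases ?_ (fun j => ?_) s
      · rw [Fin.snoc_last]; exact hi₀
      · rw [Fin.snoc_castSucc]; exact Finset.mem_of_mem_erase (hπA j)
    · intro s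
      refine Fin.lastCases ?_ (fun s => ?_) s
      · intro x _ c hc hb i hi
        have hcard : (Finset.univ.image (Fin.snoc π i₀ : Fin (n + 1) → ι)) = A := by
          refine Finset.eq_of_subset_of_card_le ?_ ?_
          · intro k hk
            obtain ⟨j, -, rfl⟩ := Finset.mem_image.mp hk
            refine Fin.lastCases ?_ (fun j => ?_) j
            · rw [Fin.snoc_last]; exact hi₀
            · rw [Fin.snoc_castSucc]; exact Finset.mem_of_mem_erase (hπA j)
          · rw [hA, Finset.card_image_of_injective, Finset.card_univ, Fintype.card_fin]
            rw [Fin.snoc_injective_iff]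
            refine ⟨hπ, ?_⟩
            rintro ⟨j, hj⟩
            exact Finset.ne_of_mem_erase (hπA j) hj
        rw [← hcard] at hi
        obtain ⟨j, -, rfl⟩ := Finset.mem_image.mp hi
        refine (hb j (Fin.le_last j)).trans ?_
        rw [mul_assoc]
        refine le_mul_of_one_le_left (mul_nonneg hc (ht _).le) (one_le_pow₀ hN1)
      · intro x hx c hc hb i hi
        have himg : g '' {j | j ≤ s.castSucc} = (fun j : Fin n => g j.castSucc) '' {j | j ≤ s} := by
          ext y
          constructor
          · rintro ⟨j, hj, rfl⟩
            have hj' : (j : ℕ) ≤ s := hj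
            exact ⟨⟨j, lt_of_le_of_lt hj' s.2⟩, hj', rfl⟩
          · rintro ⟨j, hj, rfl⟩
            exact ⟨j.castSucc, hj, rfl⟩
        rw [himg] at hx
        have hb' : ∀ j ≤ s, f (L.mulVec x (π j)) ≤ c * t (π j) := by
          intro j hj
          have := hb j.castSucc (Fin.castSucc_le_castSucc_iff.mpr hj)
          rwa [Fin.snoc_castSucc] at this
        have h1 := hπx s x hx c hc hb'
        have hxV : x ∈ V := Submodule.span_mono (Set.image_subset_range _ _) hx
        have h2 := hred x hxV _ (by positivity) h1
        by_cases hi' : i = i₀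
        · rw [hi']
          refine h2.trans ?_
          have h3 : (A.card : ℝ) ≤ Fintype.card ι := by exact_mod_cast Finset.card_le_univ A
          calc (A.card : ℝ) * ((Fintype.card ι : ℝ) ^ n * c) * t i₀
              ≤ Fintype.card ι * ((Fintype.card ι : ℝ) ^ n * c) * t i₀ := by
                have := (ht i₀).le
                gcongr
            _ = _ := by ring
        · refine (h1 i (Finset.mem_erase.mpr ⟨hi', hi⟩)).trans ?_
          have := (ht i).le
          have h4 : (Fintype.card ι : ℝ) ^ n ≤ (Fintype.card ι : ℝ) ^ (n + 1) :=
            pow_le_pow_right₀ hN1 (Nat.le_succ n)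
          gcongr

variable {S : Type} [Fintype S] (PS : PlaceSystem K S)

/-- Division of the weights at the distinguished place. -/
noncomputable def rescale [DecidableEq S] (t : S → ι → ℝ) (ρ : ι → ℝ) : S → ι → ℝ :=
  fun v i => if v = PS.v₀ then t v i / ρ i else t v i

theorem rescale_pos [DecidableEq S] {t : S → ι → ℝ} (ht : ∀ v i, 0 < t v i) {ρ : ι → ℝ}
    (hρ : ∀ i, 0 < ρ i) (v : S) (i : ι) : 0 < rescale PS t ρ v i := by
  rw [rescale]
  split_ifs
  exacts [div_pos (ht v i) (hρ i), ht v i]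

theorem tvol_rescale [DecidableEq S] (t : S → ι → ℝ) {ρ : ι → ℝ} (hρ : ∀ i, 0 < ρ i) :
    tvol PS (rescale PS t ρ) * ∏ i, ρ i = tvol PS t := by
  have h0 : ∏ i, ρ i ≠ 0 := (Finset.prod_pos fun i _ => hρ i).ne'
  rw [tvol, tvol, ← Finset.mul_prod_erase _ _ (Finset.mem_univ PS.v₀),
    ← Finset.mul_prod_erase _ (fun v => (∏ i, t v i) ^ PS.mult v) (Finset.mem_univ PS.v₀)]
  have h1 : ∏ v ∈ Finset.univ.erase PS.v₀, (∏ i, rescale PS t ρ v i) ^ PS.mult v =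
      ∏ v ∈ Finset.univ.erase PS.v₀, (∏ i, t v i) ^ PS.mult v :=
    Finset.prod_congr rfl fun v hv => by simp only [rescale, if_neg (Finset.ne_of_mem_erase hv)]
  rw [h1]
  simp only [rescale, if_true, PS.mult_v₀, pow_one, Finset.prod_div_distrib]
  field_simp

theorem theight_eq_mul [DecidableEq S] (L : S → Matrix ι ι K) (t : S → ι → ℝ) (x : ι → K) :
    theight PS L t x = tnorm (PS.abv PS.v₀) (L PS.v₀) (t PS.v₀) x *
      ∏ v ∈ Finset.univ.erase PS.v₀, tnorm (PS.abv v) (L v) (t v) x ^ PS.mult v := by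
  rw [theight, ← Finset.mul_prod_erase _ _ (Finset.mem_univ PS.v₀), PS.mult_v₀, pow_one]

theorem exists_flattening [DecidableEq S] [Nonempty ι] (L : S → Matrix ι ι K) {t : S → ι → ℝ}
    (ht : ∀ v i, 0 < t v i) {N : ℕ} (hN : Fintype.card ι = N) (g : Fin N → ι → K) {ρ : Fin N → ℝ}
    (hρ : ∀ s, 0 < ρ s) (hanti : Antitone ρ) :
    ∃ π : Fin N ≃ ι, ∀ s, ∀ x ∈ Submodule.span K (g '' {j | j ≤ s}),
      ρ s * theight PS L t x ≤ (N : ℝ) ^ N * theight PS L (rescale PS t (ρ ∘ π.symm)) x := by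
  obtain ⟨π, hπ, -, hx⟩ := exists_elimination_order (PS.abv PS.v₀) (L PS.v₀) (ht PS.v₀) N
    Finset.univ (by rw [Finset.card_univ, hN]) g
  have hbij : Function.Bijective π :=
    (Fintype.bijective_iff_injective_and_card π).mpr ⟨hπ, by rw [Fintype.card_fin, hN]⟩
  refine ⟨Equiv.ofBijective π hbij, fun s x hxs => ?_⟩
  set e := Equiv.ofBijective π hbij with he
  set t' := rescale PS t (ρ ∘ e.symm) with ht'
  have ht'0 : ∀ v i, 0 < t' v i := rescale_pos PS ht fun i => hρ _
  set c' := tnorm (PS.abv PS.v₀) (L PS.v₀) (t' PS.v₀) x with hc'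
  have hc'0 : 0 ≤ c' := tnorm_nonneg _ _ (ht'0 _) _
  have h1 := hx s x hxs (c' / ρ s) (div_nonneg hc'0 (hρ s).le) (by
    intro j hj
    refine (abv_mulVec_le_tnorm _ _ (ht'0 PS.v₀) x (π j)).trans ?_
    have h2 : t' PS.v₀ (π j) = t PS.v₀ (π j) / ρ j := by
      simp only [ht', rescale, if_true, Function.comp]
      rw [show e.symm (π j) = j from e.symm_apply_apply j]
    rw [h2, div_mul_eq_mul_div, mul_div_assoc]
    have h3 := hanti hj
    have := (ht PS.v₀ (π j)).le
    have := hρ s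
    rw [← hc']
    gcongr)
  have h4 : tnorm (PS.abv PS.v₀) (L PS.v₀) (t PS.v₀) x ≤ (N : ℝ) ^ N * (c' / ρ s) :=
    tnorm_le (ht _) fun i => by rw [← hN] at h1 ⊢; exact h1 i (Finset.mem_univ _)
  have h5 : ∏ v ∈ Finset.univ.erase PS.v₀, tnorm (PS.abv v) (L v) (t' v) x ^ PS.mult v =
      ∏ v ∈ Finset.univ.erase PS.v₀, tnorm (PS.abv v) (L v) (t v) x ^ PS.mult v :=
    Finset.prod_congr rfl fun v hv => by
      have : t' v = t v := by
        ext i; simp only [ht', rescale, if_neg (Finset.ne_of_mem_erase hv)]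
      rw [this]
  rw [theight_eq_mul PS L t, theight_eq_mul PS L t', h5, ← mul_assoc, ← mul_assoc]
  refine mul_le_mul_of_nonneg_right ?_ (Finset.prod_nonneg fun v _ =>
    pow_nonneg (tnorm_nonneg _ _ (ht v) _) _)
  have h6 := mul_le_mul_of_nonneg_left h4 (hρ s).le
  refine h6.trans_eq ?_
  have := (hρ s).ne'
  field_simp
  exact hc'

theorem exists_mem_span_notMem_span {N : ℕ} (hN : Fintype.card ι = N) {g : Fin N → ι → K}
    (hg : LinearIndependent K g) {x : ι → K} (hx : x ≠ 0) :
    ∃ s, x ∈ Submodule.span K (g '' {j | j ≤ s}) ∧ x ∉ Submodule.span K (g '' {j | j < s}) := by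
  classical
  have hspan : Submodule.span K (Set.range g) = ⊤ :=
    hg.span_eq_top_of_card_eq_finrank' (by rw [Fintype.card_fin, Module.finrank_fintype_fun_eq_card, hN])
  have hN0 : N ≠ 0 := by
    rintro rfl
    have : IsEmpty ι := Fintype.card_eq_zero_iff.mp hN
    exact hx (Subsingleton.elim _ _)
  have hex : ∃ k, x ∈ Submodule.span K (g '' {j | (j : ℕ) ≤ k}) := by
    refine ⟨N, ?_⟩
    have : {j : Fin N | (j : ℕ) ≤ N} = Set.univ := by ext j; simp
    rw [this, Set.image_univ, hspan]
    trivial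
  have hle : Nat.find hex ≤ N - 1 := by
    refine Nat.find_min' hex ?_
    have : {j : Fin N | (j : ℕ) ≤ N - 1} = Set.univ := by
      ext j; have := j.2; simp; omega
    rw [this, Set.image_univ, hspan]
    trivial
  refine ⟨⟨Nat.find hex, by omega⟩, Nat.find_spec hex, fun hmem => ?_⟩
  by_cases h0 : Nat.find hex = 0
  · have : {j : Fin N | j < ⟨Nat.find hex, by omega⟩} = ∅ := by
      ext j; simp [Fin.lt_def, h0]
    rw [this, Set.image_empty, Submodule.span_empty] at hmem
    exact hx hmem
  · refine Nat.find_min hex (m := Nat.find hex - 1) (by omega) ?_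
    have : {j : Fin N | j < ⟨Nat.find hex, by omega⟩} =
        {j : Fin N | (j : ℕ) ≤ Nat.find hex - 1} := by
      ext j
      simp only [Fin.lt_def, Set.mem_ofPred_eq]
      omega
    rw [← this]
    exact hmem

/-- The analogue of Minkowski's second theorem for twisted heights. -/
theorem exists_tvol_mul_prod_minima_le [Nonempty ι] (L : S → Matrix ι ι K) {N : ℕ}
    (hN : Fintype.card ι = N) :
    ∃ C : ℝ, 0 < C ∧ ∀ t : S → ι → ℝ, (∀ v i, 0 < t v i) → ∀ (g : Fin N → ι → K) (η : Fin N → ℝ),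
      Minima PS L t g η → tvol PS t * ∏ s, η s ≤ C := by
  classical
  obtain ⟨C, hC, h⟩ := exists_theight_pow_mul_tvol_le PS L
  refine ⟨((N : ℝ) ^ N) ^ N * C, ?_, fun t ht g η hg => ?_⟩
  · have : 0 < N := hN ▸ Fintype.card_pos
    positivity
  obtain ⟨π, hπ⟩ := exists_flattening PS L ht hN g (ρ := fun s => (η s)⁻¹)
    (fun s => inv_pos.mpr (hg.pos s))
    (fun s s' hs => inv_anti₀ (hg.pos s) (hg.mono hs))
  set ρ : ι → ℝ := (fun s => (η s)⁻¹) ∘ π.symm with hρ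
  have hρ0 : ∀ i, 0 < ρ i := fun i => inv_pos.mpr (hg.pos _)
  have ht' := rescale_pos PS ht hρ0
  obtain ⟨x, hx0, hxr, hx⟩ := h _ ht'
  obtain ⟨s, hs1, hs2⟩ := exists_mem_span_notMem_span hN hg.indep hx0
  have h1 := hπ s x hs1
  have h2 : 1 ≤ (N : ℝ) ^ N * theight PS L (rescale PS t ρ) x := by
    refine le_trans ?_ h1
    rw [inv_mul_eq_div, le_div_iff₀ (hg.pos s), one_mul]
    exact hg.ge s x hxr hs2
  have h3 : tvol PS t * ∏ s, η s = tvol PS (rescale PS t ρ) := by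
    have h4 : (∏ i, ρ i) * ∏ s, η s = 1 := by
      rw [hρ, ← π.prod_comp ((fun s => (η s)⁻¹) ∘ π.symm), ← Finset.prod_mul_distrib]
      refine Finset.prod_eq_one fun s _ => ?_
      simp [(hg.pos s).ne']
    rw [← tvol_rescale PS t hρ0, mul_assoc, h4, mul_one]
  rw [h3]
  have h5 := tvol_pos PS ht'
  rw [hN] at hx
  calc tvol PS (rescale PS t ρ) ≤
        ((N : ℝ) ^ N * theight PS L (rescale PS t ρ) x) ^ N * tvol PS (rescale PS t ρ) :=
        le_mul_of_one_le_left h5.le (one_le_pow₀ h2)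
    _ = ((N : ℝ) ^ N) ^ N * (theight PS L (rescale PS t ρ) x ^ N * tvol PS (rescale PS t ρ)) := by
        rw [mul_pow]; ring
    _ ≤ _ := mul_le_mul_of_nonneg_left hx (by positivity)

end Davenport

section Flat
variable {K : Type*} [Field K] {ι : Type} [Fintype ι] [DecidableEq ι]
  {S : Type} [Fintype S] (PS : PlaceSystem K S)

theorem le_of_prod_le {m : ℕ} {x : Fin (m + 1) → ℝ} {a b P : ℝ} (ha : 0 < a) (hb : 0 < b)
    (hx : ∀ s : Fin m, a ≤ x s.castSucc) (hl : b ≤ x (Fin.last m)) (hP : ∏ s, x s ≤ P)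
    (s : Fin m) : x s.castSucc * (a ^ (m - 1) * b) ≤ P := by
  classical
  refine le_trans ?_ hP
  rw [Fin.prod_univ_castSucc, ← Finset.mul_prod_erase _ _ (Finset.mem_univ s), mul_assoc]
  have h0 : 0 ≤ x s.castSucc := ha.le.trans (hx s)
  refine mul_le_mul_of_nonneg_left ?_ h0
  have h1 : a ^ (m - 1) ≤ ∏ j ∈ Finset.univ.erase s, x j.castSucc := by
    have h2 : ∏ _j ∈ Finset.univ.erase s, a ≤ ∏ j ∈ Finset.univ.erase s, x j.castSucc :=
      Finset.prod_le_prod (fun _ _ => ha.le) fun j _ => hx j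
    rwa [Finset.prod_const, Finset.card_erase_of_mem (Finset.mem_univ s), Finset.card_univ,
      Fintype.card_fin] at h2
  exact mul_le_mul h1 hl hb.le (le_trans (by positivity) h1)

theorem exists_flat_weights [DecidableEq S] [Nonempty ι] {L : S → Matrix ι ι K}
    (hL : ∀ v, (L v).det ≠ 0) {m : ℕ} (hm : 1 ≤ m) (hN : Fintype.card ι = m + 1) :
    ∃ C : ℝ, 1 ≤ C ∧ ∀ t : S → ι → ℝ, (∀ v i, 0 < t v i) → ∀ (H : Submodule K (ι → K)) (Y Z a : ℝ),
      0 < Y → C * Y < Z → 0 < a → Module.finrank K H = m →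
      (∃ y : Fin m → ι → K, LinearIndependent K y ∧ (∀ l i, y l i ∈ PS.ring) ∧
        ∀ l, y l ∈ H ∧ theight PS L t (y l) ≤ Y) →
      (∀ x : ι → K, (∀ i, x i ∈ PS.ring) → x ∉ H → Z ≤ theight PS L t x) →
      (∀ x : ι → K, (∀ i, x i ∈ PS.ring) → x ≠ 0 → a ≤ theight PS L t x) →
      ∃ ρ : ι → ℝ, (∀ i, 1 ≤ ρ i ∧ ρ i * a ≤ 2 * Y) ∧
        ∃ y : Fin m → ι → K, LinearIndependent K y ∧ (∀ l i, y l i ∈ PS.ring) ∧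
          ∀ l, y l ∈ H ∧ theight PS L (rescale PS t ρ) (y l) ^ (m + 1) *
            tvol PS (rescale PS t ρ) * Z ≤ C * Y := by
  classical
  obtain ⟨c₁, hc₁, hLB⟩ := exists_le_tvol_mul_prod_theight PS hL
  obtain ⟨C₂, hC₂, hM2⟩ := exists_tvol_mul_prod_minima_le PS L hN
  set C₀ : ℝ := ((m + 1 : ℕ) : ℝ) ^ (m + 1) with hC₀
  have hC₀1 : 1 ≤ C₀ := one_le_pow₀ (by exact_mod_cast Nat.succ_le_succ (Nat.zero_le m))
  set C₃ : ℝ := C₂ * 2 ^ (m + 1) / c₁ with hC₃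
  have hC₃0 : 0 < C₃ := by positivity
  set C₄ : ℝ := C₃ * (2 * C₀) ^ m with hC₄
  have hC₄0 : 0 < C₄ := by positivity
  refine ⟨2 + 4 * C₀ * C₄ + (2 * C₄) ^ (m + 1) * 2 * C₂, ?_, ?_⟩
  · have : 0 ≤ 4 * C₀ * C₄ + (2 * C₄) ^ (m + 1) * 2 * C₂ := by positivity
    linarith
  intro t ht H Y Z a hY hYZ ha hH hy hZ hlow
  obtain ⟨y, hyi, hyr, hyH⟩ := hy
  have hbig1 : 2 * Y < Z := by
    have : 0 ≤ (4 * C₀ * C₄ + (2 * C₄) ^ (m + 1) * 2 * C₂) * Y := by positivity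
    linarith
  have hbig2 : 4 * C₀ * C₄ * Y < Z := by
    have : 0 ≤ (2 + (2 * C₄) ^ (m + 1) * 2 * C₂) * Y := by positivity
    linarith
  obtain ⟨g, η, hg⟩ := exists_minima PS hL ht hN
  -- the first minima lie in the hyperplane
  have hηY : ∀ s : Fin m, η s.castSucc ≤ Y := by
    intro s
    by_contra hcon
    push Not at hcon
    have h1 : ∀ l, y l ∈ Submodule.span K (g '' {j | j < s.castSucc}) := by
      intro l
      by_contra hl
      exact absurd ((hg.ge _ _ (hyr l) hl).trans (hyH l).2) (not_le.mpr hcon)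
    have h2 : Submodule.span K (Set.range y) ≤ Submodule.span K (g '' {j | j < s.castSucc}) :=
      Submodule.span_le.mpr (by rintro _ ⟨l, rfl⟩; exact h1 l)
    have h3 := Submodule.finrank_mono h2
    rw [finrank_span_eq_card hyi, Fintype.card_fin] at h3
    have h4 : g '' {j | j < s.castSucc} =
        ((Finset.univ.filter (fun j => j < s.castSucc)).image g : Finset (ι → K)) := by
      simp
    rw [h4] at h3
    have h5 := (finrank_span_finset_le_card (R := K)
      ((Finset.univ.filter (fun j => j < s.castSucc)).image g)).trans Finset.card_image_le
    have h6 : (Finset.univ.filter (fun j : Fin (m + 1) => j < s.castSucc)).card = s := by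
      rw [Finset.filter_gt_eq_Iio, Fin.card_Iio]; rfl
    rw [h6] at h5
    have := h3.trans h5
    have := s.2
    omega
  have hgH : ∀ s : Fin m, g s.castSucc ∈ H := by
    intro s
    by_contra hs
    have := hZ _ (hg.mem _) hs
    linarith [hg.le s.castSucc, hηY s]
  have hgi : LinearIndependent K fun s : Fin m => g s.castSucc :=
    hg.indep.comp _ (Fin.castSucc_injective m)
  have hrange : g '' {j | j < Fin.last m} = Set.range fun s : Fin m => g s.castSucc := by
    ext z
    constructor
    · rintro ⟨j, hj, rfl⟩
      exact ⟨⟨j, hj⟩, rfl⟩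
    · rintro ⟨s, rfl⟩
      exact ⟨s.castSucc, Fin.castSucc_lt_last s, rfl⟩
  have hspan : Submodule.span K (g '' {j | j < Fin.last m}) = H := by
    rw [hrange]
    refine Submodule.eq_of_le_of_finrank_eq
      (Submodule.span_le.mpr (by rintro _ ⟨l, rfl⟩; exact hgH l)) ?_
    rw [finrank_span_eq_card hgi, Fintype.card_fin, hH]
  have hlastH : g (Fin.last m) ∉ H := by
    rw [← hspan]
    exact hg.indep.notMem_span_image (by simp)
  set E : ℝ := η (⟨m - 1, by omega⟩ : Fin m).castSucc with hE
  set F : ℝ := η (Fin.last m) with hF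
  have hE0 : 0 < E := hg.pos _
  have hF0 : 0 < F := hg.pos _
  have hEY : E ≤ Y := hηY _
  have hZF : Z ≤ 2 * F := (hZ _ (hg.mem _) hlastH).trans (hg.le _)
  have hEF : E ≤ F := hg.mono (Fin.le_last _)
  have hηE : ∀ s : Fin m, η s.castSucc ≤ E := fun s => hg.mono (by
    rw [Fin.castSucc_le_castSucc_iff, Fin.le_def]
    have := s.2
    simp only
    omega)
  have hFx : ∀ x : ι → K, (∀ i, x i ∈ PS.ring) → x ∉ H → F ≤ theight PS L t x :=
    fun x hxr hx => hg.ge _ x hxr (by rw [hspan]; exact hx)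
  -- flattening
  set r : Fin (m + 1) → ℝ := fun s => if s = Fin.last m then 1 else E / η s with hr
  have hrlast : r (Fin.last m) = 1 := if_pos rfl
  have hrcast : ∀ s : Fin m, r s.castSucc = E / η s.castSucc :=
    fun s => if_neg (Fin.castSucc_lt_last s).ne
  have hr1 : ∀ s, 1 ≤ r s := by
    intro s
    refine Fin.lastCases ?_ (fun s => ?_) s
    · rw [hrlast]
    · rw [hrcast, one_le_div (hg.pos _)]
      exact hηE s
  have hr0 : ∀ s, 0 < r s := fun s => one_pos.trans_le (hr1 s)
  have hranti : Antitone r := by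
    intro s s' hss
    by_cases hs' : s' = Fin.last m
    · rw [hs', hrlast]; exact hr1 s
    · have hs : s ≠ Fin.last m := by
        intro h0
        rw [h0, Fin.last_le_iff] at hss
        exact hs' hss
      simp only [hr, if_neg hs, if_neg hs']
      exact div_le_div_of_nonneg_left hE0.le (hg.pos _) (hg.mono hss)
  obtain ⟨π, hπ⟩ := exists_flattening PS L ht hN g hr0 hranti
  set ρ : ι → ℝ := r ∘ π.symm with hρ
  have hρ0 : ∀ i, 0 < ρ i := fun i => hr0 _
  have ht' := rescale_pos PS ht hρ0
  set t' := rescale PS t ρ with ht'def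
  set D' := tvol PS t' with hD'
  have hD'0 : 0 < D' := tvol_pos PS ht'
  have hlow1 : ∀ x : ι → K, (∀ i, x i ∈ PS.ring) → x ≠ 0 → E ≤ C₀ * theight PS L t' x := by
    intro x hxr hx0
    obtain ⟨s, hs1, hs2⟩ := exists_mem_span_notMem_span hN hg.indep hx0
    refine le_trans ?_ (hπ s x hs1)
    have h1 := hg.ge s x hxr hs2
    by_cases hs : s = Fin.last m
    · rw [hs, hrlast, one_mul]
      rw [hs] at h1
      exact hEF.trans h1
    · simp only [hr, if_neg hs]
      rw [div_mul_eq_mul_div, le_div_iff₀ (hg.pos s)]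
      exact mul_le_mul_of_nonneg_left h1 hE0.le
  have hlow2 : ∀ x : ι → K, (∀ i, x i ∈ PS.ring) → x ∉ H → F ≤ C₀ * theight PS L t' x := by
    intro x hxr hxH
    have hx0 : x ≠ 0 := fun h0 => hxH (h0 ▸ H.zero_mem)
    obtain ⟨s, hs1, hs2⟩ := exists_mem_span_notMem_span hN hg.indep hx0
    have hs : s = Fin.last m := by
      by_contra hs
      have hs' := Fin.lt_last_iff_ne_last.mpr hs
      refine hxH (hspan ▸ Submodule.span_mono (Set.image_mono ?_) hs1)
      intro j hj
      exact lt_of_le_of_lt hj hs'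
    have h1 := hπ s x hs1
    rw [hs, hrlast, one_mul] at h1
    exact (hFx x hxr hxH).trans h1
  have hvol : tvol PS t * ∏ s, η s = D' * (E ^ m * F) := by
    rw [← tvol_rescale PS t hρ0, mul_assoc]
    congr 1
    rw [hρ, ← π.prod_comp (r ∘ π.symm), ← Finset.prod_mul_distrib, Fin.prod_univ_castSucc]
    simp only [Function.comp, Equiv.symm_apply_apply, hrlast, one_mul, hrcast]
    congr 1
    rw [Finset.prod_congr rfl fun s _ => div_mul_cancel₀ E (hg.pos s.castSucc).ne',
      Finset.prod_const, Finset.card_univ, Fintype.card_fin]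
  have hvol1 : c₁ ≤ 2 ^ (m + 1) * (D' * (E ^ m * F)) := by
    refine (hLB t ht _ (Fintype.equivFinOfCardEq hN).symm g hg.indep hg.mem).trans ?_
    rw [← hvol]
    have h1 : ∏ s, theight PS L t (g s) ≤ ∏ s, 2 * η s :=
      Finset.prod_le_prod (fun s _ => theight_nonneg PS L ht _) fun s _ => hg.le s
    rw [Finset.prod_mul_distrib, Finset.prod_const, Finset.card_univ, Fintype.card_fin] at h1
    refine (mul_le_mul_of_nonneg_left h1 (tvol_pos PS ht).le).trans_eq (by ring)
  have hvol2 : D' * (E ^ m * F) ≤ C₂ := hvol ▸ hM2 t ht g η hg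
  -- minima of the new height
  obtain ⟨g', η', hg'⟩ := exists_minima PS hL ht' hN
  have hprod : ∏ s, η' s ≤ C₃ * (E ^ m * F) := by
    have h1 : D' * ∏ s, η' s ≤ C₂ := hM2 t' ht' g' η' hg'
    have h3 : D' * ∏ s, η' s ≤ D' * (C₃ * (E ^ m * F)) := by
      refine h1.trans ?_
      rw [hC₃, div_mul_eq_mul_div, ← mul_div_assoc, le_div_iff₀ hc₁]
      calc C₂ * c₁ ≤ C₂ * (2 ^ (m + 1) * (D' * (E ^ m * F))) :=
            mul_le_mul_of_nonneg_left hvol1 hC₂.le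
        _ = _ := by ring
    exact le_of_mul_le_mul_left h3 hD'0
  have hη'1 : ∀ s, E / (2 * C₀) ≤ η' s := by
    intro s
    rw [div_le_iff₀ (by positivity)]
    have h1 := hlow1 _ (hg'.mem s) (hg'.indep.ne_zero s)
    have h2 := mul_le_mul_of_nonneg_left (hg'.le s) (zero_le_one.trans hC₀1)
    linarith
  have hη'2 : ∀ s, g' s ∉ H → F / (2 * C₀) ≤ η' s := by
    intro s hs
    rw [div_le_iff₀ (by positivity)]
    have h1 := hlow2 _ (hg'.mem s) hs
    have h2 := mul_le_mul_of_nonneg_left (hg'.le s) (zero_le_one.trans hC₀1)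
    linarith
  have hη'last : F / (2 * C₀) ≤ η' (Fin.last m) := by
    obtain ⟨j, hj⟩ : ∃ j, g' j ∉ H := by
      by_contra hcon
      push Not at hcon
      have h1 : Submodule.span K (Set.range g') ≤ H :=
        Submodule.span_le.mpr (by rintro _ ⟨l, rfl⟩; exact hcon l)
      have h2 := Submodule.finrank_mono h1
      rw [finrank_span_eq_card hg'.indep, Fintype.card_fin, hH] at h2
      omega
    exact (hη'2 j hj).trans (hg'.mono (Fin.le_last j))
  have hη'3 : ∀ s : Fin m, η' s.castSucc ≤ C₄ * E := by
    intro s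
    have h1 := le_of_prod_le (a := E / (2 * C₀)) (b := F / (2 * C₀)) (by positivity)
      (by positivity) (fun s => hη'1 s.castSucc) hη'last hprod s
    have h2 : (E / (2 * C₀)) ^ (m - 1) * (F / (2 * C₀)) = E ^ (m - 1) * F / (2 * C₀) ^ m := by
      obtain ⟨p, rfl⟩ : ∃ p, m = p + 1 := ⟨m - 1, by omega⟩
      rw [Nat.add_sub_cancel, div_pow, pow_succ (2 * C₀)]
      field_simp
    have h3 : E ^ m = E ^ (m - 1) * E := by
      rw [← pow_succ]; congr 1; omega
    rw [h2, ← mul_div_assoc, div_le_iff₀ (by positivity), h3] at h1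
    have h4 : 0 < E ^ (m - 1) * F := by positivity
    refine le_of_mul_le_mul_right (h1.trans_eq ?_) h4
    rw [hC₄]; ring
  have hg'H : ∀ s : Fin m, g' s.castSucc ∈ H := by
    intro s
    by_contra hs
    have h1 := hη'2 _ hs
    rw [div_le_iff₀ (by positivity)] at h1
    have h2 : η' s.castSucc * (2 * C₀) ≤ C₄ * Y * (2 * C₀) := by
      refine mul_le_mul_of_nonneg_right ((hη'3 s).trans ?_) (by positivity)
      exact mul_le_mul_of_nonneg_left hEY hC₄0.le
    linarith
  refine ⟨ρ, fun i => ⟨hr1 _, ?_⟩, fun s => g' s.castSucc,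
    hg'.indep.comp _ (Fin.castSucc_injective m), fun s => hg'.mem _, fun s => ⟨hg'H s, ?_⟩⟩
  · have haη : ∀ s, a ≤ 2 * η s := fun s =>
      (hlow _ (hg.mem s) (hg.indep.ne_zero s)).trans (hg.le s)
    simp only [hρ, Function.comp]
    refine Fin.lastCases ?_ (fun s => ?_) (π.symm i)
    · rw [hrlast, one_mul]
      exact (haη (⟨m - 1, by omega⟩ : Fin m).castSucc).trans (by linarith)
    · rw [hrcast, div_mul_eq_mul_div, div_le_iff₀ (hg.pos _)]
      have h1 := haη s.castSucc
      have h2 := hg.pos s.castSucc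
      calc E * a ≤ Y * (2 * η s.castSucc) := mul_le_mul hEY h1 ha.le hY.le
        _ = _ := by ring
  · have h1 : theight PS L t' (g' s.castSucc) ≤ 2 * C₄ * E := by
      linarith [hg'.le s.castSucc, hη'3 s]
    calc theight PS L t' (g' s.castSucc) ^ (m + 1) * D' * Z
        ≤ (2 * C₄ * E) ^ (m + 1) * D' * (2 * F) := by
          have := theight_nonneg PS L ht' (g' s.castSucc)
          have : 0 ≤ Z := by linarith
          gcongr
      _ = (2 * C₄) ^ (m + 1) * 2 * E * (D' * (E ^ m * F)) := by rw [mul_pow, pow_succ E]; ring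
      _ ≤ (2 * C₄) ^ (m + 1) * 2 * Y * C₂ := by gcongr
      _ ≤ (2 + 4 * C₀ * C₄ + (2 * C₄) ^ (m + 1) * 2 * C₂) * Y := by
          have : 0 ≤ (2 + 4 * C₀ * C₄) * Y := by positivity
          linarith

end Flat

section Gap
variable {K : Type*} [Field K] {ι : Type} [Fintype ι] [DecidableEq ι]
  {S : Type} [Fintype S] (PS : PlaceSystem K S)

theorem theight_le_mul_of_le [Nonempty ι] (L : S → Matrix ι ι K) {t t' : S → ι → ℝ}
    (ht : ∀ v i, 0 < t v i) (ht' : ∀ v i, 0 < t' v i) {r : S → ℝ}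
    (h : ∀ v i, t v i ≤ r v * t' v i) (x : ι → K) :
    theight PS L t' x ≤ (∏ v, r v ^ PS.mult v) * theight PS L t x := by
  rw [theight, theight, ← Finset.prod_mul_distrib]
  refine Finset.prod_le_prod (fun v _ => pow_nonneg (tnorm_nonneg _ _ (ht' v) _) _) fun v _ => ?_
  rw [← mul_pow]
  refine pow_le_pow_left₀ (tnorm_nonneg _ _ (ht' v) _) (tnorm_le (ht' v) fun i => ?_) _
  have h1 := tnorm_nonneg (PS.abv v) (L v) (ht v) x
  calc PS.abv v ((L v).mulVec x i) ≤ tnorm (PS.abv v) (L v) (t v) x * t v i :=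
        abv_mulVec_le_tnorm _ _ (ht v) x i
    _ ≤ tnorm (PS.abv v) (L v) (t v) x * (r v * t' v i) := mul_le_mul_of_nonneg_left (h v i) h1
    _ = _ := by ring

theorem theight_rescale_const_le [DecidableEq S] [Nonempty ι] (L : S → Matrix ι ι K)
    {t : S → ι → ℝ} (ht : ∀ v i, 0 < t v i) {s : ℝ} (hs : 0 < s) (x : ι → K) :
    theight PS L (rescale PS t fun _ => s) x ≤ s * theight PS L t x := by
  have h1 := theight_le_mul_of_le PS L ht (rescale_pos PS ht fun _ : ι => hs)
    (r := fun v => if v = PS.v₀ then s else 1)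
    (fun v i => by
      rw [rescale]
      split_ifs
      · rw [mul_div_cancel₀ _ hs.ne']
      · rw [one_mul]) x
  refine h1.trans_eq ?_
  congr 1
  rw [Fintype.prod_eq_single PS.v₀ fun v hv => by rw [if_neg hv, one_pow], if_pos rfl, PS.mult_v₀,
    pow_one]

theorem log_tvol {t : S → ι → ℝ} (ht : ∀ v i, 0 < t v i) :
    Real.log (tvol PS t) = ∑ v, (PS.mult v : ℝ) * ∑ i, Real.log (t v i) := by
  rw [tvol, Real.log_prod fun v _ => (pow_pos (Finset.prod_pos fun i _ => ht v i) _).ne']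
  refine Finset.sum_congr rfl fun v _ => ?_
  rw [Real.log_pow, Real.log_prod fun i _ => (ht v i).ne']

theorem exists_finite_net {A : ℝ} {ε : ℝ} (hε : 0 < ε) (P : (S → ι → ℝ) → Prop) :
    ∃ F : Finset (S → ι → ℝ), (∀ c ∈ F, P c) ∧
      ∀ c, P c → (∀ v i, |c v i| ≤ A) → ∃ c' ∈ F, ∀ v i, |c v i - c' v i| ≤ ε := by
  set s : Set (S → ι → ℝ) := {c | P c ∧ ∀ v i, |c v i| ≤ A} with hs
  have hb : TotallyBounded s := by
    refine (isCompact_closedBall (0 : S → ι → ℝ) (max A 0)).totallyBounded.subset fun c hc => ?_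
    rw [Metric.mem_closedBall, dist_pi_le_iff (le_max_right _ _)]
    intro v
    rw [dist_pi_le_iff (le_max_right _ _)]
    intro i
    rw [Real.dist_eq]
    simpa using Or.inl (hc.2 v i)
  obtain ⟨F, hFs, hF, hcov⟩ := Metric.finite_approx_of_totallyBounded hb ε hε
  refine ⟨hF.toFinset, fun c hc => (hFs (hF.mem_toFinset.mp hc)).1, fun c hc hcA => ?_⟩
  have h1 := hcov (show c ∈ s from ⟨hc, hcA⟩)
  simp only [Set.mem_iUnion] at h1
  obtain ⟨c', hc', hd⟩ := h1
  refine ⟨c', hF.mem_toFinset.mpr hc', fun v i => ?_⟩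
  rw [← Real.dist_eq]
  exact ((dist_le_pi_dist _ _ i).trans (dist_le_pi_dist _ _ v)).trans hd.le

/-- A hyperplane generated by vectors of small twisted height, outside of which the twisted
height is large, belongs to a finite list. -/
theorem exists_finite_hyperplanes_of_gap [CharZero K] {L : S → Matrix ι ι K}
    (hL : ∀ v, (L v).det ≠ 0) {m : ℕ} (hm : 1 ≤ m) (hN : Fintype.card ι = m + 1) {A δ : ℝ}
    (hA : 0 < A) (hδ : 0 < δ) :
    ∃ q₀ : ℝ, ∃ Λ : Finset (ι → K), ∀ q ≥ q₀, ∀ t : S → ι → ℝ, (∀ v i, 0 < t v i) →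
      (∀ v i, |Real.log (t v i)| ≤ A * q) → ∀ (ℓ : ι → K) (Y Z : ℝ), ℓ ≠ 0 → 0 < Y →
      Y ≤ Real.exp (A * q) → Real.exp (δ * q) * Y ≤ Z →
      (∃ y : Fin m → ι → K, LinearIndependent K y ∧ (∀ l i, y l i ∈ PS.ring) ∧
        ∀ l, ∑ i, ℓ i * y l i = 0 ∧ theight PS L t (y l) ≤ Y) →
      (∀ x : ι → K, (∀ i, x i ∈ PS.ring) → ∑ i, ℓ i * x i ≠ 0 → Z ≤ theight PS L t x) →
      ∃ ℓ' ∈ Λ, ∃ a : K, a ≠ 0 ∧ ℓ = a • ℓ' := by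
  classical
  have hne : Nonempty ι := Fintype.card_pos_iff.mp (by omega)
  obtain ⟨C, hC, hflat⟩ := exists_flat_weights PS hL hm hN
  obtain ⟨Cl, hCl, hlow⟩ := exists_one_le_theight_mul PS hL
  set n : ℕ := ∑ v, PS.mult v with hn
  have hn1 : 1 ≤ n := (PS.mult_pos PS.v₀).trans
    (Finset.single_le_sum (f := PS.mult) (fun _ _ => Nat.zero_le _) (Finset.mem_univ PS.v₀))
  have hnR : (1 : ℝ) ≤ n := by exact_mod_cast hn1
  set N : ℝ := (m : ℝ) + 1 with hNdef
  have hN1 : 1 ≤ N := by rw [hNdef]; linarith [Nat.cast_nonneg (α := ℝ) m]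
  set A₁ : ℝ := (2 + n) * A + Real.log 2 + n * Real.log Cl with hA₁
  have hlogCl : 0 ≤ Real.log Cl := Real.log_nonneg hCl
  have hlog2 : 0 ≤ Real.log 2 := Real.log_nonneg one_le_two
  have hA₁0 : 0 ≤ A₁ := by positivity
  set A₂ : ℝ := A₁ * (1 + n) with hA₂
  set ε : ℝ := δ / (4 * n * N) with hε
  have hε0 : 0 < ε := by positivity
  set δ' : ℝ := δ / (2 * N) with hδ'
  have hδ'0 : 0 < δ' := by positivity
  obtain ⟨F, hF0, hF⟩ := exists_finite_net (S := S) (ι := ι) (A := A₂) hε0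
    (fun c => ∑ v, (PS.mult v : ℝ) * ∑ i, c v i = 0)
  have hcard : 2 ≤ Fintype.card ι := by omega
  choose q₁ Λ₁ hΛ₁ using fun (p : F × ι) =>
    exists_finite_hyperplanes_of_index PS hcard hL (c := p.1.1) hδ'0 (hF0 p.1.1 p.1.2) p.2
  refine ⟨1 + ∑ p, |q₁ p| + |4 * Real.log C / δ| + |2 * Real.log C / δ|,
    Finset.univ.biUnion Λ₁, ?_⟩
  intro q hq t ht htA ℓ Y Z hℓ hY hYA hYZ hy hZ
  have hs0 : 0 ≤ ∑ p, |q₁ p| := Finset.sum_nonneg fun _ _ => abs_nonneg _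
  have hq1 : 1 ≤ q := by linarith [abs_nonneg (4 * Real.log C / δ), abs_nonneg (2 * Real.log C / δ)]
  have hq0 : 0 < q := by linarith
  have hqp : ∀ p, q₁ p ≤ q := by
    intro p
    have h1 := Finset.single_le_sum (f := fun p => |q₁ p|) (fun _ _ => abs_nonneg _)
      (Finset.mem_univ p)
    have h2 := le_abs_self (q₁ p)
    linarith [abs_nonneg (4 * Real.log C / δ), abs_nonneg (2 * Real.log C / δ)]
  have hqC : Real.log C < δ * q := by
    have h1 : 2 * Real.log C / δ < q := (le_abs_self _).trans_lt
      (by linarith [abs_nonneg (4 * Real.log C / δ)])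
    rw [div_lt_iff₀ hδ] at h1
    have := Real.log_nonneg hC
    linarith
  have hqC4 : 4 * Real.log C ≤ δ * q := by
    have h1 : 4 * Real.log C / δ ≤ q := (le_abs_self _).trans
      (by linarith [abs_nonneg (2 * Real.log C / δ)])
    rw [div_le_iff₀ hδ] at h1
    linarith
  have hC0 : 0 < C := one_pos.trans_le hC
  -- the hyperplane as a submodule
  set φ : Module.Dual K (ι → K) := ∑ i, ℓ i • LinearMap.proj i with hφ
  have hφx : ∀ x, φ x = ∑ i, ℓ i * x i := fun x => by simp [hφ]
  have hφ0 : φ ≠ 0 := by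
    obtain ⟨i, hi⟩ := Function.ne_iff.mp hℓ
    intro h0
    have h1 : φ (Pi.single i 1) = 0 := by rw [h0]; rfl
    rw [hφx] at h1
    simp [Pi.single_apply] at h1
    exact hi h1
  have hker : Module.finrank K (LinearMap.ker φ) = m := by
    have := Module.Dual.finrank_ker_add_one_of_ne_zero hφ0
    rw [Module.finrank_fintype_fun_eq_card, hN] at this
    omega
  have hmem : ∀ x, x ∈ LinearMap.ker φ ↔ ∑ i, ℓ i * x i = 0 := fun x => by
    rw [LinearMap.mem_ker, hφx]
  set B : ℝ := Real.exp (A * q) with hB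
  have htB : ∀ v i, t v i ≤ B := fun v i => by
    rw [hB, ← Real.log_le_iff_le_exp (ht v i)]
    exact (le_abs_self _).trans (htA v i)
  have hCl0 : 0 < Cl := one_pos.trans_le hCl
  have hB0 : 0 < B := Real.exp_pos _
  set a : ℝ := 1 / (Cl * B) ^ n with ha
  have ha0 : 0 < a := by positivity
  obtain ⟨ρ, hρ, y, hyi, hyr, hyH⟩ := hflat t ht (LinearMap.ker φ) Y Z a hY (by
      refine lt_of_lt_of_le ?_ hYZ
      refine mul_lt_mul_of_pos_right ?_ hY
      rwa [← Real.log_lt_iff_lt_exp hC0]) ha0 hker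
    (by
      obtain ⟨y, hyi, hyr, hyH⟩ := hy
      exact ⟨y, hyi, hyr, fun l => ⟨(hmem _).mpr (hyH l).1, (hyH l).2⟩⟩)
    (fun x hxr hx => hZ x hxr fun h => hx ((hmem x).mpr h))
    (fun x hxr hx0 => by
      rw [ha, div_le_iff₀ (by positivity)]
      exact hlow t ht B htB x hx0 hxr)
  have hρ0 : ∀ i, 0 < ρ i := fun i => one_pos.trans_le (hρ i).1
  have ht' := rescale_pos PS ht hρ0
  set t' := rescale PS t ρ with ht'def
  have hlogρ : ∀ i, Real.log (ρ i) ≤ Real.log 2 + A * q + n * (Real.log Cl + A * q) := by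
    intro i
    have h1 : ρ i ≤ 2 * Y * (Cl * B) ^ n := by
      have := (hρ i).2
      rw [ha, mul_one_div, div_le_iff₀ (by positivity)] at this
      exact this
    have h2 : ρ i ≤ 2 * B * (Cl * B) ^ n := h1.trans (by gcongr)
    refine (Real.log_le_log (hρ0 i) h2).trans_eq ?_
    rw [Real.log_mul (by positivity) (by positivity), Real.log_mul (by positivity) (by positivity),
      Real.log_pow, Real.log_mul (by positivity) (by positivity), hB, Real.log_exp]
  have hlogt' : ∀ v i, |Real.log (t' v i)| ≤ A₁ * q := by
    intro v i
    have h1 := htA v i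
    have h2 := hlogρ i
    have h3 := Real.log_nonneg (hρ i).1
    have h4 : A * q + (Real.log 2 + A * q + n * (Real.log Cl + A * q)) ≤ A₁ * q := by
      rw [hA₁]
      nlinarith [mul_nonneg (Nat.cast_nonneg (α := ℝ) n) hlogCl]
    have h5 : 0 ≤ Real.log 2 + A * q + n * (Real.log Cl + A * q) := by positivity
    rw [ht'def, rescale]
    split_ifs
    · rw [Real.log_div (ht v i).ne' (hρ0 i).ne', abs_le]
      rw [abs_le] at h1
      constructor <;> linarith
    · linarith
  set D' := tvol PS t' with hD'
  have hD'0 : 0 < D' := tvol_pos PS ht'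
  have hlogD : |Real.log D'| ≤ n * (N * (A₁ * q)) := by
    rw [hD', log_tvol PS ht']
    refine (Finset.abs_sum_le_sum_abs _ _).trans ?_
    rw [hn, Nat.cast_sum, Finset.sum_mul]
    refine Finset.sum_le_sum fun v _ => ?_
    rw [abs_mul, Nat.abs_cast]
    refine mul_le_mul_of_nonneg_left ((Finset.abs_sum_le_sum_abs _ _).trans ?_) (Nat.cast_nonneg _)
    refine (Finset.sum_le_card_nsmul _ _ _ fun i _ => hlogt' v i).trans_eq ?_
    rw [Finset.card_univ, hN, nsmul_eq_mul]
    push_cast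
    rw [hNdef]
  set s : ℝ := Real.exp (Real.log D' / N) with hs
  have hs1 : 0 < s := Real.exp_pos _
  have hsN : s ^ (m + 1) = D' := by
    rw [hs, ← Real.exp_nat_mul]
    push_cast
    rw [← hNdef, mul_div_cancel₀ _ (by positivity), Real.exp_log hD'0]
  set t'' := rescale PS t' fun _ => s with ht''def
  have ht'' : ∀ v i, 0 < t'' v i := rescale_pos PS ht' fun _ => hs1
  have hvol : tvol PS t'' = 1 := by
    have h1 := tvol_rescale PS t' (ρ := fun _ : ι => s) fun _ => hs1
    rw [Finset.prod_const, Finset.card_univ, hN, hsN, ← hD'] at h1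
    exact mul_right_cancel₀ hD'0.ne' (h1.trans (one_mul _).symm)
  set c : S → ι → ℝ := fun v i => Real.log (t'' v i) / q with hc
  have hct : ∀ v i, t'' v i = Real.exp (c v i * q) := fun v i => by
    rw [hc]
    simp only
    rw [div_mul_cancel₀ _ hq0.ne', Real.exp_log (ht'' v i)]
  have hc0 : ∑ v, (PS.mult v : ℝ) * ∑ i, c v i = 0 := by
    have h1 := log_tvol PS ht''
    rw [hvol, Real.log_one] at h1
    have h2 : ∑ v, (PS.mult v : ℝ) * ∑ i, c v i =
        (∑ v, (PS.mult v : ℝ) * ∑ i, Real.log (t'' v i)) / q := by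
      rw [Finset.sum_div]
      refine Finset.sum_congr rfl fun v _ => ?_
      rw [mul_div_assoc, Finset.sum_div]
    rw [h2, ← h1, zero_div]
  have hcA : ∀ v i, |c v i| ≤ A₂ := by
    intro v i
    rw [hc]
    simp only
    rw [abs_div, abs_of_pos hq0, div_le_iff₀ hq0]
    have h1 := hlogt' v i
    have h2 : |Real.log D' / N| ≤ n * (A₁ * q) := by
      rw [abs_div, abs_of_pos (by positivity : 0 < N), div_le_iff₀ (by positivity)]
      linarith
    have h3 : A₂ * q = A₁ * q + n * (A₁ * q) := by rw [hA₂]; ring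
    rw [ht''def, rescale]
    split_ifs
    · rw [Real.log_div (ht' v i).ne' hs1.ne', hs, Real.log_exp, h3]
      exact (abs_sub _ _).trans (add_le_add h1 h2)
    · have : 0 ≤ n * (A₁ * q) := by positivity
      linarith
  obtain ⟨c', hc'F, hcc'⟩ := hF c hc0 hcA
  have hsmall : ∀ l, theight PS L (fun v i => Real.exp (c' v i * q)) (y l) ≤
      Real.exp (-δ' * q) := by
    intro l
    have h1 := theight_rescale_const_le PS L ht' hs1 (y l)
    have h2 := theight_le_mul_of_le PS L ht'' (t' := fun v i => Real.exp (c' v i * q))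
      (fun v i => Real.exp_pos _) (r := fun _ => Real.exp (ε * q))
      (fun v i => by
        rw [hct, ← Real.exp_add, Real.exp_le_exp, ← add_mul]
        refine mul_le_mul_of_nonneg_right ?_ hq0.le
        linarith [(abs_le.mp (hcc' v i)).2]) (y l)
    rw [Finset.prod_pow_eq_pow_sum, ← hn, ← Real.exp_nat_mul] at h2
    set X := theight PS L t' (y l) with hX
    have hX0 : 0 ≤ X := theight_nonneg PS L ht' _
    have h3 : X ^ (m + 1) * D' * Z ≤ C * Y := (hyH l).2
    have h4 : (s * X) ^ (m + 1) ≤ C * Real.exp (-(δ * q)) := by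
      rw [mul_pow, hsN]
      have h5 : X ^ (m + 1) * D' * (Real.exp (δ * q) * Y) ≤ C * Y :=
        (mul_le_mul_of_nonneg_left hYZ (by positivity)).trans h3
      have h6 : X ^ (m + 1) * D' * Real.exp (δ * q) ≤ C :=
        le_of_mul_le_mul_right (by linarith) hY
      rw [Real.exp_neg, ← div_eq_mul_inv, le_div_iff₀ (Real.exp_pos _)]
      linarith
    have h7 : (Real.exp (n * (ε * q)) * (s * X)) ^ (m + 1) ≤ Real.exp (-δ' * q) ^ (m + 1) := by
      rw [mul_pow, ← Real.exp_nat_mul, ← Real.exp_nat_mul]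
      refine (mul_le_mul_of_nonneg_left h4 (Real.exp_pos _).le).trans ?_
      have h8 : C = Real.exp (Real.log C) := (Real.exp_log hC0).symm
      conv_lhs => rw [h8]
      rw [← Real.exp_add, ← Real.exp_add, Real.exp_le_exp]
      push_cast
      rw [← hNdef]
      have h9 : N * (n * (ε * q)) = δ * q / 4 := by
        rw [hε]
        have : (n : ℝ) ≠ 0 := by positivity
        field_simp
      have h10 : N * (-δ' * q) = -(δ * q) / 2 := by
        rw [hδ']
        field_simp
      rw [h9, h10]
      linarith
    have h11 := le_of_pow_le_pow_left₀ (Nat.succ_ne_zero m) (Real.exp_pos _).le h7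
    refine h2.trans (le_trans ?_ h11)
    exact mul_le_mul_of_nonneg_left h1 (Real.exp_pos _).le
  obtain ⟨i₀, hi₀⟩ := Function.ne_iff.mp hℓ
  have e : {l : ι // l ≠ i₀} ≃ Fin m := Fintype.equivFinOfCardEq (by
    rw [Fintype.card_subtype_compl, Fintype.card_subtype_eq, hN]
    rfl)
  set x : ι → ι → K := fun l => if h : l ≠ i₀ then y (e ⟨l, h⟩) else 0 with hx
  have hxl : ∀ l (h : l ≠ i₀), x l = y (e ⟨l, h⟩) := fun l h => dif_pos h
  have hsh : SmallHyperplane PS L c' δ' i₀ q ℓ x := by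
    refine ⟨hi₀, fun l hl => ?_, ?_, fun l i => ?_, fun l hl => ?_⟩
    · rw [hxl l hl]
      exact (hmem _).mp (hyH _).1
    · have h1 : (fun l : {l // l ≠ i₀} => x l) = y ∘ e := by
        ext l
        rw [hxl l.1 l.2]; rfl
      rw [h1]
      exact hyi.comp _ e.injective
    · by_cases hl : l ≠ i₀
      · rw [hxl l hl]; exact hyr _ _
      · rw [hx]; simp only [dif_neg hl]; exact zero_mem _
    · rw [hxl l hl]
      exact hsmall _
  obtain ⟨ℓ', hℓ', h⟩ := hΛ₁ (⟨c', hc'F⟩, i₀) q (hqp _) ℓ x hsh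
  exact ⟨ℓ', Finset.mem_biUnion.mpr ⟨_, Finset.mem_univ _, hℓ'⟩, h⟩

end Gap

section Compound
variable {K : Type*} [CommRing K] {n r : ℕ}

theorem exists_orderEmb_comp_perm {p : Fin r → Fin n} (hp : Function.Injective p) :
    ∃ (I : Fin r ↪o Fin n) (σ : Equiv.Perm (Fin r)), ⇑I ∘ σ = p := by
  have hcard : (Finset.univ.image p).card = r := by
    rw [Finset.card_image_of_injective _ hp, Finset.card_univ, Fintype.card_fin]
  set I := (Finset.univ.image p).orderEmbOfFin hcard with hI
  have hrange : ∀ i, ∃ j, I j = p i := by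
    intro i
    have h1 : p i ∈ Set.range I := by
      rw [hI, Finset.range_orderEmbOfFin]
      simp
    exact h1
  choose σ hσ using hrange
  have hinj : Function.Injective σ := by
    intro i j hij
    apply hp
    rw [← hσ i, ← hσ j, hij]
  exact ⟨I, Equiv.ofBijective σ (Finite.injective_iff_bijective.mp hinj), funext hσ⟩

theorem orderEmb_eq_of_range_subset {I I' : Fin r ↪o Fin n} (h : ∀ i, I i ∈ Set.range I') :
    I = I' := by
  have h1 : Set.range I = Set.range I' := by
    refine Set.eq_of_subset_of_ncard_le (Set.range_subset_iff.mpr h) ?_ (Set.finite_range _)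
    rw [← Set.image_univ, ← Set.image_univ, Set.ncard_image_of_injective _ I.injective,
      Set.ncard_image_of_injective _ I'.injective]
  exact DFunLike.coe_injective ((I.strictMono.range_inj I'.strictMono).mp h1)

/-- The Cauchy–Binet formula. -/
theorem det_mul_eq_sum_minors (F : Matrix (Fin r) (Fin n) K) (M : Matrix (Fin n) (Fin r) K) :
    (F * M).det = ∑ I : Fin r ↪o Fin n, (F.submatrix id I).det * (M.submatrix I id).det := by
  classical
  have h1 : (F * M).det = ∑ p : Fin r → Fin n, (F.submatrix id p).det * ∏ i, M (p i) i := by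
    simp only [Matrix.det_apply', Matrix.mul_apply, Finset.prod_univ_sum, Finset.mul_sum,
      Fintype.piFinset_univ, Matrix.submatrix_apply, id]
    rw [Finset.sum_comm]
    refine Finset.sum_congr rfl fun p _ => ?_
    rw [Finset.sum_mul]
    refine Finset.sum_congr rfl fun σ _ => ?_
    rw [Finset.prod_mul_distrib, mul_assoc]
  rw [h1]
  have h2 : ∀ I : Fin r ↪o Fin n, (F.submatrix id I).det * (M.submatrix I id).det =
      ∑ σ : Equiv.Perm (Fin r), (F.submatrix id (I ∘ σ)).det * ∏ i, M ((I ∘ σ) i) i := by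
    intro I
    rw [Matrix.det_apply' (M.submatrix I id), Finset.mul_sum]
    refine Finset.sum_congr rfl fun σ _ => ?_
    have h3 : F.submatrix id (I ∘ σ) = (F.submatrix id I).submatrix id σ := by
      rw [Matrix.submatrix_submatrix]; rfl
    rw [h3, Matrix.det_permute']
    simp only [Matrix.submatrix_apply, id, Function.comp]
    ring
  rw [Finset.sum_congr rfl fun I _ => h2 I, ← Fintype.sum_prod_type']
  symm
  refine Fintype.sum_of_injective (fun x : (Fin r ↪o Fin n) × Equiv.Perm (Fin r) => ⇑x.1 ∘ x.2)
    ?_ _ _ (fun p hp => ?_) fun x => rfl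
  · rintro ⟨I, σ⟩ ⟨I', σ'⟩ h
    have h3 : ∀ i, I (σ i) = I' (σ' i) := fun i => congrFun h i
    have h4 : I = I' := orderEmb_eq_of_range_subset fun i =>
      ⟨σ' (σ.symm i), by rw [← h3, Equiv.apply_symm_apply]⟩
    subst h4
    exact Prod.ext rfl (Equiv.ext fun i => I.injective (h3 i))
  · have h3 : ¬ Function.Injective p := by
      intro h
      obtain ⟨I, σ, h⟩ := exists_orderEmb_comp_perm h
      exact hp ⟨(I, σ), h⟩
    obtain ⟨i, j, hij, hne⟩ := Function.not_injective_iff.mp h3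
    rw [Matrix.det_zero_of_column_eq hne (fun k => by simp [hij]), zero_mul]

/-- The matrix of `r × r` minors. -/
noncomputable def compound (r : ℕ) (A : Matrix (Fin n) (Fin n) K) :
    Matrix (Fin r ↪o Fin n) (Fin r ↪o Fin n) K :=
  Matrix.of fun I I' => (A.submatrix I I').det

theorem compound_mul (A B : Matrix (Fin n) (Fin n) K) :
    compound r (A * B) = compound r A * compound r B := by
  ext I I'
  rw [Matrix.mul_apply]
  have := det_mul_eq_sum_minors (A.submatrix I id) (B.submatrix id I')
  rw [← Matrix.submatrix_mul _ _ _ _ _ Function.bijective_id] at this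
  exact this

theorem compound_one : compound r (1 : Matrix (Fin n) (Fin n) K) = 1 := by
  classical
  ext I I'
  rw [compound, Matrix.of_apply]
  by_cases h : I = I'
  · rw [h, Matrix.submatrix_one _ I'.injective, Matrix.det_one, Matrix.one_apply_eq]
  · rw [Matrix.one_apply_ne h]
    obtain ⟨i, hi⟩ : ∃ i, I i ∉ Set.range I' := by
      by_contra! h1
      exact h (orderEmb_eq_of_range_subset h1)
    refine Matrix.det_eq_zero_of_row_eq_zero i fun j => ?_
    rw [Matrix.submatrix_apply, Matrix.one_apply_ne]
    intro h1
    exact hi ⟨j, h1.symm⟩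

theorem compound_mul_inv {K : Type*} [Field K] {A : Matrix (Fin n) (Fin n) K} (hA : A.det ≠ 0) :
    compound r A⁻¹ * compound r A = 1 := by
  rw [← compound_mul, Matrix.nonsing_inv_mul _ (IsUnit.mk0 _ hA), compound_one]

theorem compound_det_ne_zero {K : Type*} [Field K] {A : Matrix (Fin n) (Fin n) K}
    (hA : A.det ≠ 0) : (compound r A).det ≠ 0 := by
  intro h
  have h1 := congrArg Matrix.det (compound_mul_inv (r := r) hA)
  rw [Matrix.det_mul, h, mul_zero, Matrix.det_one] at h1
  exact zero_ne_one h1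

theorem exists_prod_orderEmb_eq_pow (n r : ℕ) : ∃ b : ℕ, ∀ f : Fin n → ℝ,
    ∏ I : Fin r ↪o Fin n, ∏ i, f (I i) = (∏ j, f j) ^ b := by
  classical
  set P := Finset.powersetCard r (Finset.univ : Finset (Fin n)) with hP
  have hcount : ∀ j j' : Fin n, (P.filter (j ∈ ·)).card ≤ (P.filter (j' ∈ ·)).card := by
    intro j j'
    refine Finset.card_le_card_of_injOn (fun s => s.map (Equiv.swap j j').toEmbedding) ?_ ?_
    · intro s hs
      simp only [hP, Finset.coe_filter, Finset.mem_powersetCard, Set.mem_ofPred_eq] at hs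
      simp only [hP, Finset.coe_filter, Finset.mem_powersetCard, Set.mem_ofPred_eq]
      refine ⟨⟨Finset.subset_univ _, by rw [Finset.card_map, hs.1.2]⟩, ?_⟩
      exact Finset.mem_map.mpr ⟨j, hs.2, Equiv.swap_apply_left _ _⟩
    · exact (Finset.map_injective _).injOn
  have hb : ∃ b : ℕ, ∀ j, (P.filter (j ∈ ·)).card = b := by
    rcases isEmpty_or_nonempty (Fin n) with h | ⟨⟨j₀⟩⟩
    · exact ⟨0, fun j => isEmptyElim j⟩
    · exact ⟨_, fun j => le_antisymm (hcount j j₀) (hcount j₀ j)⟩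
  obtain ⟨b, hb⟩ := hb
  refine ⟨b, fun f => ?_⟩
  have h1 : ∏ I : Fin r ↪o Fin n, ∏ i, f (I i) = ∏ s ∈ P, ∏ j ∈ s, f j := by
    refine Finset.prod_bij (fun I _ => Finset.univ.map I.toEmbedding) ?_ ?_ ?_ ?_
    · intro I _
      simp [hP, Finset.mem_powersetCard]
    · intro I _ I' _ h
      refine orderEmb_eq_of_range_subset fun i => ?_
      have : I i ∈ Finset.univ.map I'.toEmbedding := by
        rw [← h]; simp
      simpa using this
    · intro s hs
      have hs' := (Finset.mem_powersetCard.mp hs).2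
      refine ⟨s.orderEmbOfFin hs', Finset.mem_univ _, ?_⟩
      ext j
      simp
    · intro I _
      rw [Finset.prod_map]
      rfl
  rw [h1, Finset.prod_comm' (t' := Finset.univ) (s' := fun j => P.filter (j ∈ ·))
    (by intro s j; simp), ← Finset.prod_pow]
  refine Finset.prod_congr rfl fun j _ => ?_
  rw [Finset.prod_const, hb]

theorem orderEmb_add_le (I : Fin r ↪o Fin n) (i : Fin r) (d : ℕ) (h : (i : ℕ) + d < r) :
    (I i : ℕ) + d ≤ I ⟨i + d, h⟩ := by
  induction d with
  | zero => simp
  | succ d ih =>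
    have h1 := ih (by omega)
    have h2 : I ⟨i + d, by omega⟩ < I ⟨i + (d + 1), h⟩ := I.strictMono (by simp [Fin.lt_def])
    rw [Fin.lt_def] at h2
    omega

end Compound

section MinimaGap
variable {K : Type*} [Field K] {S : Type} [Fintype S] (PS : PlaceSystem K S) {n r : ℕ}

theorem mulVec_eq_zero_of_minors {F F' : Matrix (Fin r) (Fin n) K}
    {R : Matrix (Fin n) (Fin r) K} (hR : F' * R = 1) {a : K} (ha : a ≠ 0)
    (h : ∀ I : Fin r ↪o Fin n, (F.submatrix id I).det = a * (F'.submatrix id I).det)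
    {u : Fin n → K} (hu : F.mulVec u = 0) : F'.mulVec u = 0 := by
  ext i
  set M := R.updateCol i u with hM
  have h1 : (F' * M).det = F'.mulVec u i := by
    rw [hM, Matrix.mul_updateCol, hR, ← Matrix.cramer_apply, Matrix.cramer_one]
    rfl
  have h2 : (F * M).det = 0 := by
    rw [hM, Matrix.mul_updateCol, hu]
    exact Matrix.det_eq_zero_of_column_eq_zero i fun j => by simp
  have h3 : (F * M).det = a * (F' * M).det := by
    rw [det_mul_eq_sum_minors, det_mul_eq_sum_minors, Finset.mul_sum]
    refine Finset.sum_congr rfl fun I _ => ?_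
    rw [h I, mul_assoc]
  rw [h2, h1] at h3
  exact (mul_eq_zero.mp h3.symm).resolve_left ha

theorem eq_of_le_apply_zero {s : ℕ} (hsr : s + r = n) (hr : 0 < r) (I : Fin r ↪o Fin n)
    (h : s ≤ I ⟨0, hr⟩) (i : Fin r) : (I i : ℕ) = s + i := by
  have h1 := orderEmb_add_le I ⟨0, hr⟩ i (by simp)
  have h2 := orderEmb_add_le I i (r - 1 - i) (by omega)
  have h3 : (⟨0 + (i : ℕ), by simp⟩ : Fin r) = i := by ext; simp
  simp only at h1
  rw [h3] at h1
  have h4 := (I ⟨i + (r - 1 - i), by omega⟩).isLt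
  have := i.isLt
  omega

theorem mul_prod_le_prod_top {s : ℕ} (hsr : s + r = n) (hr : 0 < r) {η : Fin n → ℝ}
    (hmono : Monotone η) (hpos : ∀ j, 0 < η j) {c : ℝ}
    (hgap : ∀ j : Fin n, (j : ℕ) < s → c * η j ≤ η ⟨s, by omega⟩) (I : Fin r ↪o Fin n)
    (hI : (I ⟨0, hr⟩ : ℕ) < s) :
    c * ∏ i, η (I i) ≤ ∏ i : Fin r, η ⟨s + i, by omega⟩ := by
  rw [← Finset.mul_prod_erase _ _ (Finset.mem_univ (⟨0, hr⟩ : Fin r)), ← mul_assoc,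
    ← Finset.mul_prod_erase Finset.univ (fun i : Fin r => η ⟨s + i, by omega⟩)
      (Finset.mem_univ (⟨0, hr⟩ : Fin r))]
  refine mul_le_mul (hgap _ hI) ?_ (Finset.prod_nonneg fun i _ => (hpos _).le) (hpos _).le
  refine Finset.prod_le_prod (fun i _ => (hpos _).le) fun i _ => hmono ?_
  have h2 := orderEmb_add_le I i (r - 1 - i) (by omega)
  have h4 := (I ⟨i + (r - 1 - i), by omega⟩).isLt
  have := i.isLt
  rw [Fin.le_def]
  simp only
  omega

/-- The weights of the forms given by the minors of a system of linear forms. -/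
noncomputable def compoundWeight (r : ℕ) (t : S → Fin n → ℝ) : S → (Fin r ↪o Fin n) → ℝ :=
  fun v I => ∏ i, t v (I i)

theorem compoundWeight_pos {t : S → Fin n → ℝ} (ht : ∀ v i, 0 < t v i) (v : S)
    (I : Fin r ↪o Fin n) : 0 < compoundWeight r t v I :=
  Finset.prod_pos fun _ _ => ht v _

theorem theight_compound_le [Nonempty (Fin r ↪o Fin n)] (L : S → Matrix (Fin n) (Fin n) K)
    {t : S → Fin n → ℝ} (ht : ∀ v i, 0 < t v i) (g : Fin n → Fin n → K) (J : Fin r ↪o Fin n) :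
    theight PS (fun v => compound r (L v)) (compoundWeight r t)
      (fun I => ((Matrix.of fun i j => g j i).submatrix I J).det) ≤
      (r.factorial : ℝ) ^ (∑ v, PS.mult v) * ∏ i, theight PS L t (g (J i)) := by
  set G : Matrix (Fin n) (Fin n) K := Matrix.of fun i j => g j i with hG
  simp only [theight]
  rw [Finset.prod_comm, ← Finset.prod_pow_eq_pow_sum, ← Finset.prod_mul_distrib]
  have hpos := compoundWeight_pos (r := r) ht
  refine Finset.prod_le_prod (fun v _ => pow_nonneg (tnorm_nonneg _ _ (hpos v) _) _) fun v _ => ?_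
  rw [Finset.prod_pow, ← mul_pow]
  refine pow_le_pow_left₀ (tnorm_nonneg _ _ (hpos v) _) (tnorm_le (hpos v) fun I => ?_) _
  have h1 : (compound r (L v)).mulVec (fun I => (G.submatrix I J).det) I =
      ((L v * G).submatrix I J).det := by
    have := congrFun (congrFun (compound_mul (r := r) (L v) G) I) J
    rw [Matrix.mul_apply] at this
    exact this.symm
  rw [h1]
  have h2 := abv_det_le (PS.abv v) (A := (L v * G).submatrix I J) (r := fun i => t v (I i))
    (s := fun l => tnorm (PS.abv v) (L v) (t v) (g (J l))) (fun i l => by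
      have h3 := abv_mulVec_le_tnorm (PS.abv v) (L v) (ht v) (g (J l)) (I i)
      rw [mul_comm]
      exact h3)
  refine h2.trans (le_of_eq ?_)
  rw [Fintype.card_fin, compoundWeight]
  ring

theorem exists_tvol_compoundWeight (n r : ℕ) : ∃ b : ℕ,
    (∀ t : S → Fin n → ℝ, tvol PS (compoundWeight r t) = tvol PS t ^ b) ∧
    ∀ f : Fin n → ℝ, ∏ I : Fin r ↪o Fin n, ∏ i, f (I i) = (∏ j, f j) ^ b := by
  obtain ⟨b, hb⟩ := exists_prod_orderEmb_eq_pow n r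
  refine ⟨b, fun t => ?_, hb⟩
  rw [tvol, tvol, ← Finset.prod_pow]
  refine Finset.prod_congr rfl fun v _ => ?_
  rw [← pow_mul, mul_comm, pow_mul, ← hb]
  rfl

theorem exists_minima_le_exp (hn : 0 < n) {L : S → Matrix (Fin n) (Fin n) K}
    (hL : ∀ v, (L v).det ≠ 0) {A : ℝ} (hA : 0 < A) :
    ∃ B : ℝ, 0 < B ∧ ∀ q : ℝ, 1 ≤ q → ∀ t : S → Fin n → ℝ, (∀ v i, 0 < t v i) →
      (∀ v i, |Real.log (t v i)| ≤ A * q) → ∀ (g : Fin n → Fin n → K) (η : Fin n → ℝ),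
      Minima PS L t g η → ∀ j, η j ≤ Real.exp (B * q) := by
  classical
  have : Nonempty (Fin n) := ⟨⟨0, hn⟩⟩
  obtain ⟨C, hC, hvol⟩ := exists_tvol_mul_prod_minima_le PS L (Fintype.card_fin n)
  obtain ⟨C₁, hC₁, hlow⟩ := exists_one_le_theight_mul PS hL
  set M : ℕ := ∑ v, PS.mult v with hM
  set E : ℝ := Real.log 2 + M * (Real.log C₁ + A) with hE
  have hlog2 := Real.log_nonneg one_le_two
  have hlogC₁ := Real.log_nonneg hC₁
  have hE0 : 0 ≤ E := by positivity
  set B : ℝ := |Real.log C| + M * (n * A) + n * E + 1 with hB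
  have hB0 : 0 < B := by positivity
  refine ⟨B, hB0, fun q hq t ht htA g η hη j => ?_⟩
  have hq0 : 0 < q := by linarith
  have hgood : ∀ j, -(E * q) ≤ Real.log (η j) := by
    intro j
    have h1 := hlow t ht (Real.exp (A * q)) (fun v i => by
      rw [← Real.log_le_iff_le_exp (ht v i)]
      exact (le_abs_self _).trans (htA v i)) (g j) (hη.indep.ne_zero j) (hη.mem j)
    have h2 : 1 ≤ 2 * η j * (C₁ * Real.exp (A * q)) ^ M :=
      h1.trans (mul_le_mul_of_nonneg_right (hη.le j) (by positivity))
    have h3 := Real.log_nonneg h2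
    have hηj := hη.pos j
    rw [Real.log_mul (by positivity) (by positivity), Real.log_mul (by norm_num) hηj.ne',
      Real.log_pow, Real.log_mul (by positivity) (Real.exp_pos _).ne', Real.log_exp] at h3
    have h4 : Real.log 2 ≤ Real.log 2 * q := le_mul_of_one_le_right hlog2 hq
    have h5 : Real.log C₁ ≤ Real.log C₁ * q := le_mul_of_one_le_right hlogC₁ hq
    have h6 : (M : ℝ) * Real.log C₁ ≤ M * (Real.log C₁ * q) :=
      mul_le_mul_of_nonneg_left h5 (Nat.cast_nonneg _)
    rw [hE]
    linarith
  have h1 := hvol t ht g η hη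
  have hprod : 0 < ∏ s, η s := Finset.prod_pos fun s _ => hη.pos s
  have h2 := Real.log_le_log (mul_pos (tvol_pos PS ht) hprod) h1
  rw [Real.log_mul (tvol_pos PS ht).ne' hprod.ne', Real.log_prod fun s _ => (hη.pos s).ne',
    log_tvol PS ht] at h2
  have h3 : -((M : ℝ) * (n * (A * q))) ≤ ∑ v, (PS.mult v : ℝ) * ∑ i, Real.log (t v i) := by
    rw [hM, Nat.cast_sum, Finset.sum_mul, ← Finset.sum_neg_distrib]
    refine Finset.sum_le_sum fun v _ => ?_
    rw [← mul_neg]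
    refine mul_le_mul_of_nonneg_left ?_ (Nat.cast_nonneg _)
    have : ∑ i : Fin n, -(A * q) ≤ ∑ i, Real.log (t v i) :=
      Finset.sum_le_sum fun i _ => (abs_le.mp (htA v i)).1
    rw [Finset.sum_const, Finset.card_univ, Fintype.card_fin, nsmul_eq_mul] at this
    linarith
  have h4 : Real.log (η j) + E * q ≤ ∑ s, (Real.log (η s) + E * q) :=
    Finset.single_le_sum (f := fun s => Real.log (η s) + E * q)
      (fun s _ => by linarith [hgood s]) (Finset.mem_univ j)
  rw [Finset.sum_add_distrib, Finset.sum_const, Finset.card_univ, Fintype.card_fin,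
    nsmul_eq_mul] at h4
  rw [← Real.log_le_iff_le_exp (hη.pos j), hB]
  have h5 : |Real.log C| ≤ |Real.log C| * q := le_mul_of_one_le_right (abs_nonneg _) hq
  have h6 := le_abs_self (Real.log C)
  have h7 : 0 ≤ E * q := by positivity
  linarith

end MinimaGap

section FiniteSubspaces
variable {K : Type*} [Field K] {S : Type} [Fintype S] (PS : PlaceSystem K S) {n r : ℕ}

/-- The subspace generated by the first minima, when followed by a large gap, belongs to a
finite list of proper subspaces. -/
theorem exists_finite_subspaces_of_gap [CharZero K] {s : ℕ} (hsr : s + r = n) (hs : 0 < s)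
    (hr : 0 < r) {L : S → Matrix (Fin n) (Fin n) K} (hL : ∀ v, (L v).det ≠ 0) {A δ : ℝ}
    (hA : 0 < A) (hδ : 0 < δ) :
    ∃ q₀ : ℝ, ∃ Φ : Finset (Fin n → K), (∀ φ ∈ Φ, φ ≠ 0) ∧ ∀ q ≥ q₀, ∀ t : S → Fin n → ℝ,
      (∀ v i, 0 < t v i) → (∀ v i, |Real.log (t v i)| ≤ A * q) →
      ∀ (g : Fin n → Fin n → K) (η : Fin n → ℝ), Minima PS L t g η →
      (∀ j : Fin n, (j : ℕ) < s → Real.exp (δ * q) * η j ≤ η ⟨s, by omega⟩) →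
      ∃ φ ∈ Φ, ∀ u ∈ Submodule.span K (g '' {j | (j : ℕ) < s}), ∑ i, φ i * u i = 0 := by
  classical
  have hn : 0 < n := by omega
  have : Nonempty (Fin n) := ⟨⟨0, hn⟩⟩
  set J := Fin r ↪o Fin n with hJ
  set top : J := OrderEmbedding.ofStrictMono (fun i : Fin r => (⟨s + i, by omega⟩ : Fin n))
    (fun i j hij => by rw [Fin.lt_def] at hij ⊢; simpa using hij) with htop
  have htop_apply : ∀ i, top i = (⟨s + i, by omega⟩ : Fin n) := fun i => rfl
  set bot : J := OrderEmbedding.ofStrictMono (fun i : Fin r => (⟨i, by omega⟩ : Fin n))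
    (fun i j hij => by rw [Fin.lt_def] at hij ⊢; simpa using hij) with hbot
  have hbt : bot ≠ top := by
    intro h
    have := congrArg (fun I : J => ((I ⟨0, hr⟩ : Fin n) : ℕ)) h
    have h1 : 0 = s + 0 := this
    omega
  have : Nonempty J := ⟨top⟩
  have hJ2 : 1 < Fintype.card J := Fintype.one_lt_card_iff.mpr ⟨bot, top, hbt⟩
  obtain ⟨m, hm⟩ : ∃ m, Fintype.card J = m + 1 := ⟨Fintype.card J - 1, by omega⟩
  have hm1 : 1 ≤ m := by omega
  have hLW : ∀ v, (compound r (L v)).det ≠ 0 := fun v => compound_det_ne_zero (hL v)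
  obtain ⟨B, hB, hηB⟩ := exists_minima_le_exp PS hn hL hA
  obtain ⟨C, hC, hvol⟩ := exists_tvol_mul_prod_minima_le PS L (Fintype.card_fin n)
  obtain ⟨c, hc, hlow⟩ := exists_le_tvol_mul_prod_theight PS hLW
  obtain ⟨b, htv, hprodb⟩ := exists_tvol_compoundWeight PS n r
  set k₁ : ℝ := (r.factorial : ℝ) ^ (∑ v, PS.mult v) * 2 ^ r with hk₁
  have hk₁0 : 0 < k₁ := by positivity
  set k₂ : ℝ := c / (k₁ ^ m * C ^ b) with hk₂
  have hk₂0 : 0 < k₂ := by positivity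
  set A' : ℝ := n * A + |Real.log k₁| + r * B + 1 with hA'
  have hA'0 : 0 < A' := by positivity
  obtain ⟨q₁, Λ, hΛ⟩ := exists_finite_hyperplanes_of_gap PS hLW hm1 hm hA'0 (half_pos hδ)
  set Q : (J → K) → Matrix (Fin r) (Fin n) K → Prop := fun ℓ' F' =>
    (∃ R : Matrix (Fin n) (Fin r) K, F' * R = 1) ∧
      ∃ a : K, a ≠ 0 ∧ ∀ I : J, (F'.submatrix id I).det = a * ℓ' I with hQ
  set φ : (J → K) → Fin n → K := fun ℓ' =>
    if h : ∃ F', Q ℓ' F' then h.choose ⟨0, hr⟩ else 1 with hφ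
  refine ⟨1 + |q₁| + |2 * Real.log (k₁ / k₂) / δ|, Λ.image φ, ?_, ?_⟩
  · intro ψ hψ
    obtain ⟨ℓ', -, rfl⟩ := Finset.mem_image.mp hψ
    simp only [hφ]
    split_ifs with h
    · obtain ⟨⟨R, hR⟩, -⟩ := h.choose_spec
      intro h0
      have h1 := congrFun (congrFun hR ⟨0, hr⟩) ⟨0, hr⟩
      rw [Matrix.mul_apply, Matrix.one_apply_eq] at h1
      simp [h0] at h1
    · intro h0
      exact one_ne_zero (congrFun h0 ⟨0, hn⟩)
  intro q hq t ht htA g η hη hgap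
  have hq1 : 1 ≤ q := by linarith [abs_nonneg q₁, abs_nonneg (2 * Real.log (k₁ / k₂) / δ)]
  have hq0 : 0 < q := by linarith
  have hqq₁ : q₁ ≤ q := by
    linarith [le_abs_self q₁, abs_nonneg (2 * Real.log (k₁ / k₂) / δ)]
  have hqk : Real.log (k₁ / k₂) ≤ δ / 2 * q := by
    have h1 : 2 * Real.log (k₁ / k₂) / δ ≤ q := by
      linarith [abs_nonneg q₁, le_abs_self (2 * Real.log (k₁ / k₂) / δ)]
    rw [div_le_iff₀ hδ] at h1
    linarith
  set G : Matrix (Fin n) (Fin n) K := Matrix.of fun i j => g j i with hG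
  have hGdet : G.det ≠ 0 := by
    have h1 : LinearIndependent K G.col := hη.indep
    exact ((Matrix.isUnit_iff_isUnit_det _).mp
      (Matrix.linearIndependent_cols_iff_isUnit.mp h1)).ne_zero
  have hGi : G⁻¹ * G = 1 := Matrix.nonsing_inv_mul _ (IsUnit.mk0 _ hGdet)
  set gW : J → J → K := fun I' I => (G.submatrix I I').det with hgW
  have hgWcol : gW = (compound r G).col := rfl
  have hgWi : LinearIndependent K gW := by
    rw [hgWcol]
    exact Matrix.linearIndependent_cols_iff_isUnit.mpr
      ((Matrix.isUnit_iff_isUnit_det _).mpr (IsUnit.mk0 _ (compound_det_ne_zero hGdet)))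
  have hgWr : ∀ I' I, gW I' I ∈ PS.ring := by
    intro I' I
    simp only [hgW]
    rw [Matrix.det_apply]
    refine sum_mem fun σ _ => ?_
    rw [Units.smul_def]
    exact PS.ring.zsmul_mem (prod_mem fun i _ => hη.mem _ _) _
  set ℓ : J → K := fun I => (G⁻¹.submatrix top I).det with hℓ
  have hℓg : ∀ I', ∑ I, ℓ I * gW I' I = if top = I' then 1 else 0 := by
    intro I'
    have := congrFun (congrFun (compound_mul_inv (r := r) hGdet) top) I'
    rw [Matrix.mul_apply, Matrix.one_apply] at this
    exact this
  have hℓ0 : ℓ ≠ 0 := by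
    intro h
    have := hℓg top
    rw [h, if_pos rfl] at this
    simp at this
  set E : ℝ := ∏ i : Fin r, η ⟨s + i, by omega⟩ with hE
  have hE0 : 0 < E := Finset.prod_pos fun i _ => hη.pos _
  set tW := compoundWeight r t with htW
  have htW0 : ∀ v I, 0 < tW v I := compoundWeight_pos ht
  have hheight : ∀ I', theight PS (fun v => compound r (L v)) tW (gW I') ≤
      k₁ * ∏ i, η (I' i) := by
    intro I'
    refine (theight_compound_le PS L ht g I').trans ?_
    rw [hk₁, mul_assoc]
    refine mul_le_mul_of_nonneg_left ?_ (by positivity)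
    have : (2 : ℝ) ^ r * ∏ i, η (I' i) = ∏ i, (2 * η (I' i)) := by
      rw [Finset.prod_mul_distrib, Finset.prod_const, Finset.card_univ, Fintype.card_fin]
    rw [this]
    exact Finset.prod_le_prod (fun i _ => theight_nonneg PS L ht _) fun i _ => hη.le _
  have hne : ∀ I' : J, I' ≠ top → ((I' ⟨0, hr⟩ : Fin n) : ℕ) < s := by
    intro I' hI'
    by_contra! h
    refine hI' (DFunLike.ext _ _ fun i => Fin.ext ?_)
    rw [eq_of_le_apply_zero hsr hr I' h i, htop_apply]
  set Y : ℝ := k₁ * Real.exp (-(δ * q)) * E with hY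
  set Z : ℝ := k₂ * E with hZ
  have hY0 : 0 < Y := by positivity
  have hEB : Real.log E ≤ r * (B * q) := by
    rw [hE, Real.log_prod fun i _ => (hη.pos _).ne']
    have : ∑ i : Fin r, Real.log (η ⟨s + i, by omega⟩) ≤ ∑ i : Fin r, B * q :=
      Finset.sum_le_sum fun i _ =>
        (Real.log_le_iff_le_exp (hη.pos _)).mpr (hηB q hq1 t ht htA g η hη _)
    rwa [Finset.sum_const, Finset.card_univ, Fintype.card_fin, nsmul_eq_mul] at this
  have hYA : Y ≤ Real.exp (A' * q) := by
    rw [← Real.log_le_iff_le_exp hY0, hY, Real.log_mul (by positivity) hE0.ne',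
      Real.log_mul hk₁0.ne' (Real.exp_pos _).ne', Real.log_exp, hA']
    have h1 := le_abs_self (Real.log k₁)
    have h2 : |Real.log k₁| ≤ |Real.log k₁| * q := le_mul_of_one_le_right (abs_nonneg _) hq1
    have h3 : 0 ≤ δ * q := by positivity
    have h4 : 0 ≤ n * A * q := by positivity
    linarith
  have hYZ : Real.exp (δ / 2 * q) * Y ≤ Z := by
    rw [hY, hZ]
    have h1 : k₁ / k₂ ≤ Real.exp (δ / 2 * q) := (Real.log_le_iff_le_exp (by positivity)).mp hqk
    rw [div_le_iff₀ hk₂0] at h1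
    have h2 : Real.exp (δ / 2 * q) * (k₁ * Real.exp (-(δ * q)) * E) =
        (Real.exp (-(δ / 2 * q)) * k₁) * E := by
      have : Real.exp (-(δ / 2 * q)) = Real.exp (δ / 2 * q) * Real.exp (-(δ * q)) := by
        rw [← Real.exp_add]; congr 1; ring
      rw [this]; ring
    rw [h2]
    refine mul_le_mul_of_nonneg_right ?_ hE0.le
    rw [Real.exp_neg, inv_mul_le_iff₀ (Real.exp_pos _)]
    exact h1
  have htWA : ∀ v I, |Real.log (tW v I)| ≤ A' * q := by
    intro v I
    rw [htW, compoundWeight, Real.log_prod fun i _ => (ht v _).ne']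
    refine (Finset.abs_sum_le_sum_abs _ _).trans ?_
    have h1 : ∑ i, |Real.log (t v (I i))| ≤ ∑ _i : Fin r, A * q :=
      Finset.sum_le_sum fun i _ => htA v _
    rw [Finset.sum_const, Finset.card_univ, Fintype.card_fin, nsmul_eq_mul] at h1
    refine h1.trans ?_
    rw [hA']
    have h2 : (r : ℝ) ≤ n := by exact_mod_cast (by omega : r ≤ n)
    have h3 : (r : ℝ) * (A * q) ≤ n * (A * q) := mul_le_mul_of_nonneg_right h2 (by positivity)
    have h4 : 0 ≤ (|Real.log k₁| + r * B + 1) * q := by positivity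
    linarith
  have hcardJ : Fintype.card {I : J // I ≠ top} = m := by
    rw [Fintype.card_subtype_compl, Fintype.card_subtype_eq, hm, Nat.add_sub_cancel]
  set e := (Fintype.equivFinOfCardEq hcardJ).symm with he
  have hmem : ∃ ℓ' ∈ Λ, ∃ a : K, a ≠ 0 ∧ ℓ = a • ℓ' := by
    refine hΛ q hqq₁ tW htW0 htWA ℓ Y Z hℓ0 hY0 hYA hYZ
      ⟨fun l => gW (e l).1, hgWi.comp (fun l => (e l).1)
        (Subtype.val_injective.comp e.injective), fun l I => hgWr _ _, fun l => ⟨?_, ?_⟩⟩ ?_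
    · rw [hℓg, if_neg (e l).2.symm]
    · refine (hheight _).trans ?_
      rw [hY, mul_assoc k₁]
      refine mul_le_mul_of_nonneg_left ?_ hk₁0.le
      rw [Real.exp_neg, ← div_eq_inv_mul, le_div_iff₀ (Real.exp_pos _), mul_comm]
      exact mul_prod_le_prod_top hsr hr hη.mono hη.pos hgap _ (hne _ (e l).2)
    · intro ω hω hℓω
      set x : J → J → K := fun I' => if I' = top then ω else gW I' with hx
      have hxi : LinearIndependent K x := by
        rw [Fintype.linearIndependent_iff]
        intro d hd
        have hxℓ : ∀ I', ∑ I, ℓ I * x I' I = if I' = top then ∑ I, ℓ I * ω I else 0 := by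
          intro I'
          by_cases h : I' = top
          · simp only [hx, if_pos h]
          · simp only [hx, if_neg h]
            rw [hℓg, if_neg (Ne.symm h)]
        have h1 : d top = 0 := by
          have h2 : ∑ I, ℓ I * (∑ I', d I' • x I') I = 0 := by rw [hd]; simp
          simp only [Finset.sum_apply, Pi.smul_apply, smul_eq_mul, Finset.mul_sum] at h2
          rw [Finset.sum_comm] at h2
          have h3 : ∀ I', ∑ I, ℓ I * (d I' * x I' I) = d I' * ∑ I, ℓ I * x I' I := by
            intro I'
            rw [Finset.mul_sum]
            exact Finset.sum_congr rfl fun I _ => by ring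
          simp only [h3, hxℓ, mul_ite, mul_zero] at h2
          rw [Fintype.sum_eq_single top fun I' h => if_neg h, if_pos rfl] at h2
          exact (mul_eq_zero.mp h2).resolve_right hℓω
        refine Fintype.linearIndependent_iff.mp hgWi d ?_
        rw [← hd]
        refine Finset.sum_congr rfl fun I' _ => ?_
        by_cases h : I' = top
        · rw [h, h1, zero_smul, zero_smul]
        · simp only [hx, if_neg h]
      have h1 := hlow tW htW0 J (Equiv.refl J) x hxi (fun I' I => by
        by_cases h : I' = top
        · simp only [hx, if_pos h]; exact hω I
        · simp only [hx, if_neg h]; exact hgWr I' I)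
      have hH0 := theight_nonneg PS (fun v => compound r (L v)) htW0
      have hrest : (∏ I' ∈ Finset.univ.erase top,
          theight PS (fun v => compound r (L v)) tW (x I')) * E ≤ k₁ ^ m * (∏ j, η j) ^ b := by
        have h2 : (∏ I' ∈ Finset.univ.erase top,
            theight PS (fun v => compound r (L v)) tW (x I')) ≤
            ∏ I' ∈ Finset.univ.erase top, (k₁ * ∏ i, η (I' i)) := by
          refine Finset.prod_le_prod (fun I' _ => hH0 _) fun I' hI' => ?_
          simp only [hx, if_neg (Finset.ne_of_mem_erase hI')]
          exact hheight I'
        rw [Finset.prod_mul_distrib, Finset.prod_const, Finset.card_erase_of_mem (Finset.mem_univ _),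
          Finset.card_univ, hm, Nat.add_sub_cancel] at h2
        have h3 : (∏ I' ∈ Finset.univ.erase top, ∏ i, η (I' i)) * E = (∏ j, η j) ^ b := by
          rw [← hprodb, ← Finset.prod_erase_mul _ _ (Finset.mem_univ top)]
          rfl
        rw [← h3, ← mul_assoc]
        exact mul_le_mul_of_nonneg_right h2 hE0.le
      rw [← Finset.mul_prod_erase _ _ (Finset.mem_univ top), htv] at h1
      have hxtop : x top = ω := if_pos rfl
      rw [hxtop] at h1
      have hv0 := tvol_pos PS ht
      have hp0 : 0 < ∏ j, η j := Finset.prod_pos fun j _ => hη.pos j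
      have h2 : (tvol PS t * ∏ j, η j) ^ b ≤ C ^ b :=
        pow_le_pow_left₀ (mul_pos hv0 hp0).le (hvol t ht g η hη) b
      rw [mul_pow] at h2
      have hω0 := hH0 ω
      set hgt := theight PS (fun v => compound r (L v)) tW ω
      rw [hZ, hk₂, div_mul_eq_mul_div, div_le_iff₀ (by positivity)]
      calc c * E ≤ tvol PS t ^ b * (hgt * ∏ I' ∈ Finset.univ.erase top,
            theight PS (fun v => compound r (L v)) tW (x I')) * E :=
            mul_le_mul_of_nonneg_right h1 hE0.le
        _ = tvol PS t ^ b * hgt * ((∏ I' ∈ Finset.univ.erase top,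
            theight PS (fun v => compound r (L v)) tW (x I')) * E) := by ring
        _ ≤ tvol PS t ^ b * hgt * (k₁ ^ m * (∏ j, η j) ^ b) :=
            mul_le_mul_of_nonneg_left hrest (mul_nonneg (pow_pos hv0 _).le hω0)
        _ = hgt * k₁ ^ m * (tvol PS t ^ b * (∏ j, η j) ^ b) := by ring
        _ ≤ hgt * k₁ ^ m * C ^ b := mul_le_mul_of_nonneg_left h2 (by positivity)
        _ = hgt * (k₁ ^ m * C ^ b) := by ring
  obtain ⟨ℓ', hℓ'Λ, a, ha, hℓ'⟩ := hmem
  have hQF : Q ℓ' (G⁻¹.submatrix top id) := by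
    refine ⟨⟨G.submatrix id top, ?_⟩, a, ha, fun I => ?_⟩
    · rw [← Matrix.submatrix_mul _ _ _ _ _ Function.bijective_id, hGi,
        Matrix.submatrix_one _ top.injective]
    · have := congrFun hℓ' I
      rw [Pi.smul_apply, smul_eq_mul] at this
      rw [← this, Matrix.submatrix_submatrix]
      rfl
  have hex : ∃ F', Q ℓ' F' := ⟨_, hQF⟩
  refine ⟨φ ℓ', Finset.mem_image_of_mem _ hℓ'Λ, fun u hu => ?_⟩
  have hFu : (G⁻¹.submatrix top id).mulVec u = 0 := by
    induction hu using Submodule.span_induction with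
    | mem x hx =>
      obtain ⟨j, hj, rfl⟩ := hx
      ext i
      have h1 := congrFun (congrFun hGi (top i)) j
      rw [Matrix.mul_apply, Matrix.one_apply_ne (by
        intro h
        have h2 : ((top i : Fin n) : ℕ) = j := congrArg _ h
        rw [htop_apply] at h2
        have h3 : (j : ℕ) < s := hj
        simp only at h2
        omega)] at h1
      exact h1
    | zero => exact Matrix.mulVec_zero _
    | add x y _ _ hx hy => rw [Matrix.mulVec_add, hx, hy, add_zero]
    | smul c x _ hx => rw [Matrix.mulVec_smul, hx, smul_zero]
  obtain ⟨⟨R, hR⟩, a', ha', hmin⟩ := hex.choose_spec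
  have h1 := mulVec_eq_zero_of_minors (F := G⁻¹.submatrix top id) hR (div_ne_zero ha ha')
    (fun I => by
      obtain ⟨-, -⟩ := hQF
      rw [hmin I, Matrix.submatrix_submatrix]
      have := congrFun hℓ' I
      rw [Pi.smul_apply, smul_eq_mul] at this
      rw [← mul_assoc, div_mul_cancel₀ _ ha', ← this]
      rfl) hFu
  have h2 := congrFun h1 ⟨0, hr⟩
  simp only [hφ, dif_pos hex]
  exact h2

end FiniteSubspaces

section Units
variable {K : Type*} [Field K] {S : Type} [Fintype S] (PS : PlaceSystem K S) {n : ℕ}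

theorem sum_log_abv_eq_zero {u : K} (hu0 : u ≠ 0) (hu : u ∈ PS.ring) (hu' : u⁻¹ ∈ PS.ring) :
    ∑ v, (PS.mult v : ℝ) * Real.log (PS.abv v u) = 0 := by
  have key : ∀ w : K, w ≠ 0 → w ∈ PS.ring →
      0 ≤ ∑ v, (PS.mult v : ℝ) * Real.log (PS.abv v w) := by
    intro w hw0 hw
    have h1 := Real.log_nonneg (PS.one_le_prod w hw hw0)
    rw [Real.log_prod fun v _ => (pow_pos ((PS.abv v).pos hw0) _).ne'] at h1
    simpa only [Real.log_pow] using h1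
  have h1 := key u hu0 hu
  have h2 := key u⁻¹ (inv_ne_zero hu0) hu'
  simp only [map_inv₀, Real.log_inv, mul_neg, Finset.sum_neg_distrib] at h2
  linarith

/-- The coordinate forms together with their sum, one of them being left out. -/
noncomputable def unitForms (K : Type*) [Field K] (n : ℕ) : Option (Fin n) → Matrix (Fin n) (Fin n) K
  | none => 1
  | some j => Matrix.updateRow 1 j fun _ => 1

theorem det_unitForms (o : Option (Fin n)) : (unitForms K n o).det = 1 := by
  cases o with
  | none => exact Matrix.det_one
  | some j =>
    rw [unitForms, ← Matrix.cramer_transpose_apply, Matrix.transpose_one, Matrix.cramer_one]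
    rfl

/-- The weights of the forms `unitForms` at a unit point. -/
noncomputable def unitWeight (f : AbsoluteValue K ℝ) (u : Fin n → K) : Option (Fin n) → Fin n → ℝ
  | none => fun i => f (u i)
  | some j => Function.update (fun i => f (u i)) j 1

theorem unitWeight_pos (f : AbsoluteValue K ℝ) {u : Fin n → K} (hu : ∀ i, u i ≠ 0)
    (o : Option (Fin n)) (i : Fin n) : 0 < unitWeight f u o i := by
  cases o with
  | none => exact f.pos (hu i)
  | some j =>
    by_cases h : i = j
    · rw [h, unitWeight, Function.update_self]
      exact one_pos
    · rw [unitWeight, Function.update_of_ne h]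
      exact f.pos (hu i)

theorem abv_unitForms_mulVec_le (f : AbsoluteValue K ℝ) {u : Fin n → K} (hsum : ∑ i, u i = -1)
    (o : Option (Fin n)) (i : Fin n) :
    f ((unitForms K n o).mulVec u i) ≤ unitWeight f u o i := by
  cases o with
  | none => rw [unitForms, Matrix.one_mulVec, unitWeight]
  | some j =>
    by_cases h : i = j
    · rw [h, unitWeight, Function.update_self, unitForms, Matrix.mulVec, Matrix.updateRow_self]
      simp only [dotProduct, one_mul, hsum, map_neg_eq_map, map_one, le_refl]
    · rw [unitWeight, Function.update_of_ne h, unitForms, Matrix.mulVec, Matrix.updateRow_ne h]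
      have := congrFun (Matrix.one_mulVec u) i
      rw [Matrix.mulVec] at this
      rw [this]

theorem log_unitWeight (f : AbsoluteValue K ℝ) (u : Fin n → K) (o : Option (Fin n)) :
    ∑ i, Real.log (unitWeight f u o i) =
      ∑ i, Real.log (f (u i)) - Real.log (f (o.elim 1 u)) := by
  cases o with
  | none => simp [unitWeight]
  | some j =>
    rw [← Finset.add_sum_erase _ _ (Finset.mem_univ j),
      ← Finset.add_sum_erase _ (fun i => Real.log (f (u i))) (Finset.mem_univ j)]
    simp only [unitWeight, Function.update_self, Real.log_one, Option.elim_some]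
    rw [Finset.sum_congr rfl fun i hi => by
      rw [Function.update_of_ne (Finset.ne_of_mem_erase hi)]]
    ring

theorem abs_log_unitWeight_le (f : AbsoluteValue K ℝ) {u : Fin n → K} {q : ℝ} (hq : 0 ≤ q)
    (h : ∀ i, |Real.log (f (u i))| ≤ q) (o : Option (Fin n)) (i : Fin n) :
    |Real.log (unitWeight f u o i)| ≤ q := by
  cases o with
  | none => exact h i
  | some j =>
    by_cases hij : i = j
    · rw [hij, unitWeight, Function.update_self, Real.log_one, abs_zero]
      exact hq
    · rw [unitWeight, Function.update_of_ne hij]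
      exact h i

theorem exists_ne_zero_sum_eq_zero (hn : 2 ≤ n) (u : Fin n → K) :
    ∃ φ : Fin n → K, φ ≠ 0 ∧ ∑ i, φ i * u i = 0 := by
  set f : (Fin n → K) →ₗ[K] K := ∑ i, u i • LinearMap.proj i with hf
  have h1 : LinearMap.ker f ≠ ⊥ := LinearMap.ker_ne_bot_of_finrank_lt (by
    rw [Module.finrank_self, Module.finrank_fin_fun]; omega)
  obtain ⟨φ, hφ, hφ0⟩ := Submodule.exists_mem_ne_zero_of_ne_bot h1
  refine ⟨φ, hφ0, ?_⟩
  rw [LinearMap.mem_ker, hf] at hφ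
  simp only [LinearMap.sum_apply, LinearMap.smul_apply, LinearMap.proj_apply, smul_eq_mul] at hφ
  rw [← hφ]
  exact Finset.sum_congr rfl fun i _ => mul_comm _ _

theorem exists_gap_of_minima {L : S → Matrix (Fin n) (Fin n) K} {t : S → Fin n → ℝ}
    (ht : ∀ v i, 0 < t v i) {g : Fin n → Fin n → K} {η : Fin n → ℝ} (hη : Minima PS L t g η)
    {u : Fin n → K} (hu0 : u ≠ 0) (hur : ∀ i, u i ∈ PS.ring) (hu : theight PS L t u ≤ 1)
    {c q : ℝ} (hc : 0 < c) (hq : 0 < q) (hn : 0 < n)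
    (hlow : c ≤ tvol PS t * ∏ l, theight PS L t (g l)) (hvol : Real.log (tvol PS t) = -q)
    (hqc : 2 * (n * Real.log 2 - Real.log c) < q) :
    ∃ s : Fin n, 0 < (s : ℕ) ∧
      (∀ j : Fin n, (j : ℕ) < s → Real.exp (1 / (2 * n ^ 2) * q) * η j ≤ η s) ∧
      u ∈ Submodule.span K (g '' {j | (j : ℕ) < s}) := by
  set δ : ℝ := 1 / (2 * n ^ 2) with hδ
  have hnR : (0 : ℝ) < n := by exact_mod_cast hn
  have hδ0 : 0 < δ := by positivity
  have hex : ∃ s : Fin n, ∃ h : 0 < (s : ℕ),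
      Real.exp (δ * q) * max (η ⟨s - 1, by omega⟩) 1 ≤ η s := by
    by_contra! hno
    have h1 : ∀ j : ℕ, ∀ hj : j < n, η ⟨j, hj⟩ ≤ Real.exp (j * (δ * q)) := by
      intro j
      induction j with
      | zero =>
        intro hj
        rw [Nat.cast_zero, zero_mul, Real.exp_zero]
        refine (hη.ge ⟨0, hj⟩ u hur ?_).trans hu
        have : {j : Fin n | j < ⟨0, hj⟩} = ∅ := by
          ext j
          simp [Fin.lt_def]
        rw [this, Set.image_empty, Submodule.span_empty, Submodule.mem_bot]
        exact hu0
      | succ j ih =>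
        intro hj
        have h2 := ih (by omega)
        have h3 := hno ⟨j + 1, hj⟩ (Nat.succ_pos j)
        refine h3.le.trans ?_
        have h4 : Real.exp ((j + 1 : ℕ) * (δ * q)) =
            Real.exp (δ * q) * Real.exp (j * (δ * q)) := by
          rw [← Real.exp_add]; congr 1; push_cast; ring
        rw [h4]
        refine mul_le_mul_of_nonneg_left (max_le h2 ?_) (Real.exp_pos _).le
        exact Real.one_le_exp (by positivity)
    have h2 : ∀ l, theight PS L t (g l) ≤ 2 * Real.exp (n * (δ * q)) := by
      intro l
      refine (hη.le l).trans (mul_le_mul_of_nonneg_left ((h1 l l.isLt).trans ?_) zero_le_two)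
      rw [Real.exp_le_exp]
      refine mul_le_mul_of_nonneg_right ?_ (by positivity)
      exact_mod_cast l.isLt.le
    have h3 : ∏ l, theight PS L t (g l) ≤ (2 * Real.exp (n * (δ * q))) ^ n := by
      refine (Finset.prod_le_prod (fun l _ => theight_nonneg PS L ht _) fun l _ => h2 l).trans_eq ?_
      rw [Finset.prod_const, Finset.card_univ, Fintype.card_fin]
    have h4 := hlow.trans (mul_le_mul_of_nonneg_left h3 (tvol_pos PS ht).le)
    have h5 := Real.log_le_log hc h4
    rw [Real.log_mul (tvol_pos PS ht).ne' (by positivity), hvol, Real.log_pow,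
      Real.log_mul (by norm_num) (Real.exp_pos _).ne', Real.log_exp] at h5
    have h6 : (n : ℝ) * (n * (δ * q)) = q / 2 := by
      rw [hδ]; field_simp
    linarith
  obtain ⟨s, hs, hgap⟩ := hex
  refine ⟨s, hs, fun j hj => ?_, ?_⟩
  · refine le_trans (mul_le_mul_of_nonneg_left ?_ (Real.exp_pos _).le) hgap
    refine le_max_of_le_left (hη.mono ?_)
    rw [Fin.le_def]
    simp only
    omega
  · by_contra hnot
    have h1 := (hη.ge s u hur hnot).trans hu
    have h2 : 1 < Real.exp (δ * q) := Real.one_lt_exp_iff.mpr (by positivity)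
    have h3 : Real.exp (δ * q) * 1 ≤ Real.exp (δ * q) * max (η ⟨s - 1, by omega⟩) 1 :=
      mul_le_mul_of_nonneg_left (le_max_right _ _) (Real.exp_pos _).le
    linarith

/-- The solutions of the unit equation belong to finitely many proper subspaces. -/
theorem exists_finite_forms_of_units [CharZero K] (hn : 2 ≤ n) :
    ∃ Φ : Finset (Fin n → K), (∀ φ ∈ Φ, φ ≠ 0) ∧ ∀ u : Fin n → K,
      (∀ i, u i ≠ 0 ∧ u i ∈ PS.ring ∧ (u i)⁻¹ ∈ PS.ring) → ∑ i, u i = -1 →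
      ∃ φ ∈ Φ, ∑ i, φ i * u i = 0 := by
  classical
  have hn0 : 0 < n := by omega
  set Lo : (S → Option (Fin n)) → S → Matrix (Fin n) (Fin n) K :=
    fun o v => unitForms K n (o v) with hLo
  have hL : ∀ o v, (Lo o v).det ≠ 0 := by
    intro o v
    rw [hLo, det_unitForms]
    exact one_ne_zero
  set δ : ℝ := 1 / (2 * n ^ 2) with hδ
  have hnR : (0 : ℝ) < n := by exact_mod_cast hn0
  have hδ0 : 0 < δ := by positivity
  choose c hc hlow using fun o => exists_le_tvol_mul_prod_theight PS (hL o)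
  choose q₁ Φ₁ hΦ₁ hΦ using fun p : (S → Option (Fin n)) × {s : Fin n // 0 < (s : ℕ)} =>
    exists_finite_subspaces_of_gap PS (s := p.2.1) (r := n - p.2.1) (n := n) (by omega) p.2.2
      (by omega) (hL p.1) one_pos hδ0
  choose ψ hψ0 hψ using exists_ne_zero_sum_eq_zero (K := K) hn
  obtain ⟨C, hC, hroot⟩ := PS.root_bound
  set q₀ : ℝ := 1 + ∑ p, |q₁ p| + ∑ o, |2 * (n * Real.log 2 - Real.log (c o))| with hq₀
  have hs1 : 0 ≤ ∑ p, |q₁ p| := Finset.sum_nonneg fun _ _ => abs_nonneg _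
  have hs2 : 0 ≤ ∑ o, |2 * (n * Real.log 2 - Real.log (c o))| :=
    Finset.sum_nonneg fun _ _ => abs_nonneg _
  have hfin : {u : Fin n → K | ∀ i, PS.ht (u i) ≤ C * (q₀ + 1)}.Finite := by
    have := Set.Finite.pi (t := fun _ : Fin n => {x | PS.ht x ≤ C * (q₀ + 1)})
      fun _ => PS.northcott _
    refine this.subset fun u hu => ?_
    rw [Set.mem_univ_pi]
    exact hu
  refine ⟨Finset.univ.biUnion Φ₁ ∪ hfin.toFinset.image ψ, ?_, fun u hu hsum => ?_⟩
  · intro φ hφ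
    rcases Finset.mem_union.mp hφ with h | h
    · obtain ⟨p, -, hp⟩ := Finset.mem_biUnion.mp h
      exact hΦ₁ p φ hp
    · obtain ⟨u, -, rfl⟩ := Finset.mem_image.mp h
      exact hψ0 u
  choose o ho using fun v => Finite.exists_max fun i : Option (Fin n) => PS.abv v (i.elim 1 u)
  set N : S → ℝ := fun v => Real.log (PS.abv v ((o v).elim 1 u)) with hN
  have hu0 : ∀ i, u i ≠ 0 := fun i => (hu i).1
  have hN0 : ∀ v, 0 ≤ N v := fun v => Real.log_nonneg (by simpa using ho v none)
  have hle : ∀ v i, Real.log (PS.abv v (u i)) ≤ N v := fun v i =>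
    Real.log_le_log ((PS.abv v).pos (hu0 i)) (ho v (some i))
  set q : ℝ := ∑ v, (PS.mult v : ℝ) * N v with hq
  have hq0 : 0 ≤ q := Finset.sum_nonneg fun v _ => mul_nonneg (Nat.cast_nonneg _) (hN0 v)
  have hmult : ∀ v, (1 : ℝ) ≤ PS.mult v := fun v => by exact_mod_cast PS.mult_pos v
  have hlog : ∀ v i, |Real.log (PS.abv v (u i))| ≤ q := by
    intro v i
    have h1 : (PS.mult v : ℝ) * N v ≤ q := Finset.single_le_sum
      (f := fun v => (PS.mult v : ℝ) * N v)
      (fun v _ => mul_nonneg (Nat.cast_nonneg _) (hN0 v)) (Finset.mem_univ v)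
    have h2 : N v ≤ PS.mult v * N v := le_mul_of_one_le_left (hN0 v) (hmult v)
    rw [abs_le]
    refine ⟨?_, (hle v i).trans (h2.trans h1)⟩
    by_contra! hlt
    have h3 := sum_log_abv_eq_zero PS (hu i).1 (hu i).2.1 (hu i).2.2
    have h4 : ∑ v' ∈ Finset.univ.erase v, (PS.mult v' : ℝ) * Real.log (PS.abv v' (u i)) ≤ q := by
      refine (Finset.sum_le_sum fun v' _ =>
        mul_le_mul_of_nonneg_left (hle v' i) (Nat.cast_nonneg _)).trans ?_
      exact Finset.sum_le_sum_of_subset_of_nonneg (Finset.subset_univ _)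
        fun v' _ _ => mul_nonneg (Nat.cast_nonneg _) (hN0 v')
    rw [← Finset.add_sum_erase _ _ (Finset.mem_univ v)] at h3
    have h5 : (PS.mult v : ℝ) * Real.log (PS.abv v (u i)) ≤ 1 * Real.log (PS.abv v (u i)) :=
      mul_le_mul_of_nonpos_right (hmult v) (by linarith)
    linarith
  rcases lt_or_ge q q₀ with hlt | hge
  · refine ⟨ψ u, Finset.mem_union_right _ (Finset.mem_image_of_mem _ ?_), hψ u⟩
    rw [hfin.mem_toFinset]
    intro i
    have h1 := hroot (Polynomial.X - Polynomial.C (u i)) (u i) 1 1 q₀ (by positivity)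
      (Polynomial.X_sub_C_ne_zero _) (Polynomial.natDegree_X_sub_C _).le ?_ ?_ (by rw [pow_one])
    · simpa using h1
    · intro k
      rw [Polynomial.coeff_sub, Polynomial.coeff_X, Polynomial.coeff_C]
      refine sub_mem ?_ ?_ <;> split_ifs
      exacts [one_mem _, zero_mem _, (hu i).2.1, zero_mem _]
    · intro v k
      have h1 : (1 : ℝ) ≤ Real.exp q₀ := Real.one_le_exp (by positivity)
      have h2 : PS.abv v (u i) ≤ Real.exp q₀ := by
        rw [← Real.log_le_iff_le_exp ((PS.abv v).pos (hu0 i))]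
        exact (le_abs_self _).trans ((hlog v i).trans hlt.le)
      rw [Polynomial.coeff_sub, Polynomial.coeff_X, Polynomial.coeff_C]
      rcases k with _ | _ | k
      · simpa using h2
      · simpa using h1
      · simpa using (Real.exp_pos q₀).le
  have hqpos : 0 < q := by linarith
  set t : S → Fin n → ℝ := fun v => unitWeight (PS.abv v) u (o v) with ht
  have ht0 : ∀ v i, 0 < t v i := fun v i => unitWeight_pos _ hu0 _ i
  have htA : ∀ v i, |Real.log (t v i)| ≤ 1 * q := fun v i => by
    rw [one_mul]
    exact abs_log_unitWeight_le _ hq0 (hlog v) _ i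
  have : Nonempty (Fin n) := ⟨⟨0, hn0⟩⟩
  have hheight : theight PS (Lo o) t u ≤ 1 := by
    rw [theight]
    refine Finset.prod_le_one (fun v _ => pow_nonneg (tnorm_nonneg _ _ (ht0 v) _) _) fun v _ => ?_
    refine pow_le_one₀ (tnorm_nonneg _ _ (ht0 v) _) (tnorm_le (ht0 v) fun i => ?_)
    rw [one_mul]
    exact abv_unitForms_mulVec_le _ hsum _ i
  have hvol : Real.log (tvol PS t) = -q := by
    rw [log_tvol PS ht0]
    simp only [ht, log_unitWeight, mul_sub, Finset.sum_sub_distrib]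
    have h1 : ∑ v, (PS.mult v : ℝ) * ∑ i, Real.log (PS.abv v (u i)) = 0 := by
      simp only [Finset.mul_sum]
      rw [Finset.sum_comm]
      exact Finset.sum_eq_zero fun i _ =>
        sum_log_abv_eq_zero PS (hu i).1 (hu i).2.1 (hu i).2.2
    rw [h1, zero_sub]
  obtain ⟨g, η, hη⟩ := exists_minima PS (hL o) ht0 (Fintype.card_fin n)
  have hune : u ≠ 0 := fun h => hu0 ⟨0, hn0⟩ (congrFun h _)
  have hqc : 2 * (n * Real.log 2 - Real.log (c o)) < q := by
    have h1 := Finset.single_le_sum (f := fun o => |2 * (n * Real.log 2 - Real.log (c o))|)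
      (fun _ _ => abs_nonneg _) (Finset.mem_univ o)
    have h2 := le_abs_self (2 * (n * Real.log 2 - Real.log (c o)))
    linarith
  obtain ⟨s, hs, hgap, hus⟩ := exists_gap_of_minima PS ht0 hη hune (fun i => (hu i).2.1) hheight
    (hc o) hqpos hn0 (hlow o t ht0 (Fin n) (Equiv.refl _) g hη.indep hη.mem) hvol hqc
  have hqs : q ≥ q₁ (o, ⟨s, hs⟩) := by
    have h1 := Finset.single_le_sum (f := fun p => |q₁ p|)
      (fun _ _ => abs_nonneg _) (Finset.mem_univ (o, (⟨s, hs⟩ : {s : Fin n // 0 < (s : ℕ)})))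
    have h2 := le_abs_self (q₁ (o, ⟨s, hs⟩))
    linarith
  obtain ⟨φ, hφ, hφu⟩ := hΦ (o, ⟨s, hs⟩) q hqs t ht0 htA g η hη hgap
  exact ⟨φ, Finset.mem_union_left _ (Finset.mem_biUnion.mpr ⟨_, Finset.mem_univ _, hφ⟩),
    hφu u hus⟩

end Units

/-! ### Root bounds over a number field -/

theorem max_one_pow_mul_leadingCoeff_le_of_isNonarchimedean {K : Type*} [Field K]
    (v : AbsoluteValue K ℝ) (hv : IsNonarchimedean v) {p : Polynomial K} {ξ : K} {t : ℕ}
    (hdvd : (Polynomial.X - Polynomial.C ξ) ^ t ∣ p) {B : ℝ} (hB : ∀ i, v (p.coeff i) ≤ B) :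
    max (v ξ) 1 ^ t * v p.leadingCoeff ≤ B := by
  obtain ⟨g, rfl⟩ := hdvd
  have hmul := Polynomial.gaussNorm_mul hv (c := 1) one_pos
  have hpow : ∀ t : ℕ, ((Polynomial.X - Polynomial.C ξ) ^ t).gaussNorm v 1 =
      (Polynomial.X - Polynomial.C ξ).gaussNorm v 1 ^ t := by
    intro t
    induction t with
    | zero => simpa using Polynomial.gaussNorm_C v 1 (1 : K)
    | succ t ih => rw [pow_succ, hmul, ih, pow_succ]
  have h1 : max (v ξ) 1 ≤ (Polynomial.X - Polynomial.C ξ).gaussNorm v 1 := by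
    refine max_le ?_ ?_
    · have h := Polynomial.le_gaussNorm v (Polynomial.X - Polynomial.C ξ) zero_le_one 0
      have hc : (Polynomial.X - Polynomial.C ξ).coeff 0 = -ξ := by simp
      rwa [hc, v.map_neg, pow_zero, mul_one] at h
    · have h := Polynomial.le_gaussNorm v (Polynomial.X - Polynomial.C ξ) zero_le_one 1
      have hc : (Polynomial.X - Polynomial.C ξ).coeff 1 = 1 := by
        simp [Polynomial.coeff_X]
      rwa [hc, map_one, one_pow, mul_one] at h
  have h2 : v ((Polynomial.X - Polynomial.C ξ) ^ t * g).leadingCoeff ≤ g.gaussNorm v 1 := by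
    rw [Polynomial.leadingCoeff_mul, Polynomial.leadingCoeff_pow,
      Polynomial.leadingCoeff_X_sub_C, one_pow, one_mul]
    simpa using Polynomial.le_gaussNorm v g zero_le_one g.natDegree
  obtain ⟨i, hi⟩ := Polynomial.exists_eq_gaussNorm v 1 ((Polynomial.X - Polynomial.C ξ) ^ t * g)
  calc _ ≤ (Polynomial.X - Polynomial.C ξ).gaussNorm v 1 ^ t * g.gaussNorm v 1 := by
        refine mul_le_mul (pow_le_pow_left₀ (by positivity) h1 t) h2 (v.nonneg _) ?_
        exact pow_nonneg (Polynomial.gaussNorm_nonneg v _ zero_le_one) _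
    _ = _ := by rw [← hpow, ← hmul, hi]
    _ ≤ B := by simpa using hB i

theorem max_one_pow_mul_leadingCoeff_le_of_embedding {K : Type*} [Field K]
    (φ : K →+* ℂ) {p : Polynomial K} {ξ : K} {t D : ℕ} (hD : p.natDegree ≤ D)
    (hdvd : (Polynomial.X - Polynomial.C ξ) ^ t ∣ p) {B : ℝ}
    (hB : ∀ i, ‖φ (p.coeff i)‖ ≤ B) :
    max ‖φ ξ‖ 1 ^ t * ‖φ p.leadingCoeff‖ ≤ (D + 1) * B := by
  have hsum : (p.map φ).mahlerMeasure ≤ (D + 1) * B := by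
    refine (Polynomial.mahlerMeasure_le_sum_norm_coeff _).trans ?_
    rw [Polynomial.sum_over_range' _ (by simp) (D + 1)
      (Nat.lt_succ_of_le (Polynomial.natDegree_map_le.trans hD))]
    refine (Finset.sum_le_card_nsmul _ _ B fun i _ => ?_).trans ?_
    · simpa using hB i
    · simp
  obtain ⟨g, rfl⟩ := hdvd
  refine le_trans ?_ hsum
  rw [Polynomial.map_mul, Polynomial.mahlerMeasure_mul, Polynomial.map_pow, Polynomial.map_sub,
    Polynomial.map_X, Polynomial.map_C]
  have hpow : ∀ t : ℕ, ((Polynomial.X - Polynomial.C (φ ξ)) ^ t).mahlerMeasure =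
      max ‖φ ξ‖ 1 ^ t := by
    intro t
    induction t with
    | zero => simp
    | succ t ih =>
      rw [pow_succ, Polynomial.mahlerMeasure_mul, ih, pow_succ,
        Polynomial.mahlerMeasure_X_sub_C, max_comm 1]
  rw [hpow]
  refine mul_le_mul_of_nonneg_left ?_ (by positivity)
  rw [Polynomial.leadingCoeff_mul, Polynomial.leadingCoeff_pow,
    Polynomial.leadingCoeff_X_sub_C, one_pow, one_mul]
  simpa using Polynomial.leadingCoeff_le_mahlerMeasure (g.map φ)

section NumberField

variable {K : Type*} [Field K] [NumberField K]

theorem finprod_finitePlace_le_prod (t : Finset (FinitePlace K)) (f : FinitePlace K → ℝ)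
    (hf : f.HasFiniteMulSupport) (h0 : ∀ w, 0 ≤ f w) (g : FinitePlace K → ℝ)
    (hle : ∀ w ∈ t, f w ≤ g w) (h1 : ∀ w ∉ t, f w ≤ 1) :
    ∏ᶠ w, f w ≤ ∏ w ∈ t, g w := by
  classical
  rw [finprod_eq_prod_of_mulSupport_subset f (s := hf.toFinset ∪ t) (by
    intro w hw
    exact Finset.mem_coe.2 (Finset.mem_union_left _ (hf.mem_toFinset.2 hw)))]
  rw [← Finset.prod_sdiff (Finset.subset_union_right : t ⊆ hf.toFinset ∪ t)]
  calc _ ≤ 1 * ∏ w ∈ t, g w := by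
        refine mul_le_mul (Finset.prod_le_one (fun w _ => h0 w) fun w hw => ?_)
          (Finset.prod_le_prod (fun w _ => h0 w) hle) (Finset.prod_nonneg fun w _ => h0 w) zero_le_one
        exact h1 w (Finset.mem_sdiff.1 hw).2
    _ = _ := one_mul _

theorem one_le_prod_places (t : Finset (FinitePlace K)) {x : K} (hx : x ≠ 0)
    (h1 : ∀ w ∉ t, w x ≤ 1) :
    1 ≤ (∏ w : InfinitePlace K, w x ^ w.mult) * ∏ w ∈ t, w x := by
  rw [← prod_abs_eq_one hx]
  refine mul_le_mul_of_nonneg_left ?_ (Finset.prod_nonneg fun w _ => by positivity)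
  exact finprod_finitePlace_le_prod t _ (FinitePlace.hasFiniteMulSupport hx)
    (fun w => apply_nonneg w x) _ (fun _ _ => le_rfl) h1

theorem hasFiniteMulSupport_max_one (x : K) :
    (fun w : FinitePlace K => max (w x) 1).HasFiniteMulSupport := by
  rcases eq_or_ne x 0 with rfl | hx
  · simpa [map_zero] using Function.hasFiniteMulSupport_one
  · exact (FinitePlace.hasFiniteMulSupport hx).max Function.hasFiniteMulSupport_fun_one

theorem infinitePlace_le_exp_logHeight (w : InfinitePlace K) (x : K) :
    w x ≤ Real.exp (Height.logHeight₁ x) := by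
  have h0 : (0 : ℝ) ≤ ∑ᶠ v : FinitePlace K, Real.posLog (v x) :=
    finsum_nonneg fun _ => Real.posLog_nonneg
  have h1 : Real.posLog (w x) ≤ ∑ v : InfinitePlace K, v.mult * Real.posLog (v x) := by
    refine le_trans ?_ (Finset.single_le_sum (f := fun v : InfinitePlace K =>
      (v.mult : ℝ) * Real.posLog (v x)) (fun v _ => mul_nonneg (Nat.cast_nonneg _)
      Real.posLog_nonneg) (Finset.mem_univ w))
    refine le_mul_of_one_le_left Real.posLog_nonneg ?_
    exact_mod_cast Nat.one_le_iff_ne_zero.2 w.mult_ne_zero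
  calc w x ≤ max (w x) 1 := le_max_left _ _
    _ = Real.exp (Real.posLog (w x)) := by
      rw [Real.posLog_eq_log_max_one (apply_nonneg w x), Real.exp_log (by positivity), max_comm]
    _ ≤ _ := Real.exp_le_exp.2 (by rw [NumberField.logHeight₁_eq]; linarith)

theorem finitePlace_le_exp_logHeight (w : FinitePlace K) (x : K) :
    w x ≤ Real.exp (Height.logHeight₁ x) := by
  have h0 : (0 : ℝ) ≤ ∑ v : InfinitePlace K, v.mult * Real.posLog (v x) :=
    Finset.sum_nonneg fun _ _ => mul_nonneg (Nat.cast_nonneg _) Real.posLog_nonneg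
  have hlog : ∀ v : FinitePlace K, Real.posLog (v x) = Real.log (max (v x) 1) := fun v => by
    rw [Real.posLog_eq_log_max_one (apply_nonneg v x), max_comm]
  have h1 : Real.posLog (w x) ≤ ∑ᶠ v : FinitePlace K, Real.posLog (v x) := by
    refine single_le_finsum (f := fun v : FinitePlace K => Real.posLog (v x)) w ?_
      fun v => Real.posLog_nonneg
    refine (hasFiniteMulSupport_max_one x).subset fun v hv h1 => hv ?_
    change max (v x) 1 = 1 at h1
    change Real.posLog (v x) = 0
    rw [hlog, h1, Real.log_one]
  calc w x ≤ max (w x) 1 := le_max_left _ _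
    _ = Real.exp (Real.posLog (w x)) := by rw [hlog, Real.exp_log (by positivity)]
    _ ≤ _ := Real.exp_le_exp.2 (by rw [NumberField.logHeight₁_eq]; linarith)

theorem mulHeight_pow_le_of_pow_dvd (T : Finset (FinitePlace K)) {p : Polynomial K} {ξ : K}
    {n D : ℕ} {B : ℝ} (hB0 : 0 ≤ B) (hp : p ≠ 0) (hD : p.natDegree ≤ D)
    (hint : ∀ i, ∀ w ∉ T, w (p.coeff i) ≤ 1) (hfin : ∀ i, ∀ w ∈ T, w (p.coeff i) ≤ B)
    (hinf : ∀ i, ∀ w : InfinitePlace K, w (p.coeff i) ≤ B)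
    (hdvd : (Polynomial.X - Polynomial.C ξ) ^ n ∣ p) :
    Height.mulHeight₁ ξ ^ n ≤ ((D + 1) * B) ^ Module.finrank ℚ K * B ^ T.card := by
  have hlc : p.leadingCoeff ≠ 0 := Polynomial.leadingCoeff_ne_zero.2 hp
  have hna : ∀ w : FinitePlace K, IsNonarchimedean w.val := fun w x y => by
    exact FinitePlace.add_le w x y
  have hfs : (fun w : FinitePlace K => max (w ξ) 1 ^ n).HasFiniteMulSupport :=
    (hasFiniteMulSupport_max_one ξ).pow n
  have hnn : ∀ w : FinitePlace K, 0 ≤ max (w ξ) 1 ^ n * w p.leadingCoeff := fun w =>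
    mul_nonneg (by positivity) (apply_nonneg w _)
  have key : Height.mulHeight₁ ξ ^ n = (∏ v : InfinitePlace K,
      (max (v ξ) 1 ^ n * v p.leadingCoeff) ^ v.mult) *
      ∏ᶠ v : FinitePlace K, (max (v ξ) 1 ^ n * v p.leadingCoeff) := by
    rw [finprod_mul_distrib hfs
      (FinitePlace.hasFiniteMulSupport hlc), ← finprod_pow (hasFiniteMulSupport_max_one ξ)]
    simp only [mul_pow]
    rw [Finset.prod_mul_distrib, mul_mul_mul_comm, prod_abs_eq_one hlc, mul_one,
      NumberField.mulHeight₁_eq, mul_pow, ← Finset.prod_pow]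
    congr 1
    exact Finset.prod_congr rfl fun v _ => by rw [← pow_mul, ← pow_mul, mul_comm]
  rw [key]
  refine mul_le_mul ?_ ?_ (finprod_nonneg hnn) (by positivity)
  · rw [← InfinitePlace.sum_mult_eq, ← Finset.prod_pow_eq_pow_sum]
    refine Finset.prod_le_prod (fun v _ => by positivity) fun v _ => ?_
    refine pow_le_pow_left₀ (by positivity) ?_ _
    have := max_one_pow_mul_leadingCoeff_le_of_embedding v.embedding hD hdvd (B := B) fun i => by
      rw [InfinitePlace.norm_embedding_eq]; exact hinf i v
    rwa [InfinitePlace.norm_embedding_eq, InfinitePlace.norm_embedding_eq] at this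
  · rw [← Finset.prod_const]
    refine finprod_finitePlace_le_prod T _ (hfs.mul
      (FinitePlace.hasFiniteMulSupport hlc)) hnn _ (fun w hw => ?_)
      fun w hw => ?_
    · exact max_one_pow_mul_leadingCoeff_le_of_isNonarchimedean w.val (hna w) hdvd
        fun i => hfin i w hw
    · exact max_one_pow_mul_leadingCoeff_le_of_isNonarchimedean w.val (hna w) hdvd
        fun i => hint i w hw

theorem exists_root_bound (T : Finset (FinitePlace K)) (c : ℝ) (hc : 0 ≤ c) :
    ∃ C : ℝ, 1 ≤ C ∧ ∀ (p : Polynomial K) (ξ : K) (n D : ℕ) (b : ℝ), 0 ≤ b → p ≠ 0 →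
      p.natDegree ≤ D → (∀ i, ∀ w ∉ T, w (p.coeff i) ≤ 1) →
      (∀ i, ∀ w ∈ T, w (p.coeff i) ≤ Real.exp b) →
      (∀ i, ∀ w : InfinitePlace K, w (p.coeff i) ≤ Real.exp b) →
      (Polynomial.X - Polynomial.C ξ) ^ n ∣ p →
      n * (Height.logHeight₁ ξ + c) ≤ C * (b + D) := by
  refine ⟨Module.finrank ℚ K + T.card + c + 1, by
    have : (0 : ℝ) ≤ Module.finrank ℚ K + T.card := by positivity
    linarith, ?_⟩
  intro p ξ n D b hb hp hD hint hfin hinf hdvd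
  have hn : n ≤ D := by
    have := Polynomial.natDegree_le_of_dvd hdvd hp
    rw [Polynomial.natDegree_pow, Polynomial.natDegree_X_sub_C, mul_one] at this
    exact this.trans hD
  have h := mulHeight_pow_le_of_pow_dvd T (Real.exp_pos b).le hp hD hint hfin hinf hdvd
  have hpos : 0 < Height.mulHeight₁ ξ := Height.mulHeight₁_pos ξ
  have h2 := Real.log_le_log (pow_pos hpos n) h
  have hD1 : (0 : ℝ) < D + 1 := by positivity
  rw [Real.log_pow, Real.log_mul (by positivity) (by positivity), Real.log_pow, Real.log_pow,
    Real.log_mul hD1.ne' (Real.exp_pos b).ne', Real.log_exp] at h2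
  have h3 : Real.log (D + 1) ≤ D := by
    linarith [Real.log_le_sub_one_of_pos hD1]
  have h4 : (n : ℝ) * c ≤ D * c := mul_le_mul_of_nonneg_right (by exact_mod_cast hn) hc
  have h5 : (Module.finrank ℚ K : ℝ) * (Real.log (D + 1) + b) ≤ Module.finrank ℚ K * (D + b) :=
    mul_le_mul_of_nonneg_left (by linarith) (Nat.cast_nonneg _)
  have hDn : (0 : ℝ) ≤ D := Nat.cast_nonneg _
  have h6 : 0 ≤ c * b := mul_nonneg hc hb
  have h7 : (0 : ℝ) ≤ T.card * D := by positivity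
  rw [Height.logHeight₁_eq_log_mulHeight₁]
  nlinarith

theorem finitePlace_le_one_of_int (w : FinitePlace K) (x : 𝓞 K) : w (x : K) ≤ 1 := by
  rw [← FinitePlace.norm_embedding_eq]
  exact FinitePlace.norm_le_one K _ x

theorem finitePlace_lt_one_iff (w : FinitePlace K) (x : 𝓞 K) :
    w (x : K) < 1 ↔ x ∈ w.maximalIdeal.asIdeal := by
  rw [← FinitePlace.norm_embedding_eq]
  exact FinitePlace.norm_lt_one_iff_mem K _ x

theorem one_lt_absNorm_maximalIdeal (w : FinitePlace K) :
    (1 : ℝ) < Ideal.absNorm w.maximalIdeal.asIdeal := by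
  exact_mod_cast HeightOneSpectrum.one_lt_absNorm w.maximalIdeal

theorem finitePlace_le_of_mem_pow (w : FinitePlace K) {x : 𝓞 K} {e : ℕ}
    (hx : x ∈ w.maximalIdeal.asIdeal ^ e) :
    w (x : K) ≤ ((Ideal.absNorm w.maximalIdeal.asIdeal : ℝ)⁻¹) ^ e := by
  have hq := one_lt_absNorm_maximalIdeal w
  rcases eq_or_ne x 0 with rfl | h0
  · simp
  have h := FinitePlace.apply_mul_absNorm_pow_eq_one w h0
  have hfin : FiniteMultiplicity w.maximalIdeal.asIdeal (Ideal.span {x}) :=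
    FiniteMultiplicity.of_prime_left w.maximalIdeal.prime (by simpa using h0)
  have he : e ≤ multiplicity w.maximalIdeal.asIdeal (Ideal.span {x}) :=
    hfin.pow_dvd_iff_le_multiplicity.1 (Ideal.dvd_span_singleton.2 hx)
  rw [inv_pow, ← one_div, le_div_iff₀ (by positivity), ← h]
  refine mul_le_mul_of_nonneg_left ?_ (apply_nonneg w _)
  exact pow_le_pow_right₀ hq.le he

theorem exists_uniform_unit (T : Finset (FinitePlace K)) :
    ∃ M : K, M ≠ 0 ∧ (∀ w ∉ T, w M = 1) ∧ ∀ w ∈ T, w M < 1 := by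
  classical
  set I : Ideal (𝓞 K) := ∏ w ∈ T, w.maximalIdeal.asIdeal with hI
  have hI0 : I ≠ 0 := Finset.prod_ne_zero_iff.2 fun w _ => w.maximalIdeal.ne_bot
  have hImem : I ∈ nonZeroDivisors (Ideal (𝓞 K)) := mem_nonZeroDivisors_of_ne_zero hI0
  have hcl : ClassGroup.mk0 ((⟨I, hImem⟩ : nonZeroDivisors (Ideal (𝓞 K))) ^
      Fintype.card (ClassGroup (𝓞 K))) = 1 := by
    rw [map_pow, pow_card_eq_one]
  have hpos : Fintype.card (ClassGroup (𝓞 K)) ≠ 0 := Fintype.card_ne_zero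
  rw [ClassGroup.mk0_eq_one_iff] at hcl
  obtain ⟨⟨m, hm⟩⟩ := hcl
  rw [SubmonoidClass.coe_pow] at hm
  change I ^ _ = Ideal.span {m} at hm
  have hm0 : m ≠ 0 := by
    rintro rfl
    rw [Ideal.span_singleton_eq_bot.2 rfl] at hm
    exact hI0 (pow_eq_zero_iff hpos |>.1 hm)
  have hmem : ∀ w : FinitePlace K, m ∈ w.maximalIdeal.asIdeal ↔ w ∈ T := by
    intro w
    rw [← Ideal.dvd_span_singleton, ← hm, w.maximalIdeal.prime.dvd_pow_iff_dvd hpos, hI,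
      w.maximalIdeal.prime.dvd_finsetProd_iff]
    constructor
    · rintro ⟨v, hv, hd⟩
      have : w.maximalIdeal.asIdeal = v.maximalIdeal.asIdeal :=
        ((v.maximalIdeal.isMaximal.eq_of_le w.maximalIdeal.isPrime.ne_top
          (Ideal.dvd_iff_le.1 hd))).symm
      have h2 : w = v := FinitePlace.maximalIdeal_injective (HeightOneSpectrum.ext this)
      exact h2 ▸ hv
    · exact fun hw => ⟨w, hw, dvd_rfl⟩
  refine ⟨(m : K), by exact_mod_cast hm0, fun w hw => ?_, fun w hw => ?_⟩
  · refine le_antisymm (finitePlace_le_one_of_int w m) (not_lt.1 fun h => hw ?_)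
    exact (hmem w).1 ((finitePlace_lt_one_iff w m).1 h)
  · exact (finitePlace_lt_one_iff w m).2 ((hmem w).2 hw)

/-- The `k`-th real coordinate at an infinite place. -/
noncomputable def placeCoord (k : ℕ) (z : ℂ) : ℝ := if k = 0 then z.re else z.im

theorem abs_placeCoord_le (k : ℕ) (z : ℂ) : |placeCoord k z| ≤ ‖z‖ := by
  unfold placeCoord
  split_ifs
  · exact Complex.abs_re_le_norm z
  · exact Complex.abs_im_le_norm z

theorem placeCoord_sub (k : ℕ) (z z' : ℂ) :
    placeCoord k (z - z') = placeCoord k z - placeCoord k z' := by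
  unfold placeCoord
  split_ifs <;> simp

theorem infinitePlace_le_two_mul (w : InfinitePlace K) (x : K) {δ : ℝ}
    (h : ∀ k : Fin w.mult, |placeCoord k (w.embedding x)| ≤ δ) : w x ≤ 2 * δ := by
  have hδ : 0 ≤ δ := (abs_nonneg _).trans (h ⟨0, w.mult_pos⟩)
  have h0 : |(w.embedding x).re| ≤ δ := by simpa [placeCoord] using h ⟨0, w.mult_pos⟩
  have h1 : |(w.embedding x).im| ≤ δ := by
    by_cases hw : w.IsReal
    · rw [← InfinitePlace.embedding_of_isReal_apply hw, Complex.ofReal_im, abs_zero]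
      exact hδ
    · have h2 : 1 < w.mult := by
        rw [InfinitePlace.mult, if_neg hw]
        exact one_lt_two
      simpa [placeCoord] using h ⟨1, h2⟩
  rw [← InfinitePlace.norm_embedding_eq]
  linarith [Complex.norm_le_abs_re_add_abs_im (w.embedding x)]

theorem abs_sub_le_of_floor_eq {A δ s t : ℝ} (hδ : 0 < δ) (hs : -A ≤ s) (ht : -A ≤ t)
    (h : ⌊(s + A) / δ⌋₊ = ⌊(t + A) / δ⌋₊) : |s - t| ≤ δ := by
  have key : ∀ s t : ℝ, -A ≤ t → ⌊(s + A) / δ⌋₊ = ⌊(t + A) / δ⌋₊ → s - t ≤ δ := by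
    intro s t ht h
    have h1 := Nat.lt_floor_add_one ((s + A) / δ)
    have h2 := Nat.floor_le (a := (t + A) / δ) (div_nonneg (by linarith) hδ.le)
    rw [h] at h1
    have h3 : (s + A) / δ < (t + A) / δ + 1 := by linarith
    rw [div_lt_iff₀ hδ, add_mul, div_mul_cancel₀ _ hδ.ne'] at h3
    linarith
  rw [abs_le]
  constructor <;> linarith [key s t ht h, key t s hs h.symm]

theorem exists_pow_inv_le {q β : ℝ} (hq : 1 < q) (h0 : 0 < β) (h1 : β ≤ 1) :
    ∃ e : ℕ, q⁻¹ ^ e ≤ β ∧ q ^ e ≤ q / β := by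
  obtain ⟨n, hn1, hn2⟩ := exists_nat_pow_near_of_lt_one h0 h1 (inv_pos.2 (by linarith))
    (inv_lt_one_of_one_lt₀ hq)
  refine ⟨n + 1, hn1.le, ?_⟩
  have hqn : 0 < q ^ n := by positivity
  rw [inv_pow] at hn2
  rw [pow_succ', le_div_iff₀ h0, mul_assoc]
  refine mul_le_of_le_one_right (by linarith) ?_
  calc q ^ n * β ≤ q ^ n * (q ^ n)⁻¹ := mul_le_mul_of_nonneg_left hn2 hqn.le
    _ = 1 := mul_inv_cancel₀ (ne_of_gt hqn)

/-- The pigeonhole form of Minkowski's theorem for integral vectors subject to congruences. -/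
theorem exists_int_vec_le (T : Finset (FinitePlace K)) (ι : Type*) [Fintype ι] [Nonempty ι]
    (L : InfinitePlace K → Matrix ι ι K) (L' : FinitePlace K → Matrix ι ι (𝓞 K)) :
    ∃ C : ℝ, 0 < C ∧ ∀ (b : InfinitePlace K → ι → ℝ) (β : FinitePlace K → ι → ℝ),
      (∀ w i, 0 < b w i) → (∀ w i, 0 < β w i ∧ β w i ≤ 1) →
      C ≤ (∏ w, (∏ i, b w i) ^ w.mult) * ∏ w ∈ T, ∏ i, β w i →
      ∃ x : ι → 𝓞 K, x ≠ 0 ∧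
        (∀ w i, w ((L w).mulVec (fun l => (x l : K)) i) ≤ b w i) ∧
        ∀ w ∈ T, ∀ i, w (((L' w).mulVec x i : 𝓞 K) : K) ≤ β w i := by
  classical
  set J := Module.Free.ChooseBasisIndex ℤ (𝓞 K) with hJ
  set ω : J → 𝓞 K := fun j => RingOfIntegers.basis K j with hω
  set N := Fintype.card ι with hN
  have hNpos : 0 < N := Fintype.card_pos
  have hJcard : Fintype.card J = Module.finrank ℚ K := by
    rw [← RingOfIntegers.rank, Module.finrank_eq_card_chooseBasisIndex]
  set c : ℝ := 1 + ∑ w : InfinitePlace K, ∑ i, ∑ l, ∑ j, w (L w i l) * w (ω j : K) with hc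
  have hc1 : 1 ≤ c := le_add_of_nonneg_right (Finset.sum_nonneg fun w _ =>
    Finset.sum_nonneg fun i _ => Finset.sum_nonneg fun l _ => Finset.sum_nonneg fun j _ => by
      positivity)
  have hcb : ∀ (w : InfinitePlace K) i, ∑ l, ∑ j, w (L w i l) * w (ω j : K) ≤ c := by
    intro w i
    have h1 := Finset.single_le_sum (f := fun w : InfinitePlace K =>
      ∑ i, ∑ l, ∑ j, w (L w i l) * w (ω j : K)) (fun w _ => Finset.sum_nonneg fun i _ =>
      Finset.sum_nonneg fun l _ => Finset.sum_nonneg fun j _ => by positivity) (Finset.mem_univ w)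
    have h2 := Finset.single_le_sum (f := fun i : ι =>
      ∑ l, ∑ j, w (L w i l) * w (ω j : K)) (fun i _ =>
      Finset.sum_nonneg fun l _ => Finset.sum_nonneg fun j _ => by positivity) (Finset.mem_univ i)
    have h12 := h2.trans h1
    rw [hc]
    exact h12.trans (le_add_of_nonneg_left zero_le_one)
  set q : FinitePlace K → ℝ := fun w => Ideal.absNorm w.maximalIdeal.asIdeal with hq
  have hq1 : ∀ w, 1 < q w := one_lt_absNorm_maximalIdeal
  refine ⟨(5 * c) ^ (Module.finrank ℚ K * N) * ∏ w ∈ T, q w ^ N, ?_, ?_⟩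
  · refine mul_pos (by positivity) (Finset.prod_pos fun w _ => pow_pos ?_ _)
    linarith [hq1 w]
  intro b β hb hβ hC
  choose e he1 he2 using fun w i => exists_pow_inv_le (hq1 w) (hβ w i).1 (hβ w i).2
  obtain ⟨B, hB⟩ := exists_nat_ge (1 + ∑ w : InfinitePlace K, ∑ i, b w i)
  have hB1 : (1 : ℝ) ≤ B := le_trans (le_add_of_nonneg_right (Finset.sum_nonneg fun w _ =>
    Finset.sum_nonneg fun i _ => (hb w i).le)) hB
  have hBb : ∀ w i, b w i ≤ B := by
    intro w i
    have h1 := Finset.single_le_sum (f := fun w : InfinitePlace K => ∑ i, b w i)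
      (fun w _ => Finset.sum_nonneg fun i _ => (hb w i).le) (Finset.mem_univ w)
    have h2 := Finset.single_le_sum (f := fun i : ι => b w i)
      (fun i _ => (hb w i).le) (Finset.mem_univ i)
    exact (h2.trans h1).trans ((le_add_of_nonneg_left zero_le_one).trans hB)
  set pt : (ι → J → Fin (B + 1)) → ι → 𝓞 K := fun z l => ∑ j, ((z l j : ℕ) : ℤ) • ω j with hpt
  set A : ℝ := c * B with hA
  have hval : ∀ z (w : InfinitePlace K) i, w ((L w).mulVec (fun l => (pt z l : K)) i) ≤ A := by
    intro z w i
    have hz : ∀ l j, w ((((z l j : ℕ) : ℤ) • ω j : 𝓞 K) : K) ≤ B * w (ω j : K) := by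
      intro l j
      rw [natCast_zsmul, nsmul_eq_mul]
      push_cast
      rw [map_mul]
      refine mul_le_mul_of_nonneg_right ?_ (apply_nonneg w _)
      rw [← InfinitePlace.norm_embedding_eq, map_natCast, Complex.norm_natCast]
      exact_mod_cast Nat.le_of_lt_succ (z l j).2
    calc w ((L w).mulVec (fun l => (pt z l : K)) i)
        ≤ ∑ l, w (L w i l * (pt z l : K)) := by
          exact w.1.sum_le _ _
      _ ≤ ∑ l, ∑ j, (w (L w i l) * w (ω j : K)) * B := by
          refine Finset.sum_le_sum fun l _ => ?_
          rw [map_mul]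
          calc w (L w i l) * w (pt z l : K)
              ≤ w (L w i l) * ∑ j, B * w (ω j : K) := by
                refine mul_le_mul_of_nonneg_left ?_ (apply_nonneg w _)
                rw [hpt]
                simp only [map_sum]
                exact (w.1.sum_le _ _).trans (Finset.sum_le_sum fun j _ => hz l j)
            _ = _ := by
                rw [Finset.mul_sum]
                exact Finset.sum_congr rfl fun j _ => by ring
      _ = (∑ l, ∑ j, w (L w i l) * w (ω j : K)) * B := by
          simp only [Finset.sum_mul]
      _ ≤ A := mul_le_mul_of_nonneg_right (hcb w i) (by linarith)
  set M : InfinitePlace K → ι → ℕ := fun w i => ⌊2 * A / (b w i / 2)⌋₊ + 1 with hM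
  have hcoord : ∀ z (w : InfinitePlace K) i k, |placeCoord k (w.embedding ((L w).mulVec (fun l => (pt z l : K)) i))|
      ≤ A := fun z w i k => (abs_placeCoord_le _ _).trans (by
        rw [InfinitePlace.norm_embedding_eq]; exact hval z w i)
  have hkey : ∀ z (w : InfinitePlace K) i k, ⌊(placeCoord k (w.embedding ((L w).mulVec
      (fun l => (pt z l : K)) i)) + A) / (b w i / 2)⌋₊ < M w i := by
    intro z w i k
    refine Nat.lt_succ_of_le (Nat.floor_le_floor ?_)
    refine div_le_div_of_nonneg_right ?_ (half_pos (hb w i)).le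
    linarith [(abs_le.1 (hcoord z w i k)).2]
  let Y := ((w : InfinitePlace K) → (i : ι) → Fin w.mult → Fin (M w i)) ×
    ((w : T) → (i : ι) → 𝓞 K ⧸ w.1.maximalIdeal.asIdeal ^ e w.1 i)
  let F : (ι → J → Fin (B + 1)) → Y := fun z =>
    ⟨fun w i k => ⟨_, hkey z w i k⟩, fun w i => Ideal.Quotient.mk _ ((L' w.1).mulVec (pt z) i)⟩
  have hquot : ∀ w : FinitePlace K, ∀ i,
      Finite (𝓞 K ⧸ w.maximalIdeal.asIdeal ^ e w i) := fun w i =>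
    Ideal.finiteQuotientOfFreeOfNeBot _ (pow_ne_zero _ w.maximalIdeal.ne_bot)
  have hYcard : (Nat.card Y : ℝ) = (∏ w : InfinitePlace K, (∏ i, (M w i : ℝ)) ^ w.mult) *
      ∏ w ∈ T, ∏ i, q w ^ e w i := by
    have h1 : ∀ w : T, ∀ i, Nat.card (𝓞 K ⧸ w.1.maximalIdeal.asIdeal ^ e w.1 i) =
        Ideal.absNorm w.1.maximalIdeal.asIdeal ^ e w.1 i := fun w i => by
      rw [← map_pow, Ideal.absNorm_apply]
      rfl
    rw [Nat.card_prod, Nat.card_pi, Nat.card_pi]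
    simp only [Nat.card_pi, h1, Nat.card_fin, Finset.prod_const, Finset.card_univ,
      Fintype.card_fin]
    push_cast
    congr 1
    · exact Finset.prod_congr rfl fun w _ => by rw [Finset.prod_pow]
    · exact Finset.prod_coe_sort T fun w => ∏ i, q w ^ e w i
  have hYle : (Nat.card Y : ℝ) ≤ (B : ℝ) ^ (Module.finrank ℚ K * N) := by
    have hMle : ∀ w i, (M w i : ℝ) ≤ 5 * A / b w i := by
      intro w i
      have h1 := Nat.floor_le (a := 2 * A / (b w i / 2))
        (div_nonneg (by positivity) (half_pos (hb w i)).le)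
      have h2 : 2 * A / (b w i / 2) = 4 * A / b w i := by
        rw [div_div_eq_mul_div]
        ring
      have h3 : 1 ≤ A / b w i := by
        rw [one_le_div (hb w i)]
        exact (hBb w i).trans (le_mul_of_one_le_left (by linarith) hc1)
      have h4 : 5 * A / b w i = 4 * A / b w i + A / b w i := by ring
      rw [hM]
      push_cast
      rw [h4]
      linarith
    have hbpos : 0 < ∏ w : InfinitePlace K, (∏ i, b w i) ^ w.mult :=
      Finset.prod_pos fun w _ => pow_pos (Finset.prod_pos fun i _ => hb w i) _
    have hβpos : 0 < ∏ w ∈ T, ∏ i, β w i :=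
      Finset.prod_pos fun w _ => Finset.prod_pos fun i _ => (hβ w i).1
    have h1 : ∏ w : InfinitePlace K, (∏ i, (M w i : ℝ)) ^ w.mult ≤
        (5 * A) ^ (Module.finrank ℚ K * N) / ∏ w : InfinitePlace K, (∏ i, b w i) ^ w.mult := by
      calc _ ≤ ∏ w : InfinitePlace K, (∏ i, 5 * A / b w i) ^ w.mult := by
            refine Finset.prod_le_prod (fun w _ => by positivity) fun w _ => ?_
            refine pow_le_pow_left₀ (by positivity) ?_ _
            exact Finset.prod_le_prod (fun i _ => by positivity) fun i _ => hMle w i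
        _ = _ := by
            simp only [Finset.prod_div_distrib, div_pow, Finset.prod_const, Finset.card_univ]
            rw [← InfinitePlace.sum_mult_eq, mul_comm (∑ w : InfinitePlace K, w.mult), pow_mul,
              Finset.prod_pow_eq_pow_sum]
    have h2 : ∏ w ∈ T, ∏ i, q w ^ e w i ≤ (∏ w ∈ T, q w ^ N) / ∏ w ∈ T, ∏ i, β w i := by
      rw [← Finset.prod_div_distrib]
      refine Finset.prod_le_prod (fun w _ => Finset.prod_nonneg fun i _ => pow_nonneg
        (by linarith [hq1 w]) _) fun w _ => ?_
      calc _ ≤ ∏ i, q w / β w i := Finset.prod_le_prod (fun i _ => pow_nonneg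
            (by linarith [hq1 w]) _) fun i _ => he2 w i
        _ = _ := by
          simp only [Finset.prod_div_distrib, Finset.prod_const, Finset.card_univ]
          rfl
    have hqpos : 0 < ∏ w ∈ T, q w ^ N :=
      Finset.prod_pos fun w _ => pow_pos (by linarith [hq1 w]) _
    rw [hYcard]
    calc _ ≤ ((5 * A) ^ (Module.finrank ℚ K * N) /
            ∏ w : InfinitePlace K, (∏ i, b w i) ^ w.mult) *
            ((∏ w ∈ T, q w ^ N) / ∏ w ∈ T, ∏ i, β w i) := by
          refine mul_le_mul h1 h2 (Finset.prod_nonneg fun w _ => Finset.prod_nonneg fun i _ =>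
            pow_nonneg (by linarith [hq1 w]) _) (by positivity)
      _ = (B : ℝ) ^ (Module.finrank ℚ K * N) * (((5 * c) ^ (Module.finrank ℚ K * N) *
            ∏ w ∈ T, q w ^ N) /
            ((∏ w, (∏ i, b w i) ^ w.mult) * ∏ w ∈ T, ∏ i, β w i)) := by
          rw [hA, ← mul_assoc, mul_pow]
          ring
      _ ≤ (B : ℝ) ^ (Module.finrank ℚ K * N) * 1 := by
          refine mul_le_mul_of_nonneg_left ?_ (by positivity)
          exact (div_le_one (mul_pos hbpos hβpos)).2 hC
      _ = _ := mul_one _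
  have hXcard : (Nat.card (ι → J → Fin (B + 1)) : ℝ) =
      ((B : ℝ) + 1) ^ (Module.finrank ℚ K * N) := by
    simp only [Nat.card_pi, Nat.card_fin, Finset.prod_const, Finset.card_univ, hJcard]
    push_cast
    rw [pow_mul]
  have hnotinj : ¬ Function.Injective F := by
    intro hinj
    have h1 : (Nat.card (ι → J → Fin (B + 1)) : ℝ) ≤ Nat.card Y := by
      exact_mod_cast Nat.card_le_card_of_injective F hinj
    have h2 : (B : ℝ) ^ (Module.finrank ℚ K * N) < ((B : ℝ) + 1) ^ (Module.finrank ℚ K * N) :=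
      pow_lt_pow_left₀ (by linarith) (by linarith)
        (Nat.mul_pos Module.finrank_pos hNpos).ne'
    linarith
  rw [Function.not_injective_iff] at hnotinj
  obtain ⟨z, z', hFz, hne⟩ := hnotinj
  refine ⟨pt z - pt z', ?_, ?_, ?_⟩
  · intro h0
    apply hne
    funext l j
    have h1 : pt z l - pt z' l = 0 := congrFun h0 l
    have h2 : ∑ j, (((z l j : ℕ) : ℤ) - ((z' l j : ℕ) : ℤ)) • RingOfIntegers.basis K j = 0 := by
      rw [← h1, hpt]
      simp only [sub_smul, Finset.sum_sub_distrib, hω]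
    have h3 := Fintype.linearIndependent_iff.1 (RingOfIntegers.basis K).linearIndependent _ h2 j
    exact Fin.ext (by omega)
  · intro w i
    have hlin : (L w).mulVec (fun l => (((pt z - pt z') l : 𝓞 K) : K)) i =
        (L w).mulVec (fun l => (pt z l : K)) i - (L w).mulVec (fun l => (pt z' l : K)) i := by
      rw [← Pi.sub_apply, ← Matrix.mulVec_sub]
      congr 2
    rw [hlin]
    have := infinitePlace_le_two_mul w ((L w).mulVec (fun l => (pt z l : K)) i -
      (L w).mulVec (fun l => (pt z' l : K)) i) (δ := b w i / 2) fun k => by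
      rw [map_sub, placeCoord_sub]
      refine abs_sub_le_of_floor_eq (A := A) (half_pos (hb w i)) (abs_le.1 (hcoord z w i k)).1
        (abs_le.1 (hcoord z' w i k)).1 ?_
      exact congrArg Fin.val (congrFun (congrFun (congrFun (congrArg Prod.fst hFz) w) i) k)
    linarith
  · intro w hw i
    refine (finitePlace_le_of_mem_pow w (e := e w i) ?_).trans (he1 w i)
    rw [Matrix.mulVec_sub, Pi.sub_apply, ← Ideal.Quotient.eq]
    exact congrFun (congrFun (congrArg Prod.snd hFz) ⟨w, hw⟩) i

theorem prod_places_eq_one (T : Finset (FinitePlace K)) {M : K} (hM : M ≠ 0)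
    (h1 : ∀ w ∉ T, w M = 1) : (∏ w : InfinitePlace K, w M ^ w.mult) * ∏ w ∈ T, w M = 1 := by
  have hpos : 0 < (∏ w : InfinitePlace K, w M ^ w.mult) * ∏ w ∈ T, w M :=
    mul_pos (Finset.prod_pos fun w _ => pow_pos (w.pos_iff.2 hM) _)
      (Finset.prod_pos fun w _ => w.pos_iff.2 hM)
  refine le_antisymm ?_ (one_le_prod_places T hM fun w hw => (h1 w hw).le)
  have h := one_le_prod_places T (inv_ne_zero hM) fun w hw => by rw [map_inv₀, h1 w hw, inv_one]
  simp only [map_inv₀, inv_pow, Finset.prod_inv_distrib] at h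
  rw [← mul_inv] at h
  exact (one_le_inv₀ hpos).1 h

/-- Minkowski's first theorem for parallelepipeds over the ring of `T`-integers. -/
theorem exists_minkowski (T : Finset (FinitePlace K)) (ι : Type*) [Fintype ι] [Nonempty ι]
    (L : InfinitePlace K → Matrix ι ι K) (L' : FinitePlace K → Matrix ι ι K) :
    ∃ C : ℝ, 0 < C ∧ ∀ (b : InfinitePlace K → ι → ℝ) (b' : FinitePlace K → ι → ℝ),
      (∀ w i, 0 < b w i) → (∀ w ∈ T, ∀ i, 0 < b' w i) →
      C ≤ (∏ w, (∏ i, b w i) ^ w.mult) * ∏ w ∈ T, ∏ i, b' w i →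
      ∃ x : ι → K, x ≠ 0 ∧ (∀ i, ∀ w : FinitePlace K, w ∉ T → w (x i) ≤ 1) ∧
        (∀ w i, w ((L w).mulVec x i) ≤ b w i) ∧
        ∀ w ∈ T, ∀ i, w ((L' w).mulVec x i) ≤ b' w i := by
  classical
  obtain ⟨⟨m, hm0⟩, hm⟩ := IsLocalization.exist_integer_multiples (nonZeroDivisors (𝓞 K))
    (T ×ˢ (Finset.univ : Finset (ι × ι))) fun t => L' t.1 t.2.1 t.2.2
  have hmK : (m : K) ≠ 0 := by
    exact_mod_cast nonZeroDivisors.ne_zero hm0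
  have hm' : ∀ w : FinitePlace K, ∀ i j, ∃ y : 𝓞 K, w ∈ T → (y : K) = m * L' w i j := by
    intro w i j
    by_cases hw : w ∈ T
    · obtain ⟨y, hy⟩ := hm (w, i, j) (by simp [hw])
      exact ⟨y, fun _ => hy.trans (Algebra.smul_def _ _)⟩
    · exact ⟨0, fun h => absurd h hw⟩
  choose L₁ hL₁ using hm'
  obtain ⟨C, hC0, hC⟩ := exists_int_vec_le T ι L fun w => Matrix.of (L₁ w)
  obtain ⟨M, hM0, hM1, hMT⟩ := exists_uniform_unit T
  set N := Fintype.card ι with hN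
  have hmpos : 0 < ∏ w ∈ T, w (m : K) ^ N :=
    Finset.prod_pos fun w _ => pow_pos (w.pos_iff.2 hmK) _
  refine ⟨C / ∏ w ∈ T, w (m : K) ^ N, div_pos hC0 hmpos, fun b b' hb hb' hprod => ?_⟩
  have hs : ∃ s : ℕ, ∀ w ∈ T, ∀ i, w (m : K) * w M ^ s * b' w i ≤ 1 := by
    have h1 : ∀ᶠ s : ℕ in Filter.atTop, ∀ w ∈ T, ∀ i, w (m : K) * w M ^ s * b' w i ≤ 1 := by
      rw [Filter.eventually_all_finset]
      intro w hw
      rw [Filter.eventually_all]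
      intro i
      have h2 : Filter.Tendsto (fun s : ℕ => w (m : K) * w M ^ s * b' w i) Filter.atTop
          (nhds (w (m : K) * 0 * b' w i)) :=
        ((tendsto_pow_atTop_nhds_zero_of_lt_one (apply_nonneg w M) (hMT w hw)).const_mul
          _).mul_const _
      rw [mul_zero, zero_mul] at h2
      exact (h2.eventually_lt_const one_pos).mono fun s hs => hs.le
    exact h1.exists
  obtain ⟨s, hs⟩ := hs
  have hMpos : ∀ w : FinitePlace K, 0 < w M := fun w => w.pos_iff.2 hM0
  have hMpos' : ∀ w : InfinitePlace K, 0 < w M := fun w => w.pos_iff.2 hM0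
  have hmwpos : ∀ w : FinitePlace K, 0 < w (m : K) := fun w => w.pos_iff.2 hmK
  obtain ⟨x, hx0, hxi, hxT⟩ := hC (fun w i => w M ^ s * b w i)
    (fun w i => if w ∈ T then w (m : K) * w M ^ s * b' w i else 1)
    (fun w i => mul_pos (pow_pos (hMpos' w) _) (hb w i))
    (fun w i => by
      split_ifs with hw
      · exact ⟨mul_pos (mul_pos (hmwpos w) (pow_pos (hMpos w) _)) (hb' w hw i), hs w hw i⟩
      · exact ⟨one_pos, le_rfl⟩)
    (by
      have h1 : ∏ w : InfinitePlace K, (∏ i, w M ^ s * b w i) ^ w.mult =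
          (∏ w : InfinitePlace K, w M ^ w.mult) ^ (s * N) *
            ∏ w : InfinitePlace K, (∏ i, b w i) ^ w.mult := by
        rw [← Finset.prod_pow, ← Finset.prod_mul_distrib]
        refine Finset.prod_congr rfl fun w _ => ?_
        rw [Finset.prod_mul_distrib, Finset.prod_const, Finset.card_univ, mul_pow, ← hN]
        ring
      have h2 : (∏ w ∈ T, ∏ i, if w ∈ T then w (m : K) * w M ^ s * b' w i else 1) =
          (∏ w ∈ T, w (m : K) ^ N) * (∏ w ∈ T, w M) ^ (s * N) * ∏ w ∈ T, ∏ i, b' w i := by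
        rw [← Finset.prod_pow, ← Finset.prod_mul_distrib, ← Finset.prod_mul_distrib]
        refine Finset.prod_congr rfl fun w hw => ?_
        simp only [if_pos hw]
        rw [Finset.prod_mul_distrib, Finset.prod_const, Finset.card_univ, mul_pow, ← hN]
        ring
      rw [h1, h2]
      rw [div_le_iff₀ hmpos] at hprod
      refine hprod.trans (le_of_eq ?_)
      have h3 := congrArg (· ^ (s * N)) (prod_places_eq_one T hM0 hM1)
      simp only [one_pow, mul_pow] at h3
      linear_combination (-((∏ w, (∏ i, b w i) ^ w.mult) * (∏ w ∈ T, ∏ i, b' w i) *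
        ∏ w ∈ T, w (m : K) ^ N)) * h3)
  have hMs : M ^ s ≠ 0 := pow_ne_zero _ hM0
  have hsmul : ∀ A : Matrix ι ι K, ∀ i, A.mulVec (fun l => (M ^ s)⁻¹ * (x l : K)) i =
      (M ^ s)⁻¹ * A.mulVec (fun l => (x l : K)) i := by
    intro A i
    have := congrFun (Matrix.mulVec_smul A ((M ^ s)⁻¹) (fun l => (x l : K))) i
    simpa [Pi.smul_def] using this
  refine ⟨fun l => (M ^ s)⁻¹ * (x l : K), ?_, ?_, ?_, ?_⟩
  · intro h0
    apply hx0
    funext l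
    have h1 := (mul_eq_zero.1 (congrFun h0 l)).resolve_left (inv_ne_zero hMs)
    exact_mod_cast h1
  · intro i w hw
    rw [map_mul, map_inv₀, map_pow, hM1 w hw, one_pow, inv_one, one_mul]
    exact finitePlace_le_one_of_int w _
  · intro w i
    rw [hsmul, map_mul, map_inv₀, map_pow, inv_mul_le_iff₀ (pow_pos (hMpos' w) _)]
    exact hxi w i
  · intro w hw i
    have h1 := hxT w hw i
    rw [if_pos hw] at h1
    have h2 : (((Matrix.of (L₁ w)).mulVec x i : 𝓞 K) : K) =
        m * (L' w).mulVec (fun l => (x l : K)) i := by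
      simp only [Matrix.mulVec, dotProduct, Matrix.of_apply, map_sum, map_mul, Finset.mul_sum,
        hL₁ w _ _ hw, mul_assoc]
    rw [h2, map_mul, mul_assoc, mul_le_mul_iff_right₀ (hmwpos w)] at h1
    rw [hsmul, map_mul, map_inv₀, map_pow, inv_mul_le_iff₀ (pow_pos (hMpos w) _)]
    exact h1

theorem infinitePlace_le_house (w : InfinitePlace K) (x : K) : w x ≤ house x := by
  rw [← InfinitePlace.norm_embedding_eq]
  exact norm_embedding_le_house x _

theorem house_le_of_forall_infinitePlace {x : K} {B : ℝ} (h : ∀ w : InfinitePlace K, w x ≤ B) :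
    house x ≤ B := by
  have hB : 0 ≤ B := (apply_nonneg _ _).trans (h (Classical.arbitrary _))
  exact (pi_norm_le_iff_of_nonneg hB).2 fun σ => h (InfinitePlace.mk σ)

/-- Siegel's lemma. -/
theorem exists_siegel_vec (K : Type*) [Field K] [NumberField K] :
    ∃ C : ℝ, 1 ≤ C ∧ ∀ (ι κ : Type) [Fintype ι] [Fintype κ]
      (A : κ → ι → 𝓞 K) (b : ℝ), 0 ≤ b → Nonempty ι → 2 * Fintype.card κ ≤ Fintype.card ι →
      Fintype.card ι ≤ Real.exp b → (∀ i j, ∀ w : InfinitePlace K, w (A i j : K) ≤ Real.exp b) →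
      ∃ x : ι → 𝓞 K, x ≠ 0 ∧ (∀ j, ∀ w : InfinitePlace K, w (x j : K) ≤ Real.exp (C * (b + 1))) ∧
        ∀ i, ∑ j, A i j * x j = 0 := by
  classical
  obtain ⟨c, hc⟩ : ∃ c : ℝ, ∀ (ι κ : Type) [Fintype ι] [Fintype κ] (a : Matrix κ ι (𝓞 K))
      (_ : a ≠ 0) (_ : 0 < Fintype.card κ) (_ : Fintype.card κ < Fintype.card ι) (A : ℝ)
      (_ : ∀ k l, house (algebraMap (𝓞 K) K (a k l)) ≤ A) (_ : 0 ≤ A),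
      ∃ ξ : ι → 𝓞 K, ξ ≠ 0 ∧ a.mulVec ξ = 0 ∧ ∀ l, house (ξ l).1 ≤
        c * ((c * (Fintype.card ι : ℕ) * A) ^
          (((Fintype.card κ : ℕ) : ℝ) / ((Fintype.card ι : ℕ) - (Fintype.card κ : ℕ)))) :=
    ⟨_, fun ι κ _ _ a ha h0 hlt A hA hA0 =>
      NumberField.house.exists_ne_zero_int_vec_house_le K a ha h0 hlt rfl hA rfl⟩
  set c₀ : ℝ := |c| + 1 with hc₀
  have hc1 : 1 ≤ c₀ := le_add_of_nonneg_left (abs_nonneg c)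
  have hcc : |c| ≤ c₀ := by linarith
  have hlog : 0 ≤ Real.log c₀ := Real.log_nonneg hc1
  refine ⟨2 * Real.log c₀ + 2, by linarith, fun ι κ _ _ A b hb hι hcard hle hA => ?_⟩
  have hexp1 : 1 ≤ Real.exp ((2 * Real.log c₀ + 2) * (b + 1)) :=
    Real.one_le_exp (by positivity)
  by_cases hA0 : Matrix.of A = 0
  · refine ⟨fun _ => 1, fun h => one_ne_zero (congrFun h (Classical.choice hι)),
      fun j w => by simpa using hexp1, fun i => Finset.sum_eq_zero fun j _ => ?_⟩
    have : A i j = 0 := congrFun (congrFun hA0 i) j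
    rw [this, zero_mul]
  · have hκ : 0 < Fintype.card κ := by
      refine Fintype.card_pos_iff.2 (not_isEmpty_iff.1 fun h => hA0 ?_)
      ext i
      exact h.elim i
    have hlt : Fintype.card κ < Fintype.card ι := by omega
    obtain ⟨ξ, hξ0, hξ, hξb⟩ := hc ι κ (Matrix.of A) hA0 hκ hlt (Real.exp b)
      (fun k l => house_le_of_forall_infinitePlace (hA k l)) (Real.exp_pos b).le
    refine ⟨ξ, hξ0, fun j w => ?_, fun i => congrFun hξ i⟩
    refine (infinitePlace_le_house w _).trans ((hξb j).trans ?_)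
    have hq : (2 : ℝ) * Fintype.card κ ≤ Fintype.card ι := by exact_mod_cast hcard
    have hκ' : (0 : ℝ) < Fintype.card κ := by exact_mod_cast hκ
    set y : ℝ := ((Fintype.card κ : ℕ) : ℝ) / ((Fintype.card ι : ℕ) - (Fintype.card κ : ℕ)) with hy
    have hy0 : 0 ≤ y := div_nonneg hκ'.le (by linarith)
    have hy1 : y ≤ 1 := (div_le_one (by linarith)).2 (by linarith)
    set X := c * (Fintype.card ι : ℕ) * Real.exp b with hX
    have hXle : |X| ≤ c₀ * Real.exp b * Real.exp b := by
      rw [hX, abs_mul, abs_mul, Real.abs_exp, Nat.abs_cast]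
      gcongr
    have hB1 : 1 ≤ c₀ * Real.exp b * Real.exp b := by
      have := Real.one_le_exp hb
      nlinarith [mul_nonneg (sub_nonneg.2 hc1) (sub_nonneg.2 this)]
    have hpow : |X ^ y| ≤ c₀ * Real.exp b * Real.exp b := by
      calc |X ^ y| ≤ |X| ^ y := Real.abs_rpow_le_abs_rpow X y
        _ ≤ (c₀ * Real.exp b * Real.exp b) ^ y := Real.rpow_le_rpow (abs_nonneg X) hXle hy0
        _ ≤ (c₀ * Real.exp b * Real.exp b) ^ (1 : ℝ) := Real.rpow_le_rpow_of_exponent_le hB1 hy1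
        _ = _ := Real.rpow_one _
    calc c * X ^ y ≤ |c| * |X ^ y| := by rw [← abs_mul]; exact le_abs_self _
      _ ≤ c₀ * (c₀ * Real.exp b * Real.exp b) := by gcongr
      _ = Real.exp (2 * Real.log c₀ + 2 * b) := by
          rw [Real.exp_add, two_mul, two_mul, Real.exp_add, Real.exp_add,
            Real.exp_log (by linarith)]
          ring
      _ ≤ _ := Real.exp_le_exp.2 (by nlinarith [mul_nonneg hlog hb])

/-- A number field with a nonempty finite set of finite places carries the arithmetic input. -/
theorem exists_placeSystem (T : Finset (FinitePlace K)) (hT : T.Nonempty) :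
    ∃ (N : ℕ) (PS : PlaceSystem K (Fin N)), ∀ x, x ∈ PS.ring ↔ ∀ w ∉ T, w x ≤ 1 := by
  classical
  set I := InfinitePlace K ⊕ T with hI
  set e : Fin (Fintype.card I) ≃ I := (Fintype.equivFin I).symm with he
  set a : I → AbsoluteValue K ℝ := Sum.elim (fun w => w.1) (fun w => w.1.1) with ha
  set mu : I → ℕ := Sum.elim (fun w => w.mult) (fun _ => 1) with hmu
  obtain ⟨w₀, hw₀⟩ := hT
  set c : ℝ := ((Height.totalWeight K : ℕ) : ℝ) with hc
  have hc0 : 0 ≤ c := Nat.cast_nonneg _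
  have hadd : ∀ w : FinitePlace K, ∀ x y, w x ≤ 1 → w y ≤ 1 → w (x + y) ≤ 1 := fun w x y hx hy =>
    (FinitePlace.add_le w x y).trans (max_le hx hy)
  let O : Subring K :=
    { carrier := {x | ∀ w : FinitePlace K, w ∉ T → w x ≤ 1}
      mul_mem' := fun {x y} hx hy w hw => by
        rw [map_mul]
        exact mul_le_one₀ (hx w hw) (apply_nonneg w _) (hy w hw)
      one_mem' := fun w _ => (map_one w).le
      add_mem' := fun hx hy w hw => hadd w _ _ (hx w hw) (hy w hw)
      zero_mem' := fun w _ => (map_zero w).le.trans zero_le_one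
      neg_mem' := fun {x} hx w hw => by
        have : w (-x) = w x := w.1.map_neg x
        rw [this]
        exact hx w hw }
  have hO : ∀ x, x ∈ O ↔ ∀ w ∉ T, w x ≤ 1 := fun x => Iff.rfl
  have hprod : ∀ f : I → ℝ, ∏ v, f (e v) ^ mu (e v) =
      (∏ w : InfinitePlace K, f (Sum.inl w) ^ w.mult) * ∏ w : T, f (Sum.inr w) := by
    intro f
    rw [e.prod_comp (fun i => f i ^ mu i), Fintype.prod_sum_type]
    simp [hmu]
  refine ⟨Fintype.card I,
    { abv := fun v => a (e v)
      mult := fun v => mu (e v)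
      mult_pos := fun v => ?_
      v₀ := e.symm (Sum.inr ⟨w₀, hw₀⟩)
      mult_v₀ := by simp [hmu]
      int := (algebraMap (𝓞 K) K).range
      ring := O
      int_le := ?_
      frac := ?_
      one_le_prod := ?_
      minkowski := ?_
      siegel := ?_
      ht := fun x => Height.logHeight₁ x + c
      ht_nonneg := fun x => add_nonneg (Height.zero_le_logHeight₁ x) hc0
      ht_inv := fun x => by rw [Height.logHeight₁_inv]
      ht_mul_le := fun x y => ?_
      ht_add_le := fun x y => ?_
      abv_le := ?_
      northcott := ?_
      root_bound := ?_ }, hO⟩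
  · rcases e v with w | w
    · exact w.mult_pos
    · exact le_rfl
  · rintro x ⟨y, rfl⟩ w _
    exact finitePlace_le_one_of_int w y
  · intro x
    obtain ⟨y, z, hz, rfl⟩ := IsFractionRing.div_surjective (A := 𝓞 K) x
    have hz0 : (z : K) ≠ 0 := by exact_mod_cast nonZeroDivisors.ne_zero hz
    exact ⟨z, ⟨z, rfl⟩, hz0, y, (mul_div_cancel₀ _ hz0).symm⟩
  · intro x hx h0
    have h1 := one_le_prod_places T h0 hx
    rw [← Finset.prod_coe_sort T] at h1
    rw [hprod fun i => a i x]
    exact h1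
  · intro ι _ _ L
    obtain ⟨C, hC0, hC⟩ := exists_minkowski T ι (fun w => L (e.symm (Sum.inl w)))
      (fun w => if hw : w ∈ T then L (e.symm (Sum.inr ⟨w, hw⟩)) else 0)
    refine ⟨C, hC0, fun b hb hCb => ?_⟩
    obtain ⟨x, hx0, hxO, hxi, hxT⟩ := hC (fun w => b (e.symm (Sum.inl w)))
      (fun w => if hw : w ∈ T then b (e.symm (Sum.inr ⟨w, hw⟩)) else 0) (fun w => hb _)
      (fun w hw i => by rw [dif_pos hw]; exact hb _ i) (by
        refine hCb.trans (le_of_eq ?_)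
        have h1 := hprod fun v => ∏ i, b (e.symm v) i
        simp only [Equiv.symm_apply_apply] at h1
        rw [h1]
        congr 1
        conv_rhs => rw [← Finset.prod_coe_sort]
        refine Finset.prod_congr rfl fun w _ => ?_
        rw [dif_pos w.2])
    refine ⟨x, hx0, hxO, fun v i => ?_⟩
    obtain ⟨v, rfl⟩ := e.symm.surjective v
    rw [Equiv.apply_symm_apply]
    rcases v with w | w
    · exact hxi w i
    · have := hxT w.1 w.2 i
      rw [dif_pos w.2, dif_pos w.2] at this
      exact this
  · obtain ⟨C, hC1, hC⟩ := exists_siegel_vec K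
    refine ⟨C, hC1, fun ι κ _ _ A b hb hι hcard hle hA => ?_⟩
    choose A' hA' using fun i j => (hA i j).1
    obtain ⟨x, hx0, hxb, hx⟩ := hC ι κ A' b hb hι hcard hle fun i j w => by
      have := (hA i j).2 (e.symm (Sum.inl w))
      rw [Equiv.apply_symm_apply, ← hA' i j] at this
      exact this
    refine ⟨fun j => (x j : K), fun h => hx0 ?_, fun j => ⟨⟨x j, rfl⟩, fun v => ?_⟩, fun i => ?_⟩
    · funext j
      exact RingOfIntegers.coe_eq_zero_iff.1 (congrFun h j)
    · rcases hv : e v with w | w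
      · exact hxb j w
      · exact (finitePlace_le_one_of_int w.1 _).trans (Real.one_le_exp (by positivity))
    · have := congrArg (algebraMap (𝓞 K) K) (hx i)
      simpa only [map_sum, map_mul, map_zero, hA'] using this
  · have := Height.logHeight₁_mul_le x y
    linarith
  · have := Height.logHeight₁_add_le x y
    have h2 : c * Real.log 2 ≤ c := mul_le_of_le_one_right hc0 (by
      linarith [Real.log_two_lt_d9])
    linarith
  · intro v x
    refine le_trans ?_ (Real.exp_le_exp.2 (le_add_of_nonneg_right hc0))
    rcases hv : e v with w | w
    · exact infinitePlace_le_exp_logHeight w x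
    · exact finitePlace_le_exp_logHeight w.1 x
  · intro B
    refine (NumberField.finite_setOfPred_logHeight₁_le K (B - c)).subset fun x hx => ?_
    simp only [Set.mem_ofPred_eq] at hx ⊢
    linarith
  · obtain ⟨C, hC1, hC⟩ := exists_root_bound T c hc0
    refine ⟨C, hC1, fun p ξ t D b hb hp hD hpO hpb hdvd => ?_⟩
    refine hC p ξ t D b hb hp hD hpO (fun i w hw => ?_) (fun i w => ?_) hdvd
    · have := hpb (e.symm (Sum.inr ⟨w, hw⟩)) i
      rwa [Equiv.apply_symm_apply] at this
    · have := hpb (e.symm (Sum.inl w)) i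
      rwa [Equiv.apply_symm_apply] at this

theorem nonempty_finitePlace (K : Type*) [Field K] [NumberField K] : Nonempty (FinitePlace K) := by
  obtain ⟨M, hM⟩ := Ideal.exists_maximal (𝓞 K)
  exact ⟨FinitePlace.mk ⟨M, hM.isPrime,
    Ring.ne_bot_of_isMaximal_of_not_isField hM (RingOfIntegers.not_isField K)⟩⟩

theorem finitePlace_le_one_of_valuation {w : FinitePlace K} {x : K}
    (h : w.maximalIdeal.valuation K x ≤ 1) : w x ≤ 1 := by
  rw [← FinitePlace.norm_embedding_eq, FinitePlace.norm_embedding']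
  exact_mod_cast (WithZeroMulInt.toNNReal_le_one_iff
    (by exact_mod_cast one_lt_absNorm_maximalIdeal w)).2 h

theorem exists_finset_finitePlace (s : Finset K) (T : Finset (FinitePlace K)) :
    ∃ T' : Finset (FinitePlace K), T'.Nonempty ∧ T ⊆ T' ∧ ∀ c ∈ s, ∀ w ∉ T', w c ≤ 1 := by
  classical
  have hfin : ∀ c : K, {w : FinitePlace K | 1 < w c}.Finite := by
    intro c
    rcases eq_or_ne c 0 with rfl | hc
    · simp [zero_le_one.not_gt]
    · exact (FinitePlace.hasFiniteMulSupport hc).subset fun w hw => ne_of_gt hw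
  obtain ⟨w₀⟩ := nonempty_finitePlace K
  refine ⟨insert w₀ (T ∪ s.biUnion fun c => (hfin c).toFinset), Finset.insert_nonempty _ _,
    fun w hw => by simp [hw], fun c hc w hw => not_lt.1 fun h => hw ?_⟩
  refine Finset.mem_insert_of_mem (Finset.mem_union_right _ (Finset.mem_biUnion.2 ⟨c, hc, ?_⟩))
  exact (hfin c).mem_toFinset.2 h

theorem exists_minimal_relation {V : Type*} [AddCommGroup V] [Module K V] {m : ℕ}
    {L : Fin m → V} (hdep : ¬ LinearIndependent K L) :
    ∃ g : Fin m → K, g ≠ 0 ∧ ∑ i, g i • L i = 0 ∧ ∀ h : Fin m → K, ∑ i, h i • L i = 0 →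
      (∀ i, g i = 0 → h i = 0) → ∀ i, g i ≠ 0 → h i = 0 → h = 0 := by
  classical
  have hex : ∃ r, ∃ g : Fin m → K, g ≠ 0 ∧ ∑ i, g i • L i = 0 ∧
      (Finset.univ.filter fun i => g i ≠ 0).card = r := by
    rw [Fintype.linearIndependent_iff] at hdep
    push Not at hdep
    obtain ⟨g, hg, i, hi⟩ := hdep
    exact ⟨_, g, fun h => hi (congrFun h i), hg, rfl⟩
  obtain ⟨g, hg0, hg, hcard⟩ := Nat.find_spec hex
  refine ⟨g, hg0, hg, fun h hh hsub i hi hhi => by_contra fun h0 => ?_⟩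
  refine Nat.find_min hex ?_ ⟨h, h0, hh, rfl⟩
  rw [← hcard]
  refine Finset.card_lt_card (Finset.ssubset_iff_of_subset ?_ |>.2 ⟨i, by simp [hi], by simp [hhi]⟩)
  intro j hj
  simp only [Finset.mem_filter, Finset.mem_univ, true_and] at hj ⊢
  exact fun hgj => hj (hsub j hgj)

theorem exists_homogeneous_of_finset_forms {F : Type*} [Field F] {n : ℕ} (C : Finset (Fin n → F))
    (hC : ∀ c ∈ C, c ≠ 0) :
    ∃ (d : ℕ) (P : MvPolynomial (Fin n) F), P ≠ 0 ∧ P.IsHomogeneous d ∧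
      ∀ x, (∃ c ∈ C, (∑ j, c j * x j) = 0) → MvPolynomial.eval x P = 0 := by
  classical
  refine ⟨∑ c ∈ C, 1, ∏ c ∈ C, ∑ j, MvPolynomial.C (c j) * X j, ?_, ?_, ?_⟩
  · refine Finset.prod_ne_zero_iff.2 fun c hc h => hC c hc ?_
    funext i
    have h1 := congrArg (MvPolynomial.eval (Pi.single i 1)) h
    simpa [Pi.single_apply] using h1
  · refine IsHomogeneous.prod _ _ _ fun c _ => IsHomogeneous.sum _ _ _ fun j _ => ?_
    simpa using (isHomogeneous_C (Fin n) (c j)).mul (isHomogeneous_X F j)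
  · rintro x ⟨c, hc, hcx⟩
    rw [map_prod]
    refine Finset.prod_eq_zero hc ?_
    simpa using hcx

theorem exists_finset_forms_of_integral_ratios {V : Type*} [AddCommGroup V] [Module K V]
    (T : Finset (FinitePlace K)) {m : ℕ} {L : Fin m → V} (hL : ∀ i, L i ≠ 0)
    (hpairwise : ∀ i j, i ≠ j → ∀ c : K, L i ≠ c • L j) (hdep : ¬ LinearIndependent K L)
    (R : Set (V →ₗ[K] K)) (hR : ∀ x ∈ R, ∀ i, x (L i) ≠ 0)
    (hint : ∀ i j, ∃ a : K, a ≠ 0 ∧ ∀ x ∈ R, ∀ w ∉ T, w (a * x (L i) / x (L j)) ≤ 1) :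
    ∃ C : Finset V, (∀ c ∈ C, c ≠ 0) ∧ ∀ x ∈ R, ∃ c ∈ C, x c = 0 := by
  classical
  obtain ⟨g, hg0, hg, hmin⟩ := exists_minimal_relation hdep
  obtain ⟨i₀, hi₀⟩ := Function.ne_iff.1 hg0
  rw [Pi.zero_apply] at hi₀
  set J : Finset (Fin m) := (Finset.univ.filter fun i => g i ≠ 0).erase i₀ with hJ
  have hmemJ : ∀ i, i ∈ J ↔ i ≠ i₀ ∧ g i ≠ 0 := by simp [hJ]
  have hrel : g i₀ • L i₀ + ∑ i ∈ J, g i • L i = 0 := by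
    rw [← hg, hJ, Finset.add_sum_erase _ (fun i => g i • L i) (by simp [hi₀])]
    refine Finset.sum_subset (Finset.filter_subset _ _) fun i _ hi => ?_
    have : g i = 0 := by simpa using hi
    rw [this, zero_smul]
  have hJcard : 2 ≤ J.card := by
    by_contra! hlt
    rcases Nat.lt_or_ge J.card 1 with h0 | h1
    · rw [Finset.card_eq_zero.1 (Nat.lt_one_iff.1 h0), Finset.sum_empty, add_zero] at hrel
      exact (smul_ne_zero hi₀ (hL i₀)) hrel
    · obtain ⟨j, hj⟩ := Finset.card_eq_one.1 (le_antisymm (Nat.le_of_lt_succ hlt) h1)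
      have hj0 := (hmemJ j).1 (hj ▸ Finset.mem_singleton_self j)
      rw [hj, Finset.sum_singleton] at hrel
      refine hpairwise i₀ j hj0.1.symm (-((g i₀)⁻¹ * g j)) ?_
      rw [neg_smul, mul_smul, ← smul_neg, ← eq_neg_of_add_eq_zero_left hrel, inv_smul_smul₀ hi₀]
  set e : Fin J.card ≃ J := J.equivFin.symm with he
  have heJ : ∀ s, (e s : Fin m) ≠ i₀ ∧ g (e s) ≠ 0 := fun s => (hmemJ _).1 (e s).2
  choose a ha0 ha using hint
  obtain ⟨T', hT'ne, hTT', hT'⟩ := exists_finset_finitePlace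
    (Finset.univ.image (fun s => g (e s) / (g i₀ * a (e s) i₀)) ∪
      Finset.univ.image fun s => g i₀ / (g (e s) * a i₀ (e s))) T
  obtain ⟨N, PS, hPS⟩ := exists_placeSystem T' hT'ne
  obtain ⟨Φ, hΦ0, hΦ⟩ := exists_finite_forms_of_units PS hJcard
  refine ⟨Φ.image fun φ => ∑ s, (φ s * g (e s)) • L (e s), ?_, fun x hx => ?_⟩
  · intro c hc h0
    obtain ⟨φ, hφ, rfl⟩ := Finset.mem_image.1 hc
    refine hΦ0 φ hφ ?_
    set h : Fin m → K := fun i => if hi : i ∈ J then φ (e.symm ⟨i, hi⟩) * g i else 0 with hh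
    have hhe : ∀ s, h (e s) = φ s * g (e s) := fun s => by simp [hh]
    have hhJ : ∀ i ∉ J, h i = 0 := fun i hi => dif_neg hi
    have hsum : ∑ i, h i • L i = 0 := by
      rw [← h0, ← Finset.sum_subset (Finset.subset_univ J) fun i _ hi => by
        rw [hhJ i hi, zero_smul], ← Finset.sum_coe_sort, ← e.sum_comp]
      exact Finset.sum_congr rfl fun s _ => by rw [hhe]
    have hz := hmin h hsum (fun i hi => hhJ i fun hiJ => ((hmemJ i).1 hiJ).2 hi) i₀ hi₀
      (hhJ i₀ fun hiJ => ((hmemJ i₀).1 hiJ).1 rfl)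
    funext s
    have h1 := hhe s
    rw [hz] at h1
    exact (mul_eq_zero.1 h1.symm).resolve_right (heJ s).2
  · have hx0 := hR x hx
    have hmul : ∀ b c : K, (∀ w ∉ T', w b ≤ 1) → (∀ w ∉ T', w c ≤ 1) → b * c ∈ PS.ring :=
      fun b c hb hc => PS.ring.mul_mem ((hPS b).2 hb) ((hPS c).2 hc)
    obtain ⟨φ, hφ, hφu⟩ := hΦ (fun s => g (e s) * x (L (e s)) / (g i₀ * x (L i₀)))
      (fun s => by
        refine ⟨div_ne_zero (mul_ne_zero (heJ s).2 (hx0 _)) (mul_ne_zero hi₀ (hx0 _)), ?_, ?_⟩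
        · have h1 := hmul _ _ (hT' (g (e s) / (g i₀ * a (e s) i₀))
            (Finset.mem_union_left _ (Finset.mem_image_of_mem _ (Finset.mem_univ s))))
            (fun w hw => ha (e s) i₀ x hx w fun h => hw (hTT' h))
          convert h1 using 1
          have := ha0 (e s) i₀
          have := hx0 i₀
          field_simp
        · have h1 := hmul _ _ (hT' (g i₀ / (g (e s) * a i₀ (e s)))
            (Finset.mem_union_right _ (Finset.mem_image_of_mem
              (fun s => g i₀ / (g (e s) * a i₀ (e s))) (Finset.mem_univ s))))
            (fun w hw => ha i₀ (e s) x hx w fun h => hw (hTT' h))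
          convert h1 using 1
          have := ha0 i₀ (e s)
          have := hx0 (e s)
          have := (heJ s).2
          rw [inv_div]
          field_simp)
      (by
        have h1 := congrArg x hrel
        rw [map_add, map_sum, map_zero, ← Finset.sum_coe_sort, ← e.sum_comp] at h1
        simp only [map_smul, smul_eq_mul] at h1
        rw [← Finset.sum_div, eq_neg_of_add_eq_zero_right h1, neg_div,
          div_self (mul_ne_zero hi₀ (hx0 _))])
    refine ⟨_, Finset.mem_image_of_mem _ hφ, ?_⟩
    simp only [mul_div_assoc', ← Finset.sum_div] at hφu
    have h1 := (div_eq_zero_iff.1 hφu).resolve_right (mul_ne_zero hi₀ (hx0 _))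
    simpa only [map_sum, map_smul, smul_eq_mul, mul_assoc] using h1

end NumberField

end SubspaceAux

/-- Condition (a) of the main theorem: if the pairwise non-proportional linear forms
`L_1, …, L_m` are linearly dependent over `k`, and `R ⊆ ℙⁿ(k)` is a set of points, off
the hyperplanes `L_i = 0`, on which all the ratios `L_i/L_j` are `S`-integral up to a
fixed constant, then `R` is contained in a finite union of hyperplanes; in particular
`R` is not Zariski-dense. -/
theorem not_zariski_dense_of_linearly_dependent_forms
    (k : Type*) [Field k] [NumberField k]
    (T : Finset (HeightOneSpectrum (𝓞 k)))
    (n m : ℕ) (hm : 2 ≤ m)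
    (L : Fin m → (Fin (n + 1) → k)) (hL : ∀ i, L i ≠ 0)
    (hpairwise : ∀ i j, i ≠ j → ∀ c : k, L i ≠ c • L j)
    (hdep : ¬ LinearIndependent k L)
    (R : Set (Fin (n + 1) → k))
    (hR : ∀ x ∈ R, ∀ i, (∑ j, L i j * x j) ≠ 0)
    (hint : ∀ i j : Fin m, ∃ a : k, a ≠ 0 ∧ ∀ x ∈ R,
      a * (∑ j', L i j' * x j') / (∑ j', L j j' * x j') ∈
        (↑T : Set (HeightOneSpectrum (𝓞 k))).integer k) :
    -- `R` is contained in a finite union of hyperplanes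
    (∃ C : Finset (Fin (n + 1) → k), (∀ c ∈ C, c ≠ 0) ∧
      ∀ x ∈ R, ∃ c ∈ C, (∑ j, c j * x j) = 0) ∧
    -- in particular, `R` is not Zariski-dense
    (∃ (d : ℕ) (P : MvPolynomial (Fin (n + 1)) k), P ≠ 0 ∧ P.IsHomogeneous d ∧
      ∀ x ∈ R, MvPolynomial.eval x P = 0) := by
  classical
  let ev : (Fin (n + 1) → k) → (Fin (n + 1) → k) →ₗ[k] k := fun x => (dotProductBilin k k).flip x
  have hev : ∀ x c, ev x c = ∑ j, c j * x j := fun _ _ => rfl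
  obtain ⟨C, hC0, hC⟩ := SubspaceAux.exists_finset_forms_of_integral_ratios
    (T.image FinitePlace.mk) hL hpairwise hdep (ev '' R)
    (by rintro _ ⟨x, hx, rfl⟩ i; exact hR x hx i)
    (fun i j => by
      obtain ⟨a, ha0, ha⟩ := hint i j
      refine ⟨a, ha0, ?_⟩
      rintro _ ⟨x, hx, rfl⟩ w hw
      refine SubspaceAux.finitePlace_le_one_of_valuation (ha x hx w.maximalIdeal fun h => hw ?_)
      exact Finset.mem_image.2 ⟨_, h, FinitePlace.mk_maximalIdeal w⟩)
  have hCR : ∀ x ∈ R, ∃ c ∈ C, (∑ j, c j * x j) = 0 := fun x hx => hC _ ⟨x, hx, rfl⟩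
  obtain ⟨d, P, hP0, hPd, hP⟩ := SubspaceAux.exists_homogeneous_of_finset_forms C hC0
  exact ⟨⟨C, hC0, hCR⟩, d, P, hP0, hPd, fun x hx => hP x (hCR x hx)⟩
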